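/- There is a constant C (depending only on b, c_+, c_- and the fixed cutoff functions) such that for every integer ℓ≥1, every p∈(1,2], every nonempty U⊂(0,∞), and each choice of sign ±, ‖ sup_{u∈U} | Σ_{j∈ℤ} T_{j,ℓ,±}^u f | ‖_{L^p(ℝ²)} ≤ C (p-1)^{-2} θ_{p,ℓ} 𝒦_p(U,2^{-ℓ}) ‖f‖_{L^p(ℝ²)} for all Schwartz functions f on ℝ². -/

import Mathlib

open MeasureTheory Filter Set Topology
open scoped ENNReal NNReal Topology Classical

noncomputable section

/-- The homogeneous curve of degree `b`: `γ_b(t) = c₊ t^b` for `t > 0`,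
`γ_b(t) = c₋ (-t)^b` for `t < 0`, `γ_b(0) = 0`. -/
def curve (b cp cm t : ℝ) : ℝ :=
  if 0 < t then cp * t ^ b else if t < 0 then cm * (-t) ^ b else 0

/-- The maximal function along the curve `(t, u γ_b(t))`. -/
def Mu (b cp cm u : ℝ) (f : ℝ × ℝ → ℝ) (x : ℝ × ℝ) : ℝ :=
  ⨆ R : {R : ℝ // 0 < R},
    ((R : ℝ))⁻¹ * ∫ t in (0:ℝ)..(R : ℝ), |f (x - (t, u * curve b cp cm t))|

/-- The maximal function `𝓜^U f = sup_{u ∈ U} M^{(u)} f`. -/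
def calM (b cp cm : ℝ) (U : Set ℝ) (f : ℝ × ℝ → ℝ) (x : ℝ × ℝ) : ℝ :=
  ⨆ u : U, Mu b cp cm (u : ℝ) f x

/-- The Hilbert transform along the curve `(t, u γ_b(t))` (principal value). -/
def Hu (b cp cm u : ℝ) (f : ℝ × ℝ → ℝ) (x : ℝ × ℝ) : ℝ :=
  limUnder (𝓝[>] (0:ℝ)) fun ε : ℝ =>
    ∫ t in {t : ℝ | ε < |t| ∧ |t| < ε⁻¹}, f (x - (t, u * curve b cp cm t)) / t

/-- The maximal function `𝓗^U f = sup_{u ∈ U} |H^{(u)} f|`, valued in `ℝ≥0∞`. -/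
def calH (b cp cm : ℝ) (U : Set ℝ) (f : ℝ × ℝ → ℝ) (x : ℝ × ℝ) : ℝ≥0∞ :=
  ⨆ u : U, ENNReal.ofReal |Hu b cp cm (u : ℝ) f x|

/-- The `L^p` norm of an `ℝ≥0∞`-valued function on `ℝ²`. -/
def lpN (g : ℝ × ℝ → ℝ≥0∞) (p : ℝ) : ℝ≥0∞ :=
  (∫⁻ x : ℝ × ℝ, g x ^ p) ^ (1 / p)

def eN (p : ℝ) : ℝ≥0∞ := ENNReal.ofReal p

/-- `U^r = r⁻¹ U ∩ [1,2] = {ρ ∈ [1,2] : rρ ∈ U}`. -/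
def UrSet (U : Set ℝ) (r : ℝ) : Set ℝ := {ρ : ℝ | ρ ∈ Icc (1:ℝ) 2 ∧ r * ρ ∈ U}

/-- `N(A,δ)`: minimal number of intervals of length `δ` needed to cover `A`. -/
def covN (A : Set ℝ) (δ : ℝ) : ℕ :=
  sInf {n : ℕ | ∃ F : Finset ℝ, F.card = n ∧ A ⊆ ⋃ a ∈ F, Icc a (a + δ)}

/-- `𝒦_p(U,δ) = δ^{1-1/p} sup_{r>0} N(U^r,δ)^{1/p}`. -/
def Kp (U : Set ℝ) (δ p : ℝ) : ℝ :=
  δ ^ (1 - 1 / p) * ⨆ r : {r : ℝ // 0 < r}, ((covN (UrSet U (r : ℝ)) δ : ℝ)) ^ (1 / p)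

/-- `p_cr(U) = 1 + limsup_{δ→0+} sup_{r>0} log N(U^r,δ) / log(1/δ)`. -/
def pcr (U : Set ℝ) : ℝ :=
  1 + limsup (fun δ : ℝ =>
      (⨆ r : {r : ℝ // 0 < r}, Real.log (covN (UrSet U (r : ℝ)) δ)) / Real.log δ⁻¹)
    (𝓝[>] (0:ℝ))

/-- `𝔑(U) = 1 + #{n ∈ ℤ : [2ⁿ, 2ⁿ⁺¹] ∩ U ≠ ∅}`. -/
def frakN (U : Set ℝ) : ℕ∞ :=
  1 + Set.encard {n : ℤ | (Icc ((2:ℝ) ^ n) ((2:ℝ) ^ (n + 1)) ∩ U).Nonempty}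

/-- `√(log 𝔑(U))`, valued in `ℝ≥0∞` (equal to `∞` if `𝔑(U) = ∞`). -/
def sqrtLogN (U : Set ℝ) : ℝ≥0∞ :=
  if frakN U = ⊤ then ⊤
  else ENNReal.ofReal (Real.sqrt (Real.log ((frakN U).toNat : ℝ)))

/-- The `L^p → L^p` operator norm of `𝓜^U` (smallest admissible constant, possibly `∞`). -/
def opNormM (b cp cm : ℝ) (U : Set ℝ) (p : ℝ) : ℝ≥0∞ :=
  sInf {C : ℝ≥0∞ | ∀ f : SchwartzMap (ℝ × ℝ) ℝ,
    eLpNorm (calM b cp cm U ⇑f) (eN p) volume ≤ C * eLpNorm ⇑f (eN p) volume}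

/-- The `L^p → L^p` operator norm of `𝓗^U` (smallest admissible constant, possibly `∞`). -/
def opNormH (b cp cm : ℝ) (U : Set ℝ) (p : ℝ) : ℝ≥0∞ :=
  sInf {C : ℝ≥0∞ | ∀ f : SchwartzMap (ℝ × ℝ) ℝ,
    lpN (calH b cp cm U ⇑f) p ≤ C * eLpNorm ⇑f (eN p) volume}

/-- `θ_{p,ℓ}`. -/
def theta (p : ℝ) (l : ℕ) : ℝ :=
  if (l : ℝ) ≤ (p - 1)⁻¹ then (p - 1) ^ (3 - 10 / p) else (l : ℝ) ^ (7 * (2 / p - 1))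

/-- `Σ_{ℓ≥1} θ_{p,ℓ} 𝒦_p(U, 2^{-ℓ})`, valued in `ℝ≥0∞`. -/
def KpSum (U : Set ℝ) (p : ℝ) : ℝ≥0∞ :=
  ∑' l : ℕ, ENNReal.ofReal (theta p (l + 1) * Kp U ((2:ℝ) ^ (-((l : ℝ) + 1))) p)



/-- The Fourier transform on `ℝ²`. -/
def FT (f : ℝ × ℝ → ℂ) (ξ : ℝ × ℝ) : ℂ :=
  ∫ x : ℝ × ℝ,
    Complex.exp ((((-(2 * Real.pi * (x.1 * ξ.1 + x.2 * ξ.2))) : ℝ) : ℂ) * Complex.I) * f x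

/-- The inverse Fourier transform on `ℝ²`. -/
def FTinv (g : ℝ × ℝ → ℂ) (x : ℝ × ℝ) : ℂ :=
  ∫ ξ : ℝ × ℝ,
    Complex.exp (((2 * Real.pi * (x.1 * ξ.1 + x.2 * ξ.2) : ℝ) : ℂ) * Complex.I) * g ξ

/-- `τ̂₀(ξ) = ∫ e^{-2πi(ξ₁t + ξ₂γ_b(t))} χ₊(t) dt`. -/
def tauHat (b cp cm : ℝ) (χp : ℝ → ℝ) (ξ : ℝ × ℝ) : ℂ :=
  ∫ t : ℝ,
    Complex.exp ((((-(2 * Real.pi * (ξ.1 * t + ξ.2 * curve b cp cm t))) : ℝ) : ℂ) * Complex.I)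
      * ((χp t : ℝ) : ℂ)

/-- `σ̂(ξ) = ∫ e^{-2πi(ξ₁t + ξ₂γ_b(t))} χ(t) dt/t` for a cutoff `χ`. -/
def sigmaHat (b cp cm : ℝ) (χ : ℝ → ℝ) (ξ : ℝ × ℝ) : ℂ :=
  ∫ t : ℝ,
    Complex.exp ((((-(2 * Real.pi * (ξ.1 * t + ξ.2 * curve b cp cm t))) : ℝ) : ℂ) * Complex.I)
      * ((χ t / t : ℝ) : ℂ)

/-- `ρ̂₀(ξ) = (1-η₀(ξ)) ς₋(ξ₁/(c₊ξ₂)) τ̂₀(ξ)`. -/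
def rhoHat (b cp cm : ℝ) (χp : ℝ → ℝ) (η : ℝ × ℝ → ℝ) (ςm : ℝ → ℝ) (ξ : ℝ × ℝ) : ℂ :=
  (((1 - η ξ) * ςm (ξ.1 / (cp * ξ.2)) : ℝ) : ℂ) * tauHat b cp cm χp ξ

/-- `μ̂_{0,±}`; `sgn = true` is the `+` sign. -/
def muHat (b cp cm : ℝ) (χp : ℝ → ℝ) (η : ℝ × ℝ → ℝ) (ςp ςm : ℝ → ℝ) (sgn : Bool)
    (ξ : ℝ × ℝ) : ℂ :=
  if sgn then
    (((1 - η ξ) * ςm (ξ.1 / (cp * ξ.2)) : ℝ) : ℂ) * sigmaHat b cp cm χp ξ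
  else
    (((1 - η ξ) * ςp (ξ.1 / (cm * ξ.2)) : ℝ) : ℂ) * sigmaHat b cp cm (fun t => χp (-t)) ξ

/-- `ζ_ℓ(ξ) = ζ₀(2^{-ℓ}ξ) - ζ₀(2^{1-ℓ}ξ)`. -/
def zl (ζ : ℝ × ℝ → ℝ) (l : ℕ) (ξ : ℝ × ℝ) : ℝ :=
  ζ ((2:ℝ) ^ (-(l : ℝ)) • ξ) - ζ ((2:ℝ) ^ (1 - (l : ℝ)) • ξ)

/-- The anisotropic dilation `ξ ↦ (2^{-j}ξ₁, 2^{-jb} u ξ₂)`. -/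
def dil (b : ℝ) (j : ℤ) (u : ℝ) (ξ : ℝ × ℝ) : ℝ × ℝ :=
  ((2:ℝ) ^ (-(j : ℝ)) * ξ.1, (2:ℝ) ^ (-((j : ℝ) * b)) * (u * ξ.2))

/-- `A_{j,ℓ}^u`, defined via `(A_{j,ℓ}^u f)^(ξ) = ζ_ℓ(...) ρ̂₀(...) f̂(ξ)`. -/
def Ajl (b cp cm : ℝ) (χp : ℝ → ℝ) (η : ℝ × ℝ → ℝ) (ςm : ℝ → ℝ) (ζ : ℝ × ℝ → ℝ)
    (j : ℤ) (l : ℕ) (u : ℝ) (f : ℝ × ℝ → ℝ) : ℝ × ℝ → ℂ :=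
  FTinv fun ξ =>
    ((zl ζ l (dil b j u ξ) : ℝ) : ℂ) * rhoHat b cp cm χp η ςm (dil b j u ξ)
      * FT (fun x => ((f x : ℝ) : ℂ)) ξ

/-- `T_{j,ℓ,±}^u`, defined via `(T_{j,ℓ,±}^u f)^(ξ) = ζ_ℓ(...) μ̂_{0,±}(...) f̂(ξ)`. -/
def Tjl (b cp cm : ℝ) (χp : ℝ → ℝ) (η : ℝ × ℝ → ℝ) (ςp ςm : ℝ → ℝ) (ζ : ℝ × ℝ → ℝ)
    (sgn : Bool) (j : ℤ) (l : ℕ) (u : ℝ) (f : ℝ × ℝ → ℝ) : ℝ × ℝ → ℂ :=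
  FTinv fun ξ =>
    ((zl ζ l (dil b j u ξ) : ℝ) : ℂ) * muHat b cp cm χp η ςp ςm sgn (dil b j u ξ)
      * FT (fun x => ((f x : ℝ) : ℂ)) ξ

/-- `φ̂₀(ξ) = η₀(ξ)τ̂₀(ξ) + (1-η₀(ξ))(1-ς₋(ξ₁/(c₊ξ₂)))τ̂₀(ξ)` (maximal-function version). -/
def phiHatTau (b cp cm : ℝ) (χp : ℝ → ℝ) (η : ℝ × ℝ → ℝ) (ςm : ℝ → ℝ) (ξ : ℝ × ℝ) : ℂ :=
  ((η ξ + (1 - η ξ) * (1 - ςm (ξ.1 / (cp * ξ.2))) : ℝ) : ℂ) * tauHat b cp cm χp ξ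

/-- `A_{j,0}^u`, defined via `(A_{j,0}^u f)^(ξ) = φ̂₀(2^{-j}ξ₁, 2^{-jb}uξ₂) f̂(ξ)`. -/
def Aj0 (b cp cm : ℝ) (χp : ℝ → ℝ) (η : ℝ × ℝ → ℝ) (ςm : ℝ → ℝ)
    (j : ℤ) (u : ℝ) (f : ℝ × ℝ → ℝ) : ℝ × ℝ → ℂ :=
  FTinv fun ξ => phiHatTau b cp cm χp η ςm (dil b j u ξ) * FT (fun x => ((f x : ℝ) : ℂ)) ξ

/-- `φ̂₀(ξ)` (Hilbert-transform version, built from `σ̂_±`). -/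
def phiHatSigma (b cp cm : ℝ) (χp : ℝ → ℝ) (η : ℝ × ℝ → ℝ) (ςp ςm : ℝ → ℝ)
    (ξ : ℝ × ℝ) : ℂ :=
  ((η ξ : ℝ) : ℂ) * (sigmaHat b cp cm χp ξ + sigmaHat b cp cm (fun t => χp (-t)) ξ)
    + (((1 - η ξ) * (1 - ςm (ξ.1 / (cp * ξ.2))) : ℝ) : ℂ) * sigmaHat b cp cm χp ξ
    + (((1 - η ξ) * (1 - ςp (ξ.1 / (cm * ξ.2))) : ℝ) : ℂ)
        * sigmaHat b cp cm (fun t => χp (-t)) ξ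

/-- `S^{(u)}`, defined via `(S^{(u)} f)^(ξ) = Σ_j φ̂₀(2^{-j}ξ₁, 2^{-jb}uξ₂) f̂(ξ)`. -/
def Sop (b cp cm : ℝ) (χp : ℝ → ℝ) (η : ℝ × ℝ → ℝ) (ςp ςm : ℝ → ℝ)
    (u : ℝ) (f : ℝ × ℝ → ℝ) : ℝ × ℝ → ℂ :=
  FTinv fun ξ =>
    (∑' j : ℤ, phiHatSigma b cp cm χp η ςp ςm (dil b j u ξ)) * FT (fun x => ((f x : ℝ) : ℂ)) ξ

/-- The convolution `τ_j^u * f`. -/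
def tauConv (b cp cm : ℝ) (χp : ℝ → ℝ) (j : ℤ) (u : ℝ) (f : ℝ × ℝ → ℝ) (x : ℝ × ℝ) : ℝ :=
  ∫ t : ℝ, f (x - (t, u * curve b cp cm t)) * ((2:ℝ) ^ j * χp ((2:ℝ) ^ j * t))

/-- The `ℓ^p(ℕ)` norm of a sequence. -/
def wNorm (w : ℕ → ℂ) (p : ℝ) : ℝ≥0∞ :=
  (∑' i : ℕ, ENNReal.ofReal (‖w i‖ ^ p)) ^ (1 / p)

/-- The auxiliary maximal operator `𝔐_R[f,w]`. -/
def MfrakR (b cp cm : ℝ) (χp : ℝ → ℝ) (s : ℤ → ℕ → ℝ) (R : ℕ)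
    (f : ℝ × ℝ → ℝ) (w : ℤ → ℕ → ℂ) (x : ℝ × ℝ) : ℝ≥0∞ :=
  ⨆ (j : ℤ) (_ : -(R:ℤ) ≤ j ∧ j ≤ R) (n : ℤ) (_ : -(R:ℤ) ≤ n ∧ n ≤ R) (i : ℕ),
    ENNReal.ofReal
      (‖w n i‖ * |tauConv b cp cm χp j ((2:ℝ) ^ (b * (n : ℝ)) * s n i) f x|)

/-- `B_p(R)`: the best constant in `‖𝔐_R[f,w]‖_p ≤ C (sup_n ‖w_n‖_{ℓ^p}) ‖f‖_p`. -/
def BpR (b cp cm : ℝ) (χp : ℝ → ℝ) (s : ℤ → ℕ → ℝ) (p : ℝ) (R : ℕ) : ℝ≥0∞ :=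
  ⨆ (f : SchwartzMap (ℝ × ℝ) ℝ) (w : ℤ → ℕ → ℂ)
    (_ : eLpNorm ⇑f (eN p) volume ≤ 1) (_ : ∀ n : ℤ, wNorm (w n) p ≤ 1),
    lpN (MfrakR b cp cm χp s R ⇑f w) p

/-- `ℓ^q` norm (over an index type) of an `ℝ≥0∞`-valued family, `q ∈ (0,∞]`. -/
def lqS {ι : Type*} (q : ℝ≥0∞) (g : ι → ℝ≥0∞) : ℝ≥0∞ :=
  if q = ⊤ then ⨆ i, g i else (∑' i, g i ^ q.toReal) ^ (1 / q.toReal)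

/-- The quotient `p/q`, with the convention `p/∞ = 0`. -/
def pqr (p : ℝ) (q : ℝ≥0∞) : ℝ := if q = ⊤ then 0 else p / q.toReal

section
open scoped FourierTransform SchwartzMap

/-- The dyadic interval `[k 2^n, (k+1) 2^n)`. -/
def dyI (n k : ℤ) : Set ℝ := Ico ((k : ℝ) * (2:ℝ) ^ n) (((k : ℝ) + 1) * (2:ℝ) ^ n)

lemma mem_dyI {n k : ℤ} {x : ℝ} : x ∈ dyI n k ↔ ⌊x / (2:ℝ) ^ n⌋ = k := by
  have h : (0:ℝ) < (2:ℝ) ^ n := by positivity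
  rw [Int.floor_eq_iff, dyI, mem_Ico, le_div_iff₀ h, div_lt_iff₀ h]

lemma dyI_subset {n m k k' : ℤ} (h : n ≤ m) {x : ℝ} (hx : x ∈ dyI n k) (hx' : x ∈ dyI m k') :
    dyI n k ⊆ dyI m k' := by
  obtain ⟨d, rfl⟩ := Int.le.dest h
  have hp : (0:ℝ) < (2:ℝ) ^ n := by positivity
  have hm : (2:ℝ) ^ (n + (d:ℤ)) = (2:ℝ) ^ d * (2:ℝ) ^ n := by
    rw [zpow_add₀ (by norm_num), zpow_natCast, mul_comm]
  have e1 : (k' : ℝ) * (2:ℝ) ^ d < k + 1 := by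
    have := lt_of_le_of_lt hx'.1 hx.2
    rw [hm, ← mul_assoc] at this
    exact lt_of_mul_lt_mul_right this hp.le
  have e2 : (k : ℝ) < (k' + 1) * (2:ℝ) ^ d := by
    have := lt_of_le_of_lt hx.1 hx'.2
    rw [hm, ← mul_assoc] at this
    exact lt_of_mul_lt_mul_right this hp.le
  have f1 : k' * 2 ^ d ≤ k := by
    have : k' * 2 ^ d < k + 1 := by exact_mod_cast e1
    omega
  have f2 : k + 1 ≤ (k' + 1) * 2 ^ d := by
    have : k < (k' + 1) * 2 ^ d := by exact_mod_cast e2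
    omega
  have g1 : (k' : ℝ) * (2:ℝ) ^ d ≤ k := by exact_mod_cast f1
  have g2 : (k : ℝ) + 1 ≤ (k' + 1) * (2:ℝ) ^ d := by exact_mod_cast f2
  intro y hy
  refine ⟨?_, ?_⟩
  · rw [hm, ← mul_assoc]
    exact (mul_le_mul_of_nonneg_right g1 hp.le).trans hy.1
  · rw [hm, ← mul_assoc]
    exact hy.2.trans_le (mul_le_mul_of_nonneg_right g2 hp.le)

/-- The stopping dyadic intervals of `f` at height `a`. -/
def czS (f : ℝ → ℝ) (a : ℝ) : Set (ℤ × ℤ) :=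
  {i | a * (2:ℝ) ^ i.1 < ∫ x in dyI i.1 i.2, f x ∧
    ∀ m, i.1 < m → ∀ k', dyI i.1 i.2 ⊆ dyI m k' → ∫ x in dyI m k', f x ≤ a * (2:ℝ) ^ m}

lemma dyI_nonempty (n k : ℤ) : (dyI n k).Nonempty := by
  have hp : (0:ℝ) < (2:ℝ) ^ n := by positivity
  exact ⟨k * (2:ℝ) ^ n, le_refl _, by nlinarith⟩

lemma czS_disjoint (f : ℝ → ℝ) (a : ℝ) :
    (czS f a).PairwiseDisjoint (fun i => dyI i.1 i.2) := by
  rintro ⟨n, k⟩ hi ⟨m, k'⟩ hj hne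
  rw [Function.onFun, Set.disjoint_left]
  intro x hx hx'
  apply hne
  rcases lt_trichotomy n m with h | h | h
  · exact absurd (hi.2 m h k' (dyI_subset h.le hx hx')) (not_le.2 hj.1)
  · subst h
    rw [mem_dyI] at hx hx'
    simp only at hx hx'
    rw [← hx, ← hx']
  · exact absurd (hj.2 n h k (dyI_subset h.le hx' hx)) (not_le.2 hi.1)

lemma czS_upper {f : ℝ → ℝ} (hf : Integrable f) (h0 : ∀ x, 0 ≤ f x) {a : ℝ} {i : ℤ × ℤ}
    (hi : i ∈ czS f a) : ∫ x in dyI i.1 i.2, f x ≤ 2 * a * (2:ℝ) ^ i.1 := by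
  obtain ⟨n, k⟩ := i
  obtain ⟨x, hx⟩ := dyI_nonempty n k
  have hs : dyI n k ⊆ dyI (n + 1) ⌊x / (2:ℝ) ^ (n+1)⌋ :=
    dyI_subset (by omega) hx (mem_dyI.2 rfl)
  have h1 := hi.2 (n + 1) (by simp) _ hs
  have h2 : ∫ x in dyI n k, f x ≤ ∫ x in dyI (n + 1) ⌊x / (2:ℝ) ^ (n+1)⌋, f x :=
    setIntegral_mono_set hf.integrableOn (ae_of_all _ h0) (LE.le.eventuallyLE hs)
  refine h2.trans (h1.trans (le_of_eq ?_))
  rw [zpow_add_one₀ (by norm_num)]; ring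

lemma czS_cover {f : ℝ → ℝ} (hf : Integrable f) (h0 : ∀ x, 0 ≤ f x) {a : ℝ} (ha : 0 < a) {x : ℝ}
    (hx : x ∉ ⋃ i ∈ czS f a, dyI i.1 i.2) (n : ℤ) :
    ∫ y in dyI n ⌊x / (2:ℝ) ^ n⌋, f y ≤ a * (2:ℝ) ^ n := by
  by_contra! hcon
  let P : ℤ → Prop := fun m => a * (2:ℝ) ^ m < ∫ y in dyI m ⌊x / (2:ℝ) ^ m⌋, f y
  obtain ⟨N, hN⟩ : ∃ N : ℕ, (∫ y, f y) / a < (2:ℝ) ^ N := pow_unbounded_of_one_lt _ (by norm_num)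
  have hb : ∀ m, P m → m ≤ N := by
    intro m hm
    by_contra! hlt
    have h1 : a * (2:ℝ) ^ m < ∫ y, f y :=
      lt_of_lt_of_le hm (setIntegral_le_integral hf (ae_of_all _ h0))
    have h2 : (2:ℝ) ^ N ≤ (2:ℝ) ^ m := by
      rw [← zpow_natCast]; exact zpow_le_zpow_right₀ (by norm_num) hlt.le
    rw [div_lt_iff₀ ha] at hN
    nlinarith
  obtain ⟨m, hm, hmax⟩ := Int.exists_greatest_of_bdd (P := P) ⟨N, hb⟩ ⟨n, hcon⟩
  apply hx
  rw [mem_iUnion₂]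
  refine ⟨(m, ⌊x / (2:ℝ) ^ m⌋), ⟨hm, ?_⟩, mem_dyI.2 rfl⟩
  intro m' hm' k' hsub
  have : ⌊x / (2:ℝ) ^ m'⌋ = k' := mem_dyI.1 (hsub (mem_dyI.2 rfl))
  subst this
  by_contra! h
  exact absurd (hmax m' h) (not_le.2 hm')

lemma czS_ae {f : ℝ → ℝ} (hf : Integrable f) (h0 : ∀ x, 0 ≤ f x) {a : ℝ} (ha : 0 < a) :
    ∀ᵐ x, x ∉ (⋃ i ∈ czS f a, dyI i.1 i.2) → f x ≤ a := by
  filter_upwards [IsUnifLocDoublingMeasure.ae_tendsto_average (μ := (volume : Measure ℝ))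
    hf.locallyIntegrable 1] with x hx hnot
  have ht : Tendsto (fun n : ℕ => (2:ℝ) ^ (-(n:ℤ)) / 2) atTop (𝓝[>] 0) := by
    rw [tendsto_nhdsWithin_iff]
    refine ⟨?_, Eventually.of_forall fun n => by simp⟩
    have : Tendsto (fun n : ℕ => ((1:ℝ)/2) ^ n / 2) atTop (𝓝 (0 / 2)) :=
      (tendsto_pow_atTop_nhds_zero_of_lt_one (by norm_num) (by norm_num)).div_const 2
    rw [zero_div] at this
    refine this.congr fun n => ?_
    rw [zpow_neg, zpow_natCast, one_div, inv_pow]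
  let k : ℕ → ℤ := fun n => ⌊x / (2:ℝ) ^ (-(n:ℤ))⌋
  have key : ∀ n : ℕ, Metric.closedBall (((k n : ℝ) + 1/2) * (2:ℝ) ^ (-(n:ℤ)))
      ((2:ℝ) ^ (-(n:ℤ)) / 2) = Icc ((k n : ℝ) * (2:ℝ) ^ (-(n:ℤ)))
        (((k n : ℝ) + 1) * (2:ℝ) ^ (-(n:ℤ))) := by
    intro n
    rw [Real.closedBall_eq_Icc]
    congr 1 <;> ring
  have h := hx (fun n : ℕ => ((k n : ℝ) + 1/2) * (2:ℝ) ^ (-(n:ℤ))) _ ht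
    (Eventually.of_forall fun n => by
      rw [one_mul, key]
      exact Ico_subset_Icc_self (mem_dyI.2 rfl : x ∈ dyI _ (k n)))
  refine le_of_tendsto' h fun n => ?_
  have hp : (0:ℝ) < (2:ℝ) ^ (-(n:ℤ)) := by positivity
  rw [key, setAverage_eq, integral_Icc_eq_integral_Ico, Real.volume_real_Icc_of_le (by nlinarith)]
  have := czS_cover hf h0 ha hnot (-(n:ℤ))
  rw [show ((k n : ℝ) + 1) * (2:ℝ) ^ (-(n:ℤ)) - k n * (2:ℝ) ^ (-(n:ℤ)) = (2:ℝ) ^ (-(n:ℤ)) by ring,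
    smul_eq_mul, inv_mul_le_iff₀ hp, mul_comm _ a]
  exact this

/-- Strongly measurable, integrable and bounded functions. -/
structure Nice {X E : Type*} [MeasureSpace X] [NormedAddCommGroup E] (f : X → E) : Prop where
  sm : StronglyMeasurable f
  int : Integrable f
  bdd : ∃ C : ℝ, ∀ x, ‖f x‖ ≤ C

lemma Nice.add {X E : Type*} [MeasureSpace X] [NormedAddCommGroup E] {f g : X → E}
    (hf : Nice f) (hg : Nice g) : Nice (f + g) := by
  obtain ⟨C, hC⟩ := hf.bdd
  obtain ⟨D, hD⟩ := hg.bdd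
  exact ⟨hf.sm.add hg.sm, hf.int.add hg.int,
    C + D, fun x => (norm_add_le _ _).trans (add_le_add (hC x) (hD x))⟩

lemma Nice.neg {X E : Type*} [MeasureSpace X] [NormedAddCommGroup E] {f : X → E}
    (hf : Nice f) : Nice (-f) := by
  obtain ⟨C, hC⟩ := hf.bdd
  exact ⟨hf.sm.neg, hf.int.neg, C, fun x => by simpa using hC x⟩

lemma Nice.sub {X E : Type*} [MeasureSpace X] [NormedAddCommGroup E] {f g : X → E}
    (hf : Nice f) (hg : Nice g) : Nice (f - g) := by
  rw [sub_eq_add_neg]; exact hf.add hg.neg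

lemma measurableSet_dyI (n k : ℤ) : MeasurableSet (dyI n k) := measurableSet_Ico

lemma volume_dyI (n k : ℤ) : volume (dyI n k) = ENNReal.ofReal ((2:ℝ) ^ n) := by
  rw [dyI, Real.volume_Ico]; congr 1; ring

lemma cz_decomp {E : Type*} [NormedAddCommGroup E] [NormedSpace ℝ E] [CompleteSpace E]
    [SecondCountableTopology E] {f : ℝ → E} (hf : Nice f) {a : ℝ} (ha : 0 < a) :
    ∃ (S : Set (ℤ × ℤ)) (g b : ℝ → E), S.PairwiseDisjoint (fun i => dyI i.1 i.2) ∧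
      f = g + b ∧ Nice g ∧ Nice b ∧ (∀ i ∈ S, ∫ y in dyI i.1 i.2, b y = 0) ∧
      (∀ x, x ∉ (⋃ i ∈ S, dyI i.1 i.2) → b x = 0) ∧
      (∀ i ∈ S, ∫⁻ y in dyI i.1 i.2, ‖b y‖ₑ ≤ ENNReal.ofReal (4 * a) * volume (dyI i.1 i.2)) ∧
      (∫⁻ y, ‖g y‖ₑ ^ 2 ≤ ENNReal.ofReal (2 * a) ^ 2 * volume (⋃ i ∈ S, dyI i.1 i.2)
        + ∫⁻ y in {y | ‖f y‖ ≤ a}, ‖f y‖ₑ ^ 2) ∧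
      (ENNReal.ofReal (a / 2) * volume (⋃ i ∈ S, dyI i.1 i.2)
        ≤ ∫⁻ y in {y | a / 2 < ‖f y‖}, ‖f y‖ₑ) := by
  let _ : MeasurableSpace E := borel E
  have _ : BorelSpace E := ⟨rfl⟩
  let S := czS (fun x => ‖f x‖) a
  have hSc : S.Countable := Set.to_countable S
  have hdis : S.PairwiseDisjoint (fun i => dyI i.1 i.2) := czS_disjoint _ _
  let m : ℤ × ℤ → E := fun i => ((2:ℝ) ^ i.1)⁻¹ • ∫ y in dyI i.1 i.2, f y
  let Ω : Set ℝ := ⋃ i ∈ S, dyI i.1 i.2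
  have hΩ : MeasurableSet Ω := MeasurableSet.biUnion hSc fun i _ => measurableSet_dyI _ _
  let t : Option S → Set ℝ := fun o => o.elim Ωᶜ (fun i => dyI i.1.1 i.1.2)
  let gg : Option S → ℝ → E := fun o => o.elim f (fun i _ => m i.1)
  obtain ⟨g, hgm, hg⟩ := exists_measurable_piecewise t
    (by rintro (_ | i); exacts [hΩ.compl, measurableSet_dyI _ _]) gg
    (by rintro (_ | i); exacts [hf.sm.measurable, measurable_const])
    (by
      rintro (_ | i) (_ | j) hij x ⟨hx, hx'⟩
      · exact absurd rfl hij
      · exact absurd (mem_biUnion j.2 hx') hx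
      · exact absurd (mem_biUnion i.2 hx) hx'
      · have hne : (i : ℤ × ℤ) ≠ j := fun h => hij (by rw [Subtype.ext h])
        exact absurd hx' (Set.disjoint_left.1 (hdis i.2 j.2 hne) hx))
  have hg0 : ∀ x ∉ Ω, g x = f x := fun x hx => hg none hx
  have hg1 : ∀ i ∈ S, ∀ x ∈ dyI i.1 i.2, g x = m i := fun i hi x hx => hg (some ⟨i, hi⟩) hx
  have hpos : ∀ n : ℤ, (0:ℝ) < (2:ℝ) ^ n := fun n => by positivity
  have hm : ∀ i ∈ S, ‖m i‖ ≤ 2 * a := by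
    intro i hi
    have h1 := czS_upper hf.int.norm (fun x => norm_nonneg _) hi
    have h2 : ‖∫ y in dyI i.1 i.2, f y‖ ≤ ∫ y in dyI i.1 i.2, ‖f y‖ := norm_integral_le_integral_norm _
    simp only [m, norm_smul, norm_inv, Real.norm_eq_abs, abs_of_pos (hpos i.1)]
    rw [inv_mul_le_iff₀ (hpos _)]
    linarith
  have hmv : ∀ i ∈ S, ENNReal.ofReal ((2:ℝ) ^ i.1) * ‖m i‖ₑ ≤ ∫⁻ y in dyI i.1 i.2, ‖f y‖ₑ := by
    intro i hi
    refine le_trans (le_of_eq ?_) (enorm_integral_le_lintegral_enorm _)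
    have : ENNReal.ofReal ((2:ℝ) ^ i.1) = ‖(2:ℝ) ^ i.1‖ₑ := by
      rw [Real.enorm_eq_ofReal (hpos _).le]
    rw [this, ← enorm_smul]
    simp only [m]
    rw [smul_smul, mul_inv_cancel₀ (hpos _).ne', one_smul]
  have hup : ∀ i ∈ S, ∫⁻ y in dyI i.1 i.2, ‖f y‖ₑ ≤ ENNReal.ofReal (2 * a) * volume (dyI i.1 i.2) := by
    intro i hi
    have h1 := czS_upper hf.int.norm (fun x => norm_nonneg _) hi
    rw [volume_dyI, ← ENNReal.ofReal_mul (by positivity), ← ofReal_integral_norm_eq_lintegral_enorm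
      hf.int.integrableOn]
    exact ENNReal.ofReal_le_ofReal h1
  have hgi : ∀ i ∈ S, ∫⁻ y in dyI i.1 i.2, ‖g y‖ₑ = ENNReal.ofReal ((2:ℝ) ^ i.1) * ‖m i‖ₑ := by
    intro i hi
    rw [setLIntegral_congr_fun (g := fun _ => ‖m i‖ₑ) (measurableSet_dyI _ _)
      (fun x hx => by simp only [hg1 i hi x hx]), setLIntegral_const, volume_dyI, mul_comm]
  obtain ⟨C, hC⟩ := hf.bdd
  have hgn : Nice g := by
    refine ⟨hgm.stronglyMeasurable, ⟨hgm.aestronglyMeasurable, ?_⟩, max (2 * a) C, fun x => ?_⟩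
    · refine lt_of_le_of_lt ?_ hf.int.hasFiniteIntegral
      rw [← lintegral_add_compl _ hΩ, ← lintegral_add_compl (fun y => ‖f y‖ₑ) hΩ]
      refine add_le_add ?_ ?_
      · rw [lintegral_biUnion hSc (fun i _ => measurableSet_dyI _ _) hdis,
          lintegral_biUnion hSc (fun i _ => measurableSet_dyI _ _) hdis]
        exact ENNReal.tsum_le_tsum fun i => (hgi i i.2).trans_le (hmv i i.2)
      · exact setLIntegral_mono' hΩ.compl fun x hx => by rw [hg0 x hx]
    · by_cases hx : x ∈ Ω
      · obtain ⟨i, hi, hxi⟩ := mem_iUnion₂.1 hx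
        rw [hg1 i hi x hxi]; exact (hm i hi).trans (le_max_left _ _)
      · rw [hg0 x hx]; exact (hC x).trans (le_max_right _ _)
  refine ⟨S, g, f - g, hdis, by abel, hgn, hf.sub hgn, ?_, ?_, ?_, ?_, ?_⟩
  · intro i hi
    have : ∫ y in dyI i.1 i.2, g y = (2:ℝ) ^ i.1 • m i := by
      rw [setIntegral_congr_fun (g := fun _ => m i) (measurableSet_dyI _ _)
        (fun x hx => hg1 i hi x hx), setIntegral_const, measureReal_def, volume_dyI,
        ENNReal.toReal_ofReal (hpos _).le]
    simp only [Pi.sub_apply]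
    rw [integral_sub hf.int.integrableOn hgn.int.integrableOn, this]
    simp only [m]
    rw [smul_smul, mul_inv_cancel₀ (hpos _).ne', one_smul, sub_self]
  · intro x hx
    simp [hg0 x hx]
  · intro i hi
    calc ∫⁻ y in dyI i.1 i.2, ‖(f - g) y‖ₑ
        ≤ ∫⁻ y in dyI i.1 i.2, (‖f y‖ₑ + ‖g y‖ₑ) := lintegral_mono fun y => enorm_sub_le
      _ = (∫⁻ y in dyI i.1 i.2, ‖f y‖ₑ) + ∫⁻ y in dyI i.1 i.2, ‖g y‖ₑ :=
          lintegral_add_left hf.sm.enorm _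
      _ ≤ ENNReal.ofReal (2 * a) * volume (dyI i.1 i.2) + ENNReal.ofReal (2 * a) * volume (dyI i.1 i.2) := by
          refine add_le_add (hup i hi) ?_
          rw [hgi i hi]; exact (hmv i hi).trans (hup i hi)
      _ = _ := by
          rw [← add_mul, ← ENNReal.ofReal_add (by positivity) (by positivity)]; congr 2; ring
  · rw [← lintegral_add_compl _ hΩ]
    refine add_le_add ?_ ?_
    · calc ∫⁻ x in Ω, ‖g x‖ₑ ^ 2 ≤ ∫⁻ x in Ω, ENNReal.ofReal (2 * a) ^ 2 := by
            refine setLIntegral_mono' hΩ fun x hx => ?_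
            obtain ⟨i, hi, hxi⟩ := mem_iUnion₂.1 hx
            rw [hg1 i hi x hxi]
            gcongr
            rw [← ofReal_norm]
            exact ENNReal.ofReal_le_ofReal (hm i hi)
        _ = _ := by rw [setLIntegral_const]
    · have hae := czS_ae hf.int.norm (fun x => norm_nonneg _) ha
      have hms : MeasurableSet {y | ‖f y‖ ≤ a} := measurableSet_le hf.sm.norm.measurable measurable_const
      rw [← lintegral_indicator hΩ.compl, ← lintegral_indicator hms]
      refine lintegral_mono_ae ?_
      filter_upwards [hae] with x hx
      by_cases hxΩ : x ∈ Ω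
      · simp [hxΩ]
      · have : x ∈ {y | ‖f y‖ ≤ a} := hx hxΩ
        rw [indicator_of_mem (by exact hxΩ), indicator_of_mem this, hg0 x hxΩ]
  · have hms : MeasurableSet {y | a / 2 < ‖f y‖} := measurableSet_lt measurable_const hf.sm.norm.measurable
    calc ENNReal.ofReal (a / 2) * volume Ω = ∑' i : S, ENNReal.ofReal (a / 2) * volume (dyI i.1.1 i.1.2) := by
          rw [measure_biUnion hSc hdis (fun i _ => measurableSet_dyI _ _), ENNReal.tsum_mul_left]
      _ ≤ ∑' i : S, ∫⁻ y in dyI i.1.1 i.1.2, {y | a / 2 < ‖f y‖}.indicator (fun y => ‖f y‖ₑ) y := by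
          refine ENNReal.tsum_le_tsum fun i => ?_
          have h1 : ENNReal.ofReal a * volume (dyI i.1.1 i.1.2) ≤ ∫⁻ y in dyI i.1.1 i.1.2, ‖f y‖ₑ := by
            rw [volume_dyI, ← ENNReal.ofReal_mul (by positivity), ← ofReal_integral_norm_eq_lintegral_enorm
              hf.int.integrableOn]
            exact ENNReal.ofReal_le_ofReal i.2.1.le
          have h2 : ∫⁻ y in dyI i.1.1 i.1.2, ‖f y‖ₑ ≤
              (∫⁻ y in dyI i.1.1 i.1.2, {y | a / 2 < ‖f y‖}.indicator (fun y => ‖f y‖ₑ) y)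
                + ENNReal.ofReal (a / 2) * volume (dyI i.1.1 i.1.2) := by
            rw [← setLIntegral_const, ← lintegral_add_right _ measurable_const]
            refine lintegral_mono fun y => ?_
            by_cases hy : a / 2 < ‖f y‖
            · rw [indicator_of_mem (by exact hy)]; exact le_self_add
            · rw [indicator_of_notMem (by exact hy), zero_add, ← ofReal_norm]
              exact ENNReal.ofReal_le_ofReal (not_lt.1 hy)
          have h3 := h1.trans h2
          rw [show a = a / 2 + a / 2 by ring, ENNReal.ofReal_add (by positivity) (by positivity),
            add_mul, show (a / 2 + a / 2) = a by ring] at h3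
          refine (ENNReal.add_le_add_iff_right ?_).1 h3
          rw [volume_dyI]
          exact ENNReal.mul_ne_top ENNReal.ofReal_ne_top ENNReal.ofReal_ne_top
      _ = ∫⁻ y in Ω, {y | a / 2 < ‖f y‖}.indicator (fun y => ‖f y‖ₑ) y := by
          rw [lintegral_biUnion hSc (fun i _ => measurableSet_dyI _ _) hdis]
      _ ≤ ∫⁻ y, {y | a / 2 < ‖f y‖}.indicator (fun y => ‖f y‖ₑ) y := setLIntegral_le_lintegral _ _
      _ = _ := lintegral_indicator hms _

/-- Convolution of an operator valued kernel with a vector valued function. -/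
def cvK {E F : Type*} [NormedAddCommGroup E] [NormedSpace ℝ E] [NormedAddCommGroup F]
    [NormedSpace ℝ F] (K : ℝ → E →L[ℝ] F) (f : ℝ → E) (x : ℝ) : F := ∫ y, K (x - y) (f y)

section CZ
variable {E F : Type*} [NormedAddCommGroup E] [NormedSpace ℝ E] [CompleteSpace E]
    [SecondCountableTopology E] [NormedAddCommGroup F] [NormedSpace ℝ F] [CompleteSpace F]

lemma cvK_integrable {K : ℝ → E →L[ℝ] F} (hK : Continuous K) {B : ℝ} (hB : ∀ x, ‖K x‖ ≤ B)
    {f : ℝ → E} (hf : Integrable f) (x : ℝ) : Integrable (fun y => K (x - y) (f y)) := by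
  refine Integrable.mono' (hf.norm.const_mul B) ?_ (ae_of_all _ fun y => ?_)
  · have h1 : AEStronglyMeasurable (fun y => K (x - y)) volume :=
      (hK.comp (continuous_const.sub continuous_id)).aestronglyMeasurable
    exact (isBoundedBilinearMap_apply.continuous).comp_aestronglyMeasurable₂
      h1 hf.aestronglyMeasurable
  · exact (ContinuousLinearMap.le_opNorm _ _).trans
      (mul_le_mul_of_nonneg_right (hB _) (norm_nonneg _))

lemma cvK_measurable {K : ℝ → E →L[ℝ] F} (hK : Continuous K)
    {f : ℝ → E} (hf : StronglyMeasurable f) : StronglyMeasurable (cvK K f) := by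
  have : StronglyMeasurable (fun q : ℝ × ℝ => K (q.1 - q.2) (f q.2)) :=
    (isBoundedBilinearMap_apply.continuous).comp_stronglyMeasurable
      ((hK.comp (continuous_fst.sub continuous_snd)).stronglyMeasurable.prodMk
        (hf.comp_measurable measurable_snd))
  exact this.integral_prod_right

lemma cvK_add {K : ℝ → E →L[ℝ] F} (hK : Continuous K) {B : ℝ} (hB : ∀ x, ‖K x‖ ≤ B)
    {f g : ℝ → E} (hf : Integrable f) (hg : Integrable g) (x : ℝ) :
    cvK K (f + g) x = cvK K f x + cvK K g x := by
  simp only [cvK, Pi.add_apply, map_add]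
  exact integral_add (cvK_integrable hK hB hf x) (cvK_integrable hK hB hg x)

lemma cz_off {K : ℝ → E →L[ℝ] F} (hK : Continuous K) {B : ℝ} (hB : ∀ x, ‖K x‖ ≤ B) {A : ℝ≥0}
    (H2 : ∀ y, ∫⁻ x in {x | 2 * |y| ≤ |x|}, ‖K (x - y) - K x‖ₑ ≤ A)
    {b : ℝ → E} (hb : Nice b) {S : Set (ℤ × ℤ)} (hdis : S.PairwiseDisjoint (fun i => dyI i.1 i.2))
    (hb0 : ∀ i ∈ S, ∫ y in dyI i.1 i.2, b y = 0)
    (hb1 : ∀ x, x ∉ (⋃ i ∈ S, dyI i.1 i.2) → b x = 0) :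
    ∃ Z : Set ℝ, MeasurableSet Z ∧ volume Z ≤ 2 * volume (⋃ i ∈ S, dyI i.1 i.2) ∧
      ∫⁻ x in Zᶜ, ‖cvK K b x‖ₑ ≤ A * ∑' i : S, ∫⁻ y in dyI i.1.1 i.1.2, ‖b y‖ₑ := by
  have hSc : S.Countable := Set.to_countable S
  have hpos : ∀ n : ℤ, (0:ℝ) < (2:ℝ) ^ n := fun n => by positivity
  let c : ℤ × ℤ → ℝ := fun i => ((i.2 : ℝ) + 1 / 2) * (2:ℝ) ^ i.1
  let Z : Set ℝ := ⋃ i ∈ S, Metric.ball (c i) ((2:ℝ) ^ i.1)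
  have hZ : MeasurableSet Z := MeasurableSet.biUnion hSc fun i _ => measurableSet_ball
  have hΩ : MeasurableSet (⋃ i ∈ S, dyI i.1 i.2) :=
    MeasurableSet.biUnion hSc fun i _ => measurableSet_dyI _ _
  refine ⟨Z, hZ, ?_, ?_⟩
  · rw [measure_biUnion hSc hdis (fun i _ => measurableSet_dyI _ _), ← ENNReal.tsum_mul_left]
    refine (measure_biUnion_le _ hSc _).trans (ENNReal.tsum_le_tsum fun i => ?_)
    rw [Real.volume_ball, volume_dyI, ENNReal.ofReal_mul (by norm_num)]
    simp
  · have hpt : ∀ x, ‖cvK K b x‖ₑ ≤ ∑' i : S, ∫⁻ y in dyI i.1.1 i.1.2,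
        ‖K (x - y) - K (x - c i)‖ₑ * ‖b y‖ₑ := by
      intro x
      have h1 : cvK K b x = ∫ y in ⋃ i : S, dyI i.1.1 i.1.2, K (x - y) (b y) := by
        rw [← biUnion_eq_iUnion S (fun i _ => dyI i.1 i.2), cvK,
          setIntegral_eq_integral_of_forall_compl_eq_zero]
        intro y hy
        rw [hb1 y hy, map_zero]
      rw [h1, ← (hasSum_integral_iUnion (fun i : S => measurableSet_dyI i.1.1 i.1.2)
        (fun i j hij => hdis i.2 j.2 (fun h => hij (Subtype.ext h)))
        (cvK_integrable hK hB hb.int x).integrableOn).tsum_eq]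
      refine enorm_tsum_le_tsum_enorm.trans (ENNReal.tsum_le_tsum fun i => ?_)
      have h2 : ∫ y in dyI i.1.1 i.1.2, K (x - y) (b y) =
          ∫ y in dyI i.1.1 i.1.2, (K (x - y) - K (x - c i)) (b y) := by
        have h3 : ∫ y in dyI i.1.1 i.1.2, K (x - c i) (b y) = 0 := by
          rw [ContinuousLinearMap.integral_comp_comm _ hb.int.integrableOn, hb0 i i.2, map_zero]
        simp only [ContinuousLinearMap.sub_apply]
        rw [integral_sub (cvK_integrable hK hB hb.int x).integrableOn
          ((K (x - c i)).integrable_comp hb.int.integrableOn), h3, sub_zero]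
      rw [h2]
      refine (enorm_integral_le_lintegral_enorm _).trans (lintegral_mono fun y => ?_)
      exact ContinuousLinearMap.le_opENorm _ _
    have hmeas : ∀ i : S, Measurable (Function.uncurry fun x y =>
        ‖K (x - y) - K (x - c i)‖ₑ * ‖b y‖ₑ) := by
      intro i
      have h1 : Continuous (fun q : ℝ × ℝ => K (q.1 - q.2) - K (q.1 - c i)) :=
        (hK.comp (continuous_fst.sub continuous_snd)).sub
          (hK.comp (continuous_fst.sub continuous_const))
      exact h1.enorm.measurable.mul (hb.sm.enorm.comp measurable_snd)
    calc ∫⁻ x in Zᶜ, ‖cvK K b x‖ₑ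
        ≤ ∫⁻ x in Zᶜ, ∑' i : S, ∫⁻ y in dyI i.1.1 i.1.2,
          ‖K (x - y) - K (x - c i)‖ₑ * ‖b y‖ₑ := lintegral_mono fun x => hpt x
      _ = ∑' i : S, ∫⁻ x in Zᶜ, ∫⁻ y in dyI i.1.1 i.1.2,
          ‖K (x - y) - K (x - c i)‖ₑ * ‖b y‖ₑ :=
          lintegral_tsum fun i => (hmeas i).lintegral_prod_right'.aemeasurable
      _ ≤ ∑' i : S, A * ∫⁻ y in dyI i.1.1 i.1.2, ‖b y‖ₑ := by
          refine ENNReal.tsum_le_tsum fun i => ?_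
          rw [lintegral_lintegral_swap (hmeas i).aemeasurable, ← lintegral_const_mul _ hb.sm.enorm]
          refine setLIntegral_mono' (measurableSet_dyI _ _) fun y hy => ?_
          have h1 : Continuous (fun x : ℝ => K (x - y) - K (x - c i)) :=
            (hK.comp (continuous_id.sub continuous_const)).sub
              (hK.comp (continuous_id.sub continuous_const))
          rw [lintegral_mul_const _ h1.enorm.measurable]
          gcongr
          have h2 : Zᶜ ⊆ {x | 2 * |y - c i| ≤ |x - c i|} := by
            intro x hx
            have h3 : x ∉ Metric.ball (c i) ((2:ℝ) ^ i.1.1) := fun h => hx (mem_biUnion i.2 h)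
            rw [Metric.mem_ball, Real.dist_eq, not_lt] at h3
            refine le_trans ?_ h3
            have h4 := hy.1
            have h5 := hy.2
            have : |y - c i| ≤ (2:ℝ) ^ i.1.1 / 2 := by
              rw [abs_le]; constructor <;> simp only [c] <;> nlinarith
            linarith
          refine (lintegral_mono_set h2).trans (le_trans (le_of_eq ?_) (H2 (y - c i)))
          have hms : MeasurableSet {x : ℝ | 2 * |y - c i| ≤ |x|} :=
            measurableSet_le measurable_const (by fun_prop)
          have hms' : MeasurableSet {x : ℝ | 2 * |y - c i| ≤ |x - c i|} :=
            measurableSet_le measurable_const (by fun_prop)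
          rw [← lintegral_indicator hms, ← lintegral_indicator hms',
            ← lintegral_sub_right_eq_self (μ := volume) (indicator {x : ℝ | 2 * |y - c i| ≤ |x|} _) (c i)]
          refine lintegral_congr fun x => ?_
          simp only [indicator, mem_setOf_eq, sub_sub_sub_cancel_right]
      _ = _ := ENNReal.tsum_mul_left

theorem cz_weak {K : ℝ → E →L[ℝ] F} (hK : Continuous K) {B : ℝ} (hB : ∀ x, ‖K x‖ ≤ B) {A : ℝ≥0}
    (hA : A ≠ 0)
    (H1 : ∀ f : ℝ → E, Nice f → ∫⁻ x, ‖cvK K f x‖ₑ ^ 2 ≤ A ^ 2 * ∫⁻ x, ‖f x‖ₑ ^ 2)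
    (H2 : ∀ y, ∫⁻ x in {x | 2 * |y| ≤ |x|}, ‖K (x - y) - K x‖ₑ ≤ A)
    {f : ℝ → E} (hf : Nice f) {a : ℝ} (ha : 0 < a) :
    volume {x | 2 * (A : ℝ) * a < ‖cvK K f x‖} ≤
      10 * ((ENNReal.ofReal (a / 2))⁻¹ * ∫⁻ y in {y | a / 2 < ‖f y‖}, ‖f y‖ₑ)
      + (ENNReal.ofReal a ^ 2)⁻¹ * ∫⁻ y in {y | ‖f y‖ ≤ a}, ‖f y‖ₑ ^ 2 := by
  obtain ⟨S, g, b, hdis, hfgb, hg, hb, hb0, hb1, hb2, hg2, hΩ⟩ := cz_decomp hf ha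
  obtain ⟨Z, hZ, hZv, hZi⟩ := cz_off hK hB H2 hb hdis hb0 hb1
  set Ω := ⋃ i ∈ S, dyI i.1 i.2 with hΩdef
  have hSc : S.Countable := Set.to_countable S
  have ha0 : ENNReal.ofReal a ≠ 0 := by simpa using ha
  have hat : ENNReal.ofReal a ≠ ⊤ := ENNReal.ofReal_ne_top
  have hAa0 : (A : ℝ≥0∞) * ENNReal.ofReal a ≠ 0 := mul_ne_zero (by simpa using hA) ha0
  have hAat : (A : ℝ≥0∞) * ENNReal.ofReal a ≠ ⊤ := ENNReal.mul_ne_top ENNReal.coe_ne_top hat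
  have hAr : ENNReal.ofReal ((A:ℝ) * a) = A * ENNReal.ofReal a := by
    rw [ENNReal.ofReal_mul (NNReal.coe_nonneg A), ENNReal.ofReal_coe_nnreal]
  have hg3 : volume {x | (A : ℝ≥0∞) * ENNReal.ofReal a ≤ ‖cvK K g x‖ₑ} ≤
      4 * volume Ω + (ENNReal.ofReal a ^ 2)⁻¹ * ∫⁻ y in {y | ‖f y‖ ≤ a}, ‖f y‖ₑ ^ 2 := by
    have hm : Measurable (fun x => ‖cvK K g x‖ₑ ^ 2) :=
      (cvK_measurable hK hg.sm).enorm.pow_const 2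
    have h1 := meas_ge_le_lintegral_div (μ := volume) hm.aemeasurable
      (ε := ((A : ℝ≥0∞) * ENNReal.ofReal a) ^ 2) (pow_ne_zero _ hAa0) (ENNReal.pow_ne_top hAat)
    refine le_trans (measure_mono fun x hx => ?_) (h1.trans ?_)
    · exact pow_le_pow_left' (show (A : ℝ≥0∞) * ENNReal.ofReal a ≤ ‖cvK K g x‖ₑ from hx) 2
    · rw [ENNReal.div_le_iff (pow_ne_zero _ hAa0) (ENNReal.pow_ne_top hAat)]
      refine (H1 g hg).trans ((mul_le_mul_right hg2 _).trans (le_of_eq ?_))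
      rw [mul_pow, mul_comm _ ((A:ℝ≥0∞) ^ 2 * _), mul_assoc, mul_add (ENNReal.ofReal a ^ 2),
        ← mul_assoc (ENNReal.ofReal a ^ 2) (ENNReal.ofReal a ^ 2)⁻¹,
        ENNReal.mul_inv_cancel (pow_ne_zero _ ha0) (ENNReal.pow_ne_top hat), one_mul]
      congr 2
      rw [ENNReal.ofReal_mul (by norm_num), mul_pow]
      simp only [ENNReal.ofReal_ofNat]
      rw [mul_comm ((2:ℝ≥0∞)^2), mul_assoc]; norm_num
  have hb3 : volume ({x | (A : ℝ≥0∞) * ENNReal.ofReal a ≤ ‖cvK K b x‖ₑ} ∩ Zᶜ) ≤ 4 * volume Ω := by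
    have hm : Measurable (fun x => ‖cvK K b x‖ₑ) := (cvK_measurable hK hb.sm).enorm
    have h1 := meas_ge_le_lintegral_div (μ := volume.restrict Zᶜ) hm.aemeasurable hAa0 hAat
    rw [Measure.restrict_apply (measurableSet_le measurable_const hm)] at h1
    refine h1.trans ?_
    rw [ENNReal.div_le_iff hAa0 hAat]
    refine hZi.trans ?_
    rw [show 4 * volume Ω * ((A : ℝ≥0∞) * ENNReal.ofReal a)
      = A * (4 * ENNReal.ofReal a * volume Ω) by ring]
    gcongr
    calc ∑' i : S, ∫⁻ y in dyI i.1.1 i.1.2, ‖b y‖ₑ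
        ≤ ∑' i : S, ENNReal.ofReal (4 * a) * volume (dyI i.1.1 i.1.2) :=
          ENNReal.tsum_le_tsum fun i => hb2 i i.2
      _ = ENNReal.ofReal (4 * a) * volume Ω := by
          rw [ENNReal.tsum_mul_left, measure_biUnion hSc hdis (fun i _ => measurableSet_dyI _ _)]
      _ ≤ _ := by
          rw [ENNReal.ofReal_mul (by norm_num)]
          simp only [ENNReal.ofReal_ofNat, le_refl]
  have hsub : {x | 2 * (A : ℝ) * a < ‖cvK K f x‖} ⊆
      {x | (A : ℝ≥0∞) * ENNReal.ofReal a ≤ ‖cvK K g x‖ₑ} ∪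
      (({x | (A : ℝ≥0∞) * ENNReal.ofReal a ≤ ‖cvK K b x‖ₑ} ∩ Zᶜ) ∪ Z) := by
    intro x hx
    by_contra hcon
    simp only [mem_union, mem_inter_iff, mem_setOf_eq, not_or, not_and, mem_compl_iff] at hcon
    obtain ⟨h1, h2, h3⟩ := hcon
    have h4 := h2.mt (fun h => h h3)
    rw [not_le, ← hAr, ← ofReal_norm, ENNReal.ofReal_lt_ofReal_iff'] at h1 h4
    have h5 : ‖cvK K f x‖ ≤ ‖cvK K g x‖ + ‖cvK K b x‖ := by
      rw [hfgb, cvK_add hK hB hg.int hb.int]; exact norm_add_le _ _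
    have : 2 * (A : ℝ) * a < ‖cvK K f x‖ := hx
    linarith [h1.1, h4.1]
  have hfin : volume Ω ≤ (ENNReal.ofReal (a / 2))⁻¹ * ∫⁻ y in {y | a / 2 < ‖f y‖}, ‖f y‖ₑ := by
    have : ENNReal.ofReal (a / 2) ≠ 0 := by simpa using ha
    rw [mul_comm, ← div_eq_mul_inv, ENNReal.le_div_iff_mul_le (Or.inl this)
      (Or.inl ENNReal.ofReal_ne_top), mul_comm]
    exact hΩ
  refine (measure_mono hsub).trans ((measure_union_le _ _).trans ?_)
  refine (add_le_add hg3 ((measure_union_le _ _).trans (add_le_add hb3 hZv))).trans ?_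
  calc _ = 10 * volume Ω + (ENNReal.ofReal a ^ 2)⁻¹ * ∫⁻ y in {y | ‖f y‖ ≤ a}, ‖f y‖ₑ ^ 2 := by ring
    _ ≤ _ := by gcongr

end CZ

lemma lint_rpow_Ioo {r c : ℝ} (hr : -1 < r) (hc : 0 ≤ c) :
    ∫⁻ t in Ioo 0 c, ENNReal.ofReal (t ^ r) = ENNReal.ofReal (c ^ (r + 1) / (r + 1)) := by
  have h1 := integral_rpow (a := 0) (b := c) (Or.inl hr)
  rw [Real.zero_rpow (by linarith), sub_zero, intervalIntegral.integral_of_le hc,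
    integral_Ioc_eq_integral_Ioo] at h1
  have hi : IntegrableOn (fun t : ℝ => t ^ r) (Ioo 0 c) :=
    ((intervalIntegral.intervalIntegrable_rpow' hr (a := 0) (b := c)).1).mono_set Ioo_subset_Ioc_self
  rw [← h1, ofReal_integral_eq_lintegral_ofReal hi]
  exact (ae_restrict_mem measurableSet_Ioo).mono fun t ht => Real.rpow_nonneg ht.1.le _

lemma lint_rpow_Ioi {r c : ℝ} (hr : r < -1) (hc : 0 < c) :
    ∫⁻ t in Ioi c, ENNReal.ofReal (t ^ r) = ENNReal.ofReal (-c ^ (r + 1) / (r + 1)) := by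
  rw [← integral_Ioi_rpow_of_lt hr hc, ofReal_integral_eq_lintegral_ofReal
    (integrableOn_Ioi_rpow_of_lt hr hc)]
  exact (ae_restrict_mem measurableSet_Ioi).mono fun t ht => Real.rpow_nonneg (hc.le.trans (le_of_lt ht)) _

/-- Exchange of the order of integration in a layer-cake integral. -/
lemma layer_swap {X : Type*} [MeasurableSpace X] {μ : Measure X} [SFinite μ] {h : X → ℝ} {S : Set (ℝ × X)}
    (hS : MeasurableSet S) (hm : Measurable h) (r q : ℝ) :
    ∫⁻ t in Ioi (0:ℝ), ENNReal.ofReal (t ^ r) * ∫⁻ y in {y | (t, y) ∈ S}, ENNReal.ofReal (h y) ^ q ∂μ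
    = ∫⁻ y, (∫⁻ t in Ioi (0:ℝ),
        S.indicator (fun z => ENNReal.ofReal (z.1 ^ r) * ENNReal.ofReal (h z.2) ^ q) (t, y)) ∂μ := by
  have hms : ∀ t, MeasurableSet {y | (t, y) ∈ S} := fun t => measurable_prodMk_left hS
  have hhm : Measurable fun y => ENNReal.ofReal (h y) ^ q := hm.ennreal_ofReal.pow_const q
  have hrm : Measurable fun t : ℝ => ENNReal.ofReal (t ^ r) := (measurable_id.pow_const _).ennreal_ofReal
  trans ∫⁻ t in Ioi (0:ℝ), ∫⁻ y, S.indicator (fun z => ENNReal.ofReal (z.1 ^ r) * ENNReal.ofReal (h z.2) ^ q) (t, y) ∂μ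
  · refine lintegral_congr fun t => ?_
    rw [← lintegral_indicator (hms t), ← lintegral_const_mul _ (hhm.indicator (hms t))]
    refine lintegral_congr fun y => ?_
    simp only [indicator, mem_ofPred_eq]
    split_ifs <;> simp
  · refine lintegral_lintegral_swap (Measurable.aemeasurable ?_)
    exact ((hrm.comp measurable_fst).mul (hhm.comp measurable_snd)).indicator hS

/-- Layer-cake integration of the large part of a function. -/
lemma layer_large {X : Type*} [MeasurableSpace X] {μ : Measure X} [SFinite μ] {h : X → ℝ}
    (hm : Measurable h) (h0 : ∀ x, 0 ≤ h x) {p q c : ℝ} (hq : q < p) (hc : 0 < c) (hq0 : 0 < q) :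
    ∫⁻ t in Ioi (0:ℝ), ENNReal.ofReal (t ^ (p - 1 - q)) *
      ∫⁻ y in {y | c * t < h y}, ENNReal.ofReal (h y) ^ q ∂μ
    = ENNReal.ofReal (c⁻¹ ^ (p - q) / (p - q)) * ∫⁻ y, ENNReal.ofReal (h y) ^ p ∂μ := by
  have hms2 : MeasurableSet {z : ℝ × X | c * z.1 < h z.2} :=
    measurableSet_lt (by fun_prop) (hm.comp measurable_snd)
  have hrm : Measurable fun t : ℝ => ENNReal.ofReal (t ^ (p - 1 - q)) :=
    (measurable_id.pow_const _).ennreal_ofReal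
  calc _ = ∫⁻ y, (∫⁻ t in Ioi (0:ℝ), {z : ℝ × X | c * z.1 < h z.2}.indicator
          (fun z => ENNReal.ofReal (z.1 ^ (p - 1 - q)) * ENNReal.ofReal (h z.2) ^ q) (t, y)) ∂μ :=
        layer_swap hms2 hm _ _
    _ = ∫⁻ y, ENNReal.ofReal (c⁻¹ ^ (p - q) / (p - q)) * ENNReal.ofReal (h y) ^ p ∂μ := by
        refine lintegral_congr fun y => ?_
        have : ∫⁻ t in Ioi (0:ℝ), {z : ℝ × X | c * z.1 < h z.2}.indicator
            (fun z => ENNReal.ofReal (z.1 ^ (p - 1 - q)) * ENNReal.ofReal (h z.2) ^ q) (t, y)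
            = ∫⁻ t in Ioo (0:ℝ) (c⁻¹ * h y), ENNReal.ofReal (t ^ (p - 1 - q)) * ENNReal.ofReal (h y) ^ q := by
          rw [← lintegral_indicator measurableSet_Ioi, ← lintegral_indicator measurableSet_Ioo]
          refine lintegral_congr fun t => ?_
          simp only [indicator, mem_setOf_eq, mem_Ioi, mem_Ioo]
          have : t < c⁻¹ * h y ↔ c * t < h y := by rw [lt_inv_mul_iff₀ hc]
          simp only [this]
          split_ifs <;> simp_all
        rw [this, lintegral_mul_const _ hrm, lint_rpow_Ioo (by linarith)
          (mul_nonneg (inv_nonneg.2 hc.le) (h0 y)), show p - 1 - q + 1 = p - q by ring,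
          Real.mul_rpow (inv_nonneg.2 hc.le) (h0 y), mul_div_right_comm,
          ENNReal.ofReal_mul (by have := sub_pos.2 hq; positivity), mul_assoc]
        congr 1
        rw [← ENNReal.ofReal_rpow_of_nonneg (h0 y) (sub_pos.2 hq).le]
        rw [← ENNReal.rpow_add_of_nonneg _ _ (sub_pos.2 hq).le hq0.le, sub_add_cancel]
    _ = _ := lintegral_const_mul _ (hm.ennreal_ofReal.pow_const p)

/-- Layer-cake integration of the small part of a function. -/
lemma layer_small {X : Type*} [MeasurableSpace X] {μ : Measure X} [SFinite μ] {h : X → ℝ}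
    (hm : Measurable h) (h0 : ∀ x, 0 ≤ h x) {p q c : ℝ} (hq : p < q) (hc : 0 < c) (hp : 0 < p) :
    ∫⁻ t in Ioi (0:ℝ), ENNReal.ofReal (t ^ (p - 1 - q)) *
      ∫⁻ y in {y | h y ≤ c * t}, ENNReal.ofReal (h y) ^ q ∂μ
    = ENNReal.ofReal (c ^ (q - p) / (q - p)) * ∫⁻ y, ENNReal.ofReal (h y) ^ p ∂μ := by
  have hms2 : MeasurableSet {z : ℝ × X | h z.2 ≤ c * z.1} :=
    measurableSet_le (hm.comp measurable_snd) (by fun_prop)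
  have hrm : Measurable fun t : ℝ => ENNReal.ofReal (t ^ (p - 1 - q)) :=
    (measurable_id.pow_const _).ennreal_ofReal
  calc _ = ∫⁻ y, (∫⁻ t in Ioi (0:ℝ), {z : ℝ × X | h z.2 ≤ c * z.1}.indicator
          (fun z => ENNReal.ofReal (z.1 ^ (p - 1 - q)) * ENNReal.ofReal (h z.2) ^ q) (t, y)) ∂μ :=
        layer_swap hms2 hm _ _
    _ = ∫⁻ y, ENNReal.ofReal (c ^ (q - p) / (q - p)) * ENNReal.ofReal (h y) ^ p ∂μ := by
        refine lintegral_congr fun y => ?_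
        rcases (h0 y).eq_or_lt with hy | hy
        · simp only [indicator, mem_setOf_eq, ← hy, ENNReal.ofReal_zero,
            ENNReal.zero_rpow_of_pos hp, ENNReal.zero_rpow_of_pos (hp.trans hq), mul_zero, ite_self,
            lintegral_zero]
        have : ∫⁻ t in Ioi (0:ℝ), {z : ℝ × X | h z.2 ≤ c * z.1}.indicator
            (fun z => ENNReal.ofReal (z.1 ^ (p - 1 - q)) * ENNReal.ofReal (h z.2) ^ q) (t, y)
            = ∫⁻ t in Ioi (c⁻¹ * h y), ENNReal.ofReal (t ^ (p - 1 - q)) * ENNReal.ofReal (h y) ^ q := by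
          rw [← Measure.restrict_congr_set (Ioi_ae_eq_Ici (a := c⁻¹ * h y)).symm]
          rw [← lintegral_indicator measurableSet_Ioi, ← lintegral_indicator measurableSet_Ici]
          refine lintegral_congr fun t => ?_
          simp only [indicator, mem_setOf_eq, mem_Ioi, mem_Ici]
          have : c⁻¹ * h y ≤ t ↔ h y ≤ c * t := by rw [inv_mul_le_iff₀ hc]
          simp only [this]
          by_cases h1 : h y ≤ c * t
          · have : 0 < t := by
              by_contra! h2; nlinarith
            simp [h1, this]
          · simp [h1]
        rw [this, lintegral_mul_const _ hrm, lint_rpow_Ioi (by linarith)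
          (mul_pos (inv_pos.2 hc) hy), show p - 1 - q + 1 = -(q - p) by ring,
          neg_div_neg_eq, Real.mul_rpow (inv_nonneg.2 hc.le) hy.le, Real.inv_rpow hc.le,
          Real.rpow_neg hc.le, inv_inv, mul_div_right_comm,
          ENNReal.ofReal_mul (by positivity), mul_assoc]
        congr 1
        rw [← ENNReal.ofReal_rpow_of_pos hy, ← ENNReal.rpow_add _ _ (by simpa using hy)
          ENNReal.ofReal_ne_top]
        congr 1; ring
    _ = _ := lintegral_const_mul _ (hm.ennreal_ofReal.pow_const p)

/-- Strong type bound for Calderon-Zygmund convolution operators, for exponents close to `1`. -/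
lemma cz_strong {E F : Type*} [NormedAddCommGroup E] [NormedSpace ℝ E] [CompleteSpace E]
    [SecondCountableTopology E] [NormedAddCommGroup F] [NormedSpace ℝ F] [CompleteSpace F]
    {K : ℝ → E →L[ℝ] F} (hK : Continuous K) {B : ℝ} (hB : ∀ x, ‖K x‖ ≤ B) {A : ℝ≥0}
    (hA : A ≠ 0)
    (H1 : ∀ f : ℝ → E, Nice f → ∫⁻ x, ‖cvK K f x‖ₑ ^ 2 ≤ (A:ℝ≥0∞) ^ 2 * ∫⁻ x, ‖f x‖ₑ ^ 2)
    (H2 : ∀ y, ∫⁻ x in {x | 2 * |y| ≤ |x|}, ‖K (x - y) - K x‖ₑ ≤ A)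
    {f : ℝ → E} (hf : Nice f) {p : ℝ} (hp : 1 < p) (hp2 : p ≤ 4 / 3) :
    ∫⁻ x, ‖cvK K f x‖ₑ ^ p
      ≤ ENNReal.ofReal (60 / (p - 1)) * (2 * A) ^ p * ∫⁻ x, ‖f x‖ₑ ^ p := by
  have hA0 : (0:ℝ) < 2 * A := by positivity
  have hGm : StronglyMeasurable (fun x => ‖cvK K f x‖ / (2 * A)) :=
    by
    simp only [div_eq_mul_inv]; exact (cvK_measurable hK hf.sm).norm.mul_const _
  have hlc := lintegral_rpow_eq_lintegral_meas_lt_mul (volume : Measure ℝ)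
    (f := fun x => ‖cvK K f x‖ / (2 * A)) (ae_of_all _ fun x => by positivity)
    hGm.measurable.aemeasurable (p := p) (by linarith)
  have hfm : Measurable fun y => ‖f y‖ := hf.sm.norm.measurable
  have hL := layer_large (μ := (volume : Measure ℝ)) hfm (fun _ => norm_nonneg _) (p := p) (q := 1)
    (c := 1 / 2) hp (by norm_num) one_pos
  have hS := layer_small (μ := (volume : Measure ℝ)) hfm (fun _ => norm_nonneg _) (p := p) (q := 2)
    (c := 1) (by linarith) one_pos (by linarith)
  have hw : ∀ t ∈ Ioi (0:ℝ), volume {a | t < ‖cvK K f a‖ / (2 * A)} * ENNReal.ofReal (t ^ (p - 1))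
      ≤ 20 * (ENNReal.ofReal (t ^ (p - 1 - 1)) *
        ∫⁻ y in {y | 1 / 2 * t < ‖f y‖}, ENNReal.ofReal ‖f y‖ ^ (1:ℝ)) +
        ENNReal.ofReal (t ^ (p - 1 - 2)) *
        ∫⁻ y in {y | ‖f y‖ ≤ 1 * t}, ENNReal.ofReal ‖f y‖ ^ (2:ℝ) := by
    intro t ht
    have ht : 0 < t := ht
    have := cz_weak hK hB hA H1 H2 hf ht
    have e : {a | t < ‖cvK K f a‖ / (2 * A)} = {x | 2 * (A:ℝ) * t < ‖cvK K f x‖} := by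
      ext x; simp only [mem_setOf_eq]; rw [lt_div_iff₀ hA0, mul_comm]
    rw [e]
    have e1 : (ENNReal.ofReal (t / 2))⁻¹ * ENNReal.ofReal (t ^ (p - 1))
        = 2 * ENNReal.ofReal (t ^ (p - 1 - 1)) := by
      rw [← ENNReal.ofReal_inv_of_pos (by positivity), ← ENNReal.ofReal_mul (by positivity),
        show (2:ℝ≥0∞) = ENNReal.ofReal 2 by simp, ← ENNReal.ofReal_mul (by norm_num),
        Real.rpow_sub_one ht.ne' (p - 1)]
      congr 1; field_simp
    have e2 : (ENNReal.ofReal t ^ 2)⁻¹ * ENNReal.ofReal (t ^ (p - 1))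
        = ENNReal.ofReal (t ^ (p - 1 - 2)) := by
      rw [← ENNReal.ofReal_pow ht.le, ← ENNReal.ofReal_inv_of_pos (by positivity),
        ← ENNReal.ofReal_mul (by positivity), Real.rpow_sub ht (p - 1) 2, Real.rpow_two]
      congr 1; field_simp
    refine (mul_le_mul_left this _).trans (le_of_eq ?_)
    simp only [ENNReal.rpow_one, ENNReal.rpow_two, ofReal_norm, one_mul]
    rw [add_mul, ← e2, show (20:ℝ≥0∞) = 10 * 2 by norm_num, mul_assoc 10 2, ← mul_assoc 2, ← e1,
      show 1 / 2 * t = t / 2 by ring]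
    ring
  have key : ∫⁻ x, ENNReal.ofReal ((‖cvK K f x‖ / (2 * A)) ^ p)
      ≤ ENNReal.ofReal (60 / (p - 1)) * ∫⁻ x, ‖f x‖ₑ ^ p := by
    rw [hlc]
    have h1 := setLIntegral_mono' (μ := volume) measurableSet_Ioi hw
    have hmeas : Measurable fun t : ℝ => 20 * (ENNReal.ofReal (t ^ (p - 1 - 1)) *
        ∫⁻ y in {y | 1 / 2 * t < ‖f y‖}, ENNReal.ofReal ‖f y‖ ^ (1:ℝ)) := by
      refine Measurable.const_mul (Measurable.mul (measurable_id.pow_const _).ennreal_ofReal ?_) _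
      have : (fun t : ℝ => ∫⁻ y in {y | 1 / 2 * t < ‖f y‖}, ENNReal.ofReal ‖f y‖ ^ (1:ℝ))
          = fun t => ∫⁻ y, {z : ℝ × ℝ | 1 / 2 * z.1 < ‖f z.2‖}.indicator
            (fun z => ENNReal.ofReal ‖f z.2‖ ^ (1:ℝ)) (t, y) := by
        funext t
        rw [← lintegral_indicator (measurableSet_lt measurable_const hfm)]
        rfl
      rw [this]
      exact Measurable.lintegral_prod_right' (((hfm.comp measurable_snd).ennreal_ofReal.pow_const _).indicator
        (measurableSet_lt (by fun_prop) (hfm.comp measurable_snd)))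
    rw [lintegral_add_left hmeas, lintegral_const_mul' _ _ (by norm_num), hL, hS] at h1
    simp only [ofReal_norm] at h1
    refine (mul_le_mul_right h1 _).trans ?_
    rw [← mul_assoc, ← add_mul, ← mul_assoc]
    refine mul_le_mul_left ?_ _
    rw [show (20:ℝ≥0∞) = ENNReal.ofReal 20 by simp, ← ENNReal.ofReal_mul (by norm_num),
      ← ENNReal.ofReal_add (by have : 0 < p - 1 := by linarith
                               positivity) (by have : 0 < 2 - p := by linarith
                                               positivity),
      ← ENNReal.ofReal_mul (by linarith)]
    refine ENNReal.ofReal_le_ofReal ?_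
    have h2 : (1 / 2 : ℝ)⁻¹ ^ (p - 1) ≤ 3 / 2 := by
      have : ((1 / 2 : ℝ)⁻¹ ^ (p - 1)) ≤ 2 ^ (1 / 3 : ℝ) := by
        norm_num
        linarith
      refine this.trans ?_
      have h6 : ((2:ℝ) ^ (1 / 3 : ℝ)) ^ 3 = 2 := by
        rw [← Real.rpow_natCast, ← Real.rpow_mul (by norm_num)]; norm_num
      by_contra! h7
      have := pow_lt_pow_left₀ h7 (by norm_num) (n := 3) (by norm_num)
      rw [h6] at this; norm_num at this
    rw [Real.one_rpow]
    have h3 : 1 / (2 - p) ≤ 1 / (p - 1) / 2 := by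
      rw [div_div, div_le_div_iff₀ (by linarith) (by linarith)]; linarith
    have h8 : 0 ≤ 20 * ((1 / 2 : ℝ)⁻¹ ^ (p - 1) / (p - 1)) + 1 / (2 - p) := by
      have : 0 < 2 - p := by linarith
      positivity
    calc p * (20 * ((1 / 2 : ℝ)⁻¹ ^ (p - 1) / (p - 1)) + 1 / (2 - p))
        ≤ (4 / 3) * (20 * (3 / 2 / (p - 1)) + 1 / (p - 1) / 2) := by
          gcongr
      _ = (4 / 3 * (30.5)) * (1 / (p - 1)) := by ring
      _ ≤ 60 * (1 / (p - 1)) := by gcongr; norm_num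
      _ = 60 / (p - 1) := by ring
  calc ∫⁻ x, ‖cvK K f x‖ₑ ^ p
      = (2 * A) ^ p * ∫⁻ x, ENNReal.ofReal ((‖cvK K f x‖ / (2 * A)) ^ p) := by
        rw [← lintegral_const_mul' _ _ (ENNReal.rpow_ne_top_of_nonneg (by linarith) (by finiteness))]
        refine lintegral_congr fun x => ?_
        rw [← ENNReal.ofReal_rpow_of_nonneg (by positivity) (by linarith),
          ← ENNReal.mul_rpow_of_nonneg _ _ (by linarith)]
        congr 1
        rw [show (2 * (A:ℝ≥0∞)) = ENNReal.ofReal (2 * A) by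
          rw [ENNReal.ofReal_mul (by norm_num)]; simp, ← ENNReal.ofReal_mul hA0.le,
          mul_div_cancel₀ _ hA0.ne', ofReal_norm]
    _ ≤ (2 * A) ^ p * (ENNReal.ofReal (60 / (p - 1)) * ∫⁻ x, ‖f x‖ₑ ^ p) := mul_le_mul_right key _
    _ = _ := by ring

lemma eLpNorm_two_sq {X : Type*} [MeasurableSpace X] {μ : Measure X} (f : X → ℂ) :
    eLpNorm f 2 μ ^ 2 = ∫⁻ x, ‖f x‖ₑ ^ 2 ∂μ := by
  rw [eLpNorm_eq_lintegral_rpow_enorm_toReal (by norm_num) (by norm_num)]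
  simp only [ENNReal.toReal_ofNat, ENNReal.rpow_ofNat]
  rw [← ENNReal.rpow_natCast, ← ENNReal.rpow_mul]; norm_num

lemma memLp_two_of {X : Type*} [MeasurableSpace X] {μ : Measure X} {f : X → ℂ}
    (hf : AEStronglyMeasurable f μ) (h : ∫⁻ x, ‖f x‖ₑ ^ 2 ∂μ < ∞) : MemLp f 2 μ := by
  refine ⟨hf, ?_⟩
  rw [← eLpNorm_two_sq] at h
  by_contra h2
  rw [not_lt_top_iff] at h2
  simp [h2] at h

/-- Plancherel's theorem for integrable square integrable functions. -/
lemma plancherel_one {f : ℝ → ℂ} (hf : Integrable f) (h2 : ∫⁻ x, ‖f x‖ₑ ^ 2 < ∞) :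
    ∫⁻ ξ, ‖𝓕 f ξ‖ₑ ^ 2 = ∫⁻ x, ‖f x‖ₑ ^ 2 := by
  have hm : MemLp f 2 := memLp_two_of hf.aestronglyMeasurable h2
  let F : Lp ℂ 2 (volume : Measure ℝ) := hm.toLp f
  have hFf : ⇑F =ᵐ[volume] f := hm.coeFn_toLp
  have hc : Continuous (𝓕 f) :=
    VectorFourier.fourierIntegral_continuous Real.continuous_fourierChar (by fun_prop) hf
  have hae : 𝓕 f =ᵐ[volume] ((𝓕 F : Lp ℂ 2 (volume : Measure ℝ)) : ℝ → ℂ) := by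
    refine ae_eq_of_integral_contDiff_smul_eq hc.locallyIntegrable
      ((Lp.memLp (𝓕 F : Lp ℂ 2 (volume : Measure ℝ))).locallyIntegrable (by norm_num)) fun g hg hgc => ?_
    have hgc' : HasCompactSupport (fun x => (g x : ℂ)) := hgc.comp_left (g := fun x : ℝ => (x : ℂ)) (by simp)
    have hg' : ContDiff ℝ (⊤ : ℕ∞) (fun x => (g x : ℂ)) := Complex.ofRealCLM.contDiff.comp hg
    let G : SchwartzMap ℝ ℂ := hgc'.toSchwartzMap hg'
    have h1 := congrArg (fun T => T G) (Lp.fourier_toTemperedDistribution_eq F)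
    simp only [TemperedDistribution.fourier_apply, Lp.toTemperedDistribution_apply] at h1
    have h3 : ∀ x, G x = (g x : ℂ) := fun x => rfl
    have h4 := VectorFourier.integral_fourierIntegral_smul_eq_flip (f := fun x => G x) (g := f)
      (L := innerₗ ℝ) (μ := (volume : Measure ℝ)) (ν := (volume : Measure ℝ))
      Real.continuous_fourierChar (by fun_prop) G.integrable hf
    have e1 : ∫ x, g x • 𝓕 f x = ∫ x, G x • 𝓕 f x := by
      refine integral_congr_ae (ae_of_all _ fun x => ?_)
      simp [h3]
    have e2 : ∫ x, g x • (𝓕 F : Lp ℂ 2 (volume : Measure ℝ)) x = ∫ x, G x • (𝓕 F : Lp ℂ 2 (volume : Measure ℝ)) x := by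
      refine integral_congr_ae (ae_of_all _ fun x => ?_)
      simp [h3]
    rw [e1, e2, ← h1]
    have e3 : ∫ x, (𝓕 G) x • F x = ∫ x, (𝓕 G) x • f x :=
      integral_congr_ae (hFf.mono fun x hx => by simp only [hx])
    rw [e3, SchwartzMap.fourier_coe]
    rw [flip_innerₗ] at h4
    exact h4.symm
  have hn := Lp.norm_fourier_eq F
  rw [Lp.norm_def, Lp.norm_def, ENNReal.toReal_eq_toReal_iff' (Lp.eLpNorm_ne_top _)
    (Lp.eLpNorm_ne_top _), ← eLpNorm_congr_ae hae, eLpNorm_congr_ae hFf] at hn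
  rw [← eLpNorm_two_sq, ← eLpNorm_two_sq, hn]

lemma fourier_exp (f : ℝ → ℂ) (ξ : ℝ) :
    𝓕 f ξ = ∫ x, Complex.exp ((((-(2 * Real.pi * (x * ξ))) : ℝ) : ℂ) * Complex.I) * f x := by
  rw [Real.fourier_real_eq_integral_exp_smul]
  refine integral_congr_ae (ae_of_all _ fun x => ?_)
  simp only [smul_eq_mul]
  congr 3
  push_cast; ring

lemma norm_expI (t : ℝ) : ‖Complex.exp ((t : ℂ) * Complex.I)‖ = 1 :=
  Complex.norm_exp_ofReal_mul_I t

lemma fourier_slices {f : ℝ × ℝ → ℂ} (hf : Integrable f) (ξ : ℝ × ℝ) :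
    FT f ξ = 𝓕 (fun x2 => 𝓕 (fun x1 => f (x1, x2)) ξ.1) ξ.2 := by
  rw [FT, fourier_exp, Measure.volume_eq_prod, integral_prod_symm]
  · refine integral_congr_ae (ae_of_all _ fun x => ?_)
    simp only [fourier_exp]
    rw [← integral_const_mul]
    refine integral_congr_ae (ae_of_all _ fun y => ?_)
    simp only
    rw [← mul_assoc, ← Complex.exp_add]
    congr 2
    push_cast; ring
  · refine hf.bdd_mul (c := 1) ?_ (ae_of_all _ fun x => (norm_expI _).le)
    exact (by fun_prop : Continuous _).aestronglyMeasurable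

/-- Plancherel's theorem on the plane, for integrable square integrable functions. -/
lemma plancherel_two {f : ℝ × ℝ → ℂ} (hs : StronglyMeasurable f) (hf : Integrable f)
    (h2 : ∫⁻ x, ‖f x‖ₑ ^ 2 < ∞) :
    ∫⁻ ξ, ‖FT f ξ‖ₑ ^ 2 = ∫⁻ x, ‖f x‖ₑ ^ 2 := by
  have hG : StronglyMeasurable (fun q : ℝ × ℝ => 𝓕 (fun x1 => f (x1, q.2)) q.1) := by
    simp only [fourier_exp]
    refine StronglyMeasurable.integral_prod_right' (f := fun z : (ℝ × ℝ) × ℝ =>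
      Complex.exp ((((-(2 * Real.pi * (z.2 * z.1.1))) : ℝ) : ℂ) * Complex.I) * f (z.2, z.1.2)) ?_
    exact (by fun_prop : Continuous _).stronglyMeasurable.mul
      (hs.comp_measurable (by fun_prop))
  have hfm : Measurable fun x => ‖f x‖ₑ ^ 2 := hs.enorm.pow_const 2
  have hGm : Measurable fun q : ℝ × ℝ => ‖𝓕 (fun x1 => f (x1, q.2)) q.1‖ₑ ^ 2 := hG.enorm.pow_const 2
  have hfs : ∫⁻ x, ‖f x‖ₑ ^ 2 = ∫⁻ x2, ∫⁻ x1, ‖f (x1, x2)‖ₑ ^ 2 := by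
    rw [Measure.volume_eq_prod, lintegral_prod_symm _ hfm.aemeasurable]
  have h3 : ∀ᵐ x2, ∫⁻ x1, ‖f (x1, x2)‖ₑ ^ 2 < ∞ := by
    refine ae_lt_top (hfm.lintegral_prod_left') ?_
    rw [← hfs]; exact h2.ne
  have h4 : ∀ᵐ x2 : ℝ, Integrable (fun x1 => f (x1, x2)) := by
    rw [Measure.volume_eq_prod] at hf
    exact hf.prod_left_ae
  have h5 : ∀ᵐ x2 : ℝ, ∫⁻ ξ1, ‖𝓕 (fun x1 => f (x1, x2)) ξ1‖ₑ ^ 2 = ∫⁻ x1, ‖f (x1, x2)‖ₑ ^ 2 := by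
    filter_upwards [h3, h4] with x2 h3 h4 using plancherel_one h4 h3
  have h6 : ∫⁻ ξ1, ∫⁻ x2, ‖𝓕 (fun x1 => f (x1, x2)) ξ1‖ₑ ^ 2 = ∫⁻ x, ‖f x‖ₑ ^ 2 := by
    rw [hfs, ← lintegral_congr_ae h5, lintegral_lintegral_swap]
    exact hGm.aemeasurable
  have h7 : ∀ᵐ ξ1 : ℝ, ∫⁻ x2, ‖𝓕 (fun x1 => f (x1, x2)) ξ1‖ₑ ^ 2 < ∞ := by
    refine ae_lt_top (hGm.lintegral_prod_right') ?_
    rw [h6]; exact h2.ne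
  have h8 : ∀ ξ1, Integrable (fun x2 => 𝓕 (fun x1 => f (x1, x2)) ξ1) := by
    intro ξ1
    simp only [fourier_exp]
    have : Integrable (fun x : ℝ × ℝ =>
        Complex.exp ((((-(2 * Real.pi * (x.1 * ξ1))) : ℝ) : ℂ) * Complex.I) * f x) := by
      refine hf.bdd_mul (c := 1) ?_ (ae_of_all _ fun x => (norm_expI _).le)
      exact (by fun_prop : Continuous _).aestronglyMeasurable
    rw [Measure.volume_eq_prod] at this
    exact this.integral_prod_right
  have hFm : Measurable fun ξ : ℝ × ℝ =>
      ‖𝓕 (fun x2 => 𝓕 (fun x1 => f (x1, x2)) ξ.1) ξ.2‖ₑ ^ 2 := by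
    refine Measurable.pow_const (StronglyMeasurable.enorm ?_) 2
    conv => enter [1, ξ]; rw [fourier_exp]
    refine StronglyMeasurable.integral_prod_right' (f := fun z : (ℝ × ℝ) × ℝ =>
      Complex.exp ((((-(2 * Real.pi * (z.2 * z.1.2))) : ℝ) : ℂ) * Complex.I) *
        𝓕 (fun x1 => f (x1, z.2)) z.1.1) ?_
    exact (by fun_prop : Continuous _).stronglyMeasurable.mul
      (hG.comp_measurable (g := fun z : (ℝ × ℝ) × ℝ => (z.1.1, z.2)) (by fun_prop))
  simp only [fourier_slices hf]
  rw [Measure.volume_eq_prod, lintegral_prod _ hFm.aemeasurable]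
  rw [← Measure.volume_eq_prod, ← h6]
  refine lintegral_congr_ae ?_
  filter_upwards [h7] with ξ1 h7 using plancherel_one (h8 ξ1) h7

/-- Plancherel's theorem for the inverse transform. -/
lemma plancherel_inv {f : ℝ × ℝ → ℂ} (hs : StronglyMeasurable f) (hf : Integrable f)
    (h2 : ∫⁻ x, ‖f x‖ₑ ^ 2 < ∞) :
    ∫⁻ ξ, ‖FTinv f ξ‖ₑ ^ 2 = ∫⁻ x, ‖f x‖ₑ ^ 2 := by
  rw [← plancherel_two hs hf h2]
  have : ∀ ξ, FTinv f ξ = FT f (-ξ) := by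
    intro ξ
    refine integral_congr_ae (ae_of_all _ fun x => ?_)
    simp only [Prod.fst_neg, Prod.snd_neg]
    congr 4; ring
  simp only [this]
  exact lintegral_neg_eq_self (μ := (volume : Measure (ℝ × ℝ))) (f := fun ξ => ‖FT f ξ‖ₑ ^ 2)

/-- Lacunarity of a finite family of positive scales, in summed form. -/
structure LacSum {α : Type*} [Fintype α] (t : α → ℝ) (L : ℝ) : Prop where
  pos : ∀ i, 0 < t i
  sum : ∀ x : ℝ, 0 < x → ∑ i, min (x * t i) (x * t i)⁻¹ ≤ L

/-- A Littlewood-Paley kernel with quantitative bounds. -/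
structure LPk (k : ℝ → ℂ) (C : ℝ) : Prop where
  int : Integrable k
  bdd : ∀ x, ‖k x‖ ≤ C
  diff : Differentiable ℝ k
  der : ∀ x, ‖deriv k x‖ ≤ C
  der3 : ∀ x, ‖deriv k x‖ * |x| ^ 3 ≤ C
  ft1 : ∀ η, ‖𝓕 k η‖ ≤ C * |η|
  ft2 : ∀ η, ‖𝓕 k η‖ * |η| ≤ C

/-- The `L¹` normalized dilate. -/
def sc (k : ℝ → ℂ) (s : ℝ) (x : ℝ) : ℂ := (s⁻¹ : ℝ) * k (s⁻¹ * x)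

section
variable {k : ℝ → ℂ} {C : ℝ}

lemma LPk.pos (h : LPk k C) : 0 ≤ C := (norm_nonneg _).trans (h.bdd 0)

lemma sc_integrable (h : Integrable k) {s : ℝ} (hs : 0 < s) : Integrable (sc k s) :=
  (h.comp_mul_left' (inv_ne_zero hs.ne')).const_mul _

lemma sc_continuous (h : Continuous k) (s : ℝ) : Continuous (sc k s) := by
  unfold sc; fun_prop

lemma fourier_sc {s : ℝ} (hs : 0 < s) (η : ℝ) : 𝓕 (sc k s) η = 𝓕 k (s * η) := by
  simp only [fourier_exp, sc]
  have := Measure.integral_comp_mul_left (fun x : ℝ =>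
    Complex.exp ((((-(2 * Real.pi * (x * (s * η)))) : ℝ) : ℂ) * Complex.I) * k x) s⁻¹
  rw [inv_inv, abs_of_pos hs] at this
  have h2 : ∀ x : ℝ, Complex.exp ((((-(2 * Real.pi * (x * η))) : ℝ) : ℂ) * Complex.I) *
      ((s⁻¹ : ℝ) * k (s⁻¹ * x)) = (s⁻¹ : ℝ) * (Complex.exp ((((-(2 * Real.pi * (s⁻¹ * x * (s * η)))) : ℝ) : ℂ) * Complex.I) * k (s⁻¹ * x)) := by
    intro x
    rw [show s⁻¹ * x * (s * η) = x * η by field_simp]; ring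
  simp_rw [h2]
  rw [integral_const_mul, this, ← Complex.real_smul, smul_smul, inv_mul_cancel₀ hs.ne', one_smul]

lemma LPk.ft_min (h : LPk k C) {s : ℝ} (hs : 0 < s) {η : ℝ} (hη : η ≠ 0) :
    ‖𝓕 (sc k s) η‖ ≤ C * min (|η| * s) (|η| * s)⁻¹ := by
  have h1 := h.ft1 (s * η)
  have h2 := h.ft2 (s * η)
  have h3 : 0 < |η| * s := mul_pos (abs_pos.2 hη) hs
  rw [fourier_sc hs, mul_min_of_nonneg _ _ h.pos]
  have e : |s * η| = |η| * s := by rw [abs_mul, abs_of_pos hs, mul_comm]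
  rw [e] at h1 h2
  exact le_min h1 (by rwa [← div_eq_mul_inv, le_div_iff₀ h3])

lemma LPk.diff_le (h : LPk k C) {s x y : ℝ} (hs : 0 < s) (hx : 2 * |y| ≤ |x|) (hx0 : 0 < |x|) :
    ‖sc k s (x - y) - sc k s x‖ ≤ 8 * C * (|y| / x ^ 2) * min (|x|⁻¹ * s) (|x|⁻¹ * s)⁻¹ := by
  have h0 := h.pos
  have hd : ∀ z ∈ segment ℝ (s⁻¹ * x) (s⁻¹ * (x - y)), ‖deriv k z‖ ≤ C * min 1 (8 * (s / |x|) ^ 3) := by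
    intro z hz
    have hz2 : |x| / (2 * s) ≤ |z| := by
      obtain ⟨a, b, ha, hb, hab, rfl⟩ := hz
      have e : a • (s⁻¹ * x) + b • (s⁻¹ * (x - y)) = s⁻¹ * (x - b * y) := by
        simp only [smul_eq_mul]
        have : a = 1 - b := by linarith
        rw [this]; ring
      rw [e, abs_mul, abs_of_pos (inv_pos.2 hs)]
      have h1 : |b * y| ≤ |y| := by
        rw [abs_mul, abs_of_nonneg hb]
        exact mul_le_of_le_one_left (abs_nonneg _) (by linarith)
      have h2 : |x| - |b * y| ≤ |x - b * y| := abs_sub_abs_le_abs_sub _ _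
      have h3 : |x| / 2 ≤ |x - b * y| := by linarith
      calc |x| / (2 * s) = s⁻¹ * (|x| / 2) := by field_simp
        _ ≤ _ := by gcongr
    have hz0 : 0 < |x| / (2 * s) := by positivity
    rw [mul_min_of_nonneg _ _ h0, mul_one]
    refine le_min (h.der z) ?_
    have h3 := h.der3 z
    have h4 : ‖deriv k z‖ * (|x| / (2 * s)) ^ 3 ≤ C :=
      (mul_le_mul_of_nonneg_left (pow_le_pow_left₀ hz0.le hz2 3) (norm_nonneg _)).trans h3
    rw [← le_div_iff₀ (by positivity)] at h4
    refine h4.trans (le_of_eq ?_)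
    field_simp; ring
  have hm := (convex_segment (s⁻¹ * x) (s⁻¹ * (x - y))).norm_image_sub_le_of_norm_deriv_le
    (f := k) (fun z _ => h.diff z) hd (left_mem_segment ℝ _ _) (right_mem_segment ℝ _ _)
  have e : sc k s (x - y) - sc k s x = (s⁻¹ : ℝ) * (k (s⁻¹ * (x - y)) - k (s⁻¹ * x)) := by
    unfold sc; ring
  rw [e, norm_mul, Complex.norm_real, Real.norm_eq_abs, abs_of_pos (inv_pos.2 hs)]
  have e2 : ‖s⁻¹ * (x - y) - s⁻¹ * x‖ = s⁻¹ * |y| := by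
    rw [← mul_sub, norm_mul, Real.norm_eq_abs, Real.norm_eq_abs, abs_of_pos (inv_pos.2 hs)]
    simp
  rw [e2] at hm
  set r : ℝ := |x|⁻¹ * s with hr
  have hr0 : 0 < r := by positivity
  have key : r⁻¹ ^ 2 * min 1 (8 * r ^ 3) ≤ 8 * min r r⁻¹ := by
    rcases le_total r 1 with h1 | h1
    · rw [min_eq_left (h1.trans ((one_le_inv₀ hr0).2 h1))]
      calc r⁻¹ ^ 2 * min 1 (8 * r ^ 3) ≤ r⁻¹ ^ 2 * (8 * r ^ 3) := by gcongr; exact min_le_right _ _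
        _ = 8 * r := by field_simp
    · rw [min_eq_right ((inv_le_one_of_one_le₀ h1).trans h1)]
      calc r⁻¹ ^ 2 * min 1 (8 * r ^ 3) ≤ r⁻¹ ^ 2 * 1 := by gcongr; exact min_le_left _ _
        _ = r⁻¹ * r⁻¹ := by ring
        _ ≤ 8 * r⁻¹ := by
          gcongr
          exact (inv_le_one_of_one_le₀ h1).trans (by norm_num)
  calc s⁻¹ * ‖k (s⁻¹ * (x - y)) - k (s⁻¹ * x)‖
      ≤ s⁻¹ * (C * min 1 (8 * (s / |x|) ^ 3) * (s⁻¹ * |y|)) := by gcongr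
    _ = C * (|y| / x ^ 2) * (r⁻¹ ^ 2 * min 1 (8 * r ^ 3)) := by
      rw [show s / |x| = r by rw [hr]; field_simp, ← sq_abs x, hr]
      field_simp
    _ ≤ C * (|y| / x ^ 2) * (8 * min r r⁻¹) := by gcongr
    _ = _ := by ring

end

lemma lint_horm (y : ℝ) : ∫⁻ x in {x | 2 * |y| ≤ |x|}, ENNReal.ofReal (|y| / x ^ 2) ≤ 1 := by
  rcases eq_or_ne y 0 with rfl | hy
  · simp
  have hy0 : 0 < |y| := abs_pos.2 hy
  have h1 : ∫⁻ x in Ioi (2 * |y|), ENNReal.ofReal (|y| / x ^ 2) = ENNReal.ofReal (1 / 2) := by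
    have e : ∀ x ∈ Ioi (2 * |y|), ENNReal.ofReal (|y| / x ^ 2)
        = ENNReal.ofReal |y| * ENNReal.ofReal (x ^ (-2 : ℝ)) := by
      intro x hx
      have : 0 < x := (by positivity : 0 < 2 * |y|).trans hx
      rw [← ENNReal.ofReal_mul hy0.le, Real.rpow_neg this.le, Real.rpow_two]; rfl
    rw [setLIntegral_congr_fun measurableSet_Ioi e, lintegral_const_mul' _ _ (by simp),
      lint_rpow_Ioi (by norm_num) (by positivity), ← ENNReal.ofReal_mul hy0.le]
    congr 1
    norm_num
    rw [Real.rpow_neg_one]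
    field_simp
  have hsub : {x : ℝ | 2 * |y| ≤ |x|} ⊆ Ici (2 * |y|) ∪ Iic (-(2 * |y|)) := by
    intro x hx
    have hx : 2 * |y| ≤ |x| := hx
    rcases abs_choice x with h | h
    · left; rw [h] at hx; exact hx
    · right; rw [h] at hx; show x ≤ _; linarith
  refine (lintegral_mono_set hsub).trans ((lintegral_union_le _ _ _).trans ?_)
  have h2 : ∫⁻ x in Iic (-(2 * |y|)), ENNReal.ofReal (|y| / x ^ 2) = ∫⁻ x in Ici (2 * |y|), ENNReal.ofReal (|y| / x ^ 2) := by
    rw [← lintegral_indicator measurableSet_Iic, ← lintegral_indicator measurableSet_Ici,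
      ← lintegral_neg_eq_self]
    refine lintegral_congr fun x => ?_
    simp only [indicator, mem_Iic, mem_Ici, neg_le_neg_iff, even_two, Even.neg_pow]
  rw [h2, Measure.restrict_congr_set (Ioi_ae_eq_Ici (a := 2 * |y|)).symm, h1,
    ← ENNReal.ofReal_add (by norm_num) (by norm_num)]
  norm_num

/-- Convolution on the line. -/
def cv1 (k g : ℝ → ℂ) (x : ℝ) : ℂ := ∫ y, k (x - y) * g y

lemma cv1_eq (k g : ℝ → ℂ) : cv1 k g = convolution g k (ContinuousLinearMap.mul ℂ ℂ) volume := by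
  funext x
  simp only [cv1, convolution, ContinuousLinearMap.mul_apply', mul_comm]

lemma cv1_integrable {k g : ℝ → ℂ} (hk : Integrable k) (hg : Integrable g) :
    Integrable (cv1 k g) := by
  rw [cv1_eq]; exact hg.integrable_convolution _ hk

lemma fourier_cv1 {k g : ℝ → ℂ} (hk : Integrable k) (hg : Integrable g) (η : ℝ) :
    𝓕 (cv1 k g) η = 𝓕 k η * 𝓕 g η := by
  rw [cv1_eq, Real.fourier_mul_convolution_eq hg hk, mul_comm]

lemma cv1_bdd {k g : ℝ → ℂ} (hk : Integrable k) {B : ℝ} (hg : ∀ x, ‖g x‖ ≤ B) (x : ℝ) :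
    ‖cv1 k g x‖ ≤ (∫ y, ‖k y‖) * B := by
  calc ‖cv1 k g x‖ ≤ ∫ y, ‖k (x - y)‖ * B := by
        refine norm_integral_le_of_norm_le ((hk.comp_sub_left x).norm.mul_const B) (ae_of_all _ fun y => ?_)
        rw [norm_mul]
        exact mul_le_mul_of_nonneg_left (hg y) (norm_nonneg _)
    _ = _ := by
      rw [integral_mul_const, integral_sub_left_eq_self (fun y => ‖k y‖) volume x]

/-- Integrable bounded functions are square integrable. -/
lemma sq_lt_top_of_bdd {X : Type*} [MeasurableSpace X] {μ : Measure X} {E : Type*}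
    [NormedAddCommGroup E] {f : X → E} (hf : Integrable f μ)
    {B : ℝ} (hB : ∀ x, ‖f x‖ ≤ B) : ∫⁻ x, ‖f x‖ₑ ^ 2 ∂μ < ∞ := by
  have : ∫⁻ x, ‖f x‖ₑ ^ 2 ∂μ ≤ ∫⁻ x, ENNReal.ofReal B * ‖f x‖ₑ ∂μ := by
    refine lintegral_mono fun x => ?_
    rw [sq]
    gcongr
    rw [← ofReal_norm_eq_enorm]
    exact ENNReal.ofReal_le_ofReal (hB x)
  refine this.trans_lt ?_
  rw [lintegral_const_mul' _ _ (by simp)]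
  exact ENNReal.mul_lt_top (by simp) hf.2

section sys
variable {α β δ : Type*} [Fintype α] [Fintype β] [Fintype δ]

/-- An incidence pattern `α ← δ → β` with scales for which matrices with lacunary entries are
bounded on `ℓ²`. -/
def LPsys (a : δ → α) (o : δ → β) (s : δ → ℝ) (L : ℝ) : Prop :=
  (∀ d, 0 < s d) ∧ ∀ (c : δ → ℂ) (D x : ℝ), 0 ≤ D → 0 < x →
    (∀ d, ‖c d‖ ≤ D * min (x * s d) (x * s d)⁻¹) → ∀ v : α → ℂ,
      ∑ i, ‖∑ d, if o d = i then c d * v (a d) else 0‖ ^ 2 ≤ (D * L) ^ 2 * ∑ i, ‖v i‖ ^ 2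

lemma LacSum.sum_fiber_sq_le {γ : Type*} {o : δ → γ} {s : δ → ℝ} {L D x : ℝ} {i : γ} {c : δ → ℂ}
    (hL : LacSum (fun d : {d // o d = i} => s d) L) (hD : 0 ≤ D) (hx : 0 < x)
    (hc : ∀ d, ‖c d‖ ≤ D * min (x * s d) (x * s d)⁻¹) :
    ∑ d ∈ Finset.univ.filter (fun d => o d = i), ‖c d‖ ^ 2 ≤ (D * L) ^ 2 := by
  refine (Finset.sum_sq_le_sq_sum_of_nonneg fun i _ => norm_nonneg _).trans ?_
  refine pow_le_pow_left₀ (Finset.sum_nonneg fun i _ => norm_nonneg _) ?_ 2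
  refine (Finset.sum_le_sum fun d _ => hc d).trans ?_
  rw [← Finset.mul_sum]
  refine mul_le_mul_of_nonneg_left ?_ hD
  refine le_trans (le_of_eq ?_) (hL.sum x hx)
  rw [← Finset.sum_subtype_eq_sum_filter]
  simp only [Finset.subtype_univ]

/-- One output for each scale. -/
lemma LPsys.diag {a : δ → α} {s : δ → ℝ} {L : ℝ} (hs : ∀ d, 0 < s d) (hL : ∀ i, LacSum (fun d : {d // a d = i} => s d) L) :
    LPsys a (fun d : δ => d) s L := by
  refine ⟨hs, fun c D x hD hx hc v => ?_⟩
  have h1 : ∀ i : δ, (∑ d, if d = i then c d * v (a d) else 0) = c i * v (a i) := by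
    intro i; simp
  simp only [h1, norm_mul, mul_pow]
  rw [Finset.mul_sum, ← Finset.sum_fiberwise (s := Finset.univ) (g := a)]
  refine Finset.sum_le_sum fun i _ => ?_
  have h2 : ∀ d ∈ Finset.univ.filter (fun d => a d = i), ‖c d‖ ^ 2 * ‖v (a d)‖ ^ 2 = ‖c d‖ ^ 2 * ‖v i‖ ^ 2 := by
    intro d hd
    rw [(Finset.mem_filter.1 hd).2]
  rw [Finset.sum_congr rfl h2, ← Finset.sum_mul]
  refine mul_le_mul_of_nonneg_right ?_ (by positivity)
  rw [← mul_pow]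
  exact (hL i).sum_fiber_sq_le hD hx hc

/-- Sums over the fibres of the output map. -/
lemma LPsys.recomb {o : δ → β} {s : δ → ℝ} {L : ℝ} (hs : ∀ d, 0 < s d) (hL : ∀ i, LacSum (fun d : {d // o d = i} => s d) L) :
    LPsys (fun d : δ => d) o s L := by
  refine ⟨hs, fun c D x hD hx hc v => ?_⟩
  rw [← Finset.sum_fiberwise (s := Finset.univ) (g := o) (f := fun i => ‖v i‖ ^ 2), Finset.mul_sum]
  refine Finset.sum_le_sum fun i _ => ?_
  rw [← Finset.sum_filter]
  have h1 : ‖∑ d ∈ Finset.univ.filter (fun d => o d = i), c d * v d‖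
      ≤ ∑ d ∈ Finset.univ.filter (fun d => o d = i), ‖c d‖ * ‖v d‖ := by
    refine (norm_sum_le _ _).trans (le_of_eq ?_)
    simp only [norm_mul]
  refine (pow_le_pow_left₀ (norm_nonneg _) h1 2).trans ((Finset.sum_mul_sq_le_sq_mul_sq _ _ _).trans ?_)
  refine mul_le_mul_of_nonneg_right ?_ (Finset.sum_nonneg fun _ _ => by positivity)
  exact (hL i).sum_fiber_sq_le hD hx hc

/-- The matrix unit attached to `d`. -/
def mUnit (a : δ → α) (o : δ → β) (d : δ) : EuclideanSpace ℂ α →L[ℝ] EuclideanSpace ℂ β :=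
  LinearMap.toContinuousLinearMap
    { toFun := fun v => WithLp.toLp 2 (fun i => if o d = i then v (a d) else 0)
      map_add' := fun v w => by
        ext i; by_cases h : o d = i <;> simp [h]
      map_smul' := fun r v => by
        ext i; by_cases h : o d = i <;> simp [h] }

lemma mUnit_apply (a : δ → α) (o : δ → β) (d : δ) (v : EuclideanSpace ℂ α) (i : β) :
    mUnit a o d v i = if o d = i then v (a d) else 0 := rfl

/-- The operator-valued Littlewood-Paley kernel. -/
def lpK (k : ℝ → ℂ) (a : δ → α) (o : δ → β) (s : δ → ℝ) (x : ℝ) :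
    EuclideanSpace ℂ α →L[ℝ] EuclideanSpace ℂ β := ∑ d, sc k (s d) x • mUnit a o d

lemma lpK_apply (k : ℝ → ℂ) (a : δ → α) (o : δ → β) (s : δ → ℝ) (x : ℝ)
    (v : EuclideanSpace ℂ α) (i : β) :
    lpK k a o s x v i = ∑ d, if o d = i then sc k (s d) x * v (a d) else 0 := by
  simp only [lpK, ContinuousLinearMap.sum_apply, ContinuousLinearMap.smul_apply, WithLp.ofLp_sum,
    Finset.sum_apply, PiLp.smul_apply, mUnit_apply, smul_eq_mul, mul_ite, mul_zero]

lemma enorm_sq_euclid (v : EuclideanSpace ℂ α) : ‖v‖ₑ ^ 2 = ∑ i, ‖v i‖ₑ ^ 2 := by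
  have : ∀ {E : Type} [NormedAddCommGroup E] (z : E), ‖z‖ₑ ^ 2 = ENNReal.ofReal (‖z‖ ^ 2) := by
    intro E _ z
    rw [ENNReal.ofReal_pow (norm_nonneg _), ofReal_norm_eq_enorm]
  have h2 : ‖v‖ₑ ^ 2 = ENNReal.ofReal (‖v‖ ^ 2) := by
    rw [ENNReal.ofReal_pow (norm_nonneg _), ofReal_norm_eq_enorm]
  rw [h2, EuclideanSpace.norm_sq_eq, ENNReal.ofReal_sum_of_nonneg (fun _ _ => by positivity)]
  simp only [this]

variable {k : ℝ → ℂ} {C L : ℝ} {a : δ → α} {o : δ → β} {s : δ → ℝ}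

lemma LPk.continuous (h : LPk k C) : Continuous k := h.diff.continuous

lemma lpK_continuous (h : LPk k C) : Continuous (lpK k a o s) := by
  unfold lpK
  exact continuous_finset_sum _ fun d _ => (sc_continuous h.continuous _).smul continuous_const

lemma lpK_bdd (h : LPk k C) : ∃ B : ℝ, ∀ x, ‖lpK k a o s x‖ ≤ B := by
  refine ⟨∑ d, ‖((s d)⁻¹ : ℝ)‖ * C * ‖mUnit a o d‖, fun x => ?_⟩
  refine (norm_sum_le _ _).trans (Finset.sum_le_sum fun d _ => ?_)
  rw [norm_smul, sc, norm_mul, Complex.norm_real]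
  have := h.bdd ((s d)⁻¹ * x)
  gcongr

lemma Nice.coord {X : Type*} [MeasureSpace X] {f : X → EuclideanSpace ℂ α} (hf : Nice f) (i : α) :
    Nice (fun x => f x i) := by
  obtain ⟨B, hB⟩ := hf.bdd
  have hc : Continuous (fun v : EuclideanSpace ℂ α => v i) := by fun_prop
  exact ⟨hc.comp_stronglyMeasurable hf.sm,
    hf.int.norm.mono' ((hc.comp_stronglyMeasurable hf.sm).aestronglyMeasurable)
      (ae_of_all _ fun x => PiLp.norm_apply_le _ _),
    B, fun x => (PiLp.norm_apply_le _ _).trans (hB x)⟩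

lemma Nice.euclid {X : Type*} [MeasureSpace X] {f : α → X → ℂ} (hf : ∀ i, Nice (f i)) :
    Nice (fun x => (WithLp.toLp 2 (fun i => f i x) : EuclideanSpace ℂ α)) := by
  choose B hB using fun i => (hf i).bdd
  have hle : ∀ v : α → ℂ, ‖(WithLp.toLp 2 v : EuclideanSpace ℂ α)‖ ≤ ∑ i, ‖v i‖ := by
    intro v
    rw [EuclideanSpace.norm_eq]
    refine Real.sqrt_le_iff.2 ⟨Finset.sum_nonneg fun _ _ => norm_nonneg _, ?_⟩
    exact Finset.sum_sq_le_sq_sum_of_nonneg fun i _ => norm_nonneg _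
  have hm : StronglyMeasurable (fun x => (WithLp.toLp 2 (fun i => f i x) : EuclideanSpace ℂ α)) :=
    (PiLp.continuous_toLp 2 _).comp_stronglyMeasurable
      (Measurable.stronglyMeasurable (measurable_pi_iff.2 fun i => (hf i).sm.measurable))
  exact ⟨hm, Integrable.mono' (integrable_finset_sum _ fun i _ => (hf i).int.norm)
      hm.aestronglyMeasurable (ae_of_all _ fun x => hle _),
    ∑ i, B i, fun x => (hle _).trans (Finset.sum_le_sum fun i _ => hB i x)⟩

lemma cvK_lpK (h : LPk k C) (hs : ∀ d, 0 < s d) {f : ℝ → EuclideanSpace ℂ α} (hf : Nice f) (x : ℝ) (i : β) :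
    cvK (lpK k a o s) f x i = ∑ d, if o d = i then cv1 (sc k (s d)) (fun y => f y (a d)) x else 0 := by
  obtain ⟨B, hB⟩ := lpK_bdd (a := a) (o := o) (s := s) h
  have hi := cvK_integrable (lpK_continuous h) hB hf.int x
  have e := ((EuclideanSpace.proj (𝕜 := ℂ) i).restrictScalars ℝ : EuclideanSpace ℂ β →L[ℝ] ℂ).integral_comp_comm hi
  have e2 : cvK (lpK k a o s) f x i = ∫ y, lpK k a o s (x - y) (f y) i := e.symm
  rw [e2]
  simp only [lpK_apply]
  rw [integral_finset_sum]
  · refine Finset.sum_congr rfl fun d _ => ?_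
    by_cases hd : o d = i
    · simp only [hd, if_true, cv1]
    · simp [hd]
  · intro d _
    by_cases hd : o d = i
    · simp only [hd, if_true]
      obtain ⟨B', hB'⟩ := (hf.coord (a d)).bdd
      exact ((sc_integrable h.int (hs d)).comp_sub_left x).mul_bdd (c := B') (hf.coord (a d)).sm.aestronglyMeasurable
        (ae_of_all _ hB')
    · simp [hd]

lemma nice_cv1 {k g : ℝ → ℂ} (hkc : Continuous k) (hk : Integrable k) (hg : Nice g) : Nice (cv1 k g) := by
  obtain ⟨B, hB⟩ := hg.bdd
  refine ⟨?_, cv1_integrable hk hg.int, _, cv1_bdd hk hB⟩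
  have : StronglyMeasurable (fun q : ℝ × ℝ => k (q.1 - q.2) * g q.2) :=
    (hkc.comp (continuous_fst.sub continuous_snd)).stronglyMeasurable.mul
      (hg.sm.comp_measurable measurable_snd)
  exact this.integral_prod_right

lemma Nice.sum {X E δ : Type*} [MeasureSpace X] [NormedAddCommGroup E] (S : Finset δ) {f : δ → X → E}
    (hf : ∀ i ∈ S, Nice (f i)) : Nice (fun x => ∑ i ∈ S, f i x) := by
  induction S using Finset.induction_on with
  | empty => simpa using (⟨stronglyMeasurable_const, integrable_zero _ _ _, 0, by simp⟩ : Nice (fun _ : X => (0 : E)))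
  | insert i S hi ih =>
    simp only [Finset.sum_insert hi]
    exact (hf i (by simp)).add (ih fun j hj => hf j (by simp [hj]))

lemma Nice.zero {X E : Type*} [MeasureSpace X] [NormedAddCommGroup E] : Nice (fun _ : X => (0 : E)) :=
  ⟨stronglyMeasurable_const, integrable_zero _ _ _, 0, by simp⟩

lemma ofReal_norm_sq {E : Type*} [NormedAddCommGroup E] (z : E) : ‖z‖ₑ ^ 2 = ENNReal.ofReal (‖z‖ ^ 2) := by
  rw [ENNReal.ofReal_pow (norm_nonneg _), ofReal_norm_eq_enorm]

lemma lp_H1 (h : LPk k C) (hL : 0 ≤ L) (hs : LPsys a o s L) {f : ℝ → EuclideanSpace ℂ α} (hf : Nice f) :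
    ∫⁻ x, ‖cvK (lpK k a o s) f x‖ₑ ^ 2 ≤ ENNReal.ofReal (C * L) ^ 2 * ∫⁻ x, ‖f x‖ₑ ^ 2 := by
  have hC := h.pos
  have hn : ∀ d, Nice (cv1 (sc k (s d)) (fun y => f y (a d))) := fun d =>
    nice_cv1 (sc_continuous h.continuous _) (sc_integrable h.int (hs.1 d)) (hf.coord _)
  have hG : ∀ i d, Nice (fun x => if o d = i then cv1 (sc k (s d)) (fun y => f y (a d)) x else 0) := by
    intro i d
    by_cases hd : o d = i
    · simpa only [hd, if_true] using hn d
    · simpa only [hd, if_false] using Nice.zero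
  have hGs : ∀ i, Nice (fun x => ∑ d, if o d = i then cv1 (sc k (s d)) (fun y => f y (a d)) x else 0) :=
    fun i => Nice.sum _ fun d _ => hG i d
  have hF : ∀ i η, 𝓕 (fun x => ∑ d, if o d = i then cv1 (sc k (s d)) (fun y => f y (a d)) x else 0) η
      = ∑ d, if o d = i then 𝓕 (sc k (s d)) η * 𝓕 (fun y => f y (a d)) η else 0 := by
    intro i η
    simp only [fourier_exp, Finset.mul_sum]
    rw [integral_finset_sum]
    · refine Finset.sum_congr rfl fun d _ => ?_
      by_cases hd : o d = i
      · simp only [hd, if_true]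
        have := fourier_cv1 (sc_integrable h.int (hs.1 d)) (hf.coord (a d)).int η
        simpa only [fourier_exp] using this
      · simp [hd]
    · intro d _
      refine (hG i d).int.norm.mono' ?_ (ae_of_all _ fun x => ?_)
      · exact ((by fun_prop : Continuous fun x : ℝ => Complex.exp ((((-(2 * Real.pi * (x * η))) : ℝ) : ℂ) * Complex.I)).aestronglyMeasurable).mul (hG i d).int.aestronglyMeasurable
      · rw [norm_mul, norm_expI, one_mul]
  have hFm : ∀ {g : ℝ → ℂ}, Integrable g → Continuous (𝓕 g) := fun hg =>
    VectorFourier.fourierIntegral_continuous Real.continuous_fourierChar (by fun_prop) hg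
  have hl2 : ∀ {g : ℝ → ℂ}, Nice g → ∫⁻ x, ‖g x‖ₑ ^ 2 < ∞ := by
    intro g hg
    obtain ⟨B, hB⟩ := hg.bdd
    exact sq_lt_top_of_bdd hg.int hB
  simp only [enorm_sq_euclid, cvK_lpK h hs.1 hf]
  rw [lintegral_finset_sum' _ fun i _ => ((hGs i).sm.enorm.pow_const 2).aemeasurable,
    lintegral_finset_sum' _ fun i _ => ((hf.coord i).sm.enorm.pow_const 2).aemeasurable]
  have e1 : ∀ i, ∫⁻ x, ‖∑ d, if o d = i then cv1 (sc k (s d)) (fun y => f y (a d)) x else 0‖ₑ ^ 2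
      = ∫⁻ η, ‖∑ d, if o d = i then 𝓕 (sc k (s d)) η * 𝓕 (fun y => f y (a d)) η else 0‖ₑ ^ 2 := by
    intro i
    rw [← plancherel_one (hGs i).int (hl2 (hGs i))]
    simp only [hF]
  have e2 : ∀ i, ∫⁻ x, ‖f x i‖ₑ ^ 2 = ∫⁻ η, ‖𝓕 (fun y => f y i) η‖ₑ ^ 2 := fun i =>
    (plancherel_one (hf.coord i).int (hl2 (hf.coord i))).symm
  simp only [e1, e2]
  rw [← lintegral_finset_sum', ← lintegral_finset_sum' _ fun i _ => ((hFm (hf.coord i).int).enorm.measurable.pow_const 2).aemeasurable,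
    ← lintegral_const_mul' _ _ (by simp)]
  · refine lintegral_mono_ae ?_
    have : ∀ᵐ η : ℝ, η ≠ 0 := by
      rw [ae_iff]; simp
    filter_upwards [this] with η hη
    simp only [ofReal_norm_sq]
    rw [← ENNReal.ofReal_sum_of_nonneg (fun _ _ => by positivity),
      ← ENNReal.ofReal_sum_of_nonneg (fun _ _ => by positivity), ← ENNReal.ofReal_pow (by positivity),
      ← ENNReal.ofReal_mul (by positivity)]
    refine ENNReal.ofReal_le_ofReal ?_
    exact hs.2 (fun d => 𝓕 (sc k (s d)) η) C |η| hC (abs_pos.2 hη) (fun d => h.ft_min (hs.1 d) hη)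
      (fun i => 𝓕 (fun y => f y i) η)
  · intro i _
    refine Measurable.aemeasurable ?_
    refine (Continuous.enorm ?_).measurable.pow_const 2
    refine continuous_finset_sum _ fun d _ => ?_
    by_cases hd : o d = i
    · simp only [hd, if_true]
      exact (hFm (sc_integrable h.int (hs.1 d))).mul (hFm (hf.coord _).int)
    · simp only [hd, if_false]; exact continuous_const

lemma lp_H2 (h : LPk k C) (hL : 0 ≤ L) (hs : LPsys a o s L) (y : ℝ) :
    ∫⁻ x in {x | 2 * |y| ≤ |x|}, ‖lpK k a o s (x - y) - lpK k a o s x‖ₑ ≤ ENNReal.ofReal (8 * C * L) := by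
  have hC := h.pos
  have key : ∀ᵐ x ∂(volume.restrict {x : ℝ | 2 * |y| ≤ |x|}),
      ‖lpK k a o s (x - y) - lpK k a o s x‖ₑ ≤ ENNReal.ofReal (8 * C * L) * ENNReal.ofReal (|y| / x ^ 2) := by
    have h0 : ∀ᵐ x : ℝ, x ≠ 0 := by rw [ae_iff]; simp
    filter_upwards [ae_restrict_of_ae h0, ae_restrict_mem (by measurability)] with x hx0 hx
    have hx : 2 * |y| ≤ |x| := hx
    rw [← ENNReal.ofReal_mul (by positivity), ← ofReal_norm_eq_enorm]
    refine ENNReal.ofReal_le_ofReal ?_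
    refine ContinuousLinearMap.opNorm_le_bound _ (by positivity) fun v => ?_
    have hh := hs.2 (fun d => sc k (s d) (x - y) - sc k (s d) x) (8 * C * (|y| / x ^ 2)) |x|⁻¹
      (by positivity) (inv_pos.2 (abs_pos.2 hx0)) (fun d => h.diff_le (hs.1 d) hx (abs_pos.2 hx0)) v
    rw [← EuclideanSpace.norm_sq_eq] at hh
    have e : ∑ i, ‖∑ d, if o d = i then (sc k (s d) (x - y) - sc k (s d) x) * v (a d) else 0‖ ^ 2
        = ‖(lpK k a o s (x - y) - lpK k a o s x) v‖ ^ 2 := by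
      rw [EuclideanSpace.norm_sq_eq]
      refine Finset.sum_congr rfl fun i _ => ?_
      rw [ContinuousLinearMap.sub_apply, PiLp.sub_apply, lpK_apply, lpK_apply, ← Finset.sum_sub_distrib]
      congr 2
      refine Finset.sum_congr rfl fun d _ => ?_
      split_ifs
      · ring
      · simp
    rw [e, ← mul_pow] at hh
    have := le_of_sq_le_sq hh (by positivity)
    linarith
  refine (lintegral_mono_ae key).trans ?_
  rw [lintegral_const_mul' _ _ (by simp)]
  exact (mul_le_of_le_one_right' (lint_horm y))

/-- Vector-valued Littlewood-Paley bounds on the line. -/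
lemma lp_one (h : LPk k C) (hL : 0 ≤ L) (hs : LPsys a o s L) {f : ℝ → EuclideanSpace ℂ α} (hf : Nice f)
    {p : ℝ} (hp : p = 2 ∨ (1 < p ∧ p ≤ 4 / 3)) :
    ∫⁻ x, ‖cvK (lpK k a o s) f x‖ₑ ^ p
      ≤ ENNReal.ofReal (960 * (C * L + 1) / (p - 1)) ^ p * ∫⁻ x, ‖f x‖ₑ ^ p := by
  have hC := h.pos
  have hCL : 0 ≤ C * L := by positivity
  rcases hp with rfl | ⟨hp1, hp2⟩
  · have := lp_H1 h hL hs hf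
    simp only [← ENNReal.rpow_two] at this
    refine this.trans ?_
    gcongr
    rw [le_div_iff₀ (by norm_num)]
    linarith
  · set A : ℝ≥0 := Real.toNNReal (8 * (C * L + 1)) with hA
    have hA0 : A ≠ 0 := by
      rw [hA]; simp; positivity
    have hAe : (A : ℝ≥0∞) = ENNReal.ofReal (8 * (C * L + 1)) := rfl
    obtain ⟨B, hB⟩ := lpK_bdd (a := a) (o := o) (s := s) h
    have := cz_strong (lpK_continuous h) hB hA0
      (fun g hg => (lp_H1 h hL hs hg).trans (by
        rw [hAe]; exact mul_le_mul_left (pow_le_pow_left' (ENNReal.ofReal_le_ofReal (by linarith)) 2) _))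
      (fun y => (lp_H2 h hL hs y).trans (by
        rw [hAe]; exact ENNReal.ofReal_le_ofReal (by linarith))) hf hp1 hp2
    refine this.trans ?_
    gcongr
    have h60 : 1 ≤ 60 / (p - 1) := by rw [le_div_iff₀ (by linarith)]; linarith
    calc ENNReal.ofReal (60 / (p - 1)) * (2 * (A : ℝ≥0∞)) ^ p
        ≤ ENNReal.ofReal (60 / (p - 1)) ^ p * (2 * (A : ℝ≥0∞)) ^ p := by
          gcongr
          have h1 : (1:ℝ≥0∞) ≤ ENNReal.ofReal (60 / (p - 1)) := by
            rw [ENNReal.one_le_ofReal]; exact h60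
          calc ENNReal.ofReal (60 / (p - 1)) = ENNReal.ofReal (60 / (p - 1)) ^ (1:ℝ) := (ENNReal.rpow_one _).symm
            _ ≤ _ := ENNReal.rpow_le_rpow_of_exponent_le h1 hp1.le
      _ = _ := by
        rw [← ENNReal.mul_rpow_of_nonneg _ _ (by linarith), hAe,
          show (2:ℝ≥0∞) = ENNReal.ofReal 2 by simp, ← ENNReal.ofReal_mul (by norm_num),
          ← ENNReal.ofReal_mul (by linarith)]
        congr 2; ring

end sys

/-- Convolution in the first variable. -/
def pc1 (k : ℝ → ℂ) (g : ℝ × ℝ → ℂ) (x : ℝ × ℝ) : ℂ := cv1 k (fun y => g (y, x.2)) x.1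

/-- Convolution in the second variable. -/
def pc2 (k : ℝ → ℂ) (g : ℝ × ℝ → ℂ) (x : ℝ × ℝ) : ℂ := cv1 k (fun y => g (x.1, y)) x.2

lemma pc2_eq (k : ℝ → ℂ) (g : ℝ × ℝ → ℂ) (x : ℝ × ℝ) :
    pc2 k g x = pc1 k (fun z => g z.swap) x.swap := rfl

lemma Nice.swap {E : Type*} [NormedAddCommGroup E] {g : ℝ × ℝ → E} (hg : Nice g) :
    Nice (fun z : ℝ × ℝ => g z.swap) :=
  ⟨hg.sm.comp_measurable measurable_swap, hg.int.swap,
    hg.bdd.imp fun C h x => h _⟩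

lemma lintegral_swap (F : ℝ × ℝ → ℝ≥0∞) : ∫⁻ x : ℝ × ℝ, F x.swap = ∫⁻ x, F x :=
  (Measure.measurePreserving_swap (μ := (volume : Measure ℝ)) (ν := (volume : Measure ℝ))).lintegral_comp_emb
    MeasurableEquiv.prodComm.measurableEmbedding F

lemma pc1_sm {k : ℝ → ℂ} (hkc : Continuous k) {g : ℝ × ℝ → ℂ} (hg : StronglyMeasurable g) :
    StronglyMeasurable (pc1 k g) := by
  have : StronglyMeasurable (fun q : (ℝ × ℝ) × ℝ => k (q.1.1 - q.2) * g (q.2, q.1.2)) :=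
    (Continuous.stronglyMeasurable (by fun_prop)).mul
      (hg.comp_measurable (by fun_prop))
  exact this.integral_prod_right

lemma lintegral_pc1 {k : ℝ → ℂ} (hkc : Continuous k) {g : ℝ × ℝ → ℂ} (hg : StronglyMeasurable g) :
    ∫⁻ x, ‖pc1 k g x‖ₑ ≤ (∫⁻ y, ‖k y‖ₑ) * ∫⁻ x, ‖g x‖ₑ := by
  have h1 : ∀ x, ‖pc1 k g x‖ₑ ≤ ∫⁻ y, ‖k (x.1 - y)‖ₑ * ‖g (y, x.2)‖ₑ := fun x =>
    (enorm_integral_le_lintegral_enorm _).trans (le_of_eq (by simp only [enorm_mul]))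
  refine (lintegral_mono h1).trans ?_
  have hm : Measurable (fun q : (ℝ × ℝ) × ℝ => ‖k (q.1.1 - q.2)‖ₑ * ‖g (q.2, q.1.2)‖ₑ) :=
    (Continuous.measurable (by fun_prop)).mul
      ((hg.comp_measurable (by fun_prop)).enorm)
  rw [Measure.volume_eq_prod, lintegral_prod_symm _ hm.lintegral_prod_right'.aemeasurable,
    lintegral_prod_symm _ hg.enorm.aemeasurable, ← lintegral_const_mul]
  · refine lintegral_mono fun x2 => ?_
    show ∫⁻ x1, ∫⁻ y, ‖k (x1 - y)‖ₑ * ‖g (y, x2)‖ₑ ≤ (∫⁻ y, ‖k y‖ₑ) * ∫⁻ x1, ‖g (x1, x2)‖ₑ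
    rw [lintegral_lintegral_swap]
    · have hgm : Measurable fun y => ‖g (y, x2)‖ₑ := (hg.comp_measurable (f := g) (g := fun y : ℝ => (y, x2)) (by fun_prop)).enorm
      rw [← lintegral_const_mul _ hgm]
      refine lintegral_mono fun y => ?_
      rw [lintegral_mul_const _ (Continuous.measurable (by fun_prop))]
      rw [lintegral_sub_right_eq_self (fun z => ‖k z‖ₑ) y]
    · exact ((Continuous.measurable (by fun_prop)).mul
        ((hg.comp_measurable (by fun_prop)).enorm)).aemeasurable
  · exact hg.enorm.lintegral_prod_left'

lemma nice_pc1 {k : ℝ → ℂ} (hkc : Continuous k) (hk : Integrable k) {g : ℝ × ℝ → ℂ} (hg : Nice g) :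
    Nice (pc1 k g) := by
  obtain ⟨B, hB⟩ := hg.bdd
  have hs := pc1_sm hkc hg.sm
  exact ⟨hs, ⟨hs.aestronglyMeasurable, (lintegral_pc1 hkc hg.sm).trans_lt (ENNReal.mul_lt_top hk.2 hg.int.2)⟩,
    _, fun x => cv1_bdd hk (fun y => hB (y, x.2)) x.1⟩

lemma nice_pc2 {k : ℝ → ℂ} (hkc : Continuous k) (hk : Integrable k) {g : ℝ × ℝ → ℂ} (hg : Nice g) :
    Nice (pc2 k g) := (nice_pc1 hkc hk hg.swap).swap

section
variable {α β δ : Type*} [Fintype α] [Fintype β] [Fintype δ]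
  {k : ℝ → ℂ} {C L : ℝ} {a : δ → α} {o : δ → β} {s : δ → ℝ}

lemma enorm_rpow_euclid (v : EuclideanSpace ℂ α) (p : ℝ) :
    ‖v‖ₑ ^ p = (∑ i, ‖v i‖ₑ ^ 2) ^ (p / 2) := by
  rw [← enorm_sq_euclid, ← ENNReal.rpow_two, ← ENNReal.rpow_mul]; congr 1; ring

/-- Littlewood-Paley bound in the first variable. -/
lemma lp_pc1 (h : LPk k C) (hL : 0 ≤ L) (hs : LPsys a o s L) {f : α → ℝ × ℝ → ℂ} (hf : ∀ i, Nice (f i))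
    {p : ℝ} (hp : p = 2 ∨ (1 < p ∧ p ≤ 4 / 3)) :
    ∫⁻ x, (∑ i, ‖∑ d, if o d = i then pc1 (sc k (s d)) (f (a d)) x else 0‖ₑ ^ 2) ^ (p / 2)
      ≤ ENNReal.ofReal (960 * (C * L + 1) / (p - 1)) ^ p * ∫⁻ x, (∑ i, ‖f i x‖ₑ ^ 2) ^ (p / 2) := by
  have hn : ∀ i d, StronglyMeasurable (fun x => if o d = i then pc1 (sc k (s d)) (f (a d)) x else 0) := by
    intro i d
    by_cases hd : o d = i
    · simp only [hd, if_true]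
      exact pc1_sm (sc_continuous h.continuous _) (hf _).sm
    · simp only [hd, if_false]; exact stronglyMeasurable_const
  have hm1 : Measurable (fun x => (∑ i, ‖∑ d, if o d = i then pc1 (sc k (s d)) (f (a d)) x else 0‖ₑ ^ 2) ^ (p / 2)) := by
    refine Measurable.pow_const (Finset.measurable_fun_sum _ fun i _ => Measurable.pow_const ?_ _) _
    exact (Finset.stronglyMeasurable_fun_sum _ fun d _ => hn i d).enorm
  have hm2 : Measurable (fun x => (∑ i, ‖f i x‖ₑ ^ 2) ^ (p / 2)) :=
    Measurable.pow_const (Finset.measurable_fun_sum _ fun i _ => (hf i).sm.enorm.pow_const _) _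
  rw [Measure.volume_eq_prod, lintegral_prod_symm _ hm1.aemeasurable, lintegral_prod_symm _ hm2.aemeasurable,
    ← lintegral_const_mul _ hm2.lintegral_prod_left']
  have hae : ∀ᵐ x2 : ℝ, ∀ i, Integrable (fun x1 => f i (x1, x2)) := by
    rw [ae_all_iff]
    intro i
    have := (hf i).int
    rw [Measure.volume_eq_prod] at this
    exact this.prod_left_ae
  refine lintegral_mono_ae ?_
  filter_upwards [hae] with x2 hx2
  have hg : Nice (fun x1 => (WithLp.toLp 2 (fun i => f i (x1, x2)) : EuclideanSpace ℂ α)) :=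
    Nice.euclid fun i => ⟨(hf i).sm.comp_measurable (by fun_prop), hx2 i, (hf i).bdd.imp fun C h x => h _⟩
  have := lp_one h hL hs hg hp
  simpa only [enorm_rpow_euclid, cvK_lpK h hs.1 hg, pc1] using this

/-- Littlewood-Paley bound in the second variable. -/
lemma lp_pc2 (h : LPk k C) (hL : 0 ≤ L) (hs : LPsys a o s L) {f : α → ℝ × ℝ → ℂ} (hf : ∀ i, Nice (f i))
    {p : ℝ} (hp : p = 2 ∨ (1 < p ∧ p ≤ 4 / 3)) :
    ∫⁻ x, (∑ i, ‖∑ d, if o d = i then pc2 (sc k (s d)) (f (a d)) x else 0‖ₑ ^ 2) ^ (p / 2)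
      ≤ ENNReal.ofReal (960 * (C * L + 1) / (p - 1)) ^ p * ∫⁻ x, (∑ i, ‖f i x‖ₑ ^ 2) ^ (p / 2) := by
  have := lp_pc1 h hL hs (fun i => (hf i).swap) hp (f := fun i z => f i z.swap)
  rw [← lintegral_swap, ← lintegral_swap (fun x => (∑ i, ‖f i x‖ₑ ^ 2) ^ (p / 2))]
  simpa only [pc2_eq, Prod.swap_swap] using this

lemma lp_diag1 (h : LPk k C) (hL : 0 ≤ L) (hs : ∀ d, 0 < s d)
    (hls : ∀ i, LacSum (fun d : {d // a d = i} => s d) L) {f : α → ℝ × ℝ → ℂ} (hf : ∀ i, Nice (f i))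
    {p : ℝ} (hp : p = 2 ∨ (1 < p ∧ p ≤ 4 / 3)) :
    ∫⁻ x, (∑ d, ‖pc1 (sc k (s d)) (f (a d)) x‖ₑ ^ 2) ^ (p / 2)
      ≤ ENNReal.ofReal (960 * (C * L + 1) / (p - 1)) ^ p * ∫⁻ x, (∑ i, ‖f i x‖ₑ ^ 2) ^ (p / 2) := by
  simpa using lp_pc1 h hL (LPsys.diag hs hls) hf hp

lemma lp_diag2 (h : LPk k C) (hL : 0 ≤ L) (hs : ∀ d, 0 < s d)
    (hls : ∀ i, LacSum (fun d : {d // a d = i} => s d) L) {f : α → ℝ × ℝ → ℂ} (hf : ∀ i, Nice (f i))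
    {p : ℝ} (hp : p = 2 ∨ (1 < p ∧ p ≤ 4 / 3)) :
    ∫⁻ x, (∑ d, ‖pc2 (sc k (s d)) (f (a d)) x‖ₑ ^ 2) ^ (p / 2)
      ≤ ENNReal.ofReal (960 * (C * L + 1) / (p - 1)) ^ p * ∫⁻ x, (∑ i, ‖f i x‖ₑ ^ 2) ^ (p / 2) := by
  simpa using lp_pc2 h hL (LPsys.diag hs hls) hf hp
end

def wR (z : ℝ) : ℝ := ((1 + z ^ 2) ^ 2)⁻¹

lemma wR_pos (z : ℝ) : 0 < wR z := by unfold wR; positivity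

lemma wR_continuous : Continuous wR := by
  unfold wR; exact Continuous.inv₀ (by fun_prop) (fun z => by positivity)

lemma lint_comp_mul {g : ℝ → ℝ≥0∞} (hg : Measurable g) {c : ℝ} (hc : c ≠ 0) :
    ∫⁻ z, g (c * z) = ENNReal.ofReal |c|⁻¹ * ∫⁻ y, g y := by
  rw [← lintegral_map hg (measurable_const_mul c), Real.map_volume_mul_left hc,
    lintegral_smul_measure, abs_inv]
  rfl

lemma lint_scale {g : ℝ → ℝ≥0∞} (hg : Measurable g) {r : ℝ} (hr : 0 < r) (x : ℝ) :
    ∫⁻ z, g (x - r * z) = ENNReal.ofReal r⁻¹ * ∫⁻ y, g y := by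
  have h := lint_comp_mul (g := fun y => g (x - y)) (hg.comp (measurable_const.sub measurable_id)) hr.ne'
  rw [h, abs_of_pos hr, lintegral_sub_left_eq_self]

/-- The maximal average operator with profile `wR` at scale `r`. -/
def hlW (r : ℝ) (h : ℝ → ℝ≥0∞) (x : ℝ) : ℝ≥0∞ := ∫⁻ z, ENNReal.ofReal (wR z) * h (x - r * z)

lemma wR_le_tsum (z : ℝ) : ENNReal.ofReal (wR z) ≤
    ∑' m : ℕ, ENNReal.ofReal (16 * (16:ℝ)⁻¹ ^ m) * (if |z| ≤ 2 ^ m then 1 else 0) := by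
  obtain ⟨m, hm⟩ : ∃ m : ℕ, |z| ≤ 2 ^ m := by
    obtain ⟨m, hm⟩ := pow_unbounded_of_one_lt |z| (one_lt_two : (1:ℝ) < 2)
    exact ⟨m, hm.le⟩
  have hex : ∃ m : ℕ, |z| ≤ 2 ^ m := ⟨m, hm⟩
  refine le_trans ?_ (ENNReal.le_tsum (Nat.find hex))
  have h1 := Nat.find_spec hex
  rw [if_pos h1, mul_one]
  apply ENNReal.ofReal_le_ofReal
  rcases hn : Nat.find hex with _ | n
  · unfold wR
    have : ((1 + z ^ 2) ^ 2)⁻¹ ≤ (1:ℝ) := inv_le_one_of_one_le₀ (by nlinarith [sq_nonneg z])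
    simpa using this.trans (by norm_num)
  · have h2 : ¬ |z| ≤ 2 ^ n := Nat.find_min hex (by omega)
    push Not at h2
    unfold wR
    rw [inv_pow, ← div_eq_mul_inv, inv_eq_one_div, div_le_div_iff₀ (by positivity) (by positivity)]
    have h3 : (2:ℝ) ^ n * 2 ^ n ≤ z ^ 2 := by
      rw [← sq_abs]; nlinarith [pow_pos (two_pos : (0:ℝ) < 2) n, abs_nonneg z]
    have h4 : (16:ℝ) ^ (n+1) = 16 * ((2:ℝ)^n * 2^n)^2 := by
      rw [pow_succ, show (16:ℝ) = 2*2*2*2 by norm_num]; simp only [mul_pow]; ring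
    rw [h4]
    have : (0:ℝ) ≤ (2:ℝ)^n * 2^n := by positivity
    nlinarith [pow_le_pow_left₀ this h3 2, sq_nonneg z]

lemma hlW_le {h : ℝ → ℝ≥0∞} (hm : Measurable h) {lam : ℝ≥0∞} {x : ℝ}
    (H : ∀ ρ : ℝ, 0 < ρ → ∫⁻ y in Metric.closedBall x ρ, h y ≤ lam * ENNReal.ofReal (2 * ρ)) {r : ℝ} (hr : 0 < r) :
    hlW r h x ≤ 64 * lam := by
  have hb : ∀ m : ℕ, ∫⁻ z, (if |z| ≤ 2 ^ m then 1 else 0) * h (x - r * z) ≤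
      lam * ENNReal.ofReal (2 * 2 ^ m) := by
    intro m
    have e : ∀ z : ℝ, (if |z| ≤ 2 ^ m then 1 else 0) * h (x - r * z) =
        (Metric.closedBall x (r * 2 ^ m)).indicator h (x - r * z) := by
      intro z
      have : x - r * z ∈ Metric.closedBall x (r * 2 ^ m) ↔ |z| ≤ 2 ^ m := by
        rw [Metric.mem_closedBall, Real.dist_eq, show x - r * z - x = -(r * z) by ring, abs_neg, abs_mul,
          abs_of_pos hr]
        exact mul_le_mul_iff_right₀ hr
      by_cases hz : |z| ≤ 2 ^ m
      · rw [Set.indicator_of_mem (this.2 hz), if_pos hz, one_mul]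
      · rw [Set.indicator_of_notMem (fun hh => hz (this.1 hh)), if_neg hz, zero_mul]
    simp_rw [e]
    rw [lint_scale (hm.indicator Metric.isClosed_closedBall.measurableSet) hr,
      lintegral_indicator Metric.isClosed_closedBall.measurableSet]
    refine (mul_le_mul_right (H (r * 2 ^ m) (by positivity)) _).trans (le_of_eq ?_)
    rw [show ∀ a b c : ℝ≥0∞, a * (b * c) = b * (a * c) from fun a b c => by ring,
      ← ENNReal.ofReal_mul (by positivity)]
    congr 2; field_simp
  calc hlW r h x ≤ ∫⁻ z, ∑' m : ℕ, ENNReal.ofReal (16 * (16:ℝ)⁻¹ ^ m) * ((if |z| ≤ 2 ^ m then 1 else 0) * h (x - r * z)) := by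
        refine lintegral_mono fun z => (mul_le_mul_left (wR_le_tsum z) _).trans (le_of_eq ?_)
        rw [← ENNReal.tsum_mul_right]; simp_rw [mul_assoc]
    _ = ∑' m : ℕ, ENNReal.ofReal (16 * (16:ℝ)⁻¹ ^ m) * ∫⁻ z, ((if |z| ≤ 2 ^ m then 1 else 0) * h (x - r * z)) := by
        have hmm : ∀ m : ℕ, Measurable fun z : ℝ => ((if |z| ≤ 2 ^ m then 1 else 0 : ℝ≥0∞) * h (x - r * z)) := fun m =>
          (Measurable.ite (measurableSet_le (by fun_prop) (by fun_prop)) measurable_const measurable_const).mul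
            (hm.comp (by fun_prop))
        rw [lintegral_tsum fun m => ((hmm m).const_mul _).aemeasurable]
        congr 1; ext m
        rw [lintegral_const_mul _ (hmm m)]
    _ ≤ ∑' m : ℕ, ENNReal.ofReal (16 * (16:ℝ)⁻¹ ^ m) * (lam * ENNReal.ofReal (2 * 2 ^ m)) :=
        ENNReal.tsum_le_tsum fun m => mul_le_mul_right (hb m) _
    _ = lam * ∑' m : ℕ, ENNReal.ofReal (32 * (8:ℝ)⁻¹ ^ m) := by
        rw [← ENNReal.tsum_mul_left]
        congr 1; ext m
        rw [show ∀ a b c : ℝ≥0∞, a * (b * c) = b * (a * c) from fun a b c => by ring,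
          ← ENNReal.ofReal_mul (by positivity)]
        congr 2
        rw [show (8:ℝ)⁻¹ = 16⁻¹ * 2 by norm_num, mul_pow]; ring
    _ ≤ 64 * lam := by
        rw [mul_comm]
        refine mul_le_mul_left ?_ _
        rw [← ENNReal.ofReal_tsum_of_nonneg (fun m => by positivity)
          ((summable_geometric_of_lt_one (by norm_num) (by norm_num)).mul_left _), tsum_mul_left,
          tsum_geometric_of_lt_one (by norm_num) (by norm_num)]
        rw [show (64:ℝ≥0∞) = ENNReal.ofReal 64 by simp]
        exact ENNReal.ofReal_le_ofReal (by norm_num)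

lemma hl_vitali {h : ℝ → ℝ≥0∞} (hm : Measurable h) (hfin : ∫⁻ y, h y ≠ ∞) {lam : ℝ≥0∞} (h0 : lam ≠ 0) :
    volume {x | ∃ ρ : ℝ, 0 < ρ ∧ lam * ENNReal.ofReal (2 * ρ) < ∫⁻ y in Metric.closedBall x ρ, h y} * lam
      ≤ 5 * ∫⁻ y, h y := by
  set E := {x | ∃ ρ : ℝ, 0 < ρ ∧ lam * ENNReal.ofReal (2 * ρ) < ∫⁻ y in Metric.closedBall x ρ, h y} with hE
  by_cases ht : lam = ∞
  · have : E = ∅ := by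
      ext x; simp only [hE, mem_setOf_eq, mem_empty_iff_false, iff_false, ht]
      rintro ⟨ρ, hρ, hh⟩
      rw [ENNReal.top_mul (by simpa using hρ)] at hh
      exact absurd hh (by simp)
    simp [this]
  have hch : ∀ x : ℝ, ∃ ρ : ℝ, x ∈ E → 0 < ρ ∧ lam * ENNReal.ofReal (2 * ρ) < ∫⁻ y in Metric.closedBall x ρ, h y := by
    intro x
    by_cases hx : x ∈ E
    · obtain ⟨ρ, hρ⟩ := hx; exact ⟨ρ, fun _ => hρ⟩
    · exact ⟨0, fun hh => absurd hh hx⟩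
  choose ρ hρ using hch
  have hR : ∀ a ∈ E, ρ a ≤ ((∫⁻ y, h y) / lam).toReal := by
    intro a ha
    have h1 := (hρ a ha).2.le.trans (setLIntegral_le_lintegral _ _)
    have h2 : ENNReal.ofReal (2 * ρ a) ≤ (∫⁻ y, h y) / lam := by
      rw [ENNReal.le_div_iff_mul_le (Or.inl h0) (Or.inl ht), mul_comm]; exact h1
    have h3 := (ENNReal.ofReal_le_iff_le_toReal (ENNReal.div_ne_top hfin h0)).1 h2
    linarith [(hρ a ha).1]
  obtain ⟨u, huE, hud, huc⟩ := Vitali.exists_disjoint_subfamily_covering_enlargement_closedBall E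
    (fun x : ℝ => x) ρ _ hR 5 (by norm_num)
  have hcount : u.Countable := hud.countable_of_nonempty_interior fun a ha => by
    rw [interior_closedBall _ (hρ a (huE ha)).1.ne']
    exact Metric.nonempty_ball.2 (hρ a (huE ha)).1
  have hsub : E ⊆ ⋃ b ∈ u, Metric.closedBall b (5 * ρ b) := by
    intro a ha
    obtain ⟨b, hb, hab⟩ := huc a ha
    exact mem_biUnion hb (hab (Metric.mem_closedBall_self (hρ a ha).1.le))
  calc volume E * lam ≤ (∑' b : u, volume (Metric.closedBall (b:ℝ) (5 * ρ b))) * lam :=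
        mul_le_mul_left ((measure_mono hsub).trans (measure_biUnion_le _ hcount _)) _
    _ = ∑' b : u, 5 * (lam * ENNReal.ofReal (2 * ρ b)) := by
        rw [← ENNReal.tsum_mul_right]
        congr 1; ext b
        rw [Real.volume_closedBall, show 2 * (5 * ρ b) = 5 * (2 * ρ b) by ring, ENNReal.ofReal_mul (by norm_num)]
        simp; ring
    _ ≤ ∑' b : u, 5 * ∫⁻ y in Metric.closedBall (b:ℝ) (ρ b), h y :=
        ENNReal.tsum_le_tsum fun b => mul_le_mul_right (hρ b (huE b.2)).2.le _
    _ = 5 * ∫⁻ y in ⋃ b ∈ u, Metric.closedBall (b:ℝ) (ρ b), h y := by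
        rw [ENNReal.tsum_mul_left, lintegral_biUnion hcount (fun _ _ => Metric.isClosed_closedBall.measurableSet) hud]
    _ ≤ 5 * ∫⁻ y, h y := mul_le_mul_right (setLIntegral_le_lintegral _ _) _

section
lemma lint_wR : ∫⁻ z, ENNReal.ofReal (wR z) ≤ 4 := by
  have h1 : ∀ z, ENNReal.ofReal (wR z) ≤ ENNReal.ofReal ((1 + z ^ 2)⁻¹) := fun z =>
    ENNReal.ofReal_le_ofReal (by
      unfold wR
      exact inv_anti₀ (by positivity) (by nlinarith [sq_nonneg z]))
  refine (lintegral_mono h1).trans ?_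
  rw [← ofReal_integral_eq_lintegral_ofReal integrable_inv_one_add_sq (ae_of_all _ fun z => by positivity),
    integral_univ_inv_one_add_sq, show (4:ℝ≥0∞) = ENNReal.ofReal 4 by simp]
  exact ENNReal.ofReal_le_ofReal Real.pi_le_four

lemma hlW_measurable {h : ℝ → ℝ≥0∞} (hm : Measurable h) (r : ℝ) : Measurable (hlW r h) := by
  have : Measurable fun q : ℝ × ℝ => ENNReal.ofReal (wR q.2) * h (q.1 - r * q.2) :=
    (wR_continuous.measurable.comp measurable_snd).ennreal_ofReal.mul (hm.comp (by fun_prop))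
  exact this.lintegral_prod_right'

lemma hlW_const_le {h : ℝ → ℝ≥0∞} {B : ℝ≥0∞} (hB : ∀ y, h y ≤ B) (r x : ℝ) : hlW r h x ≤ 4 * B := by
  refine (lintegral_mono fun z => mul_le_mul_right (hB _) _).trans ?_
  rw [lintegral_mul_const _ wR_continuous.measurable.ennreal_ofReal]
  exact mul_le_mul_left lint_wR _

lemma hlW_mono {h g : ℝ → ℝ≥0∞} (hg : ∀ y, h y ≤ g y) (r x : ℝ) : hlW r h x ≤ hlW r g x :=
  lintegral_mono fun z => mul_le_mul_right (hg _) _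

lemma hlW_add {h g : ℝ → ℝ≥0∞} (hm : Measurable h) (r x : ℝ) :
    hlW r (fun y => h y + g y) x = hlW r h x + hlW r g x := by
  unfold hlW
  simp_rw [mul_add]
  exact lintegral_add_left (wR_continuous.measurable.ennreal_ofReal.mul (hm.comp (by fun_prop))) _

variable {δ : Type*} [Fintype δ]

lemma hl_strong {r : δ → ℝ} (hr : ∀ d, 0 < r d) {h : ℝ → ℝ≥0∞} (hm : Measurable h) {B : ℝ≥0∞} (hBt : B ≠ ∞)
    (hB : ∀ y, h y ≤ B) {p : ℝ} (hp : 1 < p) (hp2 : p ≤ 2) :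
    ∫⁻ x, (⨆ d, hlW (r d) h x) ^ p ≤ ENNReal.ofReal (680 / (p - 1)) ^ p * ∫⁻ x, h x ^ p := by
  by_cases hI : ∫⁻ x, h x ^ p = ∞
  · rw [hI, ENNReal.mul_top]
    · exact le_top
    · have : 0 < ENNReal.ofReal (680 / (p - 1)) := ENNReal.ofReal_pos.2 (by have : 0 < p - 1 := by linarith
                                                                            positivity)
      exact (ENNReal.rpow_pos this ENNReal.ofReal_ne_top).ne'
  have hpp : 0 < p - 1 := by linarith
  set S := fun x => ⨆ d, hlW (r d) h x with hS
  have hSm : Measurable S := Measurable.iSup fun d => hlW_measurable hm _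
  have hSb : ∀ x, S x ≠ ∞ := fun x => ne_top_of_le_ne_top (ENNReal.mul_ne_top (by simp) hBt)
    (iSup_le fun d => hlW_const_le hB (r d) x)
  have hhb : ∀ x, h x ≠ ∞ := fun x => ne_top_of_le_ne_top hBt (hB x)
  have hho : ∀ x, ENNReal.ofReal (h x).toReal = h x := fun x => ENNReal.ofReal_toReal (hhb x)
  have key : ∀ t : ℝ, 0 < t → volume {x | t < (S x).toReal / 68} * ENNReal.ofReal t ≤
      5 * ∫⁻ y in {y | 1 * t < (h y).toReal}, ENNReal.ofReal (h y).toReal ^ (1:ℝ) := by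
    intro t ht
    have hms : MeasurableSet {y | 1 * t < (h y).toReal} := measurableSet_lt measurable_const hm.ennreal_toReal
    set h1 := {y | 1 * t < (h y).toReal}.indicator h with hh1
    have hm1 : Measurable h1 := hm.indicator hms
    have e1 : ∫⁻ y in {y | 1 * t < (h y).toReal}, ENNReal.ofReal (h y).toReal ^ (1:ℝ) = ∫⁻ y, h1 y := by
      rw [hh1, lintegral_indicator hms]; simp_rw [ENNReal.rpow_one, hho]
    rw [e1]
    have hfin : ∫⁻ y, h1 y ≠ ∞ := by
      have hle : ∀ y, h1 y ≤ ENNReal.ofReal (t ^ (1 - p)) * h y ^ p := by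
        intro y
        by_cases hy : y ∈ {y | 1 * t < (h y).toReal}
        · rw [hh1, indicator_of_mem hy, ← hho y, ENNReal.ofReal_rpow_of_nonneg ENNReal.toReal_nonneg (by linarith),
            ← ENNReal.ofReal_mul (by positivity)]
          apply ENNReal.ofReal_le_ofReal
          have hy' : t ≤ (h y).toReal := by have : 1 * t < (h y).toReal := hy
                                            linarith
          set a := (h y).toReal
          have ha : 0 < a := lt_of_lt_of_le ht hy'
          calc a = a ^ (1 - p) * a ^ p := by rw [← Real.rpow_add ha]; simp
            _ ≤ t ^ (1 - p) * a ^ p := by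
              gcongr ?_ * _
              exact Real.rpow_le_rpow_of_nonpos ht hy' (by linarith)
        · rw [hh1, indicator_of_notMem hy]; exact zero_le
      refine ne_top_of_le_ne_top ?_ (lintegral_mono hle)
      rw [lintegral_const_mul _ (hm.pow_const p)]
      exact ENNReal.mul_ne_top ENNReal.ofReal_ne_top hI
    refine le_trans (mul_le_mul_left (measure_mono ?_) _) (hl_vitali hm1 hfin (lam := ENNReal.ofReal t) (by simpa using ht))
    intro x hx
    by_contra hcon
    simp only [mem_setOf_eq, not_exists, not_and, not_lt] at hcon
    have hx' : t < (S x).toReal / 68 := hx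
    have hSx : S x ≤ ENNReal.ofReal (68 * t) := by
      refine iSup_le fun d => ?_
      have hsplit : ∀ y, h y ≤ h1 y + ENNReal.ofReal t := by
        intro y
        by_cases hy : y ∈ {y | 1 * t < (h y).toReal}
        · rw [hh1, indicator_of_mem hy]; exact le_self_add
        · rw [hh1, indicator_of_notMem hy, zero_add, ← hho y]
          apply ENNReal.ofReal_le_ofReal
          have : ¬ 1 * t < (h y).toReal := hy
          linarith
      calc hlW (r d) h x ≤ hlW (r d) (fun y => h1 y + ENNReal.ofReal t) x := hlW_mono hsplit _ _
        _ = hlW (r d) h1 x + hlW (r d) (fun _ => ENNReal.ofReal t) x := hlW_add hm1 _ _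
        _ ≤ 64 * ENNReal.ofReal t + 4 * ENNReal.ofReal t :=
          add_le_add (hlW_le hm1 hcon (hr d)) (hlW_const_le (fun _ => le_rfl) _ _)
        _ = ENNReal.ofReal (68 * t) := by
          rw [ENNReal.ofReal_mul (by norm_num), ← add_mul]; congr 1; norm_num
    have := ENNReal.toReal_mono ENNReal.ofReal_ne_top hSx
    rw [ENNReal.toReal_ofReal (by positivity)] at this
    linarith
  have hL := lintegral_rpow_eq_lintegral_meas_lt_mul volume (f := fun x => (S x).toReal / 68)
    (ae_of_all _ fun x => by positivity) (hSm.ennreal_toReal.div_const _).aemeasurable (p := p) (by linarith)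
  have hlay := layer_large (μ := volume) hm.ennreal_toReal (fun x => ENNReal.toReal_nonneg) (p := p) (q := 1) (c := 1)
    hp one_pos one_pos
  have e2 : ∀ x, S x ^ p = ENNReal.ofReal (68 ^ p) * ENNReal.ofReal (((S x).toReal / 68) ^ p) := by
    intro x
    rw [← ENNReal.ofReal_mul (by positivity), ← Real.mul_rpow (by norm_num) (by positivity),
      mul_div_cancel₀ _ (by norm_num : (68:ℝ) ≠ 0), ← ENNReal.ofReal_rpow_of_nonneg ENNReal.toReal_nonneg (by linarith),
      ENNReal.ofReal_toReal (hSb x)]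
  have hl2 : ∫⁻ t in Ioi (0:ℝ), volume {a | t < (S a).toReal / 68} * ENNReal.ofReal (t ^ (p - 1)) ≤
      5 * (ENNReal.ofReal (1 / (p - 1)) * ∫⁻ x, h x ^ p) := by
    have : ENNReal.ofReal (1 / (p - 1)) * ∫⁻ x, h x ^ p =
        ENNReal.ofReal ((1:ℝ)⁻¹ ^ (p - 1) / (p - 1)) * ∫⁻ y, ENNReal.ofReal (h y).toReal ^ p := by
      simp_rw [hho]; simp
    rw [this, ← hlay, ← lintegral_const_mul' _ _ (by simp)]
    refine setLIntegral_mono' measurableSet_Ioi fun t ht => ?_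
    have ht : 0 < t := ht
    rw [show t ^ (p - 1) = t * t ^ (p - 1 - 1) by
      rw [← Real.rpow_one_add' ht.le (by linarith)]; ring_nf, ENNReal.ofReal_mul ht.le]
    calc _ = ENNReal.ofReal (t ^ (p - 1 - 1)) * (volume {x | t < (S x).toReal / 68} * ENNReal.ofReal t) := by ring
      _ ≤ _ := (mul_le_mul_right (key t ht) _).trans (le_of_eq (by ring))
  calc ∫⁻ x, S x ^ p = ENNReal.ofReal (68 ^ p) * ∫⁻ x, ENNReal.ofReal (((S x).toReal / 68) ^ p) := by
        rw [← lintegral_const_mul' _ _ ENNReal.ofReal_ne_top]; simp_rw [e2]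
    _ ≤ ENNReal.ofReal (68 ^ p) * (ENNReal.ofReal p * (5 * (ENNReal.ofReal (1 / (p - 1)) * ∫⁻ x, h x ^ p))) := by
        rw [hL]; gcongr
    _ = ENNReal.ofReal (68 ^ p * (p * 5 * (1 / (p - 1)))) * ∫⁻ x, h x ^ p := by
        rw [ENNReal.ofReal_mul (by positivity), ENNReal.ofReal_mul (by positivity), ENNReal.ofReal_mul (by positivity)]
        simp; ring
    _ ≤ _ := by
        refine mul_le_mul_left ?_ _
        rw [ENNReal.ofReal_rpow_of_nonneg (by positivity) (by linarith)]
        apply ENNReal.ofReal_le_ofReal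
        rw [show 680 / (p - 1) = 68 * (10 / (p - 1)) by ring, Real.mul_rpow (by norm_num) (by positivity)]
        gcongr
        have h1 : 1 ≤ 10 / (p - 1) := by rw [le_div_iff₀ hpp]; linarith
        calc p * 5 * (1 / (p - 1)) = (p * 5) / (p - 1) := by ring
          _ ≤ 10 / (p - 1) := by gcongr; linarith
          _ ≤ _ := Real.self_le_rpow_of_one_le h1 hp.le

/-- The strong averages with profile `wR ⊗ wR` and scales `r`, `s`. -/
def hlW2 (r s : ℝ) (h : ℝ × ℝ → ℝ≥0∞) (x : ℝ × ℝ) : ℝ≥0∞ :=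
  ∫⁻ z, ENNReal.ofReal (wR z) * ∫⁻ z', ENNReal.ofReal (wR z') * h (x.1 - r * z, x.2 - s * z')

lemma hl_strong_two {r s : δ → ℝ} (hr : ∀ d, 0 < r d) (hs : ∀ d, 0 < s d) {h : ℝ × ℝ → ℝ≥0∞} (hm : Measurable h)
    {B : ℝ≥0∞} (hBt : B ≠ ∞) (hB : ∀ y, h y ≤ B) {p : ℝ} (hp : 1 < p) (hp2 : p ≤ 2) :
    ∫⁻ x, (⨆ d, hlW2 (r d) (s d) h x) ^ p
      ≤ ENNReal.ofReal (680 / (p - 1)) ^ p * (ENNReal.ofReal (680 / (p - 1)) ^ p * ∫⁻ x, h x ^ p) := by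
  set G : ℝ × ℝ → ℝ≥0∞ := fun x => ⨆ d, hlW (s d) (fun y => h (x.1, y)) x.2 with hG
  have hGm : Measurable G := by
    refine Measurable.iSup fun d => ?_
    have : Measurable fun q : (ℝ × ℝ) × ℝ => ENNReal.ofReal (wR q.2) * h (q.1.1, q.1.2 - s d * q.2) :=
      (wR_continuous.measurable.comp measurable_snd).ennreal_ofReal.mul (hm.comp (by fun_prop))
    exact this.lintegral_prod_right'
  have hGB : ∀ x, G x ≤ 4 * B := fun x => iSup_le fun d => hlW_const_le (fun y => hB _) _ _
  set S : ℝ × ℝ → ℝ≥0∞ := fun x => ⨆ d, hlW (r d) (fun y => G (y, x.2)) x.1 with hS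
  have hSm : Measurable S := by
    refine Measurable.iSup fun d => ?_
    have : Measurable fun q : (ℝ × ℝ) × ℝ => ENNReal.ofReal (wR q.2) * G (q.1.1 - r d * q.2, q.1.2) :=
      (wR_continuous.measurable.comp measurable_snd).ennreal_ofReal.mul (hGm.comp (by fun_prop))
    exact this.lintegral_prod_right'
  have h1 : ∀ x, (⨆ d, hlW2 (r d) (s d) h x) ≤ S x := fun x => iSup_mono fun d =>
    lintegral_mono fun z => mul_le_mul_right (by
      show hlW (s d) (fun y => h (x.1 - r d * z, y)) x.2 ≤ G (x.1 - r d * z, x.2)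
      exact le_iSup (fun e => hlW (s e) (fun y => h (x.1 - r d * z, y)) x.2) d) _
  calc ∫⁻ x, (⨆ d, hlW2 (r d) (s d) h x) ^ p ≤ ∫⁻ x, S x ^ p :=
        lintegral_mono fun x => ENNReal.rpow_le_rpow (h1 x) (by linarith)
    _ = ∫⁻ x2, ∫⁻ x1, S (x1, x2) ^ p := by
        rw [Measure.volume_eq_prod, lintegral_prod_symm _ (hSm.pow_const p).aemeasurable]
    _ ≤ ∫⁻ x2, ENNReal.ofReal (680 / (p - 1)) ^ p * ∫⁻ x1, G (x1, x2) ^ p := lintegral_mono fun x2 =>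
        hl_strong hr (h := fun y => G (y, x2)) (hGm.comp (by fun_prop)) (ENNReal.mul_ne_top (by simp) hBt)
          (fun y => hGB _) hp hp2
    _ = ENNReal.ofReal (680 / (p - 1)) ^ p * ∫⁻ x1, ∫⁻ x2, G (x1, x2) ^ p := by
        rw [lintegral_const_mul _ (hGm.pow_const p).lintegral_prod_left',
          lintegral_lintegral_swap (f := fun x2 x1 => G (x1, x2) ^ p)
            ((hGm.pow_const p).comp measurable_swap).aemeasurable]
    _ ≤ ENNReal.ofReal (680 / (p - 1)) ^ p * ∫⁻ x1, ENNReal.ofReal (680 / (p - 1)) ^ p * ∫⁻ x2, h (x1, x2) ^ p :=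
        mul_le_mul_right (lintegral_mono fun x1 =>
          hl_strong hs (h := fun y => h (x1, y)) (hm.comp (by fun_prop)) hBt (fun y => hB _) hp hp2) _
    _ = _ := by
        rw [lintegral_const_mul _ (hm.pow_const p).lintegral_prod_right', Measure.volume_eq_prod,
          lintegral_prod _ (hm.pow_const p).aemeasurable]

end

section
/-- Convolution of a nonnegative function with a measure. -/
def mA (ν : Measure (ℝ × ℝ)) (h : ℝ × ℝ → ℝ≥0∞) (x : ℝ × ℝ) : ℝ≥0∞ := ∫⁻ y, h (x - y) ∂ν

section
variable {ν : Measure (ℝ × ℝ)} [IsFiniteMeasure ν]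

lemma mA_measurable {h : ℝ × ℝ → ℝ≥0∞} (hm : Measurable h) : Measurable (mA ν h) := by
  have : Measurable fun q : (ℝ × ℝ) × (ℝ × ℝ) => h (q.1 - q.2) := hm.comp (by fun_prop)
  exact this.lintegral_prod_right'

lemma mA_lint {h : ℝ × ℝ → ℝ≥0∞} (hm : Measurable h) : ∫⁻ x, mA ν h x = ν univ * ∫⁻ x, h x := by
  unfold mA
  have : Measurable fun q : (ℝ × ℝ) × (ℝ × ℝ) => h (q.1 - q.2) := hm.comp (by fun_prop)
  rw [lintegral_lintegral_swap this.aemeasurable]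
  simp_rw [lintegral_sub_right_eq_self h]
  rw [lintegral_const, mul_comm]

lemma mA_mono {h g : ℝ × ℝ → ℝ≥0∞} (hg : ∀ y, h y ≤ g y) (x : ℝ × ℝ) : mA ν h x ≤ mA ν g x :=
  lintegral_mono fun _ => hg _

lemma mA_cs {g u v : ℝ × ℝ → ℝ≥0∞} (hu : Measurable u) (hv : Measurable v) (hg : ∀ y, g y ^ 2 ≤ u y * v y)
    (x : ℝ × ℝ) : mA ν g x ^ 2 ≤ mA ν u x * mA ν v x := by
  have hc : Real.HolderConjugate 2 2 := by constructor <;> norm_num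
  have hr : ∀ a : ℝ≥0∞, (a ^ (1 / 2 : ℝ)) ^ (2:ℝ) = a := fun a => by
    rw [← ENNReal.rpow_mul]; norm_num
  have h1 : mA ν g x ≤ ∫⁻ y, ((fun y => u (x - y) ^ (1 / 2 : ℝ)) * (fun y => v (x - y) ^ (1 / 2 : ℝ))) y ∂ν := by
    refine lintegral_mono fun y => ?_
    simp only [Pi.mul_apply]
    rw [← ENNReal.mul_rpow_of_nonneg _ _ (by norm_num : (0:ℝ) ≤ 1 / 2)]
    calc g (x - y) = (g (x - y) ^ 2) ^ (1 / 2 : ℝ) := by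
          rw [← ENNReal.rpow_natCast, ← ENNReal.rpow_mul]; norm_num
      _ ≤ _ := ENNReal.rpow_le_rpow (hg _) (by norm_num)
  have h2 := ENNReal.lintegral_mul_le_Lp_mul_Lq ν hc (f := fun y => u (x - y) ^ (1 / 2 : ℝ))
    (g := fun y => v (x - y) ^ (1 / 2 : ℝ)) ((hu.comp (by fun_prop)).pow_const _).aemeasurable
    ((hv.comp (by fun_prop)).pow_const _).aemeasurable
  simp_rw [hr] at h2
  calc mA ν g x ^ 2 ≤ (mA ν u x ^ (1 / 2 : ℝ) * mA ν v x ^ (1 / 2 : ℝ)) ^ 2 := by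
        gcongr; exact h1.trans h2
    _ = _ := by
      rw [← ENNReal.rpow_natCast, ENNReal.mul_rpow_of_nonneg _ _ (by norm_num)]
      have := hr (mA ν u x)
      have := hr (mA ν v x)
      push_cast; simp_all
end

variable {δ : Type*} [Fintype δ]

/-- The square function bound for a family of convolutions. -/
def VP (ν : δ → Measure (ℝ × ℝ)) (p B : ℝ) : Prop :=
  ∀ g : δ → ℝ × ℝ → ℝ≥0∞, (∀ d, Measurable (g d)) → (∀ d x, g d x ≠ ∞) →
    ∫⁻ x, (∑ d, mA (ν d) (g d) x ^ 2) ^ (p / 2) ≤ ENNReal.ofReal B ^ p * ∫⁻ x, (∑ d, g d x ^ 2) ^ (p / 2)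

/-- The maximal bound for a family of convolutions. -/
def DP (ν : δ → Measure (ℝ × ℝ)) (p D : ℝ) : Prop :=
  ∀ h : ℝ × ℝ → ℝ≥0∞, Measurable h → (∀ x, h x ≠ ∞) →
    ∫⁻ x, (⨆ d, mA (ν d) h x) ^ p ≤ ENNReal.ofReal D ^ p * ∫⁻ x, h x ^ p

variable {ν : δ → Measure (ℝ × ℝ)} [∀ d, IsFiniteMeasure (ν d)]

lemma VP_two {m : ℝ} (hν : ∀ d, ν d univ ≤ ENNReal.ofReal m) : VP ν 2 m := by
  intro g hg _
  simp only [div_self (two_ne_zero : (2:ℝ) ≠ 0), ENNReal.rpow_one]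
  rw [lintegral_finsetSum _ fun d _ => (mA_measurable (hg d)).pow_const 2,
    lintegral_finsetSum _ fun d _ => (hg d).pow_const 2, Finset.mul_sum]
  refine Finset.sum_le_sum fun d _ => ?_
  have h1 : ∀ x, mA (ν d) (g d) x ^ 2 ≤ mA (ν d) (fun y => g d y ^ 2) x * ν d univ := fun x => by
    have := mA_cs (ν := ν d) (g := g d) (u := fun y => g d y ^ 2) (v := fun _ => 1) ((hg d).pow_const 2)
      measurable_const (fun y => by simp) x
    simpa [mA] using this
  refine (lintegral_mono h1).trans ?_
  rw [lintegral_mul_const _ (mA_measurable ((hg d).pow_const 2)), mA_lint ((hg d).pow_const 2)]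
  calc _ = ν d univ * ν d univ * ∫⁻ x, g d x ^ 2 := by ring
    _ ≤ ENNReal.ofReal m * ENNReal.ofReal m * ∫⁻ x, g d x ^ 2 :=
      mul_le_mul_left (mul_le_mul' (hν d) (hν d)) _
    _ = _ := by
      rw [show (2:ℝ) = ((2:ℕ):ℝ) by norm_num, ENNReal.rpow_natCast, sq]

lemma VP_of_DP {m D : ℝ} (hm0 : 0 ≤ m) (hD0 : 0 ≤ D) (hν : ∀ d, ν d univ ≤ ENNReal.ofReal m) {p : ℝ} (hp : 1 < p) (hp2 : p < 2)
    (hD : DP ν (p / (2 - p)) D) : VP ν p (√(m * D)) := by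
  intro g hg hgf
  have h2p : 0 < 2 - p := by linarith
  set G : ℝ × ℝ → ℝ≥0∞ := fun x => (∑ d, g d x ^ 2) ^ (1 / 2 : ℝ) with hG
  have hGm : Measurable G := (Finset.measurable_sum _ fun d _ => (hg d).pow_const 2).pow_const _
  have hGf : ∀ x, G x ≠ ∞ := fun x => by
    apply ENNReal.rpow_ne_top_of_nonneg (by norm_num)
    exact ENNReal.sum_ne_top.2 fun d _ => ENNReal.pow_ne_top (hgf d x)
  have hG2 : ∀ x, ∑ d, g d x ^ 2 = G x ^ (2:ℝ) := fun x => by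
    rw [hG]; simp only; rw [← ENNReal.rpow_mul]; norm_num
  have hGp : ∀ x, (∑ d, g d x ^ 2) ^ (p / 2) = G x ^ p := fun x => by
    rw [hG2, ← ENNReal.rpow_mul]; congr 1; ring
  set M : ℝ × ℝ → ℝ≥0∞ := fun x => ⨆ d, mA (ν d) (fun y => G y ^ (2 - p)) x with hM
  have hMm : Measurable M := Measurable.iSup fun d => mA_measurable (hGm.pow_const _)
  have hum : ∀ d, Measurable fun y => g d y ^ 2 * G y ^ (p - 2) := fun d =>
    ((hg d).pow_const 2).mul (hGm.pow_const _)
  set N : ℝ × ℝ → ℝ≥0∞ := fun x => ∑ d, mA (ν d) (fun y => g d y ^ 2 * G y ^ (p - 2)) x with hN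
  have hNm : Measurable N := Finset.measurable_sum _ fun d _ => mA_measurable (hum d)
  have h1 : ∀ x, ∑ d, mA (ν d) (g d) x ^ 2 ≤ N x * M x := by
    intro x
    rw [hN]; simp only; rw [Finset.sum_mul]
    refine Finset.sum_le_sum fun d _ => ?_
    refine (mA_cs (ν := ν d) (g := g d) (hum d) (hGm.pow_const (2 - p)) (fun y => ?_) x).trans
      (mul_le_mul_right (le_iSup (fun d => mA (ν d) (fun y => G y ^ (2 - p)) x) d) _)
    by_cases h0 : G y = 0
    · have : g d y = 0 := by
        have h3 : ∑ d, g d y ^ 2 = 0 := by rw [hG2, h0]; simp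
        have := (Finset.sum_eq_zero_iff.1 h3) d (Finset.mem_univ d)
        simpa using this
      simp [this]
    · rw [mul_assoc, ← ENNReal.rpow_add _ _ h0 (hGf y)]; simp
  have hNint : ∫⁻ x, N x ≤ ENNReal.ofReal m * ∫⁻ x, G x ^ p := by
    rw [hN, lintegral_finsetSum _ fun d _ => mA_measurable (hum d)]
    simp_rw [mA_lint (hum _)]
    calc ∑ d, ν d univ * ∫⁻ x, g d x ^ 2 * G x ^ (p - 2)
        ≤ ∑ d, ENNReal.ofReal m * ∫⁻ x, g d x ^ 2 * G x ^ (p - 2) :=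
          Finset.sum_le_sum fun d _ => mul_le_mul_left (hν d) _
      _ = ENNReal.ofReal m * ∫⁻ x, ∑ d, g d x ^ 2 * G x ^ (p - 2) := by
          rw [lintegral_finsetSum _ fun d _ => hum d, Finset.mul_sum]
      _ ≤ _ := by
          refine mul_le_mul_right (lintegral_mono fun x => ?_) _
          rw [← Finset.sum_mul, hG2]
          by_cases h0 : G x = 0
          · simp [h0]
          · rw [← ENNReal.rpow_add _ _ h0 (hGf x)]; simp
  have hMint : ∫⁻ x, M x ^ (p / (2 - p)) ≤ ENNReal.ofReal D ^ (p / (2 - p)) * ∫⁻ x, G x ^ p := by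
    refine (hD (fun y => G y ^ (2 - p)) (hGm.pow_const _)
      (fun y => ENNReal.rpow_ne_top_of_nonneg h2p.le (hGf y))).trans (le_of_eq ?_)
    simp_rw [← ENNReal.rpow_mul, mul_div_cancel₀ p h2p.ne']
  have hc : Real.HolderConjugate (2 / p) (2 / (2 - p)) := by
    refine Real.holderConjugate_iff.2 ⟨by rw [lt_div_iff₀ (by linarith)]; linarith, ?_⟩
    field_simp; ring
  have hH := ENNReal.lintegral_mul_le_Lp_mul_Lq volume hc (f := fun x => N x ^ (p / 2)) (g := fun x => M x ^ (p / 2))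
    (hNm.pow_const _).aemeasurable (hMm.pow_const _).aemeasurable
  have e1 : ∀ a : ℝ≥0∞, (a ^ (p / 2)) ^ (2 / p) = a := fun a => by
    rw [← ENNReal.rpow_mul, show p / 2 * (2 / p) = 1 by field_simp, ENNReal.rpow_one]
  have e2 : ∀ a : ℝ≥0∞, (a ^ (p / 2)) ^ (2 / (2 - p)) = a ^ (p / (2 - p)) := fun a => by
    rw [← ENNReal.rpow_mul]; congr 1; field_simp
  simp only [e1, e2, one_div_div] at hH
  simp_rw [hGp]
  calc ∫⁻ x, (∑ d, mA (ν d) (g d) x ^ 2) ^ (p / 2) ≤ ∫⁻ x, ((fun x => N x ^ (p / 2)) * fun x => M x ^ (p / 2)) x := by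
        refine lintegral_mono fun x => ?_
        simp only [Pi.mul_apply]
        rw [← ENNReal.mul_rpow_of_nonneg _ _ (by linarith)]
        exact ENNReal.rpow_le_rpow (h1 x) (by linarith)
    _ ≤ _ := hH
    _ ≤ (ENNReal.ofReal m * ∫⁻ x, G x ^ p) ^ (p / 2) *
        (ENNReal.ofReal D ^ (p / (2 - p)) * ∫⁻ x, G x ^ p) ^ ((2 - p) / 2) := by gcongr
    _ = (ENNReal.ofReal m ^ (p / 2) * ENNReal.ofReal D ^ (p / 2)) *
        ((∫⁻ x, G x ^ p) ^ (p / 2) * (∫⁻ x, G x ^ p) ^ ((2 - p) / 2)) := by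
        rw [ENNReal.mul_rpow_of_nonneg _ _ (by linarith), ENNReal.mul_rpow_of_nonneg _ _ (by linarith),
          ← ENNReal.rpow_mul, show p / (2 - p) * ((2 - p) / 2) = p / 2 by field_simp]
        ring
    _ = _ := by
        rw [← ENNReal.rpow_add_of_nonneg _ _ (by linarith) (by linarith), show p / 2 + (2 - p) / 2 = 1 by ring,
          ENNReal.rpow_one, ← ENNReal.mul_rpow_of_nonneg _ _ (by linarith), ← ENNReal.ofReal_mul hm0,
          Real.sqrt_eq_rpow, ← ENNReal.ofReal_rpow_of_nonneg (by positivity) (by norm_num), ← ENNReal.rpow_mul]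
        congr 2; ring

end

def omR (z : ℝ) : ℝ := ((1 + z ^ 2) ^ 4)⁻¹

lemma omR_pos (z : ℝ) : 0 < omR z := by unfold omR; positivity

lemma omR_continuous : Continuous omR := by
  unfold omR; exact Continuous.inv₀ (by fun_prop) (fun z => by positivity)

lemma omR_eq (z : ℝ) : omR z = wR z * wR z := by
  unfold omR wR; rw [← mul_inv]; ring_nf

lemma wR_le_one (z : ℝ) : wR z ≤ 1 := by
  unfold wR; exact inv_le_one_of_one_le₀ (by nlinarith [sq_nonneg z])

lemma omR_le_wR (z : ℝ) : omR z ≤ wR z := by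
  rw [omR_eq]; exact mul_le_of_le_one_left (wR_pos z).le (wR_le_one z)

lemma one_add_sq_add_le (a b : ℝ) : 1 + (a + b) ^ 2 ≤ 2 * (1 + a ^ 2) * (1 + b ^ 2) := by
  nlinarith [sq_nonneg (a - b), sq_nonneg (a * b)]

lemma wR_sub_le (x u : ℝ) : wR (x - u) ≤ 4 * (1 + u ^ 2) ^ 2 * wR x := by
  unfold wR
  rw [inv_eq_one_div, ← div_eq_mul_inv, div_le_div_iff₀ (by positivity) (by positivity), one_mul]
  have h := one_add_sq_add_le (x - u) u
  rw [sub_add_cancel] at h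
  calc (1 + x ^ 2) ^ 2 ≤ (2 * (1 + (x - u) ^ 2) * (1 + u ^ 2)) ^ 2 := by gcongr
    _ = _ := by ring

lemma omR_sub_le (x u : ℝ) : omR (x - u) ≤ 16 * (1 + u ^ 2) ^ 4 * omR x := by
  rw [omR_eq, omR_eq]
  have := mul_le_mul (wR_sub_le x u) (wR_sub_le x u) (wR_pos _).le (by have := wR_pos x; positivity)
  exact this.trans (le_of_eq (by ring))

lemma lint_omR : ∫⁻ z, ENNReal.ofReal (omR z) ≤ 4 :=
  (lintegral_mono fun z => ENNReal.ofReal_le_ofReal (omR_le_wR z)).trans lint_wR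

@[fun_prop] lemma omR_measurable : Measurable omR := omR_continuous.measurable
@[fun_prop] lemma wR_measurable : Measurable wR := wR_continuous.measurable

lemma omR_meas : Measurable fun z => ENNReal.ofReal (omR z) := omR_continuous.measurable.ennreal_ofReal
lemma wR_meas : Measurable fun z => ENNReal.ofReal (wR z) := wR_continuous.measurable.ennreal_ofReal

lemma omR_le_conv (u : ℝ) : ENNReal.ofReal (omR u) ≤
    4096 * ∫⁻ z, ENNReal.ofReal (omR z) * ENNReal.ofReal (omR (u - z)) := by
  have h1 : ∀ z ∈ Icc (-(1/2) : ℝ) (1/2), ENNReal.ofReal (omR u) ≤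
      4096 * (ENNReal.ofReal (omR z) * ENNReal.ofReal (omR (u - z))) := by
    intro z hz
    rw [← ENNReal.ofReal_mul (omR_pos _).le, show (4096:ℝ≥0∞) = ENNReal.ofReal 4096 by simp,
      ← ENNReal.ofReal_mul (by norm_num)]
    apply ENNReal.ofReal_le_ofReal
    have h := omR_sub_le (u - z) (-z)
    rw [sub_neg_eq_add, sub_add_cancel] at h
    have hz2 : 1 + z ^ 2 ≤ 2 := by nlinarith [hz.1, hz.2]
    have h4 : (1 + z ^ 2) ^ 4 ≤ 2 ^ 4 := by gcongr
    have h5 : (1:ℝ) ≤ 16 * omR z := by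
      unfold omR
      rw [← div_eq_mul_inv, le_div_iff₀ (by positivity)]; linarith
    have h6 := omR_pos (u - z)
    calc omR u ≤ 16 * (1 + (-z) ^ 2) ^ 4 * omR (u - z) := h
      _ ≤ 256 * omR (u - z) := by rw [neg_sq]; gcongr; linarith
      _ ≤ 256 * omR (u - z) * (16 * omR z) := le_mul_of_one_le_right (by positivity) h5
      _ = _ := by ring
  calc ENNReal.ofReal (omR u) = ∫⁻ z in Icc (-(1/2) : ℝ) (1/2), ENNReal.ofReal (omR u) := by
        rw [setLIntegral_const, Real.volume_Icc]; norm_num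
    _ ≤ ∫⁻ z in Icc (-(1/2) : ℝ) (1/2), 4096 * (ENNReal.ofReal (omR z) * ENNReal.ofReal (omR (u - z))) :=
        setLIntegral_mono' measurableSet_Icc h1
    _ ≤ ∫⁻ z, 4096 * (ENNReal.ofReal (omR z) * ENNReal.ofReal (omR (u - z))) := setLIntegral_le_lintegral _ _
    _ = _ := lintegral_const_mul' _ _ (by simp)

lemma lint_omR_le {F : ℝ → ℝ≥0∞} (hF : Measurable F) : ∫⁻ z, ENNReal.ofReal (omR z) * F z ≤
    4096 * ∫⁻ z, ENNReal.ofReal (omR z) * ∫⁻ y, ENNReal.ofReal (omR y) * F (z + y) := by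
  have hm : Measurable fun q : ℝ × ℝ => ENNReal.ofReal (omR q.2) * (ENNReal.ofReal (omR (q.1 - q.2)) * F q.1) :=
    (omR_meas.comp measurable_snd).mul ((omR_meas.comp (by fun_prop)).mul (hF.comp measurable_fst))
  calc ∫⁻ z, ENNReal.ofReal (omR z) * F z
      ≤ ∫⁻ u, 4096 * ∫⁻ z, ENNReal.ofReal (omR z) * (ENNReal.ofReal (omR (u - z)) * F u) := by
        refine lintegral_mono fun u => (mul_le_mul_left (omR_le_conv u) _).trans (le_of_eq ?_)
        rw [mul_assoc, ← lintegral_mul_const _ (by fun_prop)]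
        simp_rw [mul_assoc]
    _ = 4096 * ∫⁻ z, ∫⁻ u, ENNReal.ofReal (omR z) * (ENNReal.ofReal (omR (u - z)) * F u) := by
        rw [lintegral_const_mul _ hm.lintegral_prod_right', lintegral_lintegral_swap hm.aemeasurable]
    _ = _ := by
        congr 2; ext z
        rw [lintegral_const_mul _ (by fun_prop)]
        congr 1
        rw [← lintegral_add_right_eq_self _ z]
        congr 1; ext y; rw [add_sub_cancel_right, add_comm]

lemma lint_omR_weight : ∫⁻ z, ENNReal.ofReal (omR z) * ENNReal.ofReal ((1 + z ^ 2) ^ 2) ≤ 4 := by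
  refine le_trans (lintegral_mono fun z => ?_) lint_wR
  rw [← ENNReal.ofReal_mul (omR_pos z).le]
  apply ENNReal.ofReal_le_ofReal
  rw [omR_eq]; unfold wR; field_simp; exact le_rfl

/-- A near-to-scale-one translate of the profile is dominated by `wR`. -/
lemma lint_omR_shift {F : ℝ → ℝ≥0∞} (hF : Measurable F) {K φ δ : ℝ} (hφ : |φ| ≤ K) (hδ0 : 0 < δ) (hδ : δ ≤ 1) :
    ∫⁻ z, ENNReal.ofReal (omR z) * ∫⁻ y, ENNReal.ofReal (omR y) * F (φ + δ * z + y) ≤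
      ENNReal.ofReal (64 * (1 + K ^ 2) ^ 2) * ∫⁻ y, ENNReal.ofReal (wR y) * F y := by
  have hK : φ ^ 2 ≤ K ^ 2 := by rw [← sq_abs]; gcongr
  have h1 : ∀ z, ∫⁻ y, ENNReal.ofReal (omR y) * F (φ + δ * z + y) ≤
      ENNReal.ofReal (16 * (1 + K ^ 2) ^ 2) * ENNReal.ofReal ((1 + z ^ 2) ^ 2) * ∫⁻ y, ENNReal.ofReal (wR y) * F y := by
    intro z
    rw [← lintegral_sub_right_eq_self _ (φ + δ * z), ← lintegral_const_mul _ (by fun_prop)]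
    refine lintegral_mono fun y => ?_
    rw [add_sub_cancel, ← mul_assoc, ← ENNReal.ofReal_mul (by positivity), ← ENNReal.ofReal_mul (by positivity)]
    refine mul_le_mul_left (ENNReal.ofReal_le_ofReal ?_) _
    refine ((omR_le_wR _).trans (wR_sub_le _ _)).trans ?_
    have h2 : 1 + (φ + δ * z) ^ 2 ≤ 2 * (1 + K ^ 2) * (1 + z ^ 2) := by
      refine (one_add_sq_add_le _ _).trans ?_
      have : (δ * z) ^ 2 ≤ z ^ 2 := by
        rw [mul_pow]; exact mul_le_of_le_one_left (sq_nonneg z) (pow_le_one₀ hδ0.le hδ)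
      gcongr
    have := wR_pos y
    calc 4 * (1 + (φ + δ * z) ^ 2) ^ 2 * wR y ≤ 4 * (2 * (1 + K ^ 2) * (1 + z ^ 2)) ^ 2 * wR y := by gcongr
      _ = _ := by ring
  calc _ ≤ ∫⁻ z, ENNReal.ofReal (omR z) * (ENNReal.ofReal (16 * (1 + K ^ 2) ^ 2) * ENNReal.ofReal ((1 + z ^ 2) ^ 2) * ∫⁻ y, ENNReal.ofReal (wR y) * F y) :=
        lintegral_mono fun z => mul_le_mul_right (h1 z) _
    _ = (∫⁻ z, ENNReal.ofReal (omR z) * ENNReal.ofReal ((1 + z ^ 2) ^ 2)) * (ENNReal.ofReal (16 * (1 + K ^ 2) ^ 2) * ∫⁻ y, ENNReal.ofReal (wR y) * F y) := by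
        rw [← lintegral_mul_const _ (by fun_prop)]
        congr 1; ext z; ring
    _ ≤ 4 * (ENNReal.ofReal (16 * (1 + K ^ 2) ^ 2) * ∫⁻ y, ENNReal.ofReal (wR y) * F y) :=
        mul_le_mul_left lint_omR_weight _
    _ = _ := by
        rw [← mul_assoc, show (4:ℝ≥0∞) = ENNReal.ofReal 4 by simp, ← ENNReal.ofReal_mul (by norm_num)]
        congr 2; ring

/-- A bounded nondegenerate coordinate function on `[1/2,2]`. -/
structure NDeg (φ : ℝ → ℝ) (K C : ℝ) : Prop where
  meas : Measurable φ
  bdd : ∀ t ∈ Icc (1/2 : ℝ) 2, |φ t| ≤ K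
  pos : 0 ≤ C
  cov : ∀ G : ℝ → ℝ≥0∞, Measurable G → ∫⁻ t in Icc (1/2 : ℝ) 2, G (φ t) ≤ ENNReal.ofReal C * ∫⁻ u, G u

lemma NDeg.weight {φ : ℝ → ℝ} {K C : ℝ} (h : NDeg φ K C) {G : ℝ → ℝ≥0∞} (hG : Measurable G) :
    ∫⁻ t in Icc (1/2 : ℝ) 2, G (φ t) ≤ ENNReal.ofReal (C * (1 + K ^ 2) ^ 2) * ∫⁻ u, ENNReal.ofReal (wR u) * G u := by
  have h1 : ∀ t ∈ Icc (1/2 : ℝ) 2, G (φ t) ≤ ENNReal.ofReal ((1 + K ^ 2) ^ 2) * (ENNReal.ofReal (wR (φ t)) * G (φ t)) := by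
    intro t ht
    rw [← mul_assoc, ← ENNReal.ofReal_mul (by positivity)]
    refine le_mul_of_one_le_left zero_le ?_
    rw [ENNReal.one_le_ofReal]
    have hK : φ t ^ 2 ≤ K ^ 2 := by rw [← sq_abs]; gcongr; exact h.bdd t ht
    unfold wR
    rw [← div_eq_mul_inv, one_le_div (by positivity)]
    gcongr
  refine (setLIntegral_mono' measurableSet_Icc h1).trans ?_
  rw [lintegral_const_mul' _ _ ENNReal.ofReal_ne_top]
  refine (mul_le_mul_right (h.cov (fun u => ENNReal.ofReal (wR u) * G u) (wR_meas.mul hG)) _).trans (le_of_eq ?_)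
  rw [← mul_assoc, ← ENNReal.ofReal_mul (by positivity), mul_comm C]

lemma lint_wR_omR {G : ℝ → ℝ≥0∞} (hG : Measurable G) {δ : ℝ} (hδ0 : 0 < δ) (hδ : δ ≤ 1) :
    ∫⁻ u, ENNReal.ofReal (wR u) * ∫⁻ z, ENNReal.ofReal (omR z) * G (u + δ * z) ≤ 16 * ∫⁻ y, ENNReal.ofReal (wR y) * G y := by
  have hz : ∀ z : ℝ, ∫⁻ u, ENNReal.ofReal (wR u) * G (u + δ * z) ≤
      ENNReal.ofReal ((1 + z ^ 2) ^ 2) * (4 * ∫⁻ y, ENNReal.ofReal (wR y) * G y) := by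
    intro z
    rw [← lintegral_sub_right_eq_self _ (δ * z), ← mul_assoc, ← lintegral_const_mul _ (by fun_prop)]
    refine lintegral_mono fun u => ?_
    rw [sub_add_cancel, ← mul_assoc, show (4:ℝ≥0∞) = ENNReal.ofReal 4 by simp, ← ENNReal.ofReal_mul (by positivity),
      ← ENNReal.ofReal_mul (by positivity)]
    refine mul_le_mul_left (ENNReal.ofReal_le_ofReal ((wR_sub_le _ _).trans ?_)) _
    have hsq : (δ * z) ^ 2 ≤ z ^ 2 := by
      rw [mul_pow]; exact mul_le_of_le_one_left (sq_nonneg z) (pow_le_one₀ hδ0.le hδ)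
    have := wR_pos u
    rw [mul_comm (_ ^ 2) (4:ℝ)]
    gcongr
  have hm : Measurable fun q : ℝ × ℝ => ENNReal.ofReal (wR q.1) * (ENNReal.ofReal (omR q.2) * G (q.1 + δ * q.2)) := by
    fun_prop
  calc _ = ∫⁻ u, ∫⁻ y, ENNReal.ofReal (wR u) * (ENNReal.ofReal (omR y) * G (u + δ * y)) := by
        congr 1; ext u
        rw [lintegral_const_mul _ (by fun_prop)]
    _ = ∫⁻ y, ENNReal.ofReal (omR y) * ∫⁻ u, ENNReal.ofReal (wR u) * G (u + δ * y) := by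
        rw [lintegral_lintegral_swap hm.aemeasurable]
        congr 1; ext y
        rw [← lintegral_const_mul _ (by fun_prop)]
        congr 1; ext u; ring
    _ ≤ ∫⁻ y, ENNReal.ofReal (omR y) * (ENNReal.ofReal ((1 + y ^ 2) ^ 2) * (4 * ∫⁻ y, ENNReal.ofReal (wR y) * G y)) :=
        lintegral_mono fun y => mul_le_mul_right (hz y) _
    _ = (∫⁻ y, ENNReal.ofReal (omR y) * ENNReal.ofReal ((1 + y ^ 2) ^ 2)) * (4 * ∫⁻ y, ENNReal.ofReal (wR y) * G y) := by
        rw [← lintegral_mul_const _ (by fun_prop)]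
        simp_rw [mul_assoc]
    _ ≤ 4 * (4 * ∫⁻ y, ENNReal.ofReal (wR y) * G y) := mul_le_mul_left lint_omR_weight _
    _ = _ := by rw [← mul_assoc]; norm_num

lemma lint_omR_conv_measurable {F : ℝ → ℝ≥0∞} (hF : Measurable F) (δ : ℝ) :
    Measurable fun v => ∫⁻ y, ENNReal.ofReal (omR y) * F (v + δ * y) := by
  have : Measurable fun q : ℝ × ℝ => ENNReal.ofReal (omR q.2) * F (q.1 + δ * q.2) := by fun_prop
  exact this.lintegral_prod_right'

lemma NDeg.lint {φ : ℝ → ℝ} {K C : ℝ} (h : NDeg φ K C) {F : ℝ → ℝ≥0∞} (hF : Measurable F) {δ : ℝ} (hδ0 : 0 < δ) (hδ : δ ≤ 1) :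
    ∫⁻ t in Icc (1/2 : ℝ) 2, ∫⁻ z, ENNReal.ofReal (omR z) * ∫⁻ y, ENNReal.ofReal (omR y) * F (φ t + δ * z + δ * y) ≤
      ENNReal.ofReal (256 * (C * (1 + K ^ 2) ^ 2)) * ∫⁻ y, ENNReal.ofReal (wR y) * F y := by
  have hm := lint_omR_conv_measurable hF δ
  refine (h.weight (lint_omR_conv_measurable hm δ)).trans ?_
  have h1 := (lint_wR_omR hm hδ0 hδ).trans (mul_le_mul_right (lint_wR_omR hF hδ0 hδ) 16)
  refine (mul_le_mul_right h1 _).trans (le_of_eq ?_)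
  rw [← mul_assoc, ← mul_assoc, show (16:ℝ≥0∞) = ENNReal.ofReal 16 by simp, ← ENNReal.ofReal_mul (by have := h.pos; positivity),
    ← ENNReal.ofReal_mul (by have := h.pos; positivity)]
  congr 2; ring

/-- The measure with density `omR`. -/
def Om : Measure ℝ := volume.withDensity fun z => ENNReal.ofReal (omR z)
/-- The measure with density `wR`. -/
def Wm : Measure ℝ := volume.withDensity fun z => ENNReal.ofReal (wR z)

lemma lint_Om (F : ℝ → ℝ≥0∞) (hF : Measurable F) : ∫⁻ z, F z ∂Om = ∫⁻ z, ENNReal.ofReal (omR z) * F z := by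
  unfold Om; rw [lintegral_withDensity_eq_lintegral_mul _ omR_meas hF]; rfl

lemma lint_Wm (F : ℝ → ℝ≥0∞) (hF : Measurable F) : ∫⁻ z, F z ∂Wm = ∫⁻ z, ENNReal.ofReal (wR z) * F z := by
  unfold Wm; rw [lintegral_withDensity_eq_lintegral_mul _ wR_meas hF]; rfl

lemma Om_univ : Om univ ≤ 4 := by
  unfold Om; rw [withDensity_apply _ MeasurableSet.univ, setLIntegral_univ]; exact lint_omR

lemma Wm_univ : Wm univ ≤ 4 := by
  unfold Wm; rw [withDensity_apply _ MeasurableSet.univ, setLIntegral_univ]; exact lint_wR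

instance : IsFiniteMeasure Om := ⟨Om_univ.trans_lt (by simp)⟩
instance : IsFiniteMeasure Wm := ⟨Wm_univ.trans_lt (by simp)⟩

lemma Om_le_conv {F : ℝ → ℝ≥0∞} (hF : Measurable F) :
    ∫⁻ z, F z ∂Om ≤ 4096 * ∫⁻ z, ∫⁻ y, F (z + y) ∂Om ∂Om := by
  rw [lint_Om F hF, lint_Om _ (by fun_prop)]
  have : ∀ z, ∫⁻ y, F (z + y) ∂Om = ∫⁻ y, ENNReal.ofReal (omR y) * F (z + y) := fun z => lint_Om _ (by fun_prop)
  simp_rw [this]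
  exact lint_omR_le hF

lemma Om_shift {F : ℝ → ℝ≥0∞} (hF : Measurable F) {K φ δ : ℝ} (hφ : |φ| ≤ K) (hδ0 : 0 < δ) (hδ : δ ≤ 1) :
    ∫⁻ z, ∫⁻ y, F (φ + δ * z + y) ∂Om ∂Om ≤ ENNReal.ofReal (64 * (1 + K ^ 2) ^ 2) * ∫⁻ y, F y ∂Wm := by
  rw [lint_Om _ (by fun_prop), lint_Wm F hF]
  have : ∀ z, ∫⁻ y, F (φ + δ * z + y) ∂Om = ∫⁻ y, ENNReal.ofReal (omR y) * F (φ + δ * z + y) :=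
    fun z => lint_Om _ (by fun_prop)
  simp_rw [this]
  exact lint_omR_shift hF hφ hδ0 hδ

/-- The constant in the one-dimensional averaging bounds. -/
def ndC (K C : ℝ) : ℝ := 256 * ((1 + C) * (1 + K ^ 2) ^ 2)

lemma NDeg.Om_lint {φ : ℝ → ℝ} {K C : ℝ} (h : NDeg φ K C) {F : ℝ → ℝ≥0∞} (hF : Measurable F) {δ b : ℝ} (hδ0 : 0 < δ) (hδ : δ ≤ 1)
    (hb : b = 1 ∨ b = δ) :
    ∫⁻ t in Icc (1/2 : ℝ) 2, ∫⁻ z, ∫⁻ y, F (φ t + δ * z + b * y) ∂Om ∂Om ≤ ENNReal.ofReal (ndC K C) * ∫⁻ y, F y ∂Wm := by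
  have hC := h.pos
  rcases hb with rfl | rfl
  · calc _ ≤ ∫⁻ t in Icc (1/2 : ℝ) 2, ENNReal.ofReal (64 * (1 + K ^ 2) ^ 2) * ∫⁻ y, F y ∂Wm := by
          refine setLIntegral_mono' measurableSet_Icc fun t ht => ?_
          simp_rw [one_mul]
          exact Om_shift hF (h.bdd t ht) hδ0 hδ
      _ = ENNReal.ofReal (96 * (1 + K ^ 2) ^ 2) * ∫⁻ y, F y ∂Wm := by
          rw [setLIntegral_const, Real.volume_Icc, mul_right_comm, ← ENNReal.ofReal_mul (by positivity)]
          congr 2; ring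
      _ ≤ _ := by
          refine mul_le_mul_left (ENNReal.ofReal_le_ofReal ?_) _
          unfold ndC
          have : 0 ≤ C * (1 + K ^ 2) ^ 2 := by positivity
          nlinarith [sq_nonneg (1 + K ^ 2)]
  · have h1 := h.lint hF hδ0 hδ
    rw [lint_Wm F hF]
    have : ∀ t z, ∫⁻ y, F (φ t + b * z + b * y) ∂Om = ∫⁻ y, ENNReal.ofReal (omR y) * F (φ t + b * z + b * y) :=
      fun t z => lint_Om _ (by fun_prop)
    have h2 : ∀ t, ∫⁻ z, ∫⁻ y, F (φ t + b * z + b * y) ∂Om ∂Om = ∫⁻ z, ENNReal.ofReal (omR z) * ∫⁻ y, ENNReal.ofReal (omR y) * F (φ t + b * z + b * y) :=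
      fun t => by rw [lint_Om _ (by fun_prop)]; simp_rw [this]
    simp_rw [h2]
    refine h1.trans (mul_le_mul_left (ENNReal.ofReal_le_ofReal ?_) _)
    unfold ndC; gcongr; linarith

/-- Averages over the thickened curve. -/
def avF (φ ψ : ℝ → ℝ) (δ : ℝ) (F : ℝ × ℝ → ℝ≥0∞) : ℝ≥0∞ :=
  ∫⁻ t in Icc (1/2 : ℝ) 2, ∫⁻ z, ∫⁻ y, F (φ t + δ * z, ψ t + δ * y) ∂Om ∂Om

/-- Averages against the profile at scales `a`, `b`. -/
def omE (a b : ℝ) (F : ℝ × ℝ → ℝ≥0∞) (v : ℝ × ℝ) : ℝ≥0∞ := ∫⁻ z, ∫⁻ y, F (v.1 + a * z, v.2 + b * y) ∂Om ∂Om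

@[fun_prop] lemma omE_measurable {a b : ℝ} {F : ℝ × ℝ → ℝ≥0∞} (hF : Measurable F) : Measurable (omE a b F) := by
  unfold omE; fun_prop

lemma omE_le_conv {a b : ℝ} {F : ℝ × ℝ → ℝ≥0∞} (hF : Measurable F) (v : ℝ × ℝ) :
    omE a b F v ≤ 4096 ^ 2 * omE a b (omE a b F) v := by
  unfold omE
  calc _ ≤ ∫⁻ z, 4096 * ∫⁻ y, ∫⁻ y', F (v.1 + a * z, v.2 + b * (y + y')) ∂Om ∂Om ∂Om :=
        lintegral_mono fun z => Om_le_conv (F := fun y => F (v.1 + a * z, v.2 + b * y)) (by fun_prop)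
    _ = 4096 * ∫⁻ z, ∫⁻ y, ∫⁻ y', F (v.1 + a * z, v.2 + b * (y + y')) ∂Om ∂Om ∂Om := lintegral_const_mul _ (by fun_prop)
    _ ≤ 4096 * (4096 * ∫⁻ z, ∫⁻ z', ∫⁻ y, ∫⁻ y', F (v.1 + a * (z + z'), v.2 + b * (y + y')) ∂Om ∂Om ∂Om ∂Om) :=
        mul_le_mul_right (Om_le_conv (F := fun z => ∫⁻ y, ∫⁻ y', F (v.1 + a * z, v.2 + b * (y + y')) ∂Om ∂Om) (by fun_prop)) _
    _ = _ := by
        rw [← mul_assoc, pow_two]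
        congr 1
        refine lintegral_congr fun z => ?_
        rw [lintegral_lintegral_swap (f := fun z' y => ∫⁻ y', F (v.1 + a * (z + z'), v.2 + b * (y + y')) ∂Om)
          (by fun_prop)]
        refine lintegral_congr fun y => lintegral_congr fun z' => lintegral_congr fun y' => ?_
        congr 2 <;> ring

lemma avF_omE {φ ψ : ℝ → ℝ} (hφ : Measurable φ) (hψ : Measurable ψ) {δ a b : ℝ} {F : ℝ × ℝ → ℝ≥0∞} (hF : Measurable F) :
    avF φ ψ δ (omE a b F) =
      ∫⁻ t in Icc (1/2 : ℝ) 2, ∫⁻ z, ∫⁻ z', ∫⁻ y, ∫⁻ y', F (φ t + δ * z + a * z', ψ t + δ * y + b * y') ∂Om ∂Om ∂Om ∂Om := by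
  unfold avF omE
  refine lintegral_congr fun t => lintegral_congr fun z => ?_
  exact lintegral_lintegral_swap (f := fun y z' => ∫⁻ y', F (φ t + δ * z + a * z', ψ t + δ * y + b * y') ∂Om) (by fun_prop)

lemma avF_omE_le {φ ψ : ℝ → ℝ} {K C : ℝ} (hφ : NDeg φ K C) (hψ : NDeg ψ K C) {δ b : ℝ} (hδ0 : 0 < δ) (hδ : δ ≤ 1)
    (hb : b = 1 ∨ b = δ) {F : ℝ × ℝ → ℝ≥0∞} (hF : Measurable F) :
    avF φ ψ δ (omE 1 b F) ≤ ENNReal.ofReal (ndC K C) ^ 2 * ∫⁻ z, ∫⁻ y, F (z, y) ∂Wm ∂Wm := by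
  have hψm := hψ.meas
  have hC := hφ.pos
  rw [avF_omE hφ.meas hψ.meas hF]
  have hle : ENNReal.ofReal (64 * (1 + K ^ 2) ^ 2) ≤ ENNReal.ofReal (ndC K C) := by
    refine ENNReal.ofReal_le_ofReal ?_
    unfold ndC
    have : 0 ≤ C * (1 + K ^ 2) ^ 2 := by positivity
    nlinarith [sq_nonneg (1 + K ^ 2)]
  calc _ ≤ ∫⁻ t in Icc (1/2 : ℝ) 2, ENNReal.ofReal (ndC K C) *
        ∫⁻ u, ∫⁻ y, ∫⁻ y', F (u, ψ t + δ * y + b * y') ∂Om ∂Om ∂Wm := by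
        refine setLIntegral_mono' measurableSet_Icc fun t ht => ?_
        simp_rw [one_mul]
        exact (Om_shift (F := fun u => ∫⁻ y, ∫⁻ y', F (u, ψ t + δ * y + b * y') ∂Om ∂Om) (by fun_prop) (hφ.bdd t ht) hδ0 hδ).trans
          (mul_le_mul_left hle _)
    _ = ENNReal.ofReal (ndC K C) * ∫⁻ u, (∫⁻ t in Icc (1/2 : ℝ) 2, ∫⁻ y, ∫⁻ y', F (u, ψ t + δ * y + b * y') ∂Om ∂Om) ∂Wm := by
        rw [lintegral_const_mul _ (by fun_prop)]
        congr 1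
        exact lintegral_lintegral_swap (f := fun t u => ∫⁻ y, ∫⁻ y', F (u, ψ t + δ * y + b * y') ∂Om ∂Om) (by fun_prop)
    _ ≤ ENNReal.ofReal (ndC K C) * ∫⁻ u, ENNReal.ofReal (ndC K C) * ∫⁻ y, F (u, y) ∂Wm ∂Wm :=
        mul_le_mul_right (lintegral_mono fun u => hψ.Om_lint (F := fun y => F (u, y)) (by fun_prop) hδ0 hδ hb) _
    _ = _ := by rw [lintegral_const_mul _ (by fun_prop), ← mul_assoc, pow_two]

lemma avF_swap {φ ψ : ℝ → ℝ} {δ : ℝ} {F : ℝ × ℝ → ℝ≥0∞} (hF : Measurable F) :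
    avF φ ψ δ F = avF ψ φ δ (fun v => F v.swap) := by
  unfold avF
  refine lintegral_congr fun t => ?_
  exact lintegral_lintegral_swap (f := fun z y => F (φ t + δ * z, ψ t + δ * y)) (by fun_prop)

lemma omE_swap {a b : ℝ} {F : ℝ × ℝ → ℝ≥0∞} (hF : Measurable F) (v : ℝ × ℝ) :
    omE a b F v.swap = omE b a (fun v => F v.swap) v := by
  unfold omE
  exact lintegral_lintegral_swap (f := fun z y => F (v.swap.1 + a * z, v.swap.2 + b * y)) (by fun_prop)

lemma avF_omE_le' {φ ψ : ℝ → ℝ} {K C : ℝ} (hφ : NDeg φ K C) (hψ : NDeg ψ K C) {δ : ℝ} (hδ0 : 0 < δ) (hδ : δ ≤ 1)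
    {F : ℝ × ℝ → ℝ≥0∞} (hF : Measurable F) :
    avF φ ψ δ (omE δ 1 F) ≤ ENNReal.ofReal (ndC K C) ^ 2 * ∫⁻ z, ∫⁻ y, F (z, y) ∂Wm ∂Wm := by
  rw [avF_swap (by fun_prop)]
  simp_rw [omE_swap hF]
  refine (avF_omE_le hψ hφ hδ0 hδ (Or.inr rfl) (F := fun v => F v.swap) (by fun_prop)).trans (le_of_eq ?_)
  congr 1
  exact lintegral_lintegral_swap (f := fun z y => F (y, z)) (by fun_prop)

lemma wR_le_inv (x : ℝ) : wR x ≤ (1 + x ^ 2)⁻¹ := by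
  unfold wR
  exact inv_anti₀ (by positivity) (by nlinarith [sq_nonneg x])

lemma wR_abs_le_inv (x : ℝ) : |x| * wR x ≤ (1 + x ^ 2)⁻¹ := by
  unfold wR
  rw [← div_eq_mul_inv, ← one_div, div_le_div_iff₀ (by positivity) (by positivity)]
  have : |x| ≤ 1 + x ^ 2 := by rw [← sq_abs]; nlinarith [sq_nonneg (|x| - 1)]
  nlinarith [sq_nonneg x]

lemma wR_cube_le (x : ℝ) : wR x * |x| ^ 3 ≤ 1 := by
  unfold wR
  rw [inv_mul_le_one₀ (by positivity), ← sq_abs x]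
  nlinarith [sq_nonneg (|x| ^ 2 - |x|), sq_nonneg (|x|), sq_nonneg (|x|^2)]

/-- Decay, smoothness and cancellation give a Littlewood-Paley kernel. -/
lemma LPk.of_decay {k k' : ℝ → ℂ} {A : ℝ} (hd : ∀ x, HasDerivAt k (k' x) x) (hk' : Continuous k')
    (hb : ∀ x, ‖k x‖ ≤ A * wR x) (hb' : ∀ x, ‖k' x‖ ≤ A * wR x) (hz : ∫ x, k x = 0) : LPk k (20 * A) := by
  have hA : 0 ≤ A := by
    have := (norm_nonneg _).trans (hb 0); have h1 := wR_pos 0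
    exact nonneg_of_mul_nonneg_left this h1
  have hkc : Continuous k := continuous_iff_continuousAt.2 fun x => (hd x).continuousAt
  have hw : ∀ x, wR x ≤ 1 := wR_le_one
  have hwi : Integrable fun x => A * (1 + x ^ 2)⁻¹ := integrable_inv_one_add_sq.const_mul A
  have hwI : ∫ x : ℝ, A * (1 + x ^ 2)⁻¹ = A * Real.pi := by rw [integral_const_mul, integral_univ_inv_one_add_sq]
  have hki : Integrable k := hwi.mono' hkc.aestronglyMeasurable
    (ae_of_all _ fun x => (hb x).trans (mul_le_mul_of_nonneg_left (wR_le_inv x) hA))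
  have hki' : Integrable k' := hwi.mono' hk'.aestronglyMeasurable
    (ae_of_all _ fun x => (hb' x).trans (mul_le_mul_of_nonneg_left (wR_le_inv x) hA))
  have hpi := Real.pi_pos
  have hpi2 : Real.pi < 3.15 := Real.pi_lt_d2
  have hder : deriv k = k' := funext fun x => (hd x).deriv
  refine ⟨hki, fun x => ?_, fun x => (hd x).differentiableAt, fun x => ?_, fun x => ?_, fun η => ?_, fun η => ?_⟩
  · refine (hb x).trans ?_
    nlinarith [hw x, mul_le_mul_of_nonneg_left (hw x) hA]
  · rw [hder]; refine (hb' x).trans ?_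
    nlinarith [hw x, mul_le_mul_of_nonneg_left (hw x) hA]
  · rw [hder]
    calc ‖k' x‖ * |x| ^ 3 ≤ A * wR x * |x| ^ 3 := by gcongr; exact hb' x
      _ = A * (wR x * |x| ^ 3) := by ring
      _ ≤ A * 1 := by gcongr; exact wR_cube_le x
      _ ≤ _ := by linarith
  · have h1 : 𝓕 k η = ∫ x, (Real.fourierChar (-(x * η)) : ℂ) * k x - k x := by
      rw [integral_sub _ hki, hz, sub_zero, Real.fourier_real_eq]
      · rfl
      · refine (hki.bdd_mul (c := 1) ?_ ?_)
        · exact (Continuous.comp (by fun_prop) (Real.continuous_fourierChar.comp (by fun_prop))).aestronglyMeasurable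
        · exact ae_of_all _ fun x => (Circle.norm_coe _).le
    rw [h1]
    refine (norm_integral_le_of_norm_le (hwi.const_mul (2 * Real.pi * |η|)) (ae_of_all _ fun x => ?_)).trans ?_
    · have h2 : ‖(Real.fourierChar (-(x * η)) : ℂ) - 1‖ ≤ 2 * Real.pi * |η| * |x| := by
        rw [Real.fourierChar_apply]
        refine (Real.norm_exp_I_mul_ofReal_sub_one_le (x := 2 * Real.pi * -(x * η)) |> fun h => ?_)
        rw [mul_comm Complex.I] at h
        refine h.trans (le_of_eq ?_)
        rw [Real.norm_eq_abs, abs_mul, abs_neg, abs_mul x, abs_of_pos (by positivity : 0 < 2 * Real.pi)]; ring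
      calc ‖(Real.fourierChar (-(x * η)) : ℂ) * k x - k x‖ = ‖(Real.fourierChar (-(x * η)) : ℂ) - 1‖ * ‖k x‖ := by
            rw [← norm_mul, sub_mul, one_mul]
        _ ≤ (2 * Real.pi * |η| * |x|) * (A * wR x) := by gcongr; exact hb x
        _ = 2 * Real.pi * |η| * (A * (|x| * wR x)) := by ring
        _ ≤ _ := by gcongr; exact wR_abs_le_inv x
    · rw [integral_const_mul, hwI]
      have : Real.pi * Real.pi ≤ 10 := by nlinarith
      have h3 := mul_nonneg hA (abs_nonneg η)
      nlinarith
  · have h1 := Real.fourier_deriv hki (fun x => (hd x).differentiableAt) (by rw [hder]; exact hki')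
    have h2 : ‖𝓕 k' η‖ ≤ A * Real.pi := by
      rw [← hwI, Real.fourier_real_eq]
      refine norm_integral_le_of_norm_le hwi (ae_of_all _ fun x => ?_)
      rw [Circle.norm_smul]
      exact (hb' x).trans (mul_le_mul_of_nonneg_left (wR_le_inv x) hA)
    rw [hder] at h1
    rw [h1] at h2
    simp only [norm_smul, norm_mul, Complex.norm_real, Complex.norm_I, Real.norm_eq_abs, abs_of_pos hpi] at h2
    norm_num at h2
    nlinarith

/-- The profile as a complex function. -/
def omC (x : ℝ) : ℂ := (omR x : ℂ)

lemma omR_hasDerivAt (x : ℝ) : HasDerivAt omR (-(8 * x) * ((1 + x ^ 2) ^ 5)⁻¹) x := by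
  unfold omR
  have h : HasDerivAt (fun x : ℝ => (1 + x ^ 2) ^ 4) (4 * (1 + x ^ 2) ^ 3 * (2 * x)) x := by
    exact (((hasDerivAt_pow 2 x).const_add 1).pow 4).congr_deriv (by norm_num)
  refine (h.inv (by positivity)).congr_deriv ?_
  have : (1 + x ^ 2) ≠ 0 := by positivity
  field_simp
  ring

lemma omR_deriv_le (x : ℝ) : |-(8 * x) * ((1 + x ^ 2) ^ 5)⁻¹| ≤ 8 * wR x := by
  have : |x| ≤ 1 + x ^ 2 := by rw [← sq_abs]; nlinarith [sq_nonneg (|x| - 1)]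
  have h1 : 1 ≤ 1 + x ^ 2 := by nlinarith [sq_nonneg x]
  unfold wR
  rw [abs_mul, abs_neg, abs_mul, abs_of_pos (by norm_num : (0:ℝ) < 8), abs_of_pos (by positivity : 0 < ((1 + x ^ 2) ^ 5)⁻¹),
    ← div_eq_mul_inv, ← div_eq_mul_inv, div_le_div_iff₀ (by positivity) (by positivity), mul_assoc]
  refine mul_le_mul_of_nonneg_left ?_ (by norm_num)
  calc |x| * (1 + x ^ 2) ^ 2 ≤ (1 + x ^ 2) * (1 + x ^ 2) ^ 2 := by gcongr
    _ = (1 + x ^ 2) ^ 3 := by ring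
    _ ≤ (1 + x ^ 2) ^ 5 := pow_le_pow_right₀ h1 (by norm_num)

lemma wR_two_le (x : ℝ) : wR (2 * x) ≤ wR x := by
  unfold wR; exact inv_anti₀ (by positivity) (by gcongr ?_ ^ 2; nlinarith [sq_nonneg x])

/-- The difference of two consecutive profiles. -/
def vK (x : ℝ) : ℂ := sc omC (1/2) x - omC x

lemma omC_integrable : Integrable omC := by
  have : Integrable omR := by
    refine integrable_inv_one_add_sq.mono' omR_continuous.aestronglyMeasurable (ae_of_all _ fun x => ?_)
    rw [Real.norm_of_nonneg (omR_pos x).le]; exact (omR_le_wR x).trans (wR_le_inv x)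
  exact this.ofReal

lemma omC_continuous : Continuous omC := by unfold omC; exact Complex.continuous_ofReal.comp omR_continuous

lemma vK_LPk : LPk vK 800 := by
  have h : LPk vK (20 * 40) := by
    refine LPk.of_decay (k' := fun x => ((4 * (-(8 * (2 * x)) * ((1 + (2 * x) ^ 2) ^ 5)⁻¹) - -(8 * x) * ((1 + x ^ 2) ^ 5)⁻¹ : ℝ) : ℂ)) ?_ ?_ ?_ ?_ ?_
    · intro x
      have h1 : HasDerivAt (fun x => 2 * omR (2 * x)) (2 * ((-(8 * (2 * x)) * ((1 + (2 * x) ^ 2) ^ 5)⁻¹) * 2)) x :=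
        ((omR_hasDerivAt (2 * x)).comp x (by simpa using (hasDerivAt_id x).const_mul 2)).const_mul 2
      have h2 := (h1.sub (omR_hasDerivAt x)).ofReal_comp
      convert h2 using 1
      · ext y; unfold vK sc omC; norm_num
      · congr 1; ring
    · refine Complex.continuous_ofReal.comp ?_
      exact ((continuous_const.mul ((by fun_prop : Continuous fun x : ℝ => -(8 * (2 * x))).mul
        (Continuous.inv₀ (by fun_prop) fun x => by positivity))).sub
        ((by fun_prop : Continuous fun x : ℝ => -(8 * x)).mul (Continuous.inv₀ (by fun_prop) fun x => by positivity)))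
    · intro x
      have h0 : vK x = ((2 * omR (2 * x) - omR x : ℝ) : ℂ) := by unfold vK sc omC; norm_num
      rw [h0, Complex.norm_real, Real.norm_eq_abs]
      refine (abs_sub _ _).trans ?_
      rw [abs_of_pos (by have := omR_pos (2 * x); positivity), abs_of_pos (omR_pos x)]
      have h1 := (omR_le_wR (2 * x)).trans (wR_two_le x)
      have h2 := omR_le_wR x
      have := wR_pos x
      linarith
    · intro x
      rw [Complex.norm_real, Real.norm_eq_abs]
      refine (abs_sub _ _).trans ?_
      rw [abs_mul, abs_of_pos (by norm_num : (0:ℝ) < 4)]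
      have h1 := (omR_deriv_le (2 * x)).trans (mul_le_mul_of_nonneg_left (wR_two_le x) (by norm_num))
      have h2 := omR_deriv_le x
      linarith
    · unfold vK
      rw [integral_sub (sc_integrable omC_integrable (by norm_num)) omC_integrable]
      unfold sc
      rw [integral_const_mul, Measure.integral_comp_mul_left]
      norm_num
      ring
  norm_num at h; exact h

lemma sc_vK (r x : ℝ) : sc vK r x = sc omC (r / 2) x - sc omC r x := by
  unfold vK sc
  rw [show (r / 2)⁻¹ = 2 * r⁻¹ by rw [inv_div]; ring, show (1 / 2 : ℝ)⁻¹ = 2 by norm_num, mul_assoc 2 r⁻¹ x]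
  push_cast
  ring

lemma sc_omC_telescope (r : ℝ) (n : ℕ) (x : ℝ) :
    sc omC (r * 2⁻¹ ^ n) x = sc omC r x + ∑ i ∈ Finset.range n, sc vK (r * 2⁻¹ ^ i) x := by
  induction n with
  | zero => simp
  | succ n ih =>
    rw [Finset.sum_range_succ, ← add_assoc, ← ih, sc_vK, pow_succ, ← mul_assoc, ← div_eq_mul_inv]
    ring

/-- The measure of the thickened dilated curve. -/
def aN (φ ψ : ℝ → ℝ) (δ r s : ℝ) : Measure (ℝ × ℝ) :=
  Measure.map (fun q : ℝ × ℝ × ℝ => (r * (φ q.1 + δ * q.2.1), s * (ψ q.1 + δ * q.2.2)))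
    ((volume.restrict (Icc (1/2 : ℝ) 2)).prod (Om.prod Om))

instance {φ ψ : ℝ → ℝ} {δ r s : ℝ} : IsFiniteMeasure (aN φ ψ δ r s) := by unfold aN; infer_instance

lemma mA_aN {φ ψ : ℝ → ℝ} (hφ : Measurable φ) (hψ : Measurable ψ) {δ r s : ℝ} {h : ℝ × ℝ → ℝ≥0∞} (hh : Measurable h) (x : ℝ × ℝ) :
    mA (aN φ ψ δ r s) h x = avF φ ψ δ fun v => h (x.1 - r * v.1, x.2 - s * v.2) := by
  unfold mA aN avF
  rw [lintegral_map (by fun_prop) (by fun_prop), lintegral_prod _ (by fun_prop)]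
  refine lintegral_congr fun t => ?_
  rw [lintegral_prod _ (by fun_prop)]
  rfl

lemma aN_univ {φ ψ : ℝ → ℝ} (hφ : Measurable φ) (hψ : Measurable ψ) {δ r s : ℝ} :
    aN φ ψ δ r s univ ≤ ENNReal.ofReal 24 := by
  unfold aN
  rw [Measure.map_apply (by fun_prop) MeasurableSet.univ, preimage_univ, ← univ_prod_univ, Measure.prod_prod,
    ← univ_prod_univ, Measure.prod_prod, Measure.restrict_apply_univ, Real.volume_Icc]
  calc _ ≤ ENNReal.ofReal (2 - 1/2) * (4 * 4) := by gcongr <;> exact Om_univ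
    _ = _ := by
      rw [show (4 : ℝ≥0∞) * 4 = ENNReal.ofReal 16 by norm_num, ← ENNReal.ofReal_mul (by norm_num)]; norm_num

/-- Averages of `h` against the dilated profile. -/
def omX (a b : ℝ) (h : ℝ × ℝ → ℝ≥0∞) (x : ℝ × ℝ) : ℝ≥0∞ := ∫⁻ z, ∫⁻ y, h (x.1 - a * z, x.2 - b * y) ∂Om ∂Om

@[fun_prop] lemma omX_measurable {a b : ℝ} {h : ℝ × ℝ → ℝ≥0∞} (hh : Measurable h) : Measurable (omX a b h) := by
  unfold omX; fun_prop

lemma omX_eq {a b r s : ℝ} {h : ℝ × ℝ → ℝ≥0∞} (x v : ℝ × ℝ) :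
    omX (r * a) (s * b) h (x.1 - r * v.1, x.2 - s * v.2) = omE a b (fun v => h (x.1 - r * v.1, x.2 - s * v.2)) v := by
  unfold omX omE
  refine lintegral_congr fun z => lintegral_congr fun y => ?_
  congr 2 <;> ring

lemma hlW2_eq {r s : ℝ} {h : ℝ × ℝ → ℝ≥0∞} (hh : Measurable h) (x : ℝ × ℝ) :
    hlW2 r s h x = ∫⁻ z, ∫⁻ y, h (x.1 - r * z, x.2 - s * y) ∂Wm ∂Wm := by
  unfold hlW2
  rw [lint_Wm _ (by fun_prop)]
  refine lintegral_congr fun z => ?_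
  rw [lint_Wm _ (by fun_prop)]

section
variable {φ ψ : ℝ → ℝ} {K C : ℝ} {δ r s : ℝ}

lemma mA_aN_le_conv (hφ : Measurable φ) (hψ : Measurable ψ) {h : ℝ × ℝ → ℝ≥0∞} (hh : Measurable h) (x : ℝ × ℝ) :
    mA (aN φ ψ δ r s) h x ≤ 4096 ^ 2 * mA (aN φ ψ δ r s) (omX (r * δ) (s * δ) h) x := by
  rw [mA_aN hφ hψ hh, mA_aN hφ hψ (by fun_prop)]
  simp_rw [omX_eq]
  have hF : Measurable fun v : ℝ × ℝ => h (x.1 - r * v.1, x.2 - s * v.2) := by fun_prop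
  generalize (fun v : ℝ × ℝ => h (x.1 - r * v.1, x.2 - s * v.2)) = F at hF
  have h1 : ∀ t, ∫⁻ z, ∫⁻ y, F (φ t + δ * z, ψ t + δ * y) ∂Om ∂Om = omE δ δ F (φ t, ψ t) := fun t => rfl
  have h2 : ∀ t, ∫⁻ z, ∫⁻ y, omE δ δ F (φ t + δ * z, ψ t + δ * y) ∂Om ∂Om = omE δ δ (omE δ δ F) (φ t, ψ t) := fun t => rfl
  unfold avF
  simp_rw [h1, h2]
  rw [← lintegral_const_mul _ (by fun_prop)]
  exact lintegral_mono fun t => omE_le_conv hF _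

lemma mA_aN_omX (hφ : NDeg φ K C) (hψ : NDeg ψ K C) (hδ0 : 0 < δ) (hδ : δ ≤ 1) {a b : ℝ}
    (hab : (a = 1 ∧ b = 1) ∨ (a = 1 ∧ b = δ) ∨ (a = δ ∧ b = 1)) {h : ℝ × ℝ → ℝ≥0∞} (hh : Measurable h) (x : ℝ × ℝ) :
    mA (aN φ ψ δ r s) (omX (r * a) (s * b) h) x ≤ ENNReal.ofReal (ndC K C) ^ 2 * hlW2 r s h x := by
  rw [mA_aN hφ.meas hψ.meas (by fun_prop), hlW2_eq hh]
  simp_rw [omX_eq]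
  rcases hab with ⟨rfl, rfl⟩ | ⟨rfl, rfl⟩ | ⟨rfl, rfl⟩
  · exact avF_omE_le hφ hψ hδ0 hδ (Or.inl rfl) (F := fun v => h (x.1 - r * v.1, x.2 - s * v.2)) (by fun_prop)
  · exact avF_omE_le hφ hψ hδ0 hδ (Or.inr rfl) (F := fun v => h (x.1 - r * v.1, x.2 - s * v.2)) (by fun_prop)
  · exact avF_omE_le' hφ hψ hδ0 hδ (F := fun v => h (x.1 - r * v.1, x.2 - s * v.2)) (by fun_prop)
end

lemma cv1_omC {g : ℝ → ℝ} (hg : Measurable g) (hg0 : ∀ y, 0 ≤ g y) {a : ℝ} (ha : 0 < a) (x : ℝ) :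
    cv1 (sc omC a) (fun y => (g y : ℂ)) x = ((∫⁻ z, ENNReal.ofReal (g (x - a * z)) ∂Om).toReal : ℂ) := by
  rw [lint_Om _ (by fun_prop)]
  have h1 : ∫⁻ z, ENNReal.ofReal (omR z) * ENNReal.ofReal (g (x - a * z)) = ∫⁻ z, ENNReal.ofReal (omR z * g (x - a * z)) := by
    refine lintegral_congr fun z => (ENNReal.ofReal_mul (omR_pos z).le).symm
  rw [h1, ← integral_eq_lintegral_of_nonneg_ae (ae_of_all _ fun z => mul_nonneg (omR_pos z).le (hg0 _))
    (by apply Measurable.aestronglyMeasurable; fun_prop)]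
  unfold cv1 sc omC
  rw [← integral_sub_left_eq_self _ _ x]
  have h2 : ∀ y, (((a⁻¹ : ℝ) : ℂ) * ((omR (a⁻¹ * (x - (x - y))) : ℝ) : ℂ)) * ((g (x - y) : ℝ) : ℂ) =
      ((a⁻¹ * (fun z => omR z * g (x - a * z)) (a⁻¹ * y) : ℝ) : ℂ) := by
    intro y
    have : a * (a⁻¹ * y) = y := by field_simp
    simp only [this]
    push_cast; ring_nf
  simp_rw [h2]
  have h4 := Measure.integral_comp_mul_left (fun z => omR z * g (x - a * z)) a⁻¹
  rw [smul_eq_mul, inv_inv, abs_of_pos ha] at h4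
  rw [integral_complex_ofReal, integral_const_mul, h4, inv_mul_cancel_left₀ ha.ne']

lemma omX_bdd {a b : ℝ} {h : ℝ × ℝ → ℝ≥0∞} {B : ℝ≥0∞} (hB : ∀ x, h x ≤ B) (x : ℝ × ℝ) : omX a b h x ≤ 16 * B := by
  unfold omX
  calc _ ≤ ∫⁻ z, ∫⁻ y, B ∂Om ∂Om := lintegral_mono fun z => lintegral_mono fun y => hB _
    _ = B * Om univ * Om univ := by simp
    _ ≤ B * 4 * 4 := by gcongr <;> exact Om_univ
    _ = _ := by ring

lemma enorm_pc_omC {g : ℝ × ℝ → ℝ} (hg : Measurable g) (hg0 : ∀ y, 0 ≤ g y) {B : ℝ} (hB : ∀ y, g y ≤ B) {a b : ℝ} (ha : 0 < a) (hb : 0 < b)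
    (x : ℝ × ℝ) :
    ‖pc2 (sc omC b) (pc1 (sc omC a) fun y => (g y : ℂ)) x‖ₑ = omX a b (fun y => ENNReal.ofReal (g y)) x := by
  have hfin : ∀ y : ℝ × ℝ, ∫⁻ z, ENNReal.ofReal (g (y.1 - a * z, y.2)) ∂Om ≠ ∞ := by
    intro y
    refine ne_top_of_le_ne_top (b := ENNReal.ofReal B * Om univ) (ENNReal.mul_ne_top ENNReal.ofReal_ne_top (measure_ne_top _ _)) ?_
    rw [← lintegral_const]
    exact lintegral_mono fun z => ENNReal.ofReal_le_ofReal (hB _)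
  have h1 : pc1 (sc omC a) (fun y => (g y : ℂ)) =
      fun y => (((∫⁻ z, ENNReal.ofReal (g (y.1 - a * z, y.2)) ∂Om).toReal : ℝ) : ℂ) := by
    ext y
    unfold pc1
    exact cv1_omC (g := fun z => g (z, y.2)) (by fun_prop) (fun _ => hg0 _) ha y.1
  rw [h1]
  unfold pc2
  rw [cv1_omC (g := fun y => (∫⁻ z, ENNReal.ofReal (g (x.1 - a * z, y)) ∂Om).toReal) (by fun_prop) (fun _ => ENNReal.toReal_nonneg) hb]
  have h2 : ∀ y, ENNReal.ofReal (∫⁻ z, ENNReal.ofReal (g (x.1 - a * z, y)) ∂Om).toReal = ∫⁻ z, ENNReal.ofReal (g (x.1 - a * z, y)) ∂Om :=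
    fun y => ENNReal.ofReal_toReal (hfin (x.1, y))
  simp_rw [h2]
  have h3 : ∫⁻ y, ∫⁻ z, ENNReal.ofReal (g (x.1 - a * z, x.2 - b * y)) ∂Om ∂Om = omX a b (fun y => ENNReal.ofReal (g y)) x := by
    unfold omX
    exact lintegral_lintegral_swap (f := fun y z => ENNReal.ofReal (g (x.1 - a * z, x.2 - b * y))) (by fun_prop)
  rw [h3, ← ofReal_norm, Complex.norm_real, Real.norm_of_nonneg ENNReal.toReal_nonneg, ENNReal.ofReal_toReal]
  exact ne_top_of_le_ne_top (by finiteness) (omX_bdd (fun y => ENNReal.ofReal_le_ofReal (hB y)) x)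

lemma pc1_integrable {k : ℝ → ℂ} (hk : Integrable k) {g : ℝ × ℝ → ℂ} (hg : Nice g) (x : ℝ × ℝ) :
    Integrable fun y => k (x.1 - y) * g (y, x.2) := by
  obtain ⟨B, hB⟩ := hg.bdd
  refine (hk.comp_sub_left x.1).mul_bdd (c := B) ?_ (ae_of_all _ fun y => hB _)
  exact (hg.sm.comp_measurable (f := g) (g := fun y : ℝ => (y, x.2)) (by fun_prop)).aestronglyMeasurable

lemma pc1_telescope {g : ℝ × ℝ → ℂ} (hg : Nice g) {r : ℝ} (hr : 0 < r) (n : ℕ) (x : ℝ × ℝ) :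
    pc1 (sc omC (r * 2⁻¹ ^ n)) g x = pc1 (sc omC r) g x + ∑ i ∈ Finset.range n, pc1 (sc vK (r * 2⁻¹ ^ i)) g x := by
  unfold pc1 cv1
  rw [← integral_finsetSum, ← integral_add]
  · congr 1; ext y
    rw [sc_omC_telescope, add_mul, Finset.sum_mul]
  · exact pc1_integrable (sc_integrable omC_integrable hr) hg x
  · exact integrable_finsetSum _ fun i _ => pc1_integrable (sc_integrable vK_LPk.int (by positivity)) hg x
  · exact fun i _ => pc1_integrable (sc_integrable vK_LPk.int (by positivity)) hg x

lemma pc2_telescope {g : ℝ × ℝ → ℂ} (hg : Nice g) {r : ℝ} (hr : 0 < r) (n : ℕ) (x : ℝ × ℝ) :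
    pc2 (sc omC (r * 2⁻¹ ^ n)) g x = pc2 (sc omC r) g x + ∑ i ∈ Finset.range n, pc2 (sc vK (r * 2⁻¹ ^ i)) g x := by
  simp only [pc2_eq]
  exact pc1_telescope hg.swap hr n _

lemma pc2_add_sum {k : ℝ → ℂ} (hk : Integrable k) {g : ℝ × ℝ → ℂ} (hg : Nice g) {n : ℕ} {f : ℕ → ℝ × ℝ → ℂ} (hf : ∀ i, Nice (f i)) (x : ℝ × ℝ) :
    pc2 k (fun y => g y + ∑ i ∈ Finset.range n, f i y) x = pc2 k g x + ∑ i ∈ Finset.range n, pc2 k (f i) x := by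
  simp only [pc2_eq]
  unfold pc1 cv1
  rw [← integral_finsetSum, ← integral_add]
  · congr 1; ext y
    rw [mul_add, Finset.mul_sum]
  · exact pc1_integrable hk hg.swap x.swap
  · exact integrable_finsetSum _ fun i _ => pc1_integrable hk (hf i).swap x.swap
  · exact fun i _ => pc1_integrable hk (hf i).swap x.swap

lemma pc_telescope_le {g : ℝ × ℝ → ℂ} (hg : Nice g) {r s : ℝ} (hr : 0 < r) (hs : 0 < s) (n : ℕ) (x : ℝ × ℝ) :
    ‖pc2 (sc omC (s * 2⁻¹ ^ n)) (pc1 (sc omC (r * 2⁻¹ ^ n)) g) x‖ₑ ≤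
      ‖pc2 (sc omC s) (pc1 (sc omC (r * 2⁻¹ ^ n)) g) x‖ₑ + ‖pc2 (sc omC (s * 2⁻¹ ^ n)) (pc1 (sc omC r) g) x‖ₑ
        + ‖pc2 (sc omC s) (pc1 (sc omC r) g) x‖ₑ
        + ∑ q ∈ Finset.range n ×ˢ Finset.range n, ‖pc2 (sc vK (s * 2⁻¹ ^ q.1)) (pc1 (sc vK (r * 2⁻¹ ^ q.2)) g) x‖ₑ := by
  have n1 : ∀ r : ℝ, 0 < r → Nice (pc1 (sc omC r) g) := fun r hr =>
    nice_pc1 (sc_continuous omC_continuous r) (sc_integrable omC_integrable hr) hg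
  have n2 : ∀ i : ℕ, Nice (pc1 (sc vK (r * 2⁻¹ ^ i)) g) := fun i =>
    nice_pc1 (sc_continuous vK_LPk.continuous _) (sc_integrable vK_LPk.int (by positivity)) hg
  have h1 := pc2_telescope (n1 (r * 2⁻¹ ^ n) (by positivity)) hs n x
  have h2 := pc2_telescope (n1 r hr) hs n x
  have h3 : ∀ i, pc2 (sc vK (s * 2⁻¹ ^ i)) (pc1 (sc omC (r * 2⁻¹ ^ n)) g) x =
      pc2 (sc vK (s * 2⁻¹ ^ i)) (pc1 (sc omC r) g) x +
        ∑ j ∈ Finset.range n, pc2 (sc vK (s * 2⁻¹ ^ i)) (pc1 (sc vK (r * 2⁻¹ ^ j)) g) x := by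
    intro i
    rw [funext (pc1_telescope hg hr n)]
    exact pc2_add_sum (sc_integrable vK_LPk.int (by positivity)) (n1 r hr) n2 x
  simp_rw [h3, Finset.sum_add_distrib] at h1
  have h4 : pc2 (sc omC (s * 2⁻¹ ^ n)) (pc1 (sc omC (r * 2⁻¹ ^ n)) g) x =
      pc2 (sc omC s) (pc1 (sc omC (r * 2⁻¹ ^ n)) g) x + pc2 (sc omC (s * 2⁻¹ ^ n)) (pc1 (sc omC r) g) x
        - pc2 (sc omC s) (pc1 (sc omC r) g) x
        + ∑ q ∈ Finset.range n ×ˢ Finset.range n, pc2 (sc vK (s * 2⁻¹ ^ q.1)) (pc1 (sc vK (r * 2⁻¹ ^ q.2)) g) x := by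
    rw [Finset.sum_product, h1, h2]; ring
  rw [h4]
  refine (enorm_add_le _ _).trans (add_le_add ((enorm_sub_le).trans (add_le_add_left (enorm_add_le _ _) _)) (enorm_sum_le _ _))

lemma LacSum.scale {α : Type*} [Fintype α] {t : α → ℝ} {L c : ℝ} (h : LacSum t L) (hc : 0 < c) : LacSum (fun i => t i * c) L where
  pos i := mul_pos (h.pos i) hc
  sum x hx := by
    have := h.sum (x * c) (mul_pos hx hc)
    simpa only [mul_comm, mul_left_comm, mul_assoc] using this

lemma LacSum.comp {α β : Type*} [Fintype α] [Fintype β] {t : α → ℝ} {L : ℝ} (h : LacSum t L) {f : β → α}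
    (hf : Function.Injective f) : LacSum (fun i => t (f i)) L where
  pos i := h.pos _
  sum x hx := by
    refine le_trans ?_ (h.sum x hx)
    rw [← Finset.sum_image (s := Finset.univ) (g := f) (f := fun a => min (x * t a) (x * t a)⁻¹) hf.injOn]
    refine Finset.sum_le_sum_of_subset_of_nonneg (Finset.subset_univ _) fun i _ _ => ?_
    have := mul_pos hx (h.pos i)
    positivity

section
variable {ι κ : Type*} [Fintype ι] [Fintype κ] {r : ι → ℝ} {s : ι × κ → ℝ} {L : ℝ}

/-- A two-parameter family of lacunary scales. -/
structure Lac2 (r : ι → ℝ) (s : ι × κ → ℝ) (L : ℝ) : Prop where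
  nn : 0 ≤ L
  one : LacSum r L
  pos : ∀ d, 0 < s d
  two : ∀ i, LacSum (fun n => s (i, n)) L

lemma Lac2.scale (h : Lac2 r s L) {a b : ℝ} (ha : 0 < a) (hb : 0 < b) : Lac2 (fun i => r i * a) (fun d => s d * b) L :=
  ⟨h.nn, h.one.scale ha, fun d => mul_pos (h.pos d) hb, fun i => (h.two i).scale hb⟩

lemma Lac2.fib (h : Lac2 r s L) (i : ι) : LacSum (fun d : {d : ι × κ // d.1 = i} => s d) L := by
  have := (h.two i).comp (f := fun d : {d : ι × κ // d.1 = i} => d.1.2) (by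
    rintro ⟨⟨a, b⟩, rfl⟩ ⟨⟨c, d⟩, hd⟩ hh
    simp at hd hh; subst hd hh; rfl)
  convert this using 2 with d
  obtain ⟨⟨a, b⟩, rfl⟩ := d
  rfl

lemma lp_two_param (h : Lac2 r s L) {k : ℝ → ℂ} {C : ℝ} (hk : LPk k C) {g : ℝ × ℝ → ℂ} (hg : Nice g) {p : ℝ}
    (hp : p = 2 ∨ (1 < p ∧ p ≤ 4 / 3)) :
    ∫⁻ x, (∑ d : ι × κ, ‖pc2 (sc k (s d)) (pc1 (sc k (r d.1)) g) x‖ₑ ^ 2) ^ (p / 2) ≤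
      ENNReal.ofReal ((960 * (C * L + 1) / (p - 1)) ^ 2) ^ p * ∫⁻ x, ‖g x‖ₑ ^ p := by
  have h1 := lp_diag1 hk h.nn (a := fun _ : ι => ()) (s := r) h.one.pos
    (fun i => by convert h.one.comp (f := fun d : {d : ι // () = i} => d.1) Subtype.val_injective) (f := fun _ => g) (fun _ => hg) hp
  have h2 := lp_diag2 hk h.nn (a := fun d : ι × κ => d.1) (s := s) h.pos h.fib (f := fun i => pc1 (sc k (r i)) g)
    (fun i => nice_pc1 (sc_continuous hk.continuous _) (sc_integrable hk.int (h.one.pos i)) hg) hp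
  refine h2.trans ((mul_le_mul_right h1 _).trans (le_of_eq ?_))
  have hp0 : 0 < p - 1 := by rcases hp with rfl | hp <;> linarith
  have hL := h.nn
  have hC := hk.pos
  rw [← mul_assoc, ← ENNReal.mul_rpow_of_nonneg _ _ (by linarith), ← ENNReal.ofReal_mul (by positivity), ← pow_two]
  congr 1
  refine lintegral_congr fun x => ?_
  simp only [Finset.univ_unique, Finset.sum_singleton]
  rw [← ENNReal.rpow_natCast, ← ENNReal.rpow_mul]
  congr 1; push_cast; ring

lemma hlW2_measurable {r s : ℝ} {h : ℝ × ℝ → ℝ≥0∞} (hh : Measurable h) : Measurable (hlW2 r s h) := by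
  rw [funext (hlW2_eq hh)]; fun_prop

variable {φ ψ : ℝ → ℝ} {K C : ℝ}

lemma mA_aN_decomp (hφ : NDeg φ K C) (hψ : NDeg ψ K C) {r s : ℝ} (hr : 0 < r) (hs : 0 < s) (n : ℕ) {g : ℝ × ℝ → ℝ}
    (hg : Nice fun y => (g y : ℂ)) (hgm : Measurable g) (hg0 : ∀ y, 0 ≤ g y) {B : ℝ} (hB : ∀ y, g y ≤ B) (x : ℝ × ℝ) :
    mA (aN φ ψ (2⁻¹ ^ n) r s) (fun y => ENNReal.ofReal (g y)) x ≤
      4096 ^ 2 * (3 * ENNReal.ofReal (ndC K C) ^ 2 * hlW2 r s (fun y => ENNReal.ofReal (g y)) x +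
        ∑ q ∈ Finset.range n ×ˢ Finset.range n, mA (aN φ ψ (2⁻¹ ^ n) r s)
          (fun y => ‖pc2 (sc vK (s * 2⁻¹ ^ q.1)) (pc1 (sc vK (r * 2⁻¹ ^ q.2)) fun y => (g y : ℂ)) y‖ₑ) x) := by
  have hδ0 : (0:ℝ) < 2⁻¹ ^ n := by positivity
  have hδ : (2⁻¹ ^ n : ℝ) ≤ 1 := pow_le_one₀ (by norm_num) (by norm_num)
  have hhm : Measurable fun y => ENNReal.ofReal (g y) := by fun_prop
  refine (mA_aN_le_conv hφ.meas hψ.meas hhm x).trans (mul_le_mul_right ?_ _)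
  have h1 : ∀ y, omX (r * 2⁻¹ ^ n) (s * 2⁻¹ ^ n) (fun y => ENNReal.ofReal (g y)) y ≤
      omX (r * 2⁻¹ ^ n) (s * 1) (fun y => ENNReal.ofReal (g y)) y + omX (r * 1) (s * 2⁻¹ ^ n) (fun y => ENNReal.ofReal (g y)) y
        + omX (r * 1) (s * 1) (fun y => ENNReal.ofReal (g y)) y
      + ∑ q ∈ Finset.range n ×ˢ Finset.range n, ‖pc2 (sc vK (s * 2⁻¹ ^ q.1)) (pc1 (sc vK (r * 2⁻¹ ^ q.2)) fun y => (g y : ℂ)) y‖ₑ := by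
    intro y
    have := pc_telescope_le hg hr hs n y
    rw [enorm_pc_omC hgm hg0 hB (by positivity) (by positivity), enorm_pc_omC hgm hg0 hB (by positivity) (by positivity),
      enorm_pc_omC hgm hg0 hB (by positivity) (by positivity), enorm_pc_omC hgm hg0 hB (by positivity) (by positivity)] at this
    simpa only [mul_one] using this
  have hmV : ∀ q : ℕ × ℕ, Measurable fun y => ‖pc2 (sc vK (s * 2⁻¹ ^ q.1)) (pc1 (sc vK (r * 2⁻¹ ^ q.2)) fun y => (g y : ℂ)) y‖ₑ :=
    fun q => (nice_pc2 (sc_continuous vK_LPk.continuous _) (sc_integrable vK_LPk.int (by positivity))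
      (nice_pc1 (sc_continuous vK_LPk.continuous _) (sc_integrable vK_LPk.int (by positivity)) hg)).sm.enorm
  refine (mA_mono h1 x).trans ?_
  have h2 : ∀ {u v : ℝ × ℝ → ℝ≥0∞}, Measurable u → Measurable v → mA (aN φ ψ (2⁻¹ ^ n) r s) (fun y => u y + v y) x =
      mA (aN φ ψ (2⁻¹ ^ n) r s) u x + mA (aN φ ψ (2⁻¹ ^ n) r s) v x := by
    intro u v hu hv
    unfold mA
    exact lintegral_add_left (by fun_prop) _
  have ho : ∀ a b, Measurable (omX a b fun y => ENNReal.ofReal (g y)) := fun a b => omX_measurable hhm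
  have a1 : ∀ {u v w z : ℝ × ℝ → ℝ≥0∞}, Measurable u → Measurable v → Measurable w → Measurable z →
      mA (aN φ ψ (2⁻¹ ^ n) r s) (fun y => u y + v y + w y + z y) x = mA (aN φ ψ (2⁻¹ ^ n) r s) u x + mA (aN φ ψ (2⁻¹ ^ n) r s) v x
        + mA (aN φ ψ (2⁻¹ ^ n) r s) w x + mA (aN φ ψ (2⁻¹ ^ n) r s) z x := by
    intro u v w z hu hv hw hz
    rw [h2 (u := fun y => u y + v y + w y) (by fun_prop) hz, h2 (u := fun y => u y + v y) (by fun_prop) hw, h2 hu hv]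
  rw [a1 (ho _ _) (ho _ _) (ho _ _) (Finset.measurable_fun_sum _ fun q _ => hmV q)]
  refine add_le_add ?_ (le_of_eq ?_)
  · have e1 := mA_aN_omX (r := r) (s := s) hφ hψ hδ0 hδ (Or.inr (Or.inr ⟨rfl, rfl⟩)) hhm x
    have e2 := mA_aN_omX (r := r) (s := s) hφ hψ hδ0 hδ (Or.inr (Or.inl ⟨rfl, rfl⟩)) hhm x
    have e3 := mA_aN_omX (r := r) (s := s) hφ hψ hδ0 hδ (Or.inl ⟨rfl, rfl⟩) hhm x
    refine (add_le_add (add_le_add e1 e2) e3).trans (le_of_eq ?_)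
    ring
  · unfold mA
    rw [lintegral_finsetSum]
    exact fun q _ => (hmV q).comp (by fun_prop)

/-- The constant in the passage from square function to maximal function. -/
def dpC (K C L p B : ℝ) (n : ℕ) : ℝ :=
  2 * 4096 ^ 2 * (3 * ndC K C ^ 2 * (680 / (p - 1)) ^ 2 + (n : ℝ) ^ 2 * (B * (960 * (800 * L + 1) / (p - 1)) ^ 2))

lemma ndC_nonneg (hC : 0 ≤ C) : 0 ≤ ndC K C := by unfold ndC; positivity

lemma max_of_VP_nice (hl : Lac2 r s L) (hφ : NDeg φ K C) (hψ : NDeg ψ K C) (n : ℕ) {p B : ℝ} (hB0 : 0 ≤ B)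
    (hp : p = 2 ∨ (1 < p ∧ p ≤ 4 / 3)) (hV : VP (fun d : ι × κ => aN φ ψ (2⁻¹ ^ n) (r d.1) (s d)) p B) {g : ℝ × ℝ → ℝ}
    (hg : Nice fun y => (g y : ℂ)) (hgm : Measurable g) (hg0 : ∀ y, 0 ≤ g y) {M : ℝ} (hM : ∀ y, g y ≤ M) :
    ∫⁻ x, (⨆ d : ι × κ, mA (aN φ ψ (2⁻¹ ^ n) (r d.1) (s d)) (fun y => ENNReal.ofReal (g y)) x) ^ p ≤
      ENNReal.ofReal (dpC K C L p B n) ^ p * ∫⁻ x, ENNReal.ofReal (g x) ^ p := by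
  have hp1 : 1 < p := by rcases hp with rfl | hp <;> linarith
  have hp2 : p ≤ 2 := by rcases hp with rfl | hp <;> linarith
  have hp0 : 0 < p - 1 := by linarith
  have hC := ndC_nonneg (K := K) hφ.pos
  have hhm : Measurable fun y => ENNReal.ofReal (g y) := by fun_prop
  let Q := Finset.range n ×ˢ Finset.range n
  let V : ℕ × ℕ → ι × κ → ℝ × ℝ → ℝ≥0∞ := fun q d y =>
    ‖pc2 (sc vK (s d * 2⁻¹ ^ q.1)) (pc1 (sc vK (r d.1 * 2⁻¹ ^ q.2)) fun y => (g y : ℂ)) y‖ₑ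
  let H : ℝ × ℝ → ℝ≥0∞ := fun x => ⨆ d : ι × κ, hlW2 (r d.1) (s d) (fun y => ENNReal.ofReal (g y)) x
  let S : ℕ × ℕ → ℝ × ℝ → ℝ≥0∞ := fun q x => ∑ d : ι × κ, mA (aN φ ψ (2⁻¹ ^ n) (r d.1) (s d)) (V q d) x ^ 2
  have hVn : ∀ (q : ℕ × ℕ) (d : ι × κ), Nice (pc2 (sc vK (s d * 2⁻¹ ^ q.1)) (pc1 (sc vK (r d.1 * 2⁻¹ ^ q.2)) fun y => (g y : ℂ))) := fun q d =>
    nice_pc2 (sc_continuous vK_LPk.continuous _) (sc_integrable vK_LPk.int (mul_pos (hl.pos d) (by positivity)))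
      (nice_pc1 (sc_continuous vK_LPk.continuous _) (sc_integrable vK_LPk.int (mul_pos (hl.one.pos d.1) (by positivity))) hg)
  have hVm : ∀ (q : ℕ × ℕ) (d : ι × κ), Measurable (V q d) := fun q d => (hVn q d).sm.enorm
  have hHm : Measurable H := Measurable.iSup fun d => hlW2_measurable hhm
  have hSm : ∀ q, Measurable (S q) := fun q => Finset.measurable_fun_sum _ fun d _ => (mA_measurable (hVm q d)).pow_const 2
  have hpt : ∀ x, (⨆ d : ι × κ, mA (aN φ ψ (2⁻¹ ^ n) (r d.1) (s d)) (fun y => ENNReal.ofReal (g y)) x) ≤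
      4096 ^ 2 * (3 * ENNReal.ofReal (ndC K C) ^ 2 * H x + ∑ q ∈ Q, S q x ^ (1 / 2 : ℝ)) := by
    intro x
    refine iSup_le fun d => (mA_aN_decomp hφ hψ (hl.one.pos _) (hl.pos d) n hg hgm hg0 hM x).trans ?_
    refine mul_le_mul_right (add_le_add (mul_le_mul_right (le_iSup (fun d : ι × κ => hlW2 (r d.1) (s d) (fun y => ENNReal.ofReal (g y)) x) d) _)
      (Finset.sum_le_sum fun q _ => ?_)) _
    have h1 : mA (aN φ ψ (2⁻¹ ^ n) (r d.1) (s d)) (V q d) x ^ 2 ≤ S q x :=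
      Finset.single_le_sum (f := fun d : ι × κ => mA (aN φ ψ (2⁻¹ ^ n) (r d.1) (s d)) (V q d) x ^ 2) (fun _ _ => zero_le) (Finset.mem_univ d)
    have h2 := ENNReal.rpow_le_rpow h1 (by norm_num : (0:ℝ) ≤ 1/2)
    rwa [← ENNReal.rpow_natCast, ← ENNReal.rpow_mul, show (((2:ℕ):ℝ) * (1/2)) = 1 by norm_num, ENNReal.rpow_one] at h2
  have hH : ∫⁻ x, H x ^ p ≤ ENNReal.ofReal ((680 / (p - 1)) ^ 2) ^ p * ∫⁻ x, ENNReal.ofReal (g x) ^ p := by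
    have := hl_strong_two (r := fun d : ι × κ => r d.1) (s := s) (fun d => hl.one.pos _) hl.pos hhm
      (ENNReal.ofReal_ne_top) (fun y => ENNReal.ofReal_le_ofReal (hM y)) hp1 hp2
    refine this.trans (le_of_eq ?_)
    rw [← mul_assoc, ← ENNReal.mul_rpow_of_nonneg _ _ (by linarith), ← ENNReal.ofReal_mul (by positivity), ← pow_two]
  have hS : ∀ q, ∫⁻ x, S q x ^ (p / 2) ≤ ENNReal.ofReal (B * (960 * (800 * L + 1) / (p - 1)) ^ 2) ^ p * ∫⁻ x, ENNReal.ofReal (g x) ^ p := by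
    intro q
    refine (hV (V q) (hVm q) (fun d x => enorm_ne_top)).trans ?_
    have h1 := lp_two_param (hl.scale (a := 2⁻¹ ^ q.2) (b := 2⁻¹ ^ q.1) (by positivity) (by positivity)) vK_LPk hg hp
    refine (mul_le_mul_right h1 _).trans (le_of_eq ?_)
    rw [← mul_assoc, ← ENNReal.mul_rpow_of_nonneg _ _ (by linarith), ← ENNReal.ofReal_mul hB0]
    congr 1
    refine lintegral_congr fun x => ?_
    rw [← ofReal_norm, Complex.norm_real, Real.norm_of_nonneg (hg0 x)]
  generalize hI : ∫⁻ x, ENNReal.ofReal (g x) ^ p = I at *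
  have hpp : ∀ x, (⨆ d : ι × κ, mA (aN φ ψ (2⁻¹ ^ n) (r d.1) (s d)) (fun y => ENNReal.ofReal (g y)) x) ^ p ≤
      (2 * 4096 ^ 2) ^ p * ((3 * ENNReal.ofReal (ndC K C) ^ 2) ^ p * H x ^ p + ((n:ℝ≥0∞) ^ 2) ^ (p - 1) * ∑ q ∈ Q, S q x ^ (p / 2)) := by
    intro x
    refine (ENNReal.rpow_le_rpow (hpt x) (by linarith)).trans ?_
    rw [ENNReal.mul_rpow_of_nonneg _ _ (by linarith), ENNReal.mul_rpow_of_nonneg 2 _ (by linarith), mul_comm (2 ^ p) _, mul_assoc (_ ^ p) (2 ^ p)]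
    refine mul_le_mul_right ((ENNReal.rpow_add_le_mul_rpow_add_rpow _ _ hp1.le).trans ?_) _
    refine mul_le_mul' (ENNReal.rpow_le_rpow_of_exponent_le (by norm_num) (by linarith)) (add_le_add (le_of_eq ?_) ?_)
    · rw [← ENNReal.mul_rpow_of_nonneg _ _ (by linarith)]
    · refine (ENNReal.rpow_sum_le_const_mul_sum_rpow _ _ hp1.le).trans (le_of_eq ?_)
      have c1 : ((Q.card : ℕ) : ℝ≥0∞) = (n:ℝ≥0∞) ^ 2 := by simp [Q, pow_two]
      rw [c1]
      refine congrArg _ (Finset.sum_congr rfl fun (q : ℕ × ℕ) _ => ?_)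
      rw [← ENNReal.rpow_mul]; congr 1; ring
  refine (lintegral_mono hpp).trans ?_
  rw [lintegral_const_mul _ (by fun_prop), lintegral_add_left (by fun_prop), lintegral_const_mul _ (by fun_prop),
    lintegral_const_mul _ (by fun_prop), lintegral_finsetSum _ (by fun_prop)]
  have hQ : ∑ q ∈ Q, ∫⁻ x, S q x ^ (p / 2) ≤ (n:ℝ≥0∞) ^ 2 * (ENNReal.ofReal (B * (960 * (800 * L + 1) / (p - 1)) ^ 2) ^ p * I) := by
    refine (Finset.sum_le_sum fun q _ => hS q).trans (le_of_eq ?_)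
    simp [Q, pow_two]
  have hn : ((n:ℝ≥0∞) ^ 2) ^ (p - 1) * (n:ℝ≥0∞) ^ 2 = ((n:ℝ≥0∞) ^ 2) ^ p := by
    nth_rw 2 [← ENNReal.rpow_one ((n:ℝ≥0∞) ^ 2)]
    rw [← ENNReal.rpow_add_of_nonneg _ _ hp0.le zero_le_one, sub_add_cancel]
  calc _ ≤ (2 * 4096 ^ 2) ^ p * ((3 * ENNReal.ofReal (ndC K C) ^ 2) ^ p * (ENNReal.ofReal ((680 / (p - 1)) ^ 2) ^ p * I) +
        ((n:ℝ≥0∞) ^ 2) ^ (p - 1) * ((n:ℝ≥0∞) ^ 2 * (ENNReal.ofReal (B * (960 * (800 * L + 1) / (p - 1)) ^ 2) ^ p * I))) := by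
        gcongr
    _ = (2 * 4096 ^ 2) ^ p * ((3 * ENNReal.ofReal (ndC K C) ^ 2 * ENNReal.ofReal ((680 / (p - 1)) ^ 2)) ^ p +
        ((n:ℝ≥0∞) ^ 2 * (ENNReal.ofReal (B * (960 * (800 * L + 1) / (p - 1)) ^ 2))) ^ p) * I := by
        rw [← mul_assoc (((n:ℝ≥0∞) ^ 2) ^ (p - 1)), hn, ENNReal.mul_rpow_of_nonneg (3 * ENNReal.ofReal (ndC K C) ^ 2) _ (by linarith),
          ENNReal.mul_rpow_of_nonneg ((n:ℝ≥0∞) ^ 2) _ (by linarith)]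
        ring
    _ ≤ (2 * 4096 ^ 2) ^ p * ((3 * ENNReal.ofReal (ndC K C) ^ 2 * ENNReal.ofReal ((680 / (p - 1)) ^ 2)) +
        ((n:ℝ≥0∞) ^ 2 * (ENNReal.ofReal (B * (960 * (800 * L + 1) / (p - 1)) ^ 2)))) ^ p * I := by
        gcongr
        exact ENNReal.add_rpow_le_rpow_add _ _ hp1.le
    _ = _ := by
        rw [← ENNReal.mul_rpow_of_nonneg _ _ (by linarith)]
        congr 2
        unfold dpC
        have e2 : (2:ℝ≥0∞) = ENNReal.ofReal 2 := by simp
        have e3 : (3:ℝ≥0∞) = ENNReal.ofReal 3 := by simp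
        have e4 : (4096:ℝ≥0∞) = ENNReal.ofReal 4096 := by simp
        rw [← ENNReal.ofReal_pow hC, ← ENNReal.ofReal_natCast n, ← ENNReal.ofReal_pow (by positivity), e3, e4, ← ENNReal.ofReal_pow (by positivity),
          ← ENNReal.ofReal_mul (by positivity), ← ENNReal.ofReal_mul (by positivity), ← ENNReal.ofReal_mul (by positivity),
          ← ENNReal.ofReal_add (by positivity) (by positivity)]
        nth_rw 1 [e2]
        rw [← ENNReal.ofReal_mul (by positivity), ← ENNReal.ofReal_mul (by positivity)]
end

section
lemma VP.mono {δ : Type*} [Fintype δ] {ν : δ → Measure (ℝ × ℝ)} {p B B' : ℝ} (h : VP ν p B) (hp : 0 ≤ p) (hB : B ≤ B') : VP ν p B' :=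
  fun g hg hf => (h g hg hf).trans (mul_le_mul_left (ENNReal.rpow_le_rpow (ENNReal.ofReal_le_ofReal hB) hp) _)

lemma DP_of_nice {δ : Type*} [Fintype δ] {ν : δ → Measure (ℝ × ℝ)} [∀ d, IsFiniteMeasure (ν d)] {p D : ℝ} (hp : 0 < p)
    (H : ∀ g : ℝ × ℝ → ℝ, Nice (fun y => (g y : ℂ)) → Measurable g → (∀ y, 0 ≤ g y) → (∃ M : ℝ, ∀ y, g y ≤ M) →
      ∫⁻ x, (⨆ d, mA (ν d) (fun y => ENNReal.ofReal (g y)) x) ^ p ≤ ENNReal.ofReal D ^ p * ∫⁻ x, ENNReal.ofReal (g x) ^ p) :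
    DP ν p D := by
  intro h hm hf
  let g : ℕ → ℝ × ℝ → ℝ := fun n => (Metric.closedBall (0 : ℝ × ℝ) n).indicator fun y => min (h y).toReal n
  have hgm : ∀ n, Measurable (g n) := fun n => Measurable.indicator (by fun_prop) measurableSet_closedBall
  have hg0 : ∀ n y, 0 ≤ g n y := fun n y => indicator_nonneg (fun y _ => le_min ENNReal.toReal_nonneg (Nat.cast_nonneg n)) y
  have hgn : ∀ n y, g n y ≤ n := fun n y => by
    refine indicator_apply_le' (fun _ => min_le_right _ _) fun _ => Nat.cast_nonneg n
  have hgh : ∀ n y, g n y ≤ (h y).toReal := fun n y => by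
    refine indicator_apply_le' (fun _ => min_le_left _ _) fun _ => ENNReal.toReal_nonneg
  have hni : ∀ n, Nice (fun y => (g n y : ℂ)) := by
    intro n
    have h1 : ∀ y, ‖(g n y : ℂ)‖ ≤ n := fun y => by
      rw [Complex.norm_real, Real.norm_of_nonneg (hg0 n y)]; exact hgn n y
    refine ⟨(Complex.measurable_ofReal.comp (hgm n)).stronglyMeasurable, ?_, n, h1⟩
    have h2 : IntegrableOn (fun y => (g n y : ℂ)) (Metric.closedBall (0 : ℝ × ℝ) n) :=
      Measure.integrableOn_of_bounded (M := n) (ne_of_lt measure_closedBall_lt_top)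
        (Complex.measurable_ofReal.comp (hgm n)).aestronglyMeasurable (Eventually.of_forall h1)
    refine (integrableOn_iff_integrable_of_support_subset ?_).1 h2
    intro y hy
    by_contra hc
    exact hy (by simp [g, indicator_of_notMem hc])
  let F : ℕ → ℝ × ℝ → ℝ≥0∞ := fun n y => ENNReal.ofReal (g n y)
  have hFm : ∀ n, Measurable (F n) := fun n => (hgm n).ennreal_ofReal
  have hmono : Monotone F := by
    intro a b hab y
    refine ENNReal.ofReal_le_ofReal ?_
    have hab' : (a:ℝ) ≤ b := by exact_mod_cast hab
    by_cases hy : y ∈ Metric.closedBall (0 : ℝ × ℝ) a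
    · have hy2 : y ∈ Metric.closedBall (0 : ℝ × ℝ) b := Metric.closedBall_subset_closedBall hab' hy
      simp only [g, indicator_of_mem hy, indicator_of_mem hy2]
      exact min_le_min le_rfl hab'
    · simp only [g, indicator_of_notMem hy]
      exact hg0 b y
  have hFh : ∀ n y, F n y ≤ h y := fun n y => ENNReal.ofReal_le_of_le_toReal (hgh n y)
  have hsup : h = fun y => ⨆ n, F n y := by
    funext y
    refine le_antisymm ?_ (iSup_le fun n => hFh n y)
    obtain ⟨n, hn⟩ := exists_nat_ge (max ‖y‖ (h y).toReal)
    have h1 : y ∈ Metric.closedBall (0 : ℝ × ℝ) n := by simpa using (le_max_left _ _).trans hn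
    refine le_trans (le_of_eq ?_) (le_iSup (fun n => F n y) n)
    simp only [F, g, indicator_of_mem h1]
    rw [min_eq_left ((le_max_right _ _).trans hn), ENNReal.ofReal_toReal (hf y)]
  have hA : ∀ d x, mA (ν d) h x = ⨆ n, mA (ν d) (F n) x := by
    intro d x
    unfold mA
    have h1 := lintegral_iSup (μ := ν d) (f := fun n y => F n (x - y)) (fun n => by have := hFm n; fun_prop) fun a b hab y => hmono hab (x - y)
    rw [← h1]
    nth_rw 1 [hsup]
  have hS : ∀ x, (⨆ d, mA (ν d) h x) ^ p = ⨆ n, (⨆ d, mA (ν d) (F n) x) ^ p := by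
    intro x
    simp only [hA]
    rw [iSup_comm]
    exact (ENNReal.orderIsoRpow p hp).map_iSup _
  simp only [hS]
  rw [lintegral_iSup]
  · refine iSup_le fun n => (H (g n) (hni n) (hgm n) (hg0 n) ⟨n, hgn n⟩).trans ?_
    refine mul_le_mul_right (lintegral_mono fun x => ENNReal.rpow_le_rpow (hFh n x) hp.le) _
  · exact fun n => (Measurable.iSup fun d => mA_measurable (hFm n)).pow_const p
  · intro a b hab x
    exact ENNReal.rpow_le_rpow (iSup_mono fun d => mA_mono (fun y => hmono hab y) x) hp.le

/-- The exponents of the bootstrapping argument. -/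
def pk (k : ℕ) : ℝ := 1 / (1 - 2⁻¹ ^ (k + 1))

lemma two_inv_pow_succ_le (k : ℕ) : (2⁻¹ : ℝ) ^ (k + 1) ≤ 1 / 2 := by
  rw [pow_succ]
  have : (2⁻¹ : ℝ) ^ k ≤ 1 := pow_le_one₀ (by norm_num) (by norm_num)
  linarith

lemma pk_zero : pk 0 = 2 := by norm_num [pk]

lemma one_lt_pk (k : ℕ) : 1 < pk k := by
  have h1 := two_inv_pow_succ_le k
  have h2 : (0:ℝ) < 2⁻¹ ^ (k + 1) := by positivity
  unfold pk
  rw [lt_div_iff₀ (by linarith)]; linarith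

lemma pk_case (k : ℕ) : pk k = 2 ∨ (1 < pk k ∧ pk k ≤ 4 / 3) := by
  rcases k with _ | k
  · exact Or.inl pk_zero
  · refine Or.inr ⟨one_lt_pk _, ?_⟩
    have h1 := two_inv_pow_succ_le k
    unfold pk
    rw [pow_succ, div_le_iff₀ (by linarith)]; linarith

lemma inv_pk_sub (k : ℕ) : (pk k - 1)⁻¹ = 2 ^ (k + 1) - 1 := by
  have h3 : (1:ℝ) < 2 ^ (k + 1) := one_lt_pow₀ (by norm_num) (by omega)
  unfold pk
  rw [inv_pow] at *
  generalize (2:ℝ) ^ (k + 1) = z at *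
  have h5 : z - 1 ≠ 0 := by linarith
  have h6 : 1 / (1 - z⁻¹) - 1 = (z - 1)⁻¹ := by
    field_simp; ring
  rw [h6, inv_inv]

lemma pk_succ (k : ℕ) : pk (k + 1) / (2 - pk (k + 1)) = pk k := by
  have h1 := two_inv_pow_succ_le k
  unfold pk
  rw [pow_succ _ (k + 1)]
  generalize (2⁻¹ : ℝ) ^ (k + 1) = z at *
  have h5 : (2:ℝ) - z ≠ 0 := by linarith
  have h4 : 2 - 1 / (1 - z * 2⁻¹) = (1 - z) / (1 - z * 2⁻¹) := by field_simp; ring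
  rw [h4]; field_simp

lemma pk_succ_lt (k : ℕ) : pk (k + 1) < 2 := by
  rcases pk_case (k + 1) with h | h
  · have := inv_pk_sub (k + 1)
    rw [h] at this
    have h3 : (4:ℝ) ≤ 2 ^ (k + 1 + 1) := by
      rw [pow_succ, pow_succ]; nlinarith [one_le_pow₀ (n := k) (by norm_num : (1:ℝ) ≤ 2)]
    norm_num at this; linarith
  · linarith

/-- The constant of the bootstrapped vector-valued bounds. -/
def bootC (K C L : ℝ) : ℝ := 24 + 3 * (8 * 4096 ^ 2 * (3 * ndC K C ^ 2 * 680 ^ 2 + (960 * (800 * L + 1)) ^ 2))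

variable {ι κ : Type*} [Fintype ι] [Fintype κ] {r : ι → ℝ} {s : ι × κ → ℝ} {L K C : ℝ} {φ ψ : ℝ → ℝ}

lemma max_of_VP (hl : Lac2 r s L) (hφ : NDeg φ K C) (hψ : NDeg ψ K C) (n : ℕ) {p B : ℝ} (hB0 : 0 ≤ B)
    (hp : p = 2 ∨ (1 < p ∧ p ≤ 4 / 3)) (hV : VP (fun d : ι × κ => aN φ ψ (2⁻¹ ^ n) (r d.1) (s d)) p B) :
    DP (fun d : ι × κ => aN φ ψ (2⁻¹ ^ n) (r d.1) (s d)) p (dpC K C L p B n) :=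
  DP_of_nice (by rcases hp with rfl | hp <;> linarith) fun g hg hgm hg0 ⟨M, hM⟩ => max_of_VP_nice hl hφ hψ n hB0 hp hV hg hgm hg0 hM

lemma VP_pk (hl : Lac2 r s L) (hφ : NDeg φ K C) (hψ : NDeg ψ K C) {n : ℕ} (hn : 1 ≤ n) (k : ℕ) :
    VP (fun d : ι × κ => aN φ ψ (2⁻¹ ^ n) (r d.1) (s d)) (pk k) (bootC K C L * 4 ^ k * (n : ℝ) ^ 2) := by
  have hn1 : (1:ℝ) ≤ (n:ℝ) ^ 2 := one_le_pow₀ (by exact_mod_cast hn)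
  set G : ℝ := 8 * 4096 ^ 2 * (3 * ndC K C ^ 2 * 680 ^ 2 + (960 * (800 * L + 1)) ^ 2) with hG
  have hG0 : 0 ≤ G := by positivity
  have hE : bootC K C L = 24 + 3 * G := rfl
  induction k with
  | zero =>
    rw [pk_zero]
    refine (VP_two (fun d => aN_univ hφ.meas hψ.meas)).mono (by norm_num) ?_
    rw [hE, pow_zero, mul_one]; nlinarith
  | succ k ih =>
    have hB0 : 0 ≤ bootC K C L * 4 ^ k * (n : ℝ) ^ 2 := by rw [hE]; positivity
    have hk1 : (1:ℝ) ≤ 4 ^ k := one_le_pow₀ (by norm_num)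
    have h1 := max_of_VP hl hφ hψ n hB0 (pk_case k) ih
    have hdp0 : 0 ≤ dpC K C L (pk k) (bootC K C L * 4 ^ k * (n : ℝ) ^ 2) n := by unfold dpC; positivity
    rw [← pk_succ k] at h1
    have h2 := VP_of_DP (by norm_num : (0:ℝ) ≤ 24) (pk_succ k ▸ hdp0) (fun d => aN_univ hφ.meas hψ.meas) (one_lt_pk (k + 1)) (pk_succ_lt k) h1
    rw [pk_succ] at h2
    refine h2.mono (by linarith [one_lt_pk (k + 1)]) ?_
    refine Real.sqrt_le_iff.2 ⟨by rw [hE]; positivity, ?_⟩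
    have hq : ((pk k - 1)⁻¹) ^ 2 ≤ 4 * 4 ^ k := by
      rw [inv_pk_sub]
      have h3 : (1:ℝ) < 2 ^ (k + 1) := one_lt_pow₀ (by norm_num) (by omega)
      calc ((2:ℝ) ^ (k + 1) - 1) ^ 2 ≤ (2 ^ (k + 1)) ^ 2 := by gcongr <;> linarith
        _ = 4 * 4 ^ k := by rw [← pow_mul, mul_comm, pow_mul]; norm_num [pow_succ]; ring
    set q := ((pk k - 1)⁻¹) ^ 2 with hqd
    have hq0 : 0 ≤ q := by positivity
    set B := bootC K C L * 4 ^ k * (n : ℝ) ^ 2 with hB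
    have e : dpC K C L (pk k) B n = 2 * 4096 ^ 2 * (3 * ndC K C ^ 2 * 680 ^ 2 + (960 * (800 * L + 1)) ^ 2 * ((n:ℝ) ^ 2 * B)) * q := by
      unfold dpC; rw [hqd, div_eq_mul_inv, div_eq_mul_inv]; ring
    have hB1 : 1 ≤ (n:ℝ) ^ 2 * B := by
      have : 1 ≤ B := by
        rw [hB, hE]
        calc (1:ℝ) = 1 * 1 * 1 := by norm_num
          _ ≤ _ := by gcongr; linarith
      nlinarith
    have e2 : dpC K C L (pk k) B n ≤ G * 4 ^ k * ((n:ℝ) ^ 2 * B) := by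
      rw [e]
      calc _ ≤ 2 * 4096 ^ 2 * (3 * ndC K C ^ 2 * 680 ^ 2 * ((n:ℝ) ^ 2 * B) + (960 * (800 * L + 1)) ^ 2 * ((n:ℝ) ^ 2 * B)) * (4 * 4 ^ k) := by
            refine mul_le_mul (mul_le_mul_of_nonneg_left (add_le_add_left (le_mul_of_one_le_right (by positivity) hB1) _) (by norm_num)) hq hq0 (by positivity)
        _ = _ := by rw [hG]; ring
    calc 24 * dpC K C L (pk k) B n ≤ 24 * (G * 4 ^ k * ((n:ℝ) ^ 2 * B)) := by gcongr
      _ = (24 * G * bootC K C L) * (4 ^ k) ^ 2 * ((n:ℝ) ^ 2) ^ 2 := by rw [hB]; ring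
      _ ≤ (16 * bootC K C L ^ 2) * (4 ^ k) ^ 2 * ((n:ℝ) ^ 2) ^ 2 := by
          refine mul_le_mul_of_nonneg_right (mul_le_mul_of_nonneg_right ?_ (by positivity)) (by positivity)
          rw [hE]; nlinarith
      _ = _ := by ring

end

/-- The unimodular exponential. -/
def eI (t : ℝ) : ℂ := Complex.exp ((t : ℂ) * Complex.I)

lemma eI_add (s t : ℝ) : eI (s + t) = eI s * eI t := by
  unfold eI; rw [← Complex.exp_add]; push_cast; ring_nf

@[fun_prop] lemma eI_continuous : Continuous eI := by unfold eI; fun_prop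

lemma norm_eI (t : ℝ) : ‖eI t‖ = 1 := norm_expI t

lemma FT_def (f : ℝ × ℝ → ℂ) (ξ : ℝ × ℝ) : FT f ξ = ∫ x : ℝ × ℝ, eI (-(2 * Real.pi * (x.1 * ξ.1 + x.2 * ξ.2))) * f x := rfl

lemma FTinv_def (f : ℝ × ℝ → ℂ) (x : ℝ × ℝ) : FTinv f x = ∫ ξ : ℝ × ℝ, eI (2 * Real.pi * (x.1 * ξ.1 + x.2 * ξ.2)) * f ξ := rfl

lemma integrable_eI_mul {X : Type*} [MeasurableSpace X] {μ : Measure X} {θ : X → ℝ} (hθ : Measurable θ) {f : X → ℂ}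
    (hf : Integrable f μ) : Integrable (fun x => eI (θ x) * f x) μ :=
  hf.bdd_mul (c := 1) (by fun_prop) (ae_of_all _ fun x => (norm_eI _).le)

lemma norm_FT_le (f : ℝ × ℝ → ℂ) (ξ : ℝ × ℝ) : ‖FT f ξ‖ ≤ ∫ x, ‖f x‖ := by
  rw [FT_def]
  refine (norm_integral_le_integral_norm _).trans (le_of_eq ?_)
  simp only [norm_mul, norm_eI, one_mul]

lemma continuous_parametric {X : Type*} [MeasurableSpace X] {μ : Measure X} {Y : Type*} [TopologicalSpace Y] [FirstCountableTopology Y]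
    {θ : Y → X → ℝ} (hθ : ∀ y, Measurable (θ y)) (hθc : ∀ x, Continuous fun y => θ y x) {f : X → ℂ} (hf : Integrable f μ) :
    Continuous fun y => ∫ x, eI (θ y x) * f x ∂μ := by
  refine continuous_of_dominated (bound := fun x => ‖f x‖) (fun y => (integrable_eI_mul (hθ y) hf).1) (fun y => ae_of_all _ fun x => ?_)
    hf.norm (ae_of_all _ fun x => ?_)
  · rw [norm_mul, norm_eI, one_mul]
  · have := hθc x; fun_prop

lemma FT_continuous {f : ℝ × ℝ → ℂ} (hf : Integrable f) : Continuous (FT f) :=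
  continuous_parametric (θ := fun ξ x : ℝ × ℝ => -(2 * Real.pi * (x.1 * ξ.1 + x.2 * ξ.2))) (by fun_prop) (by fun_prop) hf

lemma FTinv_continuous {f : ℝ × ℝ → ℂ} (hf : Integrable f) : Continuous (FTinv f) :=
  continuous_parametric (θ := fun x ξ : ℝ × ℝ => 2 * Real.pi * (x.1 * ξ.1 + x.2 * ξ.2)) (by fun_prop) (by fun_prop) hf

/-- The product dilation as a measurable equivalence. -/
def scEquiv {α β : ℝ} (hα : α ≠ 0) (hβ : β ≠ 0) : ℝ × ℝ ≃ᵐ ℝ × ℝ :=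
  MeasurableEquiv.prodCongr (MeasurableEquiv.mulLeft₀ α hα) (MeasurableEquiv.mulLeft₀ β hβ)

lemma map_scEquiv {α β : ℝ} (hα : 0 < α) (hβ : 0 < β) :
    Measure.map (scEquiv hα.ne' hβ.ne') volume = ENNReal.ofReal (α * β)⁻¹ • (volume : Measure (ℝ × ℝ)) := by
  have h := Measure.map_prod_map (f := fun x : ℝ => α * x) (g := fun x : ℝ => β * x) volume volume (by fun_prop) (by fun_prop)
  rw [Real.map_volume_mul_left hα.ne', Real.map_volume_mul_left hβ.ne', Measure.prod_smul_left, Measure.prod_smul_right, smul_smul,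
    abs_of_pos (inv_pos.2 hα), abs_of_pos (inv_pos.2 hβ), ← ENNReal.ofReal_mul (by positivity), ← mul_inv] at h
  exact h.symm

lemma integral_scale2 {α β : ℝ} (hα : 0 < α) (hβ : 0 < β) (G : ℝ × ℝ → ℂ) :
    ∫ ξ : ℝ × ℝ, G (α * ξ.1, β * ξ.2) = ((α * β)⁻¹ : ℝ) * ∫ ξ, G ξ := by
  have h := integral_map_equiv (μ := volume) (scEquiv hα.ne' hβ.ne') G
  rw [map_scEquiv hα hβ, integral_smul_measure, ENNReal.toReal_ofReal (by positivity)] at h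
  rw [Complex.real_smul] at h
  exact h.symm

lemma integrable_scale2 {α β : ℝ} (hα : 0 < α) (hβ : 0 < β) {G : ℝ × ℝ → ℂ} (hG : Integrable G) :
    Integrable fun ξ : ℝ × ℝ => G (α * ξ.1, β * ξ.2) := by
  have h := integrable_map_equiv (μ := volume) (scEquiv hα.ne' hβ.ne') G
  rw [map_scEquiv hα hβ] at h
  exact h.1 (hG.smul_measure ENNReal.ofReal_ne_top)

lemma FTinv_scale {α β : ℝ} (hα : 0 < α) (hβ : 0 < β) (a : ℝ × ℝ → ℂ) (w : ℝ × ℝ) :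
    FTinv (fun ξ => a (α * ξ.1, β * ξ.2)) w = ((α * β)⁻¹ : ℝ) * FTinv a (α⁻¹ * w.1, β⁻¹ * w.2) := by
  rw [FTinv_def, FTinv_def, ← integral_scale2 hα hβ]
  refine integral_congr_ae (ae_of_all _ fun ξ => ?_)
  simp only
  congr 2
  field_simp

lemma FTinv_mul_FT {a : ℝ × ℝ → ℂ} (ha : Integrable a) {f : ℝ × ℝ → ℂ} (hf : Integrable f) {α β : ℝ} (hα : 0 < α) (hβ : 0 < β)
    (w : ℝ × ℝ) :
    FTinv (fun ξ => a (α * ξ.1, β * ξ.2) * FT f ξ) w = ∫ z : ℝ × ℝ, FTinv a z * f (w.1 - α * z.1, w.2 - β * z.2) := by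
  have hint : Integrable (Function.uncurry fun (ξ y : ℝ × ℝ) => eI (2 * Real.pi * ((w.1 - y.1) * ξ.1 + (w.2 - y.2) * ξ.2)) *
      (a (α * ξ.1, β * ξ.2) * f y)) ((volume : Measure (ℝ × ℝ)).prod volume) :=
    integrable_eI_mul (by fun_prop) ((integrable_scale2 hα hβ ha).mul_prod hf)
  have h1 : FTinv (fun ξ => a (α * ξ.1, β * ξ.2) * FT f ξ) w =
      ∫ y : ℝ × ℝ, FTinv (fun ξ => a (α * ξ.1, β * ξ.2)) (w - y) * f y := by
    calc _ = ∫ ξ : ℝ × ℝ, ∫ y : ℝ × ℝ, eI (2 * Real.pi * ((w.1 - y.1) * ξ.1 + (w.2 - y.2) * ξ.2)) * (a (α * ξ.1, β * ξ.2) * f y) := by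
          rw [FTinv_def]
          refine integral_congr_ae (ae_of_all _ fun ξ => ?_)
          simp only
          rw [FT_def, ← mul_assoc, ← integral_const_mul]
          refine integral_congr_ae (ae_of_all _ fun y => ?_)
          simp only
          rw [show 2 * Real.pi * ((w.1 - y.1) * ξ.1 + (w.2 - y.2) * ξ.2) = 2 * Real.pi * (w.1 * ξ.1 + w.2 * ξ.2) +
            -(2 * Real.pi * (y.1 * ξ.1 + y.2 * ξ.2)) by ring, eI_add]
          ring
      _ = _ := by
          rw [integral_integral_swap hint]
          refine integral_congr_ae (ae_of_all _ fun y => ?_)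
          simp only
          rw [FTinv_def, ← integral_mul_const]
          refine integral_congr_ae (ae_of_all _ fun ξ => ?_)
          simp only [Prod.fst_sub, Prod.snd_sub]
          ring
  rw [h1]
  have h2 := integral_sub_left_eq_self (fun y => FTinv (fun ξ => a (α * ξ.1, β * ξ.2)) y * f (w - y)) volume w
  simp only [sub_sub_cancel] at h2
  rw [h2]
  simp only [FTinv_scale hα hβ]
  have h3 := integral_scale2 (inv_pos.2 hα) (inv_pos.2 hβ) fun z => FTinv a z * f (w.1 - α * z.1, w.2 - β * z.2)
  have h4 : ∀ y : ℝ × ℝ, (((α * β)⁻¹ : ℝ) : ℂ) * FTinv a (α⁻¹ * y.1, β⁻¹ * y.2) * f (w - y) = (((α * β)⁻¹ : ℝ) : ℂ) *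
      (FTinv a (α⁻¹ * y.1, β⁻¹ * y.2) * f (w.1 - α * (α⁻¹ * y.1), w.2 - β * (β⁻¹ * y.2))) := by
    intro y
    rw [mul_inv_cancel_left₀ hα.ne', mul_inv_cancel_left₀ hβ.ne', mul_assoc]
    rfl
  simp only [h4]
  rw [integral_const_mul, h3, ← mul_assoc, ← Complex.ofReal_mul]
  have : (α * β)⁻¹ * (α⁻¹ * β⁻¹)⁻¹ = 1 := by field_simp
  rw [this]; simp

lemma FT_pc1 {k : ℝ → ℂ} (hkc : Continuous k) (hk : Integrable k) {f : ℝ × ℝ → ℂ} (hf : Nice f) (ξ : ℝ × ℝ) :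
    FT (pc1 k f) ξ = 𝓕 k ξ.1 * FT f ξ := by
  rw [fourier_slices (nice_pc1 hkc hk hf).int, fourier_slices hf.int, fourier_exp, fourier_exp _ ξ.2, ← integral_const_mul]
  have h1 : ∀ᵐ x2 : ℝ, Integrable fun x1 : ℝ => f (x1, x2) := by
    have := hf.int
    rw [Measure.volume_eq_prod] at this
    exact this.prod_left_ae
  refine integral_congr_ae (h1.mono fun x2 hx => ?_)
  simp only
  have h2 : (fun x1 => pc1 k f (x1, x2)) = cv1 k fun y => f (y, x2) := rfl
  rw [h2, fourier_cv1 hk hx]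
  ring

lemma FT_swap (f : ℝ × ℝ → ℂ) (ξ : ℝ × ℝ) : FT (fun z => f z.swap) ξ = FT f ξ.swap := by
  rw [FT_def, FT_def]
  have h := (Measure.measurePreserving_swap (μ := (volume : Measure ℝ)) (ν := (volume : Measure ℝ))).integral_comp
    MeasurableEquiv.prodComm.measurableEmbedding (fun x : ℝ × ℝ => eI (-(2 * Real.pi * (x.1 * ξ.2 + x.2 * ξ.1))) * f x)
  refine Eq.trans ?_ h
  refine integral_congr_ae (ae_of_all _ fun x => ?_)
  simp only [Prod.fst_swap, Prod.snd_swap]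
  rw [add_comm]

lemma FT_pc2 {k : ℝ → ℂ} (hkc : Continuous k) (hk : Integrable k) {f : ℝ × ℝ → ℂ} (hf : Nice f) (ξ : ℝ × ℝ) :
    FT (pc2 k f) ξ = 𝓕 k ξ.2 * FT f ξ := by
  have h1 : pc2 k f = fun z => pc1 k (fun z => f z.swap) z.swap := funext fun x => pc2_eq k f x
  rw [h1, FT_swap, FT_pc1 hkc hk hf.swap, FT_swap]
  rfl

lemma pc1_FTinv {k : ℝ → ℂ} (hk : Integrable k) {m : ℝ × ℝ → ℂ} (hm : Integrable m) (x : ℝ × ℝ) :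
    pc1 k (FTinv m) x = FTinv (fun ξ => 𝓕 k ξ.1 * m ξ) x := by
  have hint : Integrable (Function.uncurry fun (y : ℝ) (ξ : ℝ × ℝ) => eI (2 * Real.pi * (y * ξ.1 + x.2 * ξ.2)) * (k (x.1 - y) * m ξ))
      ((volume : Measure ℝ).prod volume) :=
    integrable_eI_mul (by fun_prop) ((hk.comp_sub_left x.1).mul_prod hm)
  calc pc1 k (FTinv m) x = ∫ y : ℝ, ∫ ξ : ℝ × ℝ, eI (2 * Real.pi * (y * ξ.1 + x.2 * ξ.2)) * (k (x.1 - y) * m ξ) := by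
        unfold pc1 cv1
        refine integral_congr_ae (ae_of_all _ fun y => ?_)
        simp only
        rw [FTinv_def, ← integral_const_mul]
        refine integral_congr_ae (ae_of_all _ fun ξ => ?_)
        simp only; ring
    _ = _ := by
        rw [integral_integral_swap hint, FTinv_def]
        refine integral_congr_ae (ae_of_all _ fun ξ => ?_)
        simp only
        rw [fourier_exp, ← mul_assoc, mul_right_comm, ← integral_const_mul, ← integral_sub_left_eq_self _ volume x.1]
        refine integral_congr_ae (ae_of_all _ fun t => ?_)
        simp only [sub_sub_cancel]
        rw [show 2 * Real.pi * ((x.1 - t) * ξ.1 + x.2 * ξ.2) = 2 * Real.pi * (x.1 * ξ.1 + x.2 * ξ.2) +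
            -(2 * Real.pi * (t * ξ.1)) by ring, eI_add]
        unfold eI
        ring

lemma schwartz_le_wR (f : 𝓢(ℝ, ℂ)) : ∃ A, ∀ x, ‖f x‖ ≤ A * wR x := by
  obtain ⟨A, hA⟩ : ∃ A, ∀ x, (1 + ‖x‖) ^ 4 * ‖f x‖ ≤ A := by
    have := fun x => SchwartzMap.one_add_le_sup_seminorm_apply (𝕜 := ℝ) (m := (4, 0)) (k := 4) (n := 0) le_rfl le_rfl f x
    simp only [norm_iteratedFDeriv_zero] at this
    exact ⟨_, this⟩
  refine ⟨A, fun x => ?_⟩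
  have h1 := hA x
  unfold wR
  rw [← div_eq_mul_inv, le_div_iff₀ (by positivity)]
  refine le_trans ?_ h1
  rw [mul_comm]
  refine mul_le_mul_of_nonneg_right ?_ (norm_nonneg _)
  have h2 : 1 + x ^ 2 ≤ (1 + ‖x‖) ^ 2 := by
    rw [Real.norm_eq_abs, ← sq_abs x]; nlinarith [abs_nonneg x]
  calc (1 + x ^ 2) ^ 2 ≤ ((1 + ‖x‖) ^ 2) ^ 2 := pow_le_pow_left₀ (by positivity) h2 2
    _ = _ := by ring

/-- A Littlewood-Paley kernel reproducing an annulus. -/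
lemma exists_LPk_one {lo hi : ℝ} (hlo : 0 < lo) (hlh : lo ≤ hi) : ∃ (k : ℝ → ℂ) (C : ℝ), LPk k C ∧
    ∀ η, lo ≤ |η| → |η| ≤ hi → 𝓕 k η = 1 := by
  let b1 : ContDiffBump (0 : ℝ) := ⟨hi, hi + 1, by linarith, by linarith⟩
  let b2 : ContDiffBump (0 : ℝ) := ⟨lo / 4, lo / 2, by linarith, by linarith⟩
  have hsm : ContDiff ℝ (⊤ : ℕ∞) fun x => ((b1 x - b2 x : ℝ) : ℂ) :=
    Complex.ofRealCLM.contDiff.comp (b1.contDiff.sub b2.contDiff)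
  have hcs : HasCompactSupport fun x => ((b1 x - b2 x : ℝ) : ℂ) := by
    have : HasCompactSupport fun x => b1 x - b2 x := b1.hasCompactSupport.sub b2.hasCompactSupport
    exact this.comp_left (g := fun x : ℝ => (x : ℂ)) (by simp)
  let S : 𝓢(ℝ, ℂ) := hcs.toSchwartzMap hsm
  have hS : ∀ x, S x = ((b1 x - b2 x : ℝ) : ℂ) := fun x => rfl
  let K : 𝓢(ℝ, ℂ) := 𝓕⁻ S
  have hFK : 𝓕 K = S := FourierTransform.fourier_fourierInv_eq S
  have hF : ∀ η, 𝓕 (K : ℝ → ℂ) η = ((b1 η - b2 η : ℝ) : ℂ) := by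
    intro η
    rw [← SchwartzMap.fourier_coe, hFK, hS]
  let K' : 𝓢(ℝ, ℂ) := SchwartzMap.derivCLM ℝ ℂ K
  obtain ⟨A, hA⟩ := schwartz_le_wR K
  obtain ⟨B, hB⟩ := schwartz_le_wR K'
  refine ⟨K, 20 * max A B, LPk.of_decay (k' := K') (fun x => ?_) K'.continuous
    (fun x => (hA x).trans (mul_le_mul_of_nonneg_right (le_max_left _ _) (wR_pos x).le))
    (fun x => (hB x).trans (mul_le_mul_of_nonneg_right (le_max_right _ _) (wR_pos x).le)) ?_, fun η h1 h2 => ?_⟩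
  · have := (K.differentiable x).hasDerivAt
    exact this
  · have h0 := hF 0
    rw [fourier_exp] at h0
    have e1 : b1 0 = 1 := b1.one_of_mem_closedBall (by simp [b1]; linarith)
    have e2 : b2 0 = 1 := b2.one_of_mem_closedBall (by simp [b2]; linarith)
    rw [e1, e2] at h0
    simpa using h0
  · rw [hF]
    have e1 : b1 η = 1 := b1.one_of_mem_closedBall (by simpa [b1] using h2)
    have e2 : b2 η = 0 := b2.zero_of_le_dist (by simp [b2]; linarith)
    rw [e1, e2]; simp

lemma FTinv_mul_fst {a : ℝ × ℝ → ℂ} (ha : ContDiff ℝ (⊤ : ℕ∞) a) (hc : HasCompactSupport a) (v : ℝ × ℝ) :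
    ∃ a' : ℝ × ℝ → ℂ, ContDiff ℝ (⊤ : ℕ∞) a' ∧ HasCompactSupport a' ∧
      ∀ z : ℝ × ℝ, FTinv a' z = ((z.1 * v.1 + z.2 * v.2 : ℝ) : ℂ) * FTinv a z := by
  have hd : ContDiff ℝ (⊤ : ℕ∞) fun ξ => fderiv ℝ a ξ v :=
    (ha.fderiv_right (m := (⊤ : ℕ∞)) (by simp)).clm_apply contDiff_const
  have hdc : HasCompactSupport fun ξ => fderiv ℝ a ξ v := hc.fderiv_apply (𝕜 := ℝ) v
  refine ⟨fun ξ => (-(2 * Real.pi * Complex.I)⁻¹) * fderiv ℝ a ξ v, contDiff_const.mul hd, ?_, fun z => ?_⟩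
  · exact hdc.mul_left
  have hθ : ∀ ξ : ℝ × ℝ, HasFDerivAt (fun ξ : ℝ × ℝ => eI (2 * Real.pi * (z.1 * ξ.1 + z.2 * ξ.2)))
      (ContinuousLinearMap.toSpanSingleton ℝ (eI (2 * Real.pi * (z.1 * ξ.1 + z.2 * ξ.2)) * Complex.I) ∘L
        ((2 * Real.pi) • (z.1 • ContinuousLinearMap.fst ℝ ℝ ℝ + z.2 • ContinuousLinearMap.snd ℝ ℝ ℝ))) ξ := by
    intro ξ
    have h1 : HasFDerivAt (fun ξ : ℝ × ℝ => 2 * Real.pi * (z.1 * ξ.1 + z.2 * ξ.2))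
        ((2 * Real.pi) • (z.1 • ContinuousLinearMap.fst ℝ ℝ ℝ + z.2 • ContinuousLinearMap.snd ℝ ℝ ℝ)) ξ :=
      ((hasFDerivAt_fst.const_mul z.1).add (hasFDerivAt_snd.const_mul z.2)).const_mul (2 * Real.pi)
    have h2 : HasDerivAt eI (eI (2 * Real.pi * (z.1 * ξ.1 + z.2 * ξ.2)) * Complex.I) (2 * Real.pi * (z.1 * ξ.1 + z.2 * ξ.2)) := by
      unfold eI
      have h3 := ((hasDerivAt_id (2 * Real.pi * (z.1 * ξ.1 + z.2 * ξ.2))).ofReal_comp.mul_const Complex.I).cexp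
      simpa using h3
    exact h2.hasFDerivAt.comp ξ h1
  have hic : ∀ g : ℝ × ℝ → ℂ, Continuous g → HasCompactSupport g → ∀ w : ℝ × ℝ → ℂ, Continuous w → Integrable fun ξ => w ξ * g ξ :=
    fun g hg hgc w hw => (hw.mul hg).integrable_of_hasCompactSupport hgc.mul_left
  have he : Continuous fun ξ : ℝ × ℝ => eI (2 * Real.pi * (z.1 * ξ.1 + z.2 * ξ.2)) := by fun_prop
  have hf' : ∀ ξ, fderiv ℝ (fun ξ : ℝ × ℝ => eI (2 * Real.pi * (z.1 * ξ.1 + z.2 * ξ.2))) ξ v =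
      eI (2 * Real.pi * (z.1 * ξ.1 + z.2 * ξ.2)) * ((2 * Real.pi * Complex.I) * ((z.1 * v.1 + z.2 * v.2 : ℝ) : ℂ)) := by
    intro ξ
    rw [(hθ ξ).fderiv]
    simp
    ring
  have key := integral_mul_fderiv_eq_neg_fderiv_mul_of_integrable (μ := (volume : Measure (ℝ × ℝ))) (𝕜 := ℂ)
    (f := fun ξ : ℝ × ℝ => eI (2 * Real.pi * (z.1 * ξ.1 + z.2 * ξ.2))) (g := a) (v := v)
    (by simp only [hf']; exact hic a ha.continuous hc _ (by fun_prop))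
    (hic _ hd.continuous hdc _ he) (hic a ha.continuous hc _ he) (fun x _ => (hθ x).differentiableAt)
    (fun x _ => ha.differentiable (by simp) x)
  simp only [hf'] at key
  rw [FTinv_def, FTinv_def]
  have e1 : ∀ ξ : ℝ × ℝ, eI (2 * Real.pi * (z.1 * ξ.1 + z.2 * ξ.2)) * (-(2 * Real.pi * Complex.I)⁻¹ * fderiv ℝ a ξ v) =
      -(2 * Real.pi * Complex.I)⁻¹ * (eI (2 * Real.pi * (z.1 * ξ.1 + z.2 * ξ.2)) * fderiv ℝ a ξ v) := fun ξ => by ring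
  have e2 : ∀ ξ : ℝ × ℝ, eI (2 * Real.pi * (z.1 * ξ.1 + z.2 * ξ.2)) * ((2 * Real.pi * Complex.I) * ((z.1 * v.1 + z.2 * v.2 : ℝ) : ℂ)) * a ξ =
      ((2 * Real.pi * Complex.I) * ((z.1 * v.1 + z.2 * v.2 : ℝ) : ℂ)) * (eI (2 * Real.pi * (z.1 * ξ.1 + z.2 * ξ.2)) * a ξ) := fun ξ => by ring
  simp only [e1, e2] at key ⊢
  rw [integral_const_mul] at key ⊢
  rw [key]
  have : (2 * Real.pi * Complex.I : ℂ) ≠ 0 := by simp [Real.pi_ne_zero]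
  field_simp

lemma FTinv_mul_quad {a : ℝ × ℝ → ℂ} (ha : ContDiff ℝ (⊤ : ℕ∞) a) (hc : HasCompactSupport a) (v : ℝ × ℝ) (n : ℕ) :
    ∃ a' : ℝ × ℝ → ℂ, ContDiff ℝ (⊤ : ℕ∞) a' ∧ HasCompactSupport a' ∧
      ∀ z : ℝ × ℝ, FTinv a' z = ((1 + (z.1 * v.1 + z.2 * v.2) ^ 2 : ℝ) : ℂ) ^ n * FTinv a z := by
  induction n with
  | zero => exact ⟨a, ha, hc, fun z => by simp⟩
  | succ n ih =>
    obtain ⟨a1, h1, h1c, h1e⟩ := ih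
    obtain ⟨a2, h2, h2c, h2e⟩ := FTinv_mul_fst h1 h1c v
    obtain ⟨a3, h3, h3c, h3e⟩ := FTinv_mul_fst h2 h2c v
    refine ⟨fun ξ => a1 ξ + a3 ξ, h1.add h3, h1c.add h3c, fun z => ?_⟩
    have hi : ∀ g : ℝ × ℝ → ℂ, ContDiff ℝ (⊤ : ℕ∞) g → HasCompactSupport g →
        Integrable fun ξ : ℝ × ℝ => eI (2 * Real.pi * (z.1 * ξ.1 + z.2 * ξ.2)) * g ξ := fun g hg hgc =>
      integrable_eI_mul (by fun_prop) (hg.continuous.integrable_of_hasCompactSupport hgc)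
    have : FTinv (fun ξ => a1 ξ + a3 ξ) z = FTinv a1 z + FTinv a3 z := by
      rw [FTinv_def, FTinv_def, FTinv_def, ← integral_add (hi _ h1 h1c) (hi _ h3 h3c)]
      refine integral_congr_ae (ae_of_all _ fun ξ => ?_)
      simp only; ring
    rw [this, h3e, h2e, h1e]
    push_cast
    ring

lemma FTinv_decay {a : ℝ × ℝ → ℂ} (ha : ContDiff ℝ (⊤ : ℕ∞) a) (hc : HasCompactSupport a) :
    ∃ A, ∀ z, ‖FTinv a z‖ ≤ A * (omR z.1 * omR z.2) := by
  obtain ⟨a1, h1, h1c, h1e⟩ := FTinv_mul_quad ha hc (1, 0) 4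
  obtain ⟨a2, h2, h2c, h2e⟩ := FTinv_mul_quad h1 h1c (0, 1) 4
  refine ⟨∫ ξ, ‖a2 ξ‖, fun z => ?_⟩
  have h3 : ‖FTinv a2 z‖ ≤ ∫ ξ, ‖a2 ξ‖ := by
    rw [FTinv_def]
    refine (norm_integral_le_integral_norm _).trans (le_of_eq ?_)
    simp only [norm_mul, norm_eI, one_mul]
  rw [h2e, h1e] at h3
  simp only [norm_mul, norm_pow, Complex.norm_real, mul_one, mul_zero, add_zero, zero_add, Real.norm_eq_abs] at h3
  rw [abs_of_pos (by positivity), abs_of_pos (by positivity)] at h3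
  unfold omR
  rw [← mul_inv, ← div_eq_mul_inv, le_div_iff₀ (by positivity)]
  linarith

/-- An amplitude supported away from the axes with a rapidly decaying inverse Fourier transform. -/
structure Amp (a : ℝ × ℝ → ℂ) (A lo hi : ℝ) : Prop where
  cont : Continuous a
  lo_pos : 0 < lo
  lo_le : lo ≤ hi
  bdd : ∀ ξ, ‖a ξ‖ ≤ A
  supp : ∀ ξ, a ξ ≠ 0 → lo ≤ |ξ.1| ∧ |ξ.1| ≤ hi ∧ lo ≤ |ξ.2| ∧ |ξ.2| ≤ hi
  dec : ∀ z, ‖FTinv a z‖ ≤ A * (omR z.1 * omR z.2)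

lemma Amp.nn {a : ℝ × ℝ → ℂ} {A lo hi : ℝ} (h : Amp a A lo hi) : 0 ≤ A := (norm_nonneg _).trans (h.bdd 0)

lemma Amp.compact {a : ℝ × ℝ → ℂ} {A lo hi : ℝ} (h : Amp a A lo hi) : HasCompactSupport a := by
  refine HasCompactSupport.of_support_subset_isCompact (K := Icc (-hi) hi ×ˢ Icc (-hi) hi) (isCompact_Icc.prod isCompact_Icc) fun ξ hξ => ?_
  obtain ⟨_, h2, _, h4⟩ := h.supp ξ hξ
  exact ⟨abs_le.1 h2, abs_le.1 h4⟩

lemma Amp.integrable {a : ℝ × ℝ → ℂ} {A lo hi : ℝ} (h : Amp a A lo hi) : Integrable a :=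
  h.cont.integrable_of_hasCompactSupport h.compact

/-- Fourier transform of a density on a curve. -/
def shF (φ ψ : ℝ → ℝ) (h : ℝ → ℂ) (ξ : ℝ × ℝ) : ℂ :=
  ∫ t in Icc (1/2 : ℝ) 2, eI (-(2 * Real.pi * (ξ.1 * φ t + ξ.2 * ψ t))) * h t

/-- The localized multiplier. -/
def mulF (a : ℝ × ℝ → ℂ) (φ ψ : ℝ → ℝ) (h : ℝ → ℂ) (δ r s : ℝ) (ξ : ℝ × ℝ) : ℂ :=
  a (δ * r * ξ.1, δ * s * ξ.2) * shF φ ψ h (r * ξ.1, s * ξ.2)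

/-- The operator with multiplier `mulF`. -/
def opT (a : ℝ × ℝ → ℂ) (φ ψ : ℝ → ℝ) (h : ℝ → ℂ) (δ r s : ℝ) (f : ℝ × ℝ → ℂ) : ℝ × ℝ → ℂ :=
  FTinv fun ξ => mulF a φ ψ h δ r s ξ * FT f ξ

section
variable {a : ℝ × ℝ → ℂ} {φ ψ : ℝ → ℝ} {h : ℝ → ℂ} {A lo hi H δ r s : ℝ}

lemma h_int (hm : Measurable h) (hH : ∀ t ∈ Icc (1/2 : ℝ) 2, ‖h t‖ ≤ H) : Integrable h (volume.restrict (Icc (1/2 : ℝ) 2)) := by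
  refine Measure.integrableOn_of_bounded (M := H) (by simp) hm.aestronglyMeasurable ?_
  exact (ae_restrict_iff' measurableSet_Icc).2 (ae_of_all _ hH)

lemma shF_continuous (hφ : Measurable φ) (hψ : Measurable ψ) (hi : Integrable h (volume.restrict (Icc (1/2 : ℝ) 2))) :
    Continuous (shF φ ψ h) :=
  continuous_parametric (θ := fun (ξ : ℝ × ℝ) t => -(2 * Real.pi * (ξ.1 * φ t + ξ.2 * ψ t))) (by fun_prop) (by fun_prop) hi

lemma norm_shF_le (hm : Measurable h) (hH : ∀ t ∈ Icc (1/2 : ℝ) 2, ‖h t‖ ≤ H) (ξ : ℝ × ℝ) : ‖shF φ ψ h ξ‖ ≤ 2 * H := by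
  have hH0 : 0 ≤ H := (norm_nonneg _).trans (hH 1 (by norm_num))
  have := norm_setIntegral_le_of_norm_le_const (μ := volume) (s := Icc (1/2 : ℝ) 2) (C := H)
    (f := fun t => eI (-(2 * Real.pi * (ξ.1 * φ t + ξ.2 * ψ t))) * h t) (by simp) (fun t ht => by
      rw [norm_mul, norm_eI, one_mul]; exact hH t ht)
  refine this.trans ?_
  rw [Measure.real, Real.volume_Icc, ENNReal.toReal_ofReal (by norm_num)]
  linarith

variable (ha : Amp a A lo hi) (hφ : Measurable φ) (hψ : Measurable ψ) (hm : Measurable h)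
  (hH : ∀ t ∈ Icc (1/2 : ℝ) 2, ‖h t‖ ≤ H) (hδ : 0 < δ) (hr : 0 < r) (hs : 0 < s)
include ha hφ hψ hm hH hδ hr hs

lemma mulF_continuous : Continuous (mulF a φ ψ h δ r s) := by
  have h1 := ha.cont
  have h2 := shF_continuous hφ hψ (h_int hm hH)
  unfold mulF
  fun_prop

lemma mulF_integrable : Integrable (mulF a φ ψ h δ r s) := by
  have h1 := integrable_scale2 (mul_pos hδ hr) (mul_pos hδ hs) ha.integrable
  have h2 := shF_continuous hφ hψ (h_int hm hH)
  exact h1.mul_bdd (c := 2 * H) (by fun_prop) (ae_of_all _ fun ξ => norm_shF_le hm hH _)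

lemma mulF_FT_integrable {f : ℝ × ℝ → ℂ} (hf : Integrable f) : Integrable fun ξ => mulF a φ ψ h δ r s ξ * FT f ξ :=
  (mulF_integrable ha hφ hψ hm hH hδ hr hs).mul_bdd (c := ∫ x, ‖f x‖) (FT_continuous hf).aestronglyMeasurable
    (ae_of_all _ fun ξ => norm_FT_le f ξ)

lemma opT_eq {f : ℝ × ℝ → ℂ} (hf : Integrable f) (x : ℝ × ℝ) :
    opT a φ ψ h δ r s f x = ∫ t in Icc (1/2 : ℝ) 2, h t * ∫ z : ℝ × ℝ, FTinv a z *
      f (x.1 - r * (φ t + δ * z.1), x.2 - s * (ψ t + δ * z.2)) := by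
  have h1 := integrable_scale2 (mul_pos hδ hr) (mul_pos hδ hs) ha.integrable
  have h2 : Integrable fun ξ : ℝ × ℝ => a (δ * r * ξ.1, δ * s * ξ.2) * FT f ξ :=
    h1.mul_bdd (c := ∫ x, ‖f x‖) (FT_continuous hf).aestronglyMeasurable (ae_of_all _ fun ξ => norm_FT_le f ξ)
  have hint : Integrable (Function.uncurry fun (ξ : ℝ × ℝ) (t : ℝ) =>
      eI (2 * Real.pi * ((x.1 - r * φ t) * ξ.1 + (x.2 - s * ψ t) * ξ.2)) * ((a (δ * r * ξ.1, δ * s * ξ.2) * FT f ξ) * h t))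
      ((volume : Measure (ℝ × ℝ)).prod (volume.restrict (Icc (1/2 : ℝ) 2))) :=
    integrable_eI_mul (by fun_prop) (h2.mul_prod (h_int hm hH))
  calc opT a φ ψ h δ r s f x = ∫ ξ : ℝ × ℝ, ∫ t in Icc (1/2 : ℝ) 2,
        eI (2 * Real.pi * ((x.1 - r * φ t) * ξ.1 + (x.2 - s * ψ t) * ξ.2)) * ((a (δ * r * ξ.1, δ * s * ξ.2) * FT f ξ) * h t) := by
        unfold opT
        rw [FTinv_def]
        refine integral_congr_ae (ae_of_all _ fun ξ => ?_)
        simp only [mulF, shF]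
        rw [show ∀ e a b c : ℂ, e * (a * b * c) = (e * (a * c)) * b from fun e a b c => by ring, ← integral_const_mul]
        refine integral_congr_ae (ae_of_all _ fun t => ?_)
        simp only
        rw [show 2 * Real.pi * ((x.1 - r * φ t) * ξ.1 + (x.2 - s * ψ t) * ξ.2) = 2 * Real.pi * (x.1 * ξ.1 + x.2 * ξ.2) +
            -(2 * Real.pi * (r * ξ.1 * φ t + s * ξ.2 * ψ t)) by ring, eI_add]
        ring
    _ = _ := by
        rw [integral_integral_swap hint]
        refine integral_congr_ae (ae_of_all _ fun t => ?_)
        simp only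
        have h3 := FTinv_mul_FT ha.integrable hf (mul_pos hδ hr) (mul_pos hδ hs) (x.1 - r * φ t, x.2 - s * ψ t)
        rw [FTinv_def] at h3
        simp only at h3
        have h4 : ∀ z : ℝ × ℝ, (x.1 - r * (φ t + δ * z.1), x.2 - s * (ψ t + δ * z.2)) =
            (x.1 - r * φ t - δ * r * z.1, x.2 - s * ψ t - δ * s * z.2) := fun z => by ring_nf
        simp only [h4]
        rw [← h3, ← integral_const_mul]
        refine integral_congr_ae (ae_of_all _ fun ξ => ?_)
        simp only
        ring

lemma opT_bound {f : ℝ × ℝ → ℂ} (hf : Nice f) (x : ℝ × ℝ) :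
    ‖opT a φ ψ h δ r s f x‖ₑ ≤ ENNReal.ofReal (H * A) * mA (aN φ ψ δ r s) (fun y => ‖f y‖ₑ) x := by
  have hfm : Measurable fun y => ‖f y‖ₑ := hf.sm.measurable.enorm
  have hH0 : 0 ≤ H := (norm_nonneg _).trans (hH 1 (by norm_num))
  rw [opT_eq ha hφ hψ hm hH hδ hr hs hf.int, mA_aN hφ hψ hfm]
  have hF : Measurable fun v : ℝ × ℝ => ‖f (x.1 - r * v.1, x.2 - s * v.2)‖ₑ := hfm.comp (by fun_prop)
  have hFe : ∀ t (z : ℝ × ℝ), ‖FTinv a z * f (x.1 - r * (φ t + δ * z.1), x.2 - s * (ψ t + δ * z.2))‖ₑ =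
      ‖FTinv a z‖ₑ * (fun v : ℝ × ℝ => ‖f (x.1 - r * v.1, x.2 - s * v.2)‖ₑ) (φ t + δ * z.1, ψ t + δ * z.2) := fun t z => enorm_mul _ _
  generalize (fun v : ℝ × ℝ => ‖f (x.1 - r * v.1, x.2 - s * v.2)‖ₑ) = F at hF hFe
  rw [avF, ← lintegral_const_mul _ (by fun_prop)]
  refine (enorm_integral_le_lintegral_enorm _).trans ?_
  refine setLIntegral_mono' measurableSet_Icc fun t ht => ?_
  rw [enorm_mul, ENNReal.ofReal_mul hH0, mul_assoc]
  refine mul_le_mul' ?_ ?_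
  · rw [← ofReal_norm]; exact ENNReal.ofReal_le_ofReal (hH t ht)
  refine (enorm_integral_le_lintegral_enorm _).trans ?_
  rw [Measure.volume_eq_prod]
  refine (lintegral_mono (g := fun z : ℝ × ℝ => ENNReal.ofReal A * (ENNReal.ofReal (omR z.1) * (ENNReal.ofReal (omR z.2) *
      F (φ t + δ * z.1, ψ t + δ * z.2)))) fun z => ?_).trans (le_of_eq ?_)
  · simp only
    rw [hFe, ← mul_assoc, ← mul_assoc, ← ENNReal.ofReal_mul ha.nn, ← ENNReal.ofReal_mul (mul_nonneg ha.nn (omR_pos _).le)]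
    refine mul_le_mul_left ?_ _
    rw [← ofReal_norm]
    refine ENNReal.ofReal_le_ofReal ((ha.dec z).trans (le_of_eq (by ring)))
  · rw [lintegral_const_mul _ (by fun_prop), lintegral_prod _ (by fun_prop), lint_Om _ (by fun_prop)]
    congr 1
    refine lintegral_congr fun z => ?_
    dsimp only
    rw [lintegral_const_mul _ (by fun_prop), lint_Om _ (by fun_prop)]

lemma opT_nice {f : ℝ × ℝ → ℂ} (hf : Nice f) : Nice (opT a φ ψ h δ r s f) := by
  have hfm : Measurable fun y => ‖f y‖ₑ := hf.sm.measurable.enorm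
  have hc : Continuous (opT a φ ψ h δ r s f) := FTinv_continuous (mulF_FT_integrable ha hφ hψ hm hH hδ hr hs hf.int)
  refine ⟨hc.stronglyMeasurable, ⟨hc.aestronglyMeasurable, ?_⟩, ∫ ξ, ‖mulF a φ ψ h δ r s ξ * FT f ξ‖, fun x => ?_⟩
  · refine (lintegral_mono (opT_bound ha hφ hψ hm hH hδ hr hs hf)).trans_lt ?_
    rw [lintegral_const_mul _ (mA_measurable hfm), mA_lint hfm]
    exact ENNReal.mul_lt_top ENNReal.ofReal_lt_top (ENNReal.mul_lt_top (measure_lt_top _ _) hf.int.2)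
  · unfold opT
    rw [FTinv_def]
    refine (norm_integral_le_integral_norm _).trans (le_of_eq ?_)
    simp only [norm_mul, norm_eI, one_mul]

/-- Inserting Littlewood-Paley projections. -/
lemma opT_repro {k : ℝ → ℂ} {C : ℝ} (hk : LPk k C) (hk1 : ∀ η, lo ≤ |η| → |η| ≤ hi → 𝓕 k η = 1) {f : ℝ × ℝ → ℂ} (hf : Nice f) (x : ℝ × ℝ) :
    opT a φ ψ h δ r s f x = pc1 (sc k (r * δ)) (opT a φ ψ h δ r s (pc2 (sc k (s * δ)) (pc1 (sc k (r * δ)) f))) x := by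
  have hrδ : 0 < r * δ := mul_pos hr hδ
  have hsδ : 0 < s * δ := mul_pos hs hδ
  have n1 := nice_pc1 (sc_continuous hk.continuous (r * δ)) (sc_integrable hk.int hrδ) hf
  have n2 := nice_pc2 (sc_continuous hk.continuous (s * δ)) (sc_integrable hk.int hsδ) n1
  unfold opT
  rw [pc1_FTinv (sc_integrable hk.int hrδ) (mulF_FT_integrable ha hφ hψ hm hH hδ hr hs n2.int)]
  congr 1
  funext ξ
  rw [FT_pc2 (sc_continuous hk.continuous _) (sc_integrable hk.int hsδ) n1, FT_pc1 (sc_continuous hk.continuous _) (sc_integrable hk.int hrδ) hf,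
    fourier_sc hrδ, fourier_sc hsδ]
  by_cases h0 : a (δ * r * ξ.1, δ * s * ξ.2) = 0
  · simp [mulF, h0]
  obtain ⟨h1, h2, h3, h4⟩ := ha.supp _ h0
  simp only at h1 h2 h3 h4
  rw [mul_comm r, mul_comm s, hk1 _ h1 h2, hk1 _ h3 h4]
  ring

end

/-- A family of admissible data: an amplitude, a nondegenerate curve and a density. -/
structure Dat (a : ℝ × ℝ → ℂ) (φ ψ : ℝ → ℝ) (h : ℝ → ℂ) (A lo hi H K C : ℝ) : Prop where
  amp : Amp a A lo hi
  nφ : NDeg φ K C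
  nψ : NDeg ψ K C
  hm : Measurable h
  hH : ∀ t ∈ Icc (1/2 : ℝ) 2, ‖h t‖ ≤ H

lemma Dat.Hnn {a : ℝ × ℝ → ℂ} {φ ψ : ℝ → ℝ} {h : ℝ → ℂ} {A lo hi H K C : ℝ} (D : Dat a φ ψ h A lo hi H K C) : 0 ≤ H :=
  (norm_nonneg _).trans (D.hH 1 (by norm_num))

lemma iSup_rpow_le {ι : Sort*} {u : ι → ℝ≥0∞} {p : ℝ} (hp : 0 < p) {b : ℝ≥0∞} (h : ∀ n, u n ^ p ≤ b) : (⨆ n, u n) ^ p ≤ b := by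
  rw [← ENNReal.le_rpow_inv_iff hp]
  exact iSup_le fun n => (ENNReal.le_rpow_inv_iff hp).2 (h n)

section
variable {ι κ : Type*} [Fintype ι] [Fintype κ] {r : ι → ℝ} {s : ι × κ → ℝ} {L : ℝ}
variable {a : ℝ × ℝ → ℂ} {φ ψ : ℝ → ℝ} {h : ℝ → ℂ} {A lo hi H K C : ℝ}

lemma max_opT_pk (D : Dat a φ ψ h A lo hi H K C) (hl : Lac2 r s L) {k : ℝ → ℂ} {Ck : ℝ} (hk : LPk k Ck)
    (hk1 : ∀ η, lo ≤ |η| → |η| ≤ hi → 𝓕 k η = 1) {l : ℕ} (hl1 : 1 ≤ l) (m : ℕ) {f : ℝ × ℝ → ℂ} (hf : Nice f) :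
    ∫⁻ x, (⨆ n : κ, ‖∑ i : ι, opT a φ ψ h (2⁻¹ ^ l) (r i) (s (i, n)) f x‖ₑ) ^ pk m ≤
      ENNReal.ofReal ((960 * (Ck * L + 1) * 2 ^ (m + 1)) ^ 3 * (H * A) * (bootC K C L * 4 ^ m * (l : ℝ) ^ 2)) ^ pk m *
        ∫⁻ x, ‖f x‖ₑ ^ pk m := by
  set p := pk m with hpdef
  have hp1 : 1 < p := one_lt_pk m
  have hp := pk_case m
  have hp0 : 0 ≤ p := by linarith
  have hCk := hk.pos
  have hL := hl.nn
  set δ : ℝ := 2⁻¹ ^ l with hδdef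
  have hδ : 0 < δ := by positivity
  have hsc := hl.scale (a := δ) (b := δ) hδ hδ
  set X : ℝ := 960 * (Ck * L + 1) / (p - 1) with hX
  have hX0 : 0 ≤ X := div_nonneg (by positivity) (by linarith)
  have hXle : X ≤ 960 * (Ck * L + 1) * 2 ^ (m + 1) := by
    rw [hX, div_eq_mul_inv, hpdef, inv_pk_sub]
    exact mul_le_mul_of_nonneg_left (by linarith) (by positivity)
  set B : ℝ := bootC K C L * 4 ^ m * (l : ℝ) ^ 2 with hB
  have hHA : 0 ≤ H * A := mul_nonneg D.Hnn D.amp.nn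
  -- the projected inputs
  let g : ι × κ → ℝ × ℝ → ℂ := fun d => pc2 (sc k (s d * δ)) (pc1 (sc k (r d.1 * δ)) f)
  have gn : ∀ d, Nice (g d) := fun d => nice_pc2 (sc_continuous hk.continuous _) (sc_integrable hk.int (hsc.pos d))
    (nice_pc1 (sc_continuous hk.continuous _) (sc_integrable hk.int (hsc.one.pos d.1)) hf)
  let G : ι × κ → ℝ × ℝ → ℂ := fun d => opT a φ ψ h δ (r d.1) (s d) (g d)
  have Gn : ∀ d, Nice (G d) := fun d => opT_nice D.amp D.nφ.meas D.nψ.meas D.hm D.hH hδ (hl.one.pos _) (hl.pos d) (gn d)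
  have hsum : ∀ x n, ∑ i : ι, opT a φ ψ h δ (r i) (s (i, n)) f x =
      ∑ d : ι × κ, if d.2 = n then pc1 (sc k (r d.1 * δ)) (G d) x else 0 := by
    intro x n
    rw [Fintype.sum_prod_type]
    refine Finset.sum_congr rfl fun i _ => ?_
    rw [Finset.sum_ite_eq' Finset.univ n]
    simp only [Finset.mem_univ, if_true]
    exact opT_repro D.amp D.nφ.meas D.nψ.meas D.hm D.hH hδ (hl.one.pos _) (hl.pos _) hk hk1 hf x
  have s1 := lp_pc1 hk hL (LPsys.recomb (o := fun d : ι × κ => d.2) (s := fun d => r d.1 * δ) (fun d => hsc.one.pos d.1) fun n => by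
      have := hsc.one.comp (f := fun d : {d : ι × κ // d.2 = n} => d.1.1) (by
        rintro ⟨⟨a, b⟩, rfl⟩ ⟨⟨c, d⟩, hd⟩ hh
        simp at hd hh; subst hd hh; rfl)
      convert this using 2) (f := G) Gn hp
  have s2 : ∫⁻ x, (∑ d, ‖G d x‖ₑ ^ 2) ^ (p / 2) ≤ ENNReal.ofReal (H * A) ^ p *
      ∫⁻ x, (∑ d : ι × κ, mA (aN φ ψ δ (r d.1) (s d)) (fun y => ‖g d y‖ₑ) x ^ 2) ^ (p / 2) := by
    rw [← lintegral_const_mul' _ _ (ENNReal.rpow_ne_top_of_nonneg hp0 ENNReal.ofReal_ne_top)]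
    refine lintegral_mono fun x => ?_
    have e : ENNReal.ofReal (H * A) ^ p = (ENNReal.ofReal (H * A) ^ 2) ^ (p / 2) := by
      rw [← ENNReal.rpow_natCast, ← ENNReal.rpow_mul]; congr 1; push_cast; ring
    rw [e, ← ENNReal.mul_rpow_of_nonneg _ _ (by linarith), Finset.mul_sum]
    refine ENNReal.rpow_le_rpow (Finset.sum_le_sum fun d _ => ?_) (by linarith)
    rw [← mul_pow]
    exact pow_le_pow_left' (opT_bound D.amp D.nφ.meas D.nψ.meas D.hm D.hH hδ (hl.one.pos _) (hl.pos d) (gn d) x) 2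
  have s3 := VP_pk hl D.nφ D.nψ hl1 m (fun d y => ‖g d y‖ₑ) (fun d => (gn d).sm.measurable.enorm) (fun d x => enorm_ne_top)
  have s4 := lp_two_param hsc hk hf hp
  calc _ ≤ ∫⁻ x, (∑ n, ‖∑ d : ι × κ, if d.2 = n then pc1 (sc k (r d.1 * δ)) (G d) x else 0‖ₑ ^ 2) ^ (p / 2) := by
        refine lintegral_mono fun x => ?_
        simp only [hsum]
        have e : ∀ z : ℝ≥0∞, z ^ p = (z ^ 2) ^ (p / 2) := fun z => by
          rw [← ENNReal.rpow_natCast, ← ENNReal.rpow_mul]; congr 1; push_cast; ring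
        refine iSup_rpow_le (by linarith) fun n => ?_
        rw [e]
        refine ENNReal.rpow_le_rpow ?_ (by linarith)
        exact Finset.single_le_sum (f := fun n => ‖∑ d : ι × κ, if d.2 = n then pc1 (sc k (r d.1 * δ)) (G d) x else 0‖ₑ ^ 2) (fun _ _ => zero_le) (Finset.mem_univ n)
    _ ≤ ENNReal.ofReal X ^ p * (ENNReal.ofReal (H * A) ^ p * (ENNReal.ofReal B ^ p * (ENNReal.ofReal (X ^ 2) ^ p * ∫⁻ x, ‖f x‖ₑ ^ p))) := by
        refine s1.trans (mul_le_mul_right (s2.trans (mul_le_mul_right (s3.trans (mul_le_mul_right s4 _)) _)) _)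
    _ ≤ _ := by
        rw [← mul_assoc, ← mul_assoc, ← mul_assoc, ← ENNReal.mul_rpow_of_nonneg _ _ hp0, ← ENNReal.mul_rpow_of_nonneg _ _ hp0,
          ← ENNReal.mul_rpow_of_nonneg _ _ hp0, ← ENNReal.ofReal_mul hX0, ← ENNReal.ofReal_mul (by positivity)]
        refine mul_le_mul_left (ENNReal.rpow_le_rpow ?_ hp0) _
        rw [mul_comm, ← ENNReal.ofReal_mul (by positivity)]
        by_cases hB0 : 0 ≤ B
        · refine ENNReal.ofReal_le_ofReal ?_
          calc X ^ 2 * (X * (H * A) * B) = X ^ 3 * (H * A) * B := by ring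
            _ ≤ _ := mul_le_mul_of_nonneg_right (mul_le_mul_of_nonneg_right (pow_le_pow_left₀ hX0 hXle 3) hHA) hB0
        · rw [ENNReal.ofReal_of_nonpos]; · exact zero_le
          have : X ^ 2 * (X * (H * A) * B) = (X ^ 3 * (H * A)) * B := by ring
          rw [this]
          exact mul_nonpos_of_nonneg_of_nonpos (by positivity) (not_le.1 hB0).le
end

/-- Van der Corput's lemma for phases with a lower bound on the second derivative. -/
lemma vdc_pos {α β lam H : ℝ} (hαβ : α ≤ β) (hβ1 : β - α ≤ 2) (hl : 0 < lam) {θ θ1 θ2 : ℝ → ℝ} {h h1 : ℝ → ℂ}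
    (hθ : ∀ t ∈ Icc α β, HasDerivAt θ (θ1 t) t) (hθ1 : ∀ t ∈ Icc α β, HasDerivAt θ1 (θ2 t) t)
    (hc2 : ContinuousOn θ2 (Icc α β)) (hlow : ∀ t ∈ Icc α β, lam ≤ θ2 t)
    (hh : ∀ t ∈ Icc α β, HasDerivAt h (h1 t) t) (hch : ContinuousOn h1 (Icc α β))
    (hH : ∀ t ∈ Icc α β, ‖h t‖ ≤ H) (hH1 : ∀ t ∈ Icc α β, ‖h1 t‖ ≤ H) :
    ‖∫ t in α..β, eI (θ t) * h t‖ ≤ 10 * H / √lam := by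
  have hH0 : 0 ≤ H := (norm_nonneg _).trans (hH α (left_mem_Icc.2 hαβ))
  have hs : 0 < √lam := Real.sqrt_pos.2 hl
  have hss : √lam * √lam = lam := Real.mul_self_sqrt hl.le
  have hu : uIcc α β = Icc α β := uIcc_of_le hαβ
  have cθ : ContinuousOn θ (Icc α β) := fun t ht => (hθ t ht).continuousAt.continuousWithinAt
  have cθ1 : ContinuousOn θ1 (Icc α β) := fun t ht => (hθ1 t ht).continuousAt.continuousWithinAt
  have ch : ContinuousOn h (Icc α β) := fun t ht => (hh t ht).continuousAt.continuousWithinAt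
  have hD : ∀ t, 0 < lam + θ1 t ^ 2 := fun t => by positivity
  have hDn : ∀ t, lam + θ1 t ^ 2 ≠ 0 := fun t => (hD t).ne'
  have hDc : ∀ t, ((lam + θ1 t ^ 2 : ℝ) : ℂ) ≠ 0 := fun t => by exact_mod_cast hDn t
  let w : ℝ → ℝ := fun t => θ1 t / (lam + θ1 t ^ 2)
  let w1 : ℝ → ℝ := fun t => (θ2 t * (lam + θ1 t ^ 2) - θ1 t * (2 * θ1 t * θ2 t)) / (lam + θ1 t ^ 2) ^ 2
  have hw : ∀ t ∈ Icc α β, HasDerivAt w (w1 t) t := by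
    intro t ht
    have h2 := (hθ1 t ht).div (((hθ1 t ht).pow 2).const_add lam) (hDn t)
    refine HasDerivAt.congr_deriv (f := w) h2 ?_
    simp only [w1]
    norm_num
  have hwb : ∀ t, |w t| ≤ 1 / (2 * √lam) := by
    intro t
    simp only [w]
    rw [abs_div, abs_of_pos (hD t), div_le_div_iff₀ (hD t) (by positivity)]
    have := sq_nonneg (√lam - |θ1 t|)
    have e : |θ1 t| ^ 2 = θ1 t ^ 2 := sq_abs _
    nlinarith
  have hw1b : ∀ t ∈ Icc α β, |w1 t| ≤ θ2 t / (lam + θ1 t ^ 2) := by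
    intro t ht
    have h2 : 0 < θ2 t := hl.trans_le (hlow t ht)
    simp only [w1]
    rw [abs_div, abs_of_pos (pow_pos (hD t) 2), div_le_div_iff₀ (pow_pos (hD t) 2) (hD t)]
    have e : θ2 t * (lam + θ1 t ^ 2) - θ1 t * (2 * θ1 t * θ2 t) = θ2 t * (lam - θ1 t ^ 2) := by ring
    have h3 : |lam - θ1 t ^ 2| ≤ lam + θ1 t ^ 2 := by
      rw [abs_le]; constructor <;> nlinarith [sq_nonneg (θ1 t)]
    rw [e, abs_mul, abs_of_pos h2]
    calc θ2 t * |lam - θ1 t ^ 2| * (lam + θ1 t ^ 2) ≤ θ2 t * (lam + θ1 t ^ 2) * (lam + θ1 t ^ 2) :=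
          mul_le_mul_of_nonneg_right (mul_le_mul_of_nonneg_left h3 h2.le) (hD t).le
      _ = _ := by ring
  -- the arctangent primitive
  let q : ℝ → ℝ := fun t => θ2 t / (lam + θ1 t ^ 2)
  have cq : ContinuousOn q (Icc α β) := hc2.div (continuousOn_const.add (cθ1.pow 2)) fun t _ => hDn t
  have hq : ∀ t ∈ Icc α β, HasDerivAt (fun t => Real.arctan (θ1 t / √lam) / √lam) (q t) t := by
    intro t ht
    have h2 := (((hθ1 t ht).div_const (√lam)).arctan).div_const (√lam)
    refine h2.congr_deriv ?_
    simp only [q]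
    have e : 1 + (θ1 t / √lam) ^ 2 = (lam + θ1 t ^ 2) / lam := by
      rw [div_pow, sq (√lam), hss]; field_simp
    rw [e]
    have := hDn t
    field_simp
    rw [show √lam ^ 2 = lam by rw [sq, hss]]
    ring
  have iq : ∫ t in α..β, q t ≤ 4 / √lam := by
    rw [intervalIntegral.integral_eq_sub_of_hasDerivAt (by rw [hu]; exact hq) (ContinuousOn.intervalIntegrable (by rwa [hu]))]
    rw [← sub_div]
    refine div_le_div_of_nonneg_right ?_ hs.le
    have a1 := Real.arctan_lt_pi_div_two (θ1 β / √lam)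
    have a2 := Real.neg_pi_div_two_lt_arctan (θ1 α / √lam)
    have := Real.pi_lt_four
    linarith
  -- integration by parts
  let F : ℝ → ℂ := fun t => eI (θ t) * (h t * (w t : ℂ))
  let R : ℝ → ℂ := fun t => eI (θ t) * (h1 t * (w t : ℂ) + h t * (w1 t : ℂ)) - Complex.I * (eI (θ t) * (h t * ((lam / (lam + θ1 t ^ 2) : ℝ) : ℂ)))
  have hF : ∀ t ∈ Icc α β, HasDerivAt F (Complex.I * (eI (θ t) * h t) + R t) t := by
    intro t ht
    have h3 : HasDerivAt (fun t => eI (θ t)) (eI (θ t) * ((θ1 t : ℂ) * Complex.I)) t := by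
      unfold eI
      exact ((hθ t ht).ofReal_comp.mul_const Complex.I).cexp
    have h4 : HasDerivAt (fun t => h t * (w t : ℂ)) (h1 t * (w t : ℂ) + h t * (w1 t : ℂ)) t := (hh t ht).mul (hw t ht).ofReal_comp
    have h5 : HasDerivAt F (eI (θ t) * ((θ1 t : ℂ) * Complex.I) * (h t * (w t : ℂ)) + eI (θ t) * (h1 t * (w t : ℂ) + h t * (w1 t : ℂ))) t := h3.mul h4
    refine h5.congr_deriv ?_
    simp only [R]
    generalize (w1 t : ℂ) = W1
    simp only [w]
    have := hDc t
    push_cast at this ⊢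
    field_simp
    ring
  have cw : ContinuousOn w (Icc α β) := fun t ht => (hw t ht).continuousAt.continuousWithinAt
  have cw1 : ContinuousOn w1 (Icc α β) :=
    ((hc2.mul (continuousOn_const.add (cθ1.pow 2))).sub (cθ1.mul ((continuousOn_const.mul cθ1).mul hc2))).div
      ((continuousOn_const.add (cθ1.pow 2)).pow 2) fun t _ => pow_ne_zero 2 (hDn t)
  have ce : ContinuousOn (fun t => eI (θ t)) (Icc α β) := eI_continuous.comp_continuousOn cθ
  have cof : ∀ {g : ℝ → ℝ}, ContinuousOn g (Icc α β) → ContinuousOn (fun t => (g t : ℂ)) (Icc α β) := fun hg =>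
    Complex.continuous_ofReal.comp_continuousOn hg
  have cR : ContinuousOn R (Icc α β) := by
    refine (ce.mul ((hch.mul (cof cw)).add (ch.mul (cof cw1)))).sub (continuousOn_const.mul (ce.mul (ch.mul (cof ?_))))
    exact continuousOn_const.div (continuousOn_const.add (cθ1.pow 2)) fun t _ => hDn t
  have cE : ContinuousOn (fun t => eI (θ t) * h t) (Icc α β) := ce.mul ch
  have iE : IntervalIntegrable (fun t => Complex.I * (eI (θ t) * h t)) volume α β :=
    ContinuousOn.intervalIntegrable (by rw [hu]; exact continuousOn_const.mul cE)
  have iR : IntervalIntegrable R volume α β := ContinuousOn.intervalIntegrable (by rwa [hu])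
  have key := intervalIntegral.integral_eq_sub_of_hasDerivAt (by rw [hu]; exact hF) (iE.add iR)
  rw [intervalIntegral.integral_add iE iR, intervalIntegral.integral_const_mul] at key
  have hRb : ∀ t ∈ Icc α β, ‖R t‖ ≤ H / (2 * √lam) + 2 * H * q t := by
    intro t ht
    have b1 : ‖h1 t * (w t : ℂ)‖ ≤ H * (1 / (2 * √lam)) := by
      rw [norm_mul, Complex.norm_real]
      exact mul_le_mul (hH1 t ht) (hwb t) (norm_nonneg _) hH0
    have b2 : ‖h t * (w1 t : ℂ)‖ ≤ H * q t := by
      rw [norm_mul, Complex.norm_real]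
      exact mul_le_mul (hH t ht) (hw1b t ht) (norm_nonneg _) hH0
    have b3 : ‖h t * ((lam / (lam + θ1 t ^ 2) : ℝ) : ℂ)‖ ≤ H * q t := by
      rw [norm_mul, Complex.norm_real, Real.norm_of_nonneg (div_nonneg hl.le (hD t).le)]
      exact mul_le_mul (hH t ht) (div_le_div_of_nonneg_right (hlow t ht) (hD t).le) (div_nonneg hl.le (hD t).le) hH0
    calc ‖R t‖ ≤ ‖h1 t * (w t : ℂ) + h t * (w1 t : ℂ)‖ + ‖h t * ((lam / (lam + θ1 t ^ 2) : ℝ) : ℂ)‖ := by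
          refine (norm_sub_le _ _).trans (le_of_eq ?_)
          rw [norm_mul, norm_eI, one_mul, norm_mul, Complex.norm_I, one_mul, norm_mul, norm_eI, one_mul]
      _ ≤ (H * (1 / (2 * √lam)) + H * q t) + H * q t := add_le_add ((norm_add_le _ _).trans (add_le_add b1 b2)) b3
      _ = _ := by ring
  have hRi : ‖∫ t in α..β, R t‖ ≤ H / √lam + 2 * H * (4 / √lam) := by
    have iq' : IntervalIntegrable q volume α β := ContinuousOn.intervalIntegrable (by rwa [hu])
    refine (intervalIntegral.norm_integral_le_of_norm_le hαβ (ae_of_all _ fun t ht => hRb t (Ioc_subset_Icc_self ht))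
      (intervalIntegrable_const.add (iq'.const_mul _))).trans ?_
    rw [intervalIntegral.integral_add intervalIntegrable_const (iq'.const_mul _), intervalIntegral.integral_const,
      intervalIntegral.integral_const_mul, smul_eq_mul]
    refine add_le_add ?_ (mul_le_mul_of_nonneg_left iq (by positivity))
    calc (β - α) * (H / (2 * √lam)) ≤ 2 * (H / (2 * √lam)) := mul_le_mul_of_nonneg_right hβ1 (by positivity)
      _ = _ := by field_simp
  have hFb : ∀ t ∈ Icc α β, ‖F t‖ ≤ H / (2 * √lam) := by
    intro t ht
    simp only [F]
    rw [norm_mul, norm_eI, one_mul, norm_mul, Complex.norm_real]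
    calc ‖h t‖ * ‖w t‖ ≤ H * (1 / (2 * √lam)) := mul_le_mul (hH t ht) (hwb t) (norm_nonneg _) hH0
      _ = _ := by ring
  have e : ‖∫ t in α..β, eI (θ t) * h t‖ = ‖F β - F α - ∫ t in α..β, R t‖ := by
    rw [← key, add_sub_cancel_right, norm_mul, Complex.norm_I, one_mul]
  rw [e]
  refine (norm_sub_le _ _).trans ((add_le_add ((norm_sub_le _ _).trans (add_le_add (hFb β (right_mem_Icc.2 hαβ)) (hFb α (left_mem_Icc.2 hαβ)))) hRi).trans (le_of_eq ?_))
  field_simp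
  ring

lemma conj_eI (t : ℝ) : (starRingEnd ℂ) (eI t) = eI (-t) := by
  unfold eI
  rw [← Complex.exp_conj]
  simp

lemma vdc_neg {α β lam H : ℝ} (hαβ : α ≤ β) (hβ1 : β - α ≤ 2) (hl : 0 < lam) {θ θ1 θ2 : ℝ → ℝ} {h h1 : ℝ → ℂ}
    (hθ : ∀ t ∈ Icc α β, HasDerivAt θ (θ1 t) t) (hθ1 : ∀ t ∈ Icc α β, HasDerivAt θ1 (θ2 t) t)
    (hc2 : ContinuousOn θ2 (Icc α β)) (hlow : ∀ t ∈ Icc α β, lam ≤ -θ2 t)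
    (hh : ∀ t ∈ Icc α β, HasDerivAt h (h1 t) t) (hch : ContinuousOn h1 (Icc α β))
    (hH : ∀ t ∈ Icc α β, ‖h t‖ ≤ H) (hH1 : ∀ t ∈ Icc α β, ‖h1 t‖ ≤ H) :
    ‖∫ t in α..β, eI (θ t) * h t‖ ≤ 10 * H / √lam := by
  have key := vdc_pos hαβ hβ1 hl (θ := fun t => -θ t) (θ1 := fun t => -θ1 t) (θ2 := fun t => -θ2 t)
    (h := fun t => (starRingEnd ℂ) (h t)) (h1 := fun t => (starRingEnd ℂ) (h1 t)) (fun t ht => (hθ t ht).neg) (fun t ht => (hθ1 t ht).neg)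
    hc2.neg hlow (fun t ht => (hh t ht).star) (Complex.continuous_conj.comp_continuousOn hch)
    (fun t ht => by rw [RCLike.norm_conj]; exact hH t ht) (fun t ht => by rw [RCLike.norm_conj]; exact hH1 t ht)
  simp only [← conj_eI, ← map_mul] at key
  rw [intervalIntegral.integral_of_le hαβ] at key ⊢
  rw [integral_conj, RCLike.norm_conj] at key
  exact key

section
variable {ι κ : Type*} [Fintype ι] [Fintype κ] {r : ι → ℝ} {s : ι × κ → ℝ} {L : ℝ}
variable {a : ℝ × ℝ → ℂ} {φ ψ : ℝ → ℝ} {h : ℝ → ℂ} {A lo hi H K C V : ℝ}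

lemma one_le_lac {lo hi x : ℝ} (hlo : 0 < lo) (h1 : lo ≤ x) (h2 : x ≤ hi) : 1 ≤ max lo⁻¹ hi * min x x⁻¹ := by
  have hx : 0 < x := hlo.trans_le h1
  have hc : 0 < max lo⁻¹ hi := lt_max_of_lt_left (inv_pos.2 hlo)
  rcases min_choice x x⁻¹ with e | e <;> rw [e]
  · calc (1 : ℝ) = lo⁻¹ * lo := (inv_mul_cancel₀ hlo.ne').symm
      _ ≤ max lo⁻¹ hi * x := mul_le_mul (le_max_left _ _) h1 hlo.le hc.le
  · rw [← div_eq_mul_inv, le_div_iff₀ hx, one_mul]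
    exact h2.trans (le_max_right _ _)

lemma sum_mulF_le (D : Dat a φ ψ h A lo hi H K C) (hl : Lac2 r s L) (hV : 0 ≤ V) (hv : ∀ ξ, ‖shF φ ψ h ξ‖ ^ 2 * |ξ.2| ≤ V ^ 2)
    {δ : ℝ} (hδ : 0 < δ) (ξ : ℝ × ℝ) :
    ∑ n, ∑ i, ‖mulF a φ ψ h δ (r i) (s (i, n)) ξ‖ ≤ A * V * √(δ / lo) * (max lo⁻¹ hi ^ 2 * L ^ 2) := by
  have hlo := D.amp.lo_pos
  have hA := D.amp.nn
  have hL := hl.nn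
  set c := max lo⁻¹ hi with hc
  set M : ℝ := A * V * √(δ / lo) with hM
  have hM0 : 0 ≤ M := by positivity
  have hsupp : ∀ i n, a (δ * r i * ξ.1, δ * s (i, n) * ξ.2) ≠ 0 →
      lo ≤ (δ * |ξ.1|) * r i ∧ (δ * |ξ.1|) * r i ≤ hi ∧ lo ≤ (δ * |ξ.2|) * s (i, n) ∧ (δ * |ξ.2|) * s (i, n) ≤ hi := by
    intro i n ha
    have := D.amp.supp _ ha
    simp only [abs_mul, abs_of_pos hδ, abs_of_pos (hl.one.pos i), abs_of_pos (hl.pos (i, n))] at this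
    rw [mul_right_comm δ (r i), mul_right_comm δ (s (i, n))] at this
    exact this
  by_cases h1 : ξ.1 = 0 ∨ ξ.2 = 0
  · have : ∀ n i, ‖mulF a φ ψ h δ (r i) (s (i, n)) ξ‖ = 0 := by
      intro n i
      have : a (δ * r i * ξ.1, δ * s (i, n) * ξ.2) = 0 := by
        by_contra hne
        obtain ⟨g1, _, g2, _⟩ := hsupp i n hne
        rcases h1 with e | e
        · rw [e] at g1; simp at g1; linarith
        · rw [e] at g2; simp at g2; linarith
      unfold mulF
      rw [this]; simp
    simp only [this, Finset.sum_const_zero]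
    positivity
  push Not at h1
  have hx1 : 0 < δ * |ξ.1| := mul_pos hδ (abs_pos.2 h1.1)
  have hx2 : 0 < δ * |ξ.2| := mul_pos hδ (abs_pos.2 h1.2)
  have hpt : ∀ n i, ‖mulF a φ ψ h δ (r i) (s (i, n)) ξ‖ ≤ M * (c ^ 2 * (min ((δ * |ξ.1|) * r i) ((δ * |ξ.1|) * r i)⁻¹ *
      min ((δ * |ξ.2|) * s (i, n)) ((δ * |ξ.2|) * s (i, n))⁻¹)) := by
    intro n i
    have hr := hl.one.pos i
    have hs := hl.pos (i, n)
    by_cases ha : a (δ * r i * ξ.1, δ * s (i, n) * ξ.2) = 0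
    · unfold mulF
      rw [ha, zero_mul, norm_zero]
      positivity
    obtain ⟨g1, g2, g3, g4⟩ := hsupp i n ha
    have e1 := one_le_lac hlo g1 g2
    have e2 := one_le_lac hlo g3 g4
    have e3 : ‖shF φ ψ h (r i * ξ.1, s (i, n) * ξ.2)‖ ≤ V * √(δ / lo) := by
      have h3 := hv (r i * ξ.1, s (i, n) * ξ.2)
      simp only [abs_mul, abs_of_pos hs] at h3
      have h4 : lo / δ ≤ s (i, n) * |ξ.2| := by
        rw [div_le_iff₀ hδ]; linarith
      refine abs_le_of_sq_le_sq' ?_ (by positivity) |>.2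
      rw [mul_pow, Real.sq_sqrt (by positivity)]
      have h5 := (mul_le_mul_of_nonneg_left h4 (sq_nonneg ‖shF φ ψ h (r i * ξ.1, s (i, n) * ξ.2)‖)).trans h3
      calc ‖shF φ ψ h (r i * ξ.1, s (i, n) * ξ.2)‖ ^ 2 = (‖shF φ ψ h (r i * ξ.1, s (i, n) * ξ.2)‖ ^ 2 * (lo / δ)) * (δ / lo) := by
            field_simp
        _ ≤ _ := mul_le_mul_of_nonneg_right h5 (by positivity)
    calc ‖mulF a φ ψ h δ (r i) (s (i, n)) ξ‖ ≤ A * (V * √(δ / lo)) := by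
          unfold mulF
          rw [norm_mul]
          exact mul_le_mul (D.amp.bdd _) e3 (norm_nonneg _) hA
      _ = M * (1 * 1) := by rw [hM]; ring
      _ ≤ M * ((c * min ((δ * |ξ.1|) * r i) ((δ * |ξ.1|) * r i)⁻¹) * (c * min ((δ * |ξ.2|) * s (i, n)) ((δ * |ξ.2|) * s (i, n))⁻¹)) :=
          mul_le_mul_of_nonneg_left (mul_le_mul e1 e2 zero_le_one (by linarith)) hM0
      _ = _ := by ring
  calc ∑ n, ∑ i, ‖mulF a φ ψ h δ (r i) (s (i, n)) ξ‖ ≤ ∑ n, ∑ i, M * (c ^ 2 * (min ((δ * |ξ.1|) * r i) ((δ * |ξ.1|) * r i)⁻¹ *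
      min ((δ * |ξ.2|) * s (i, n)) ((δ * |ξ.2|) * s (i, n))⁻¹)) := Finset.sum_le_sum fun n _ => Finset.sum_le_sum fun i _ => hpt n i
    _ = M * (c ^ 2 * ∑ i, min ((δ * |ξ.1|) * r i) ((δ * |ξ.1|) * r i)⁻¹ *
          ∑ n, min ((δ * |ξ.2|) * s (i, n)) ((δ * |ξ.2|) * s (i, n))⁻¹) := by
        rw [Finset.sum_comm]
        simp only [Finset.mul_sum]
    _ ≤ M * (c ^ 2 * ∑ i, min ((δ * |ξ.1|) * r i) ((δ * |ξ.1|) * r i)⁻¹ * L) := by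
        refine mul_le_mul_of_nonneg_left (mul_le_mul_of_nonneg_left (Finset.sum_le_sum fun i _ => ?_) (by positivity)) hM0
        have hr := hl.one.pos i
        exact mul_le_mul_of_nonneg_left ((hl.two i).sum _ hx2) (by positivity)
    _ ≤ M * (c ^ 2 * (L * L)) := by
        rw [← Finset.sum_mul]
        exact mul_le_mul_of_nonneg_left (mul_le_mul_of_nonneg_left (mul_le_mul_of_nonneg_right (hl.one.sum _ hx1) hL) (by positivity)) hM0
    _ = _ := by ring

lemma max_opT_two (D : Dat a φ ψ h A lo hi H K C) (hl : Lac2 r s L) (hV : 0 ≤ V) (hv : ∀ ξ, ‖shF φ ψ h ξ‖ ^ 2 * |ξ.2| ≤ V ^ 2)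
    {δ : ℝ} (hδ : 0 < δ) {f : ℝ × ℝ → ℂ} (hf : Nice f) :
    ∫⁻ x, (⨆ n : κ, ‖∑ i : ι, opT a φ ψ h δ (r i) (s (i, n)) f x‖ₑ) ^ 2 ≤
      ENNReal.ofReal (A * V * √(δ / lo) * (max lo⁻¹ hi ^ 2 * L ^ 2)) ^ 2 * ∫⁻ x, ‖f x‖ₑ ^ 2 := by
  have mi : ∀ n i, Integrable fun ξ => mulF a φ ψ h δ (r i) (s (i, n)) ξ * FT f ξ := fun n i =>
    mulF_FT_integrable D.amp D.nφ.meas D.nψ.meas D.hm D.hH hδ (hl.one.pos i) (hl.pos (i, n)) hf.int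
  have mc : ∀ n i, Continuous (mulF a φ ψ h δ (r i) (s (i, n))) := fun n i =>
    mulF_continuous D.amp D.nφ.meas D.nψ.meas D.hm D.hH hδ (hl.one.pos i) (hl.pos (i, n))
  let m : κ → ℝ × ℝ → ℂ := fun n ξ => ∑ i, mulF a φ ψ h δ (r i) (s (i, n)) ξ
  set E : ℝ := A * V * √(δ / lo) * (max lo⁻¹ hi ^ 2 * L ^ 2) with hE
  have hsum := sum_mulF_le D hl hV hv hδ
  have hE0 : 0 ≤ E := (Finset.sum_nonneg fun n _ => Finset.sum_nonneg fun i _ => norm_nonneg _).trans (hsum 0)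
  have hm1 : ∀ ξ, ∑ n, ‖m n ξ‖ ≤ E := fun ξ => (Finset.sum_le_sum fun n _ => norm_sum_le _ _).trans (hsum ξ)
  have hmn : ∀ n ξ, ‖m n ξ‖ ≤ E := fun n ξ =>
    (Finset.single_le_sum (f := fun n => ‖m n ξ‖) (fun _ _ => norm_nonneg _) (Finset.mem_univ n)).trans (hm1 ξ)
  have cF : Continuous (FT f) := FT_continuous hf.int
  have cm : ∀ n, Continuous (m n) := fun n => continuous_finset_sum _ fun i _ => mc n i
  have im : ∀ n, Integrable fun ξ => m n ξ * FT f ξ := by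
    intro n
    simp only [m, Finset.sum_mul]
    exact integrable_finsetSum _ fun i _ => mi n i
  have eT : ∀ n x, ∑ i, opT a φ ψ h δ (r i) (s (i, n)) f x = FTinv (fun ξ => m n ξ * FT f ξ) x := by
    intro n x
    unfold opT
    simp only [FTinv_def, m, Finset.sum_mul, Finset.mul_sum]
    rw [integral_finsetSum]
    intro i _
    exact integrable_eI_mul (by fun_prop) (mi n i)
  have hb : ∀ n ξ, ‖m n ξ * FT f ξ‖ ≤ E * ∫ x, ‖f x‖ := fun n ξ => by
    rw [norm_mul]
    exact mul_le_mul (hmn n ξ) (norm_FT_le f ξ) (norm_nonneg _) hE0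
  have hf2 : ∫⁻ x, ‖f x‖ₑ ^ 2 < ∞ := by
    obtain ⟨B, hB⟩ := hf.bdd
    exact sq_lt_top_of_bdd hf.int hB
  have hpl : ∀ n, ∫⁻ x, ‖∑ i, opT a φ ψ h δ (r i) (s (i, n)) f x‖ₑ ^ 2 = ∫⁻ ξ, ‖m n ξ‖ₑ ^ 2 * ‖FT f ξ‖ₑ ^ 2 := by
    intro n
    simp only [eT]
    have cmF : Continuous fun ξ => m n ξ * FT f ξ := (cm n).mul cF
    rw [plancherel_inv cmF.stronglyMeasurable (im n) (sq_lt_top_of_bdd (im n) (hb n))]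
    simp only [enorm_mul, mul_pow]
  have cT : ∀ n, Continuous fun x => ∑ i, opT a φ ψ h δ (r i) (s (i, n)) f x := fun n => by
    simp only [eT]
    exact FTinv_continuous (im n)
  calc ∫⁻ x, (⨆ n : κ, ‖∑ i : ι, opT a φ ψ h δ (r i) (s (i, n)) f x‖ₑ) ^ 2
      ≤ ∫⁻ x, ∑ n : κ, ‖∑ i : ι, opT a φ ψ h δ (r i) (s (i, n)) f x‖ₑ ^ 2 := by
        refine lintegral_mono fun x => ?_
        have := iSup_rpow_le (u := fun n : κ => ‖∑ i : ι, opT a φ ψ h δ (r i) (s (i, n)) f x‖ₑ) (p := 2) (by norm_num)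
          (b := ∑ n : κ, ‖∑ i : ι, opT a φ ψ h δ (r i) (s (i, n)) f x‖ₑ ^ 2) (fun n => by
            rw [ENNReal.rpow_two]
            exact Finset.single_le_sum (f := fun n : κ => ‖∑ i : ι, opT a φ ψ h δ (r i) (s (i, n)) f x‖ₑ ^ 2) (fun _ _ => zero_le) (Finset.mem_univ n))
        rwa [ENNReal.rpow_two] at this
    _ = ∫⁻ ξ, (∑ n, ‖m n ξ‖ₑ ^ 2) * ‖FT f ξ‖ₑ ^ 2 := by
        rw [lintegral_finsetSum _ fun n _ => ((cT n).measurable.enorm.pow_const 2)]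
        simp only [hpl, Finset.sum_mul]
        have hmm : ∀ n, Measurable fun ξ => ‖m n ξ‖ₑ ^ 2 * ‖FT f ξ‖ₑ ^ 2 := fun n =>
          ((cm n).measurable.enorm.pow_const 2).mul (cF.measurable.enorm.pow_const 2)
        rw [lintegral_finsetSum _ fun n _ => hmm n]
    _ ≤ ∫⁻ ξ, ENNReal.ofReal E ^ 2 * ‖FT f ξ‖ₑ ^ 2 := by
        refine lintegral_mono fun ξ => mul_le_mul_left ?_ _
        have h1 : ∑ n, ‖m n ξ‖ ^ 2 ≤ E ^ 2 := by
          calc ∑ n, ‖m n ξ‖ ^ 2 ≤ ∑ n, ‖m n ξ‖ * E := Finset.sum_le_sum fun n _ => by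
                rw [sq]; exact mul_le_mul_of_nonneg_left (hmn n ξ) (norm_nonneg _)
            _ ≤ E * E := by rw [← Finset.sum_mul]; exact mul_le_mul_of_nonneg_right (hm1 ξ) hE0
            _ = _ := (sq E).symm
        calc ∑ n, ‖m n ξ‖ₑ ^ 2 = ENNReal.ofReal (∑ n, ‖m n ξ‖ ^ 2) := by
              rw [ENNReal.ofReal_sum_of_nonneg fun n _ => sq_nonneg _]
              refine Finset.sum_congr rfl fun n _ => ?_
              rw [ENNReal.ofReal_pow (norm_nonneg _), ofReal_norm]
          _ ≤ ENNReal.ofReal (E ^ 2) := ENNReal.ofReal_le_ofReal h1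
          _ = _ := ENNReal.ofReal_pow hE0 2
    _ = _ := by
        rw [lintegral_const_mul _ (cF.measurable.enorm.pow_const 2), plancherel_two hf.sm hf.int hf2]
end

lemma min_rpow_le {x u v p : ℝ} (hx : 0 ≤ x) (hu : 0 ≤ u) (hv : 0 ≤ v) (h : x ≤ u + v) (hp : 1 ≤ p) (hp2 : p ≤ 2) :
    min (x ^ p) (x ^ (2:ℝ)) ≤ 4 * (u ^ p + v ^ (2:ℝ)) := by
  have hu0 := Real.rpow_nonneg hu p
  have hv0 := Real.rpow_nonneg hv 2
  rcases le_total v u with hvu | huv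
  · refine (min_le_left _ _).trans ?_
    calc x ^ p ≤ (2 * u) ^ p := Real.rpow_le_rpow hx (by linarith) (by linarith)
      _ = 2 ^ p * u ^ p := Real.mul_rpow (by norm_num) hu
      _ ≤ 4 * u ^ p := by
          refine mul_le_mul_of_nonneg_right ?_ hu0
          calc (2:ℝ) ^ p ≤ 2 ^ (2:ℝ) := Real.rpow_le_rpow_of_exponent_le (by norm_num) hp2
            _ = 4 := by norm_num
      _ ≤ _ := by linarith
  · refine (min_le_right _ _).trans ?_
    calc x ^ (2:ℝ) ≤ (2 * v) ^ (2:ℝ) := Real.rpow_le_rpow hx (by linarith) (by linarith)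
      _ = 4 * v ^ (2:ℝ) := by rw [Real.mul_rpow (by norm_num) hv]; norm_num
      _ ≤ _ := by linarith

lemma split_le {h u v t p q : ℝ} (ht : 0 < t) (hh : 0 ≤ h) (hu : 0 ≤ u) (hv : 0 ≤ v) (hs : h ≤ u + v) (hp : 1 ≤ p) (hp2 : p ≤ 2) :
    (if t < h then t ^ (q - 1 - p) * h ^ p else t ^ (q - 1 - 2) * h ^ (2:ℝ)) ≤
      4 * (t ^ (q - 1 - p) * u ^ p + t ^ (q - 1 - 2) * v ^ (2:ℝ)) := by
  have key : ∀ z : ℝ, 0 ≤ z → ∀ e : ℝ, t ^ (q - 1 - e) * z ^ e = t ^ (q - 1) * (z / t) ^ e := by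
    intro z hz e
    rw [Real.rpow_sub ht, Real.div_rpow hz ht.le]
    ring
  rw [key h hh, key h hh, key u hu, key v hv]
  have ht1 : 0 ≤ t ^ (q - 1) := Real.rpow_nonneg ht.le _
  have hht : 0 ≤ h / t := div_nonneg hh ht.le
  have hm := min_rpow_le hht (div_nonneg hu ht.le) (div_nonneg hv ht.le)
    (by rw [← add_div]; exact div_le_div_of_nonneg_right hs ht.le) hp hp2
  have e2 : 4 * (t ^ (q - 1) * (u / t) ^ p + t ^ (q - 1) * (v / t) ^ (2:ℝ)) = t ^ (q - 1) * (4 * ((u / t) ^ p + (v / t) ^ (2:ℝ))) := by ring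
  rw [e2]
  split_ifs with hc
  · refine mul_le_mul_of_nonneg_left (le_trans (le_min le_rfl ?_) hm) ht1
    exact Real.rpow_le_rpow_of_exponent_le (by rw [le_div_iff₀ ht]; linarith) hp2
  · refine mul_le_mul_of_nonneg_left (le_trans (le_min ?_ le_rfl) hm) ht1
    rcases hht.eq_or_lt with e | hpos
    · rw [← e, Real.zero_rpow (by norm_num), Real.zero_rpow (by linarith)]
    · exact Real.rpow_le_rpow_of_exponent_ge hpos (by rw [div_le_iff₀ ht]; linarith) hp2

lemma layer_meas {X : Type*} [MeasurableSpace X] {μ : Measure X} [SFinite μ] {h : X → ℝ} (hm : Measurable h) (c e q : ℝ) :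
    Measurable fun t : ℝ => ENNReal.ofReal (t ^ e) * ∫⁻ y in {y | c * t < h y}, ENNReal.ofReal (h y) ^ q ∂μ := by
  have hms : ∀ t, MeasurableSet {y | c * t < h y} := fun t => measurableSet_lt measurable_const hm
  have hms2 : MeasurableSet {z : ℝ × X | c * z.1 < h z.2} := measurableSet_lt (by fun_prop) (hm.comp measurable_snd)
  have h1 : Measurable fun z : ℝ × X => ENNReal.ofReal (h z.2) ^ q := (hm.comp measurable_snd).ennreal_ofReal.pow_const q
  refine (measurable_id.pow_const e).ennreal_ofReal.mul ?_
  have h2 := (h1.indicator hms2).lintegral_prod_right' (ν := μ)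
  have e : (fun t => ∫⁻ y in {y | c * t < h y}, ENNReal.ofReal (h y) ^ q ∂μ) =
      fun t => ∫⁻ y, {z : ℝ × X | c * z.1 < h z.2}.indicator (fun z => ENNReal.ofReal (h z.2) ^ q) (t, y) ∂μ := by
    funext t
    rw [← lintegral_indicator (hms t)]
    rfl
  rw [e]
  exact h2

lemma Nice.indicator' {f : ℝ × ℝ → ℂ} (hf : Nice f) {S : Set (ℝ × ℝ)} (hS : MeasurableSet S) : Nice (S.indicator f) := by
  obtain ⟨B, hB⟩ := hf.bdd
  exact ⟨hf.sm.indicator hS, hf.int.indicator hS, B, fun x => (norm_indicator_le_norm_self f x).trans (hB x)⟩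

lemma lint_indicator_rpow {f : ℝ × ℝ → ℂ} {S : Set (ℝ × ℝ)} (hS : MeasurableSet S) {q : ℝ} (hq : 0 < q) :
    ∫⁻ y, ‖S.indicator f y‖ₑ ^ q = ∫⁻ y in S, ENNReal.ofReal ‖f y‖ ^ q := by
  rw [← lintegral_indicator hS]
  refine lintegral_congr fun y => ?_
  by_cases hy : y ∈ S
  · rw [indicator_of_mem hy, indicator_of_mem hy, ofReal_norm]
  · rw [indicator_of_notMem hy, indicator_of_notMem hy, enorm_zero, ENNReal.zero_rpow_of_pos hq]

lemma balance {a0 a2 p0 p : ℝ} (h0 : 0 < a0) (h2 : 0 < a2) (hp : p0 < 2) :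
    ∃ c : ℝ, 0 < c ∧ a0 ^ p0 * c⁻¹ ^ (p - p0) = a0 ^ (p0 * (2 - p) / (2 - p0)) * a2 ^ (2 * (p - p0) / (2 - p0)) ∧
      a2 ^ (2:ℝ) * c ^ (2 - p) = a0 ^ (p0 * (2 - p) / (2 - p0)) * a2 ^ (2 * (p - p0) / (2 - p0)) := by
  have hd : 2 - p0 ≠ 0 := by linarith
  refine ⟨Real.exp ((p0 * Real.log a0 - 2 * Real.log a2) / (2 - p0)), Real.exp_pos _, ?_, ?_⟩
  · rw [← Real.exp_neg, ← Real.exp_mul, Real.rpow_def_of_pos h0, Real.rpow_def_of_pos h0, Real.rpow_def_of_pos h2, ← Real.exp_add, ← Real.exp_add]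
    congr 1
    field_simp
    ring
  · rw [← Real.exp_mul, Real.rpow_def_of_pos h0, Real.rpow_def_of_pos h2, Real.rpow_def_of_pos h2, ← Real.exp_add, ← Real.exp_add]
    congr 1
    field_simp
    ring

/-- Interpolation of strong-type bounds with a uniform constant. -/
lemma interp {T : (ℝ × ℝ → ℂ) → ℝ × ℝ → ℝ≥0∞} (hm : ∀ f, Nice f → Measurable (T f)) (hfin : ∀ f, Nice f → ∀ x, T f x ≠ ∞)
    (hadd : ∀ f g, Nice f → Nice g → ∀ x, T (f + g) x ≤ T f x + T g x) {p0 p a0 a2 : ℝ} (ha0 : 0 < a0) (ha2 : 0 < a2)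
    (hp0 : 1 ≤ p0) (hpp : p0 < p) (hp2 : p < 2)
    (h0 : ∀ f, Nice f → ∫⁻ x, T f x ^ p0 ≤ ENNReal.ofReal a0 ^ p0 * ∫⁻ x, ‖f x‖ₑ ^ p0)
    (h2 : ∀ f, Nice f → ∫⁻ x, T f x ^ (2:ℝ) ≤ ENNReal.ofReal a2 ^ (2:ℝ) * ∫⁻ x, ‖f x‖ₑ ^ (2:ℝ)) {f : ℝ × ℝ → ℂ} (hf : Nice f) :
    ∫⁻ x, T f x ^ p ≤ ENNReal.ofReal (4 * (a0 ^ (p0 * (2 - p) / (2 - p0)) * a2 ^ (2 * (p - p0) / (2 - p0)))) * ∫⁻ x, ‖f x‖ₑ ^ p := by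
  obtain ⟨c, hc, hc0, hc2⟩ := balance (p := p) ha0 ha2 (hpp.trans hp2)
  set G : ℝ := a0 ^ (p0 * (2 - p) / (2 - p0)) * a2 ^ (2 * (p - p0) / (2 - p0)) with hG
  let g : ℝ × ℝ → ℝ := fun y => ‖f y‖
  have gm : Measurable g := hf.sm.measurable.norm
  let h : ℝ × ℝ → ℝ := fun x => (T f x).toReal
  have hhm : Measurable h := (hm f hf).ennreal_toReal
  have hh0 : ∀ x, 0 ≤ h x := fun x => ENNReal.toReal_nonneg
  have hTh : ∀ x, ENNReal.ofReal (h x) = T f x := fun x => ENNReal.ofReal_toReal (hfin f hf x)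
  have mL : ∀ t, MeasurableSet {y | c * t < g y} := fun t => measurableSet_lt measurable_const gm
  have mS : ∀ t, MeasurableSet {y | g y ≤ c * t} := fun t => measurableSet_le gm measurable_const
  have mH : ∀ t, MeasurableSet {y | 1 * t < h y} := fun t => measurableSet_lt measurable_const hhm
  let f1 : ℝ → ℝ × ℝ → ℂ := fun t => {y | c * t < g y}.indicator f
  let f2 : ℝ → ℝ × ℝ → ℂ := fun t => {y | g y ≤ c * t}.indicator f
  have n1 : ∀ t, Nice (f1 t) := fun t => hf.indicator' (mL t)
  have n2 : ∀ t, Nice (f2 t) := fun t => hf.indicator' (mS t)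
  have hsplit : ∀ t, f = f1 t + f2 t := by
    intro t
    funext y
    simp only [f1, f2, Pi.add_apply, indicator, mem_setOf_eq]
    by_cases hy : c * t < g y
    · rw [if_pos hy, if_neg (not_le.2 hy), add_zero]
    · rw [if_neg hy, if_pos (not_lt.1 hy), zero_add]
  have step : ∀ t : ℝ, 0 < t → ENNReal.ofReal (t ^ (p - 1 - p0)) * (∫⁻ y in {y | 1 * t < h y}, ENNReal.ofReal (h y) ^ p0) +
      ENNReal.ofReal (t ^ (p - 1 - 2)) * (∫⁻ y in {y | h y ≤ 1 * t}, ENNReal.ofReal (h y) ^ (2:ℝ)) ≤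
      4 * (ENNReal.ofReal a0 ^ p0 * (ENNReal.ofReal (t ^ (p - 1 - p0)) * ∫⁻ y in {y | c * t < g y}, ENNReal.ofReal (g y) ^ p0) +
        ENNReal.ofReal a2 ^ (2:ℝ) * (ENNReal.ofReal (t ^ (p - 1 - 2)) * ∫⁻ y in {y | g y ≤ c * t}, ENNReal.ofReal (g y) ^ (2:ℝ))) := by
    intro t ht
    have hcompl : {y | h y ≤ 1 * t} = {y | 1 * t < h y}ᶜ := by ext y; simp
    have w1 : 0 ≤ t ^ (p - 1 - p0) := Real.rpow_nonneg ht.le _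
    have w2 : 0 ≤ t ^ (p - 1 - 2) := Real.rpow_nonneg ht.le _
    calc _ = ∫⁻ y, ENNReal.ofReal (if t < h y then t ^ (p - 1 - p0) * h y ^ p0 else t ^ (p - 1 - 2) * h y ^ (2:ℝ)) := by
          rw [hcompl, ← lintegral_add_compl (fun y => ENNReal.ofReal (if t < h y then t ^ (p - 1 - p0) * h y ^ p0 else t ^ (p - 1 - 2) * h y ^ (2:ℝ))) (mH t), ← lintegral_const_mul _ (hhm.ennreal_ofReal.pow_const _),
            ← lintegral_const_mul _ (hhm.ennreal_ofReal.pow_const _)]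
          congr 1
          · refine setLIntegral_congr_fun (mH t) fun y hy => ?_
            simp only [mem_setOf_eq, one_mul] at hy
            rw [if_pos hy, ENNReal.ofReal_mul w1, ENNReal.ofReal_rpow_of_nonneg (hh0 y) (by linarith)]
          · refine setLIntegral_congr_fun (mH t).compl fun y hy => ?_
            simp only [mem_compl_iff, mem_setOf_eq, one_mul] at hy
            rw [if_neg hy, ENNReal.ofReal_mul w2, ENNReal.ofReal_rpow_of_nonneg (hh0 y) (by norm_num)]
      _ ≤ ∫⁻ y, 4 * (ENNReal.ofReal (t ^ (p - 1 - p0)) * T (f1 t) y ^ p0 + ENNReal.ofReal (t ^ (p - 1 - 2)) * T (f2 t) y ^ (2:ℝ)) := by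
          refine lintegral_mono fun y => ?_
          have u0 := hfin _ (n1 t) y
          have v0 := hfin _ (n2 t) y
          have hle : h y ≤ (T (f1 t) y).toReal + (T (f2 t) y).toReal := by
            rw [← ENNReal.toReal_add u0 v0]
            refine ENNReal.toReal_mono (ENNReal.add_ne_top.2 ⟨u0, v0⟩) ?_
            have := hadd _ _ (n1 t) (n2 t) y
            rwa [← hsplit t] at this
          refine (ENNReal.ofReal_le_ofReal (split_le (q := p) ht (hh0 y) ENNReal.toReal_nonneg ENNReal.toReal_nonneg hle hp0 (by linarith))).trans (le_of_eq ?_)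
          rw [ENNReal.ofReal_mul (by norm_num), ENNReal.ofReal_add (by positivity) (by positivity), ENNReal.ofReal_mul w1, ENNReal.ofReal_mul w2,
            ← ENNReal.ofReal_rpow_of_nonneg ENNReal.toReal_nonneg (by linarith), ← ENNReal.ofReal_rpow_of_nonneg ENNReal.toReal_nonneg (by norm_num),
            ENNReal.ofReal_toReal u0, ENNReal.ofReal_toReal v0]
          norm_num
      _ = 4 * (ENNReal.ofReal (t ^ (p - 1 - p0)) * (∫⁻ y, T (f1 t) y ^ p0) + ENNReal.ofReal (t ^ (p - 1 - 2)) * ∫⁻ y, T (f2 t) y ^ (2:ℝ)) := by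
          have m1 := (hm _ (n1 t)).pow_const p0
          have m2 := (hm _ (n2 t)).pow_const (2:ℝ)
          rw [lintegral_const_mul' _ _ (by norm_num), lintegral_add_left (m1.const_mul _), lintegral_const_mul _ m1, lintegral_const_mul _ m2]
      _ ≤ _ := by
          refine mul_le_mul_right (add_le_add ?_ ?_) _
          · have := h0 _ (n1 t)
            rw [lint_indicator_rpow (mL t) (by linarith)] at this
            exact (mul_le_mul_right this _).trans (le_of_eq (by ring))
          · have := h2 _ (n2 t)
            rw [lint_indicator_rpow (mS t) (by norm_num)] at this
            exact (mul_le_mul_right this _).trans (le_of_eq (by ring))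
  have l1 := layer_large (μ := volume) hhm hh0 (p := p) (q := p0) (c := 1) hpp one_pos (by linarith)
  have l2 := layer_small (μ := volume) hhm hh0 (p := p) (q := 2) (c := 1) hp2 one_pos (by linarith)
  have r1 := layer_large (μ := volume) gm (fun _ => norm_nonneg _) (p := p) (q := p0) (c := c) hpp hc (by linarith)
  have r2 := layer_small (μ := volume) gm (fun _ => norm_nonneg _) (p := p) (q := 2) (c := c) hp2 hc (by linarith)
  have key := (le_lintegral_add _ _).trans (setLIntegral_mono' (μ := (volume : Measure ℝ)) measurableSet_Ioi step)
  have mm := layer_meas (μ := volume) gm c (p - 1 - p0) p0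
  rw [l1, l2, lintegral_const_mul' _ _ (by norm_num), lintegral_add_left (mm.const_mul _), lintegral_const_mul' _ _ (by finiteness),
    lintegral_const_mul' _ _ (by finiteness), r1, r2] at key
  simp only [hTh] at key
  have eg : ∀ y, ENNReal.ofReal (g y) = ‖f y‖ₑ := fun y => ofReal_norm _
  simp only [eg] at key
  set S : ℝ := 1 / (p - p0) + 1 / (2 - p) with hS
  have hS0 : 0 < S := by positivity
  have eL : ENNReal.ofReal (1⁻¹ ^ (p - p0) / (p - p0)) * (∫⁻ y, T f y ^ p) + ENNReal.ofReal (1 ^ (2 - p) / (2 - p)) * (∫⁻ y, T f y ^ p) =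
      ENNReal.ofReal S * ∫⁻ y, T f y ^ p := by
    rw [← add_mul, ← ENNReal.ofReal_add (by positivity) (by positivity), inv_one, Real.one_rpow, Real.one_rpow]
  have eR : 4 * (ENNReal.ofReal a0 ^ p0 * (ENNReal.ofReal (c⁻¹ ^ (p - p0) / (p - p0)) * (∫⁻ y, ‖f y‖ₑ ^ p)) +
      ENNReal.ofReal a2 ^ (2:ℝ) * (ENNReal.ofReal (c ^ (2 - p) / (2 - p)) * (∫⁻ y, ‖f y‖ₑ ^ p))) =
      ENNReal.ofReal S * (ENNReal.ofReal (4 * G) * ∫⁻ y, ‖f y‖ₑ ^ p) := by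
    rw [ENNReal.ofReal_rpow_of_pos ha0, ENNReal.ofReal_rpow_of_pos ha2, ← mul_assoc (ENNReal.ofReal (a0 ^ p0)), ← mul_assoc (ENNReal.ofReal (a2 ^ (2:ℝ))),
      ← ENNReal.ofReal_mul (by positivity), ← ENNReal.ofReal_mul (by positivity), ← add_mul, ← ENNReal.ofReal_add (by positivity) (by positivity),
      ← mul_assoc, ← mul_assoc, ← ENNReal.ofReal_mul hS0.le, show (4 : ℝ≥0∞) = ENNReal.ofReal 4 by norm_num, ← ENNReal.ofReal_mul (by norm_num)]
    congr 2
    rw [mul_div_assoc', mul_div_assoc', hc0, hc2, hS]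
    ring
  rw [eL, eR] at key
  exact (ENNReal.mul_le_mul_iff_right (by simpa using hS0) ENNReal.ofReal_ne_top).1 key

section
/-- The larger of the conjugate exponent and the frequency scale. -/
def bigX (p : ℝ) (l : ℕ) : ℝ := max (p / (p - 1)) l

lemma two_le_bigX {p : ℝ} (hp : 1 < p) (hp2 : p ≤ 2) (l : ℕ) : 2 ≤ bigX p l := by
  refine le_max_of_le_left ?_
  rw [le_div_iff₀ (by linarith)]
  linarith

set_option maxHeartbeats 1600000 in
lemma exponent_choice {p : ℝ} (hp : 1 < p) (hp2 : p < 2) {l : ℕ} (hl : 1 ≤ l) {M W : ℝ} (hM : 1 ≤ M) (hW : 1 ≤ W) :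
    ∃ k : ℕ, pk k < p ∧ 4 * ((M * ((2 ^ (k + 1)) ^ 3 * (4 ^ k * (l : ℝ) ^ 2))) ^ (pk k * (2 - p) / (2 - pk k)) *
      (W * √(2⁻¹ ^ l)) ^ (2 * (p - pk k) / (2 - pk k))) ≤
      (2 ^ 34 * M * W * bigX p l ^ (7 * (2 / p - 1)) * 2 ^ (-((l : ℝ) * (1 - 1 / p)))) ^ p := by
  have hX2 := two_le_bigX hp hp2.le l
  have hXl : (l : ℝ) ≤ bigX p l := le_max_right _ _
  have hXp : p / (p - 1) ≤ bigX p l := le_max_left _ _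
  set X := bigX p l with hX
  have hX0 : 0 < X := by linarith
  have hp0 : 0 < p := by linarith
  obtain ⟨k, hk1, hk2⟩ := exists_nat_pow_near (show (1:ℝ) ≤ X by linarith) (show (1:ℝ) < 2 by norm_num)
  have hk : 1 ≤ k := by
    rcases Nat.eq_zero_or_pos k with e | e
    · rw [e] at hk2; norm_num at hk2; linarith
    · exact e
  set ε : ℝ := 2⁻¹ ^ (k + 1) with hε
  have hε0 : 0 < ε := by positivity
  have hεinv : ε⁻¹ = 2 ^ (k + 1) := by rw [hε, inv_pow, inv_inv]
  have hεX : ε < X⁻¹ := by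
    rw [lt_inv_comm₀ hε0 hX0, hεinv]; exact hk2
  have hε4 : ε ≤ 1 / 4 := by
    calc ε ≤ 2⁻¹ ^ 2 := pow_le_pow_of_le_one (by norm_num) (by norm_num) (by omega)
      _ = 1 / 4 := by norm_num
  have hpk : pk k = 1 / (1 - ε) := rfl
  have hεp : ε < 1 - 1 / p := by
    refine hεX.trans_le ?_
    rw [inv_le_comm₀ hX0 (by rw [sub_pos, div_lt_one hp0]; exact hp)]
    refine le_trans (le_of_eq ?_) hXp
    have : p - 1 ≠ 0 := by linarith
    field_simp
  have h1ε : 0 < 1 - ε := by linarith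
  have hlt : pk k < p := by
    rw [hpk, div_lt_iff₀ h1ε]
    have h3 : 1 / p < 1 - ε := by linarith
    rw [div_lt_iff₀ hp0] at h3
    linarith
  refine ⟨k, hlt, ?_⟩
  -- the interpolation exponents
  have h12 : 0 < 1 - 2 * ε := by linarith
  set d : ℝ := 2 / p - 1 with hd
  have hd0 : 0 ≤ d := by rw [hd, sub_nonneg, le_div_iff₀ hp0]; linarith
  have hd1 : d ≤ 1 := by rw [hd, sub_le_iff_le_add, div_le_iff₀ hp0]; linarith
  set τ : ℝ := d / (1 - 2 * ε) with hτ
  set θ : ℝ := 2 * ((1 - 1 / p - ε) / (1 - 2 * ε)) with hθ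
  have e1 : pk k * (2 - p) / (2 - pk k) = τ * p := by
    rw [hpk, hτ, hd]
    have : 2 - 1 / (1 - ε) ≠ 0 := by
      rw [show 2 - 1 / (1 - ε) = (1 - 2 * ε) / (1 - ε) by field_simp; ring]
      exact (div_pos h12 h1ε).ne'
    rw [show 2 - 1 / (1 - ε) = (1 - 2 * ε) / (1 - ε) by field_simp; ring]
    field_simp
  have e2 : 2 * (p - pk k) / (2 - pk k) = θ * p := by
    rw [hpk, hθ]
    rw [show 2 - 1 / (1 - ε) = (1 - 2 * ε) / (1 - ε) by field_simp; ring]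
    field_simp
    ring
  have hτ0 : 0 ≤ τ := div_nonneg hd0 h12.le
  have hθ0 : 0 ≤ θ := mul_nonneg (by norm_num) (div_nonneg (by linarith) h12.le)
  have hsum : τ + θ = 1 := by
    rw [hτ, hθ, hd]; field_simp; ring
  have hτ1 : τ ≤ 1 := by linarith
  have hθ1 : θ ≤ 1 := by linarith
  rw [e1, e2]
  set Y : ℝ := X ^ (7 * d) with hY
  set Z : ℝ := (2:ℝ) ^ (-((l : ℝ) * (1 - 1 / p))) with hZ
  have hY0 : 0 < Y := Real.rpow_pos_of_pos hX0 _
  set a0 : ℝ := M * ((2 ^ (k + 1)) ^ 3 * (4 ^ k * (l : ℝ) ^ 2)) with ha0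
  have ha0p : 0 < a0 := by positivity
  have ha0le : a0 ≤ (8 * M) * X ^ (7 : ℝ) := by
    have q1 : ((2:ℝ) ^ (k + 1)) ^ 3 ≤ 8 * X ^ 3 := by
      rw [pow_succ (2:ℝ) k, mul_pow]
      have := pow_le_pow_left₀ (by positivity) hk1 3
      linarith
    have q2 : (4:ℝ) ^ k ≤ X ^ 2 := by
      rw [show (4:ℝ) = 2 ^ 2 by norm_num, ← pow_mul, mul_comm, pow_mul]
      exact pow_le_pow_left₀ (by positivity) hk1 2
    have q3 : (l:ℝ) ^ 2 ≤ X ^ 2 := pow_le_pow_left₀ (by positivity) hXl 2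
    calc a0 ≤ M * ((8 * X ^ 3) * (X ^ 2 * X ^ 2)) := by
          refine mul_le_mul_of_nonneg_left (mul_le_mul q1 (mul_le_mul q2 q3 (by positivity) (by positivity)) (by positivity) (by positivity)) (by linarith)
      _ = 8 * M * X ^ 7 := by ring
      _ = _ := by norm_cast
  have b0 : a0 ^ τ ≤ 8 * M * 2 ^ 28 * Y := by
    calc a0 ^ τ ≤ ((8 * M) * X ^ (7 : ℝ)) ^ τ := Real.rpow_le_rpow ha0p.le ha0le hτ0
      _ = (8 * M) ^ τ * X ^ (7 * τ) := by rw [Real.mul_rpow (by positivity) (by positivity), ← Real.rpow_mul hX0.le]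
      _ ≤ (8 * M) * (2 ^ 28 * Y) := by
          refine mul_le_mul (Real.rpow_le_self_of_one_le (by linarith) hτ1) ?_ (by positivity) (by positivity)
          have q1 : 7 * τ ≤ 28 * X⁻¹ + 7 * d := by
            have : τ ≤ d + 4 * ε := by
              rw [hτ, div_le_iff₀ h12]
              have t1 : 0 ≤ ε * (1 - d) := mul_nonneg hε0.le (by linarith)
              have t2 : 0 ≤ ε * (1 / 4 - ε) := mul_nonneg hε0.le (by linarith)
              linarith
            linarith
          calc X ^ (7 * τ) ≤ X ^ (28 * X⁻¹ + 7 * d) := Real.rpow_le_rpow_of_exponent_le (by linarith) q1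
            _ = X ^ (28 * X⁻¹) * Y := Real.rpow_add hX0 _ _
            _ ≤ 2 ^ 28 * Y := by
                refine mul_le_mul_of_nonneg_right ?_ hY0.le
                have q2 : X ≤ 2 ^ X := by
                  have := one_add_mul_self_le_rpow_one_add (s := 1) (p := X) (by norm_num) (by linarith)
                  norm_num at this
                  linarith
                calc X ^ (28 * X⁻¹) ≤ ((2:ℝ) ^ X) ^ (28 * X⁻¹) := Real.rpow_le_rpow hX0.le q2 (by positivity)
                  _ = 2 ^ (28 : ℝ) := by
                      rw [← Real.rpow_mul (by norm_num)]
                      congr 1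
                      field_simp
                  _ = 2 ^ 28 := by norm_cast
      _ = _ := by ring
  have b2 : (W * √(2⁻¹ ^ l)) ^ θ ≤ 2 * W * Z := by
    have q0 : √((2:ℝ)⁻¹ ^ l) = 2 ^ (-((l:ℝ) / 2)) := by
      rw [Real.sqrt_eq_rpow, inv_pow, ← Real.rpow_natCast, ← Real.rpow_neg (by norm_num), ← Real.rpow_mul (by norm_num)]
      congr 1; ring
    rw [q0, Real.mul_rpow (by linarith) (by positivity), ← Real.rpow_mul (by norm_num)]
    have q1 : (2:ℝ) ^ (-((l:ℝ) / 2) * θ) ≤ 2 * Z := by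
      rw [hZ]
      calc (2:ℝ) ^ (-((l:ℝ) / 2) * θ) ≤ 2 ^ (1 + -((l : ℝ) * (1 - 1 / p))) := by
            refine Real.rpow_le_rpow_of_exponent_le (by norm_num) ?_
            have q2 : 1 - 1 / p - ε ≤ θ / 2 := by
              rw [hθ, mul_div_cancel_left₀ _ (by norm_num), le_div_iff₀ h12]
              have : 0 ≤ (1 - 1 / p - ε) * ε := mul_nonneg (by linarith) hε0.le
              linarith
            have q3 : (l:ℝ) * ε ≤ 1 := by
              calc (l:ℝ) * ε ≤ X * X⁻¹ := mul_le_mul hXl hεX.le hε0.le hX0.le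
                _ = 1 := mul_inv_cancel₀ hX0.ne'
            have q4 := mul_le_mul_of_nonneg_left q2 (show (0:ℝ) ≤ l by linarith)
            linarith
        _ = _ := by rw [Real.rpow_add (by norm_num), Real.rpow_one]
    calc W ^ θ * (2:ℝ) ^ (-((l:ℝ) / 2) * θ) ≤ W * (2 * Z) :=
          mul_le_mul (Real.rpow_le_self_of_one_le hW hθ1) q1 (by positivity) (by linarith)
      _ = _ := by ring
  have hW0 : 0 ≤ W * √(2⁻¹ ^ l) := by positivity
  rw [Real.rpow_mul ha0p.le, Real.rpow_mul hW0]
  have b4 : (4:ℝ) ≤ 4 ^ p := Real.self_le_rpow_of_one_le (by norm_num) hp.le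
  calc 4 * ((a0 ^ τ) ^ p * ((W * √(2⁻¹ ^ l)) ^ θ) ^ p) ≤ 4 ^ p * ((8 * M * 2 ^ 28 * Y) ^ p * (2 * W * Z) ^ p) := by
        refine mul_le_mul b4 (mul_le_mul (Real.rpow_le_rpow (by positivity) b0 hp0.le) (Real.rpow_le_rpow (by positivity) b2 hp0.le) (by positivity) (by positivity)) (by positivity) (by positivity)
    _ = (4 * ((8 * M * 2 ^ 28 * Y) * (2 * W * Z))) ^ p := by
        rw [← Real.mul_rpow (by positivity) (by positivity), ← Real.mul_rpow (by positivity) (by positivity)]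
    _ = _ := by congr 1; ring

lemma bigX_theta {p : ℝ} (hp : 1 < p) (hp2 : p ≤ 2) {l : ℕ} (hl : 1 ≤ l) :
    bigX p l ^ (7 * (2 / p - 1)) ≤ 2 ^ 7 * ((p - 1) ^ (-(2:ℝ)) * theta p l) := by
  have hl0 : (1 : ℝ) ≤ l := by exact_mod_cast hl
  have hp0 : 0 < p := by linarith
  have hp1 : 0 < p - 1 := by linarith
  have hX2 := two_le_bigX hp hp2 l
  set d : ℝ := 2 / p - 1 with hd
  have hd0 : 0 ≤ d := by rw [hd, sub_nonneg, le_div_iff₀ hp0]; linarith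
  have hd1 : d ≤ 1 := by rw [hd, sub_le_iff_le_add, div_le_iff₀ hp0]; linarith
  have h27 : (2:ℝ) ^ (7 * d) ≤ 2 ^ 7 := by
    calc (2:ℝ) ^ (7 * d) ≤ 2 ^ (7:ℝ) := Real.rpow_le_rpow_of_exponent_le (by norm_num) (by linarith)
      _ = _ := by norm_cast
  unfold theta
  split_ifs with hc
  · have hX : bigX p l ≤ 2 * (p - 1)⁻¹ := by
      refine max_le ?_ ?_
      · rw [div_eq_mul_inv]; exact mul_le_mul_of_nonneg_right hp2 (by positivity)
      · have : 0 < (p - 1)⁻¹ := inv_pos.2 hp1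
        linarith
    calc bigX p l ^ (7 * d) ≤ (2 * (p - 1)⁻¹) ^ (7 * d) := Real.rpow_le_rpow (by linarith) hX (by linarith)
      _ = 2 ^ (7 * d) * (p - 1) ^ (-(7 * d)) := by
          rw [Real.mul_rpow (by norm_num) (by positivity), Real.inv_rpow hp1.le, ← Real.rpow_neg hp1.le]
      _ ≤ 2 ^ 7 * (p - 1) ^ (-2 + (3 - 10 / p)) := by
          refine mul_le_mul h27 ?_ (by positivity) (by positivity)
          refine Real.rpow_le_rpow_of_exponent_ge hp1 (by linarith) ?_
          have : 4 / p ≤ 6 := by rw [div_le_iff₀ hp0]; linarith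
          have e1 : 10 / p = 10 * (1 / p) := by ring
          have e2 : 4 / p = 4 * (1 / p) := by ring
          have e3 : 2 / p = 2 * (1 / p) := by ring
          rw [hd, e1, e3]; rw [e2] at this
          linarith
      _ = _ := by rw [Real.rpow_add hp1]
  · push Not at hc
    have hX : bigX p l ≤ 2 * l := by
      refine max_le ?_ (by linarith)
      have : p / (p - 1) = 1 + (p - 1)⁻¹ := by field_simp; ring
      rw [this]; linarith
    calc bigX p l ^ (7 * d) ≤ (2 * (l:ℝ)) ^ (7 * d) := Real.rpow_le_rpow (by linarith) hX (by linarith)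
      _ = 2 ^ (7 * d) * (l:ℝ) ^ (7 * d) := by rw [Real.mul_rpow (by norm_num) (by positivity)]
      _ ≤ 2 ^ 7 * (1 * (l:ℝ) ^ (7 * d)) := by
          rw [one_mul]
          exact mul_le_mul_of_nonneg_right h27 (by positivity)
      _ ≤ _ := by
          refine mul_le_mul_of_nonneg_left (mul_le_mul_of_nonneg_right ?_ (by positivity)) (by positivity)
          exact Real.one_le_rpow_of_pos_of_le_one_of_nonpos hp1 (by linarith) (by norm_num)

end

section
lemma FT_add {f g : ℝ × ℝ → ℂ} (hf : Integrable f) (hg : Integrable g) (ξ : ℝ × ℝ) : FT (f + g) ξ = FT f ξ + FT g ξ := by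
  rw [FT_def, FT_def, FT_def, ← integral_add (integrable_eI_mul (by fun_prop) hf) (integrable_eI_mul (by fun_prop) hg)]
  refine integral_congr_ae (ae_of_all _ fun x => ?_)
  simp only [Pi.add_apply, mul_add]

lemma FTinv_add {f g : ℝ × ℝ → ℂ} (hf : Integrable f) (hg : Integrable g) (x : ℝ × ℝ) :
    FTinv (fun ξ => f ξ + g ξ) x = FTinv f x + FTinv g x := by
  rw [FTinv_def, FTinv_def, FTinv_def, ← integral_add (integrable_eI_mul (by fun_prop) hf) (integrable_eI_mul (by fun_prop) hg)]
  refine integral_congr_ae (ae_of_all _ fun x => ?_)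
  simp only [mul_add]

lemma bootC_nonneg {K C L : ℝ} (hL : 0 ≤ L) : 0 ≤ bootC K C L := by unfold bootC; positivity

variable {a : ℝ × ℝ → ℂ} {φ ψ : ℝ → ℝ} {h : ℝ → ℂ} {A lo hi H K C : ℝ}

lemma opT_add (D : Dat a φ ψ h A lo hi H K C) {δ r s : ℝ} (hδ : 0 < δ) (hr : 0 < r) (hs : 0 < s) {f g : ℝ × ℝ → ℂ}
    (hf : Nice f) (hg : Nice g) (x : ℝ × ℝ) : opT a φ ψ h δ r s (f + g) x = opT a φ ψ h δ r s f x + opT a φ ψ h δ r s g x := by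
  have hi := fun {u : ℝ × ℝ → ℂ} (hu : Nice u) => mulF_FT_integrable D.amp D.nφ.meas D.nψ.meas D.hm D.hH hδ hr hs hu.int
  unfold opT
  rw [← FTinv_add (hi hf) (hi hg)]
  congr 1
  funext ξ
  rw [FT_add hf.int hg.int, mul_add]

/-- Uniform maximal bound over lacunary families. -/
lemma max_opT (D : Dat a φ ψ h A lo hi H K C) {V : ℝ} (hV : 0 ≤ V) (hv : ∀ ξ, ‖shF φ ψ h ξ‖ ^ 2 * |ξ.2| ≤ V ^ 2)
    {L : ℝ} (hL : 0 ≤ L) : ∃ Q : ℝ, 0 ≤ Q ∧ ∀ (ι κ : Type) [Fintype ι] [Fintype κ] (r : ι → ℝ) (s : ι × κ → ℝ), Lac2 r s L →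
      ∀ l : ℕ, 1 ≤ l → ∀ p : ℝ, 1 < p → p ≤ 2 → ∀ f : ℝ × ℝ → ℂ, Nice f →
      ∫⁻ x, (⨆ n : κ, ‖∑ i : ι, opT a φ ψ h (2⁻¹ ^ l) (r i) (s (i, n)) f x‖ₑ) ^ p ≤
        ENNReal.ofReal (Q * bigX p l ^ (7 * (2 / p - 1)) * 2 ^ (-((l : ℝ) * (1 - 1 / p)))) ^ p * ∫⁻ x, ‖f x‖ₑ ^ p := by
  obtain ⟨k, Ck, hk, hk1⟩ := exists_LPk_one D.amp.lo_pos D.amp.lo_le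
  have hCk := hk.pos
  have hA := D.amp.nn
  have hH := D.Hnn
  have hB := bootC_nonneg (K := K) (C := C) hL
  set M0 : ℝ := (960 * (Ck * L + 1)) ^ 3 * (H * A) * bootC K C L with hM0
  set W0 : ℝ := A * V * √(1 / lo) * (max lo⁻¹ hi ^ 2 * L ^ 2) with hW0
  have hM0n : 0 ≤ M0 := by positivity
  have hW0n : 0 ≤ W0 := by positivity
  set M := M0 + 1 with hM
  set W := W0 + 1 with hW
  refine ⟨2 ^ 34 * M * W, by positivity, fun ι κ _ _ r s hl l hl1 p hp hp2 f hf => ?_⟩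
  have hδ : (0:ℝ) < 2⁻¹ ^ l := by positivity
  have hX := two_le_bigX hp hp2 l
  let T : (ℝ × ℝ → ℂ) → ℝ × ℝ → ℝ≥0∞ := fun f x => ⨆ n : κ, ‖∑ i : ι, opT a φ ψ h (2⁻¹ ^ l) (r i) (s (i, n)) f x‖ₑ
  have hn : ∀ {g : ℝ × ℝ → ℂ}, Nice g → ∀ i n, Nice (opT a φ ψ h (2⁻¹ ^ l) (r i) (s (i, n)) g) := fun hg i n =>
    opT_nice D.amp D.nφ.meas D.nψ.meas D.hm D.hH hδ (hl.one.pos i) (hl.pos (i, n)) hg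
  have h2 : ∀ g, Nice g → ∫⁻ x, T g x ^ (2:ℝ) ≤ ENNReal.ofReal (W * √(2⁻¹ ^ l)) ^ (2:ℝ) * ∫⁻ x, ‖g x‖ₑ ^ (2:ℝ) := by
    intro g hg
    simp only [ENNReal.rpow_two]
    refine (max_opT_two D hl hV hv hδ hg).trans (mul_le_mul_left (pow_le_pow_left' (ENNReal.ofReal_le_ofReal ?_) 2) _)
    calc A * V * √(2⁻¹ ^ l / lo) * (max lo⁻¹ hi ^ 2 * L ^ 2) = W0 * √(2⁻¹ ^ l) := by
          rw [hW0, div_eq_mul_one_div, Real.sqrt_mul hδ.le]; ring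
      _ ≤ W * √(2⁻¹ ^ l) := mul_le_mul_of_nonneg_right (by linarith) (by positivity)
  rcases hp2.eq_or_lt with rfl | hp2'
  · refine (h2 f hf).trans (mul_le_mul_left (ENNReal.rpow_le_rpow (ENNReal.ofReal_le_ofReal ?_) (by norm_num)) _)
    have e : √((2:ℝ)⁻¹ ^ l) = 2 ^ (-((l : ℝ) * (1 - 1 / 2))) := by
      rw [Real.sqrt_eq_rpow, inv_pow, ← Real.rpow_natCast, ← Real.rpow_neg (by norm_num), ← Real.rpow_mul (by norm_num)]
      congr 1; ring
    rw [e]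
    norm_num only [Real.rpow_zero]
    refine mul_le_mul_of_nonneg_right ?_ (by positivity)
    have : 0 ≤ (17179869184 * M - 1) * W := mul_nonneg (by linarith) (by linarith)
    linarith
  · obtain ⟨m, hm, hbd⟩ := exponent_choice hp hp2' hl1 (show 1 ≤ M by linarith) (show 1 ≤ W by linarith)
    have h0 : ∀ g, Nice g → ∫⁻ x, T g x ^ pk m ≤ ENNReal.ofReal (M * ((2 ^ (m + 1)) ^ 3 * (4 ^ m * (l : ℝ) ^ 2))) ^ pk m *
        ∫⁻ x, ‖g x‖ₑ ^ pk m := by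
      intro g hg
      refine (max_opT_pk D hl hk hk1 hl1 m hg).trans (mul_le_mul_left (ENNReal.rpow_le_rpow (ENNReal.ofReal_le_ofReal ?_)
        (by linarith [one_lt_pk m])) _)
      calc (960 * (Ck * L + 1) * 2 ^ (m + 1)) ^ 3 * (H * A) * (bootC K C L * 4 ^ m * (l : ℝ) ^ 2)
          = M0 * ((2 ^ (m + 1)) ^ 3 * (4 ^ m * (l : ℝ) ^ 2)) := by rw [hM0]; ring
        _ ≤ _ := mul_le_mul_of_nonneg_right (by linarith) (by positivity)
    refine (interp (T := T) (fun g hg => ?_) (fun g hg x => ?_) (fun g g' hg hg' x => ?_) (by positivity) (by positivity)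
      (one_lt_pk m).le hm hp2' h0 h2 hf).trans ?_
    · exact Measurable.iSup fun n => (Finset.measurable_sum _ fun i _ => (hn hg i n).sm.measurable).enorm
    · have : T g x ≤ ∑ n : κ, ‖∑ i : ι, opT a φ ψ h (2⁻¹ ^ l) (r i) (s (i, n)) g x‖ₑ :=
        iSup_le fun n => Finset.single_le_sum (f := fun n => ‖∑ i : ι, opT a φ ψ h (2⁻¹ ^ l) (r i) (s (i, n)) g x‖ₑ)
          (fun _ _ => zero_le) (Finset.mem_univ n)
      exact (this.trans_lt (ENNReal.sum_lt_top.2 fun n _ => enorm_lt_top)).ne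
    · refine iSup_le fun n => ?_
      simp only [opT_add D hδ (hl.one.pos _) (hl.pos (_, n)) hg hg', Finset.sum_add_distrib]
      refine (enorm_add_le _ _).trans (add_le_add ?_ ?_)
      · exact le_iSup (fun n => ‖∑ i : ι, opT a φ ψ h (2⁻¹ ^ l) (r i) (s (i, n)) g x‖ₑ) n
      · exact le_iSup (fun n => ‖∑ i : ι, opT a φ ψ h (2⁻¹ ^ l) (r i) (s (i, n)) g' x‖ₑ) n
    · rw [ENNReal.ofReal_rpow_of_nonneg (by positivity) (by linarith)]
      exact mul_le_mul_left (ENNReal.ofReal_le_ofReal hbd) _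

end

lemma NDeg_of_deriv {φ φ1 : ℝ → ℝ} {K c : ℝ} (hm : Measurable φ) (hc : 0 < c) (hd : ∀ t ∈ Icc (1/2 : ℝ) 2, HasDerivAt φ (φ1 t) t)
    (hi : InjOn φ (Icc (1/2 : ℝ) 2)) (hlow : ∀ t ∈ Icc (1/2 : ℝ) 2, c ≤ |φ1 t|) (hK : ∀ t ∈ Icc (1/2 : ℝ) 2, |φ t| ≤ K) :
    NDeg φ K c⁻¹ where
  meas := hm
  bdd := hK
  pos := by positivity
  cov G hG := by
    have h1 := lintegral_image_eq_lintegral_abs_deriv_mul measurableSet_Icc (fun t ht => (hd t ht).hasDerivWithinAt) hi G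
    have h2 : ∫⁻ t in Icc (1/2 : ℝ) 2, G (φ t) ≤ ∫⁻ t in Icc (1/2 : ℝ) 2, ENNReal.ofReal c⁻¹ * (ENNReal.ofReal |φ1 t| * G (φ t)) := by
      refine setLIntegral_mono' (μ := volume) measurableSet_Icc fun t ht => ?_
      rw [← mul_assoc, ← ENNReal.ofReal_mul (by positivity)]
      refine le_mul_of_one_le_left (by positivity) ?_
      rw [ENNReal.one_le_ofReal, inv_mul_eq_div, one_le_div hc]
      exact hlow t ht
    refine h2.trans ?_
    rw [lintegral_const_mul' _ _ (by finiteness), ← h1]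
    exact mul_le_mul_right (setLIntegral_le_lintegral _ _) _

lemma NDeg_lin {e : ℝ} (he : |e| = 1) : NDeg (fun t => e * t) 2 1⁻¹ := by
  have he0 : e ≠ 0 := by intro h; simp [h] at he
  refine NDeg_of_deriv (φ1 := fun _ => e) (by fun_prop) one_pos (fun t _ => by simpa using (hasDerivAt_id t).const_mul e)
    (fun a _ b _ h => mul_left_cancel₀ he0 h) (fun t _ => he.ge) fun t ht => ?_
  rw [abs_mul, he, one_mul, abs_of_nonneg (by linarith [ht.1])]
  exact ht.2

lemma rpow_hasDeriv (c β : ℝ) {t : ℝ} (ht : t ∈ Icc (1/2 : ℝ) 2) : HasDerivAt (fun t => c * t ^ β) (c * (β * t ^ (β - 1))) t :=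
  (Real.hasDerivAt_rpow_const (Or.inl (by linarith [ht.1]))).const_mul c

lemma rpow_low (β : ℝ) : ∃ κ : ℝ, 0 < κ ∧ ∀ t ∈ Icc (1/2 : ℝ) 2, κ ≤ t ^ β := by
  obtain ⟨x, hx, hmin⟩ := isCompact_Icc.exists_isMinOn (⟨1, by norm_num⟩ : (Icc (1/2 : ℝ) 2).Nonempty)
    (f := fun t : ℝ => t ^ β) (fun t ht => (Real.continuousAt_rpow_const t β (Or.inl (by linarith [ht.1]))).continuousWithinAt)
  exact ⟨x ^ β, Real.rpow_pos_of_pos (by linarith [hx.1]) _, fun t ht => hmin ht⟩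

lemma NDeg_pow {b c : ℝ} (hb : 1 < b) (hc : c ≠ 0) : ∃ K C, NDeg (fun t => c * t ^ b) K C := by
  obtain ⟨κ, hκ, hlow⟩ := rpow_low (b - 1)
  refine ⟨|c| * 2 ^ b, (|c| * b * κ)⁻¹, NDeg_of_deriv (φ1 := fun t => c * (b * t ^ (b - 1))) (by fun_prop)
    (by positivity) (fun t ht => rpow_hasDeriv c b ht) ?_ ?_ ?_⟩
  · intro s hs t ht h
    have := mul_left_cancel₀ hc h
    exact (Real.rpow_left_inj (by linarith [hs.1]) (by linarith [ht.1]) (by linarith)).1 this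
  · intro t ht
    have := hlow t ht
    rw [abs_mul, abs_mul, abs_of_pos (show 0 < b by linarith), abs_of_pos (hκ.trans_le this), mul_assoc]
    exact mul_le_mul_of_nonneg_left (mul_le_mul_of_nonneg_left this (by linarith)) (abs_nonneg _)
  · intro t ht
    have ht0 : 0 ≤ t := by linarith [ht.1]
    rw [abs_mul, abs_of_nonneg (Real.rpow_nonneg ht0 b)]
    exact mul_le_mul_of_nonneg_left (Real.rpow_le_rpow ht0 ht.2 (by linarith)) (abs_nonneg _)

/-- A continuously differentiable density on `[1/2, 2]`. -/
structure Dens (h : ℝ → ℂ) : Prop where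
  meas : Measurable h
  der : ∃ h1 : ℝ → ℂ, (∀ t ∈ Icc (1/2 : ℝ) 2, HasDerivAt h (h1 t) t) ∧ ContinuousOn h1 (Icc (1/2 : ℝ) 2)

lemma Dens.bdd {h : ℝ → ℂ} (H : Dens h) : ∃ B : ℝ, ∀ t ∈ Icc (1/2 : ℝ) 2, ‖h t‖ ≤ B := by
  obtain ⟨h1, hd, -⟩ := H.der
  exact isCompact_Icc.exists_bound_of_continuousOn fun t ht => (hd t ht).continuousAt.continuousWithinAt

lemma shF_decay {b c e : ℝ} (hb : 1 < b) (hc : c ≠ 0) {h : ℝ → ℂ} (H : Dens h) :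
    ∃ V : ℝ, 0 ≤ V ∧ ∀ ξ, ‖shF (fun t => e * t) (fun t => c * t ^ b) h ξ‖ ^ 2 * |ξ.2| ≤ V ^ 2 := by
  obtain ⟨h1, hd, hc1⟩ := H.der
  obtain ⟨B0, hB0⟩ := H.bdd
  obtain ⟨B1, hB1⟩ := isCompact_Icc.exists_bound_of_continuousOn hc1
  obtain ⟨κ, hκ, hlow⟩ := rpow_low (b - 2)
  set B := max B0 B1 with hB
  set m : ℝ := 2 * Real.pi * (|c| * b * (b - 1) * κ) with hm
  have hm0 : 0 < m := by positivity
  have hBn : 0 ≤ B := ((norm_nonneg _).trans (hB0 1 (by norm_num))).trans (le_max_left _ _)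
  refine ⟨10 * B / √m, by positivity, fun ξ => ?_⟩
  by_cases hξ : ξ.2 = 0
  · rw [hξ, abs_zero, mul_zero]; positivity
  have hξ0 : 0 < |ξ.2| := abs_pos.2 hξ
  let θ : ℝ → ℝ := fun t => -(2 * Real.pi * (ξ.1 * (e * t) + ξ.2 * (c * t ^ b)))
  let θ1 : ℝ → ℝ := fun t => -(2 * Real.pi * (ξ.1 * e + ξ.2 * (c * (b * t ^ (b - 1)))))
  let θ2 : ℝ → ℝ := fun t => -(2 * Real.pi * (ξ.2 * (c * (b * ((b - 1) * t ^ (b - 1 - 1))))))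
  have hθ : ∀ t ∈ Icc (1/2 : ℝ) 2, HasDerivAt θ (θ1 t) t := fun t ht => by
    have a1 : HasDerivAt (fun t => ξ.1 * (e * t)) (ξ.1 * e) t := by
      simpa using ((hasDerivAt_id t).const_mul e).const_mul ξ.1
    exact ((a1.add ((rpow_hasDeriv c b ht).const_mul ξ.2)).const_mul (2 * Real.pi)).neg
  have hθ1 : ∀ t ∈ Icc (1/2 : ℝ) 2, HasDerivAt θ1 (θ2 t) t := fun t ht => by
    have a1 : HasDerivAt (fun t : ℝ => ξ.2 * (c * (b * t ^ (b - 1)))) (ξ.2 * (c * (b * ((b - 1) * t ^ (b - 1 - 1))))) t :=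
      ((rpow_hasDeriv b (b - 1) ht).const_mul c).const_mul ξ.2
    exact ((a1.const_add (ξ.1 * e)).const_mul (2 * Real.pi)).neg
  have hcont : ContinuousOn θ2 (Icc (1/2 : ℝ) 2) := by
    have : ContinuousOn (fun t : ℝ => t ^ (b - 1 - 1)) (Icc (1/2 : ℝ) 2) := fun t ht =>
      (Real.continuousAt_rpow_const t _ (Or.inl (by linarith [ht.1]))).continuousWithinAt
    fun_prop
  have e2 : ∀ t, θ2 t = -(ξ.2 * c) * (2 * Real.pi * (b * (b - 1) * t ^ (b - 2))) := fun t => by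
    simp only [θ2]
    rw [show b - 1 - 1 = b - 2 by ring]; ring
  have hlow2 : ∀ t ∈ Icc (1/2 : ℝ) 2, m * |ξ.2| ≤ |ξ.2 * c| * (2 * Real.pi * (b * (b - 1) * t ^ (b - 2))) := fun t ht => by
    rw [abs_mul, hm]
    have := mul_le_mul_of_nonneg_left (hlow t ht) (show 0 ≤ |ξ.2| * |c| * (2 * Real.pi * (b * (b - 1))) by positivity)
    linarith
  have hHb : ∀ t ∈ Icc (1/2 : ℝ) 2, ‖h t‖ ≤ B := fun t ht => (hB0 t ht).trans (le_max_left _ _)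
  have hH1b : ∀ t ∈ Icc (1/2 : ℝ) 2, ‖h1 t‖ ≤ B := fun t ht => (hB1 t ht).trans (le_max_right _ _)
  have hfin : ‖∫ t in (1/2 : ℝ)..2, eI (θ t) * h t‖ ≤ 10 * B / √(m * |ξ.2|) := by
    rcases le_total (ξ.2 * c) 0 with hs | hs
    · refine vdc_pos (by norm_num) (by norm_num) (by positivity) hθ hθ1 hcont (fun t ht => ?_) hd hc1 hHb hH1b
      rw [e2]
      have := hlow2 t ht
      rwa [abs_of_nonpos hs] at this
    · refine vdc_neg (by norm_num) (by norm_num) (by positivity) hθ hθ1 hcont (fun t ht => ?_) hd hc1 hHb hH1b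
      rw [e2]
      have := hlow2 t ht
      rw [abs_of_nonneg hs] at this
      linarith
  have hsh : shF (fun t => e * t) (fun t => c * t ^ b) h ξ = ∫ t in (1/2 : ℝ)..2, eI (θ t) * h t := by
    unfold shF
    rw [intervalIntegral.integral_of_le (by norm_num), integral_Icc_eq_integral_Ioc]
  rw [hsh]
  calc ‖∫ t in (1/2 : ℝ)..2, eI (θ t) * h t‖ ^ 2 * |ξ.2| ≤ (10 * B / √(m * |ξ.2|)) ^ 2 * |ξ.2| :=
        mul_le_mul_of_nonneg_right (pow_le_pow_left₀ (norm_nonneg _) hfin 2) hξ0.le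
    _ = _ := by
        rw [div_pow, div_pow, Real.sq_sqrt (by positivity), Real.sq_sqrt hm0.le]
        field_simp

/-- Smooth amplitudes supported away from the coordinate axes. -/
structure SAmp (a : ℝ × ℝ → ℂ) (lo hi : ℝ) : Prop where
  sm : ContDiff ℝ (⊤ : ℕ∞) a
  lo_pos : 0 < lo
  lo_le : lo ≤ hi
  supp : ∀ ξ, a ξ ≠ 0 → lo ≤ |ξ.1| ∧ |ξ.1| ≤ hi ∧ lo ≤ |ξ.2| ∧ |ξ.2| ≤ hi

section
variable {a : ℝ × ℝ → ℂ} {lo hi : ℝ}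

lemma SAmp.exists_amp (S : SAmp a lo hi) : ∃ A, Amp a A lo hi := by
  have hc : HasCompactSupport a := by
    refine HasCompactSupport.of_support_subset_isCompact (K := Icc (-hi) hi ×ˢ Icc (-hi) hi) (isCompact_Icc.prod isCompact_Icc) fun ξ hξ => ?_
    obtain ⟨_, h2, _, h4⟩ := S.supp ξ hξ
    exact ⟨abs_le.1 h2, abs_le.1 h4⟩
  obtain ⟨A, hA⟩ := FTinv_decay S.sm hc
  obtain ⟨B, hB⟩ := S.sm.continuous.bounded_above_of_compact_support hc
  refine ⟨max A B, S.sm.continuous, S.lo_pos, S.lo_le, fun ξ => (hB ξ).trans (le_max_right _ _), S.supp, fun z => (hA z).trans ?_⟩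
  refine mul_le_mul_of_nonneg_right (le_max_left _ _) ?_
  unfold omR
  positivity

lemma SAmp.mul_snd (S : SAmp a lo hi) : SAmp (fun ξ => (ξ.2 : ℂ) * a ξ) lo hi where
  sm := (Complex.ofRealCLM.contDiff.comp contDiff_snd).mul S.sm
  lo_pos := S.lo_pos
  lo_le := S.lo_le
  supp ξ hξ := S.supp ξ (right_ne_zero_of_mul hξ)

lemma SAmp.deriv_snd (S : SAmp a lo hi) : SAmp (fun ξ => (ξ.2 : ℂ) * fderiv ℝ a ξ (0, 1)) lo hi where
  sm := by
    have h1 : ContDiff ℝ (⊤ : ℕ∞) (fun ξ => fderiv ℝ a ξ (0, 1)) :=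
      (S.sm.fderiv_right (m := (⊤ : ℕ∞)) (by exact_mod_cast le_top)).clm_apply contDiff_const
    exact (Complex.ofRealCLM.contDiff.comp contDiff_snd).mul h1
  lo_pos := S.lo_pos
  lo_le := S.lo_le
  supp ξ hξ := by
    have h1 : fderiv ℝ a ξ ≠ 0 := fun h => by simp [h] at hξ
    have h2 : ξ ∈ tsupport a := support_fderiv_subset ℝ h1
    have hcl : IsClosed {ξ : ℝ × ℝ | lo ≤ |ξ.1| ∧ |ξ.1| ≤ hi ∧ lo ≤ |ξ.2| ∧ |ξ.2| ≤ hi} := by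
      simp only [setOf_and]
      refine IsClosed.inter (isClosed_le (by fun_prop) (by fun_prop)) (IsClosed.inter (isClosed_le (by fun_prop) (by fun_prop))
        (IsClosed.inter (isClosed_le (by fun_prop) (by fun_prop)) (isClosed_le (by fun_prop) (by fun_prop))))
    exact closure_minimal S.supp hcl h2

end

/-- The density obtained by differentiating the phase in the second frequency. -/
def hder (ψ : ℝ → ℝ) (h : ℝ → ℂ) (t : ℝ) : ℂ := ((-(2 * Real.pi * ψ t) : ℝ) : ℂ) * Complex.I * h t

section
variable {φ ψ : ℝ → ℝ} {h : ℝ → ℂ} {H K : ℝ}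

lemma eI_hasDeriv {θ : ℝ → ℝ} {θ1 s : ℝ} (h : HasDerivAt θ θ1 s) : HasDerivAt (fun s => eI (θ s)) (eI (θ s) * ((θ1 : ℂ) * Complex.I)) s := by
  unfold eI
  exact ((h.ofReal_comp).mul_const Complex.I).cexp

lemma shF_hasDeriv (hφ : Measurable φ) (hψ : Measurable ψ) (hm : Measurable h) (hH : ∀ t ∈ Icc (1/2 : ℝ) 2, ‖h t‖ ≤ H)
    (hK : ∀ t ∈ Icc (1/2 : ℝ) 2, |ψ t| ≤ K) (y w s : ℝ) :
    HasDerivAt (fun s => shF φ ψ h (y, s * w)) (w * shF φ ψ (hder ψ h) (y, s * w)) s := by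
  have hi := h_int hm hH
  have key := hasDerivAt_integral_of_dominated_loc_of_deriv_le (μ := volume.restrict (Icc (1/2 : ℝ) 2)) (x₀ := s) (s := univ)
    (F := fun s t => eI (-(2 * Real.pi * (y * φ t + s * w * ψ t))) * h t)
    (F' := fun s t => eI (-(2 * Real.pi * (y * φ t + s * w * ψ t))) * (((-(2 * Real.pi * (w * ψ t)) : ℝ) : ℂ) * Complex.I) * h t)
    (bound := fun t => 2 * Real.pi * (|w| * K) * ‖h t‖) univ_mem
    (Eventually.of_forall fun s => by fun_prop)
    (integrable_eI_mul (by fun_prop) hi) (by fun_prop) ?_ (hi.norm.const_mul _) ?_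
  · refine key.2.congr_deriv ?_
    unfold shF
    rw [← integral_const_mul]
    refine integral_congr_ae (ae_of_all _ fun t => ?_)
    simp only [hder]
    push_cast
    ring
  · refine (ae_restrict_iff' measurableSet_Icc).2 (ae_of_all _ fun t ht s _ => ?_)
    rw [norm_mul, norm_mul, norm_eI, one_mul, norm_mul, Complex.norm_I, mul_one, Complex.norm_real, norm_neg, Real.norm_eq_abs, abs_mul (2 * Real.pi), abs_mul w,
      abs_of_pos (show 0 < 2 * Real.pi by positivity)]
    refine mul_le_mul_of_nonneg_right (mul_le_mul_of_nonneg_left (mul_le_mul_of_nonneg_left (hK t ht) (abs_nonneg _)) (by positivity)) (norm_nonneg _)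
  · refine ae_of_all _ fun t s _ => (eI_hasDeriv ?_).mul_const (h t)
    have a1 : HasDerivAt (fun s : ℝ => s * w * ψ t) (w * ψ t) s := by
      simpa using ((hasDerivAt_id s).mul_const w).mul_const (ψ t)
    exact ((a1.const_add (y * φ t)).const_mul (2 * Real.pi)).neg

lemma hder_meas (hψ : Measurable ψ) (hm : Measurable h) : Measurable (hder ψ h) := by unfold hder; fun_prop

lemma hder_bdd (hH : ∀ t ∈ Icc (1/2 : ℝ) 2, ‖h t‖ ≤ H) (hK : ∀ t ∈ Icc (1/2 : ℝ) 2, |ψ t| ≤ K) :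
    ∀ t ∈ Icc (1/2 : ℝ) 2, ‖hder ψ h t‖ ≤ 2 * Real.pi * K * H := fun t ht => by
  unfold hder
  rw [norm_mul, norm_mul, Complex.norm_I, mul_one, Complex.norm_real, norm_neg, Real.norm_eq_abs, abs_mul (2 * Real.pi),
      abs_of_pos (show 0 < 2 * Real.pi by positivity)]
  have hK0 : 0 ≤ K := (abs_nonneg _).trans (hK t ht)
  exact mul_le_mul (mul_le_mul_of_nonneg_left (hK t ht) (by positivity)) (hH t ht) (norm_nonneg _) (by positivity)

end

section
variable {a : ℝ × ℝ → ℂ} {φ ψ : ℝ → ℝ} {h : ℝ → ℂ} {lo hi H K δ r : ℝ}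

lemma mulF_hasDeriv (S : SAmp a lo hi) (hφ : Measurable φ) (hψ : Measurable ψ) (hm : Measurable h)
    (hH : ∀ t ∈ Icc (1/2 : ℝ) 2, ‖h t‖ ≤ H) (hK : ∀ t ∈ Icc (1/2 : ℝ) 2, |ψ t| ≤ K) (hδ : 0 < δ) {s : ℝ} (hs : 0 < s) (ξ : ℝ × ℝ) :
    HasDerivAt (fun s => mulF a φ ψ h δ r s ξ)
      ((s⁻¹ : ℝ) * (mulF (fun ξ => (ξ.2 : ℂ) * fderiv ℝ a ξ (0, 1)) φ ψ h δ r s ξ +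
        (δ⁻¹ : ℝ) * mulF (fun ξ => (ξ.2 : ℂ) * a ξ) φ ψ (hder ψ h) δ r s ξ)) s := by
  have h1 : HasDerivAt (fun s : ℝ => (δ * r * ξ.1, δ * s * ξ.2)) ((0 : ℝ), δ * ξ.2) s := by
    have a1 : HasDerivAt (fun s : ℝ => δ * s * ξ.2) (δ * ξ.2) s := by
      simpa using ((hasDerivAt_id s).const_mul δ).mul_const ξ.2
    exact (hasDerivAt_const s _).prodMk a1
  have hd : HasFDerivAt a (fderiv ℝ a (δ * r * ξ.1, δ * s * ξ.2)) (δ * r * ξ.1, δ * s * ξ.2) :=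
    (S.sm.differentiable (by simp)).differentiableAt.hasFDerivAt
  have h2 := hd.comp_hasDerivAt s h1
  have h3 := shF_hasDeriv hφ hψ hm hH hK (r * ξ.1) ξ.2 s
  have h4 : HasDerivAt (fun s => mulF a φ ψ h δ r s ξ) _ s := h2.mul h3
  refine h4.congr_deriv ?_
  have e : fderiv ℝ a (δ * r * ξ.1, δ * s * ξ.2) (0, δ * ξ.2) = ((δ * ξ.2 : ℝ) : ℂ) * fderiv ℝ a (δ * r * ξ.1, δ * s * ξ.2) (0, 1) := by
    rw [show ((0 : ℝ), δ * ξ.2) = (δ * ξ.2) • ((0 : ℝ), (1 : ℝ)) by simp, map_smul, Complex.real_smul]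
  rw [e]
  simp only [mulF, Function.comp]
  have hs' : (s : ℂ) ≠ 0 := by exact_mod_cast hs.ne'
  have hδ' : (δ : ℂ) ≠ 0 := by exact_mod_cast hδ.ne'
  generalize fderiv ℝ a (δ * r * ξ.1, δ * s * ξ.2) (0, 1) = q1
  generalize shF φ ψ h (r * ξ.1, s * ξ.2) = q2
  generalize shF φ ψ (hder ψ h) (r * ξ.1, s * ξ.2) = q3
  generalize a (δ * r * ξ.1, δ * s * ξ.2) = q4
  push_cast
  field_simp

lemma norm_mulF_le_indicator {A : ℝ} (ha : Amp a A lo hi) (hm : Measurable h) (hH : ∀ t ∈ Icc (1/2 : ℝ) 2, ‖h t‖ ≤ H)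
    (hδ : 0 < δ) (hr : 0 < r) {s s0 : ℝ} (hs0 : 0 < s0) (hs : s0 ≤ s) (ξ : ℝ × ℝ) :
    ‖mulF a φ ψ h δ r s ξ‖ ≤ (Icc (-(hi / (δ * r))) (hi / (δ * r)) ×ˢ Icc (-(hi / (δ * s0))) (hi / (δ * s0))).indicator (fun _ => A * (2 * H)) ξ := by
  by_cases h0 : a (δ * r * ξ.1, δ * s * ξ.2) = 0
  · rw [mulF, h0, zero_mul, norm_zero]
    refine indicator_nonneg (fun _ _ => mul_nonneg ha.nn (by linarith [(norm_nonneg _).trans (hH 1 (by norm_num))])) ξ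
  · obtain ⟨-, h1, -, h2⟩ := ha.supp _ h0
    simp only [abs_mul, abs_of_pos hδ, abs_of_pos hr, abs_of_pos (hs0.trans_le hs)] at h1 h2
    have m1 : |ξ.1| ≤ hi / (δ * r) := by rw [le_div_iff₀ (by positivity)]; linarith
    have m2 : |ξ.2| ≤ hi / (δ * s0) := by
      rw [le_div_iff₀ (by positivity)]
      have := mul_le_mul_of_nonneg_left hs (show 0 ≤ |ξ.2| * δ by positivity)
      linarith
    rw [indicator_of_mem (show ξ ∈ _ ×ˢ _ from ⟨abs_le.1 m1, abs_le.1 m2⟩), mulF, norm_mul]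
    exact mul_le_mul (ha.bdd _) (norm_shF_le hm hH _) (norm_nonneg _) ha.nn

lemma opT_hasDeriv (S : SAmp a lo hi) (hφ : Measurable φ) (hψ : Measurable ψ) (hm : Measurable h)
    (hH : ∀ t ∈ Icc (1/2 : ℝ) 2, ‖h t‖ ≤ H) (hK : ∀ t ∈ Icc (1/2 : ℝ) 2, |ψ t| ≤ K) (hδ : 0 < δ) (hr : 0 < r)
    {s : ℝ} (hs : 0 < s) {f : ℝ × ℝ → ℂ} (hf : Nice f) (x : ℝ × ℝ) :
    HasDerivAt (fun s => opT a φ ψ h δ r s f x)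
      ((s⁻¹ : ℝ) * (opT (fun ξ => (ξ.2 : ℂ) * fderiv ℝ a ξ (0, 1)) φ ψ h δ r s f x +
        (δ⁻¹ : ℝ) * opT (fun ξ => (ξ.2 : ℂ) * a ξ) φ ψ (hder ψ h) δ r s f x)) s := by
  obtain ⟨A, ha⟩ := S.exists_amp
  obtain ⟨A1, ha1⟩ := S.deriv_snd.exists_amp
  obtain ⟨A2, ha2⟩ := S.mul_snd.exists_amp
  set a1 : ℝ × ℝ → ℂ := fun ξ => (ξ.2 : ℂ) * fderiv ℝ a ξ (0, 1) with ha1d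
  set a2 : ℝ × ℝ → ℂ := fun ξ => (ξ.2 : ℂ) * a ξ with ha2d
  have hm2 := hder_meas hψ hm
  have hH2 := hder_bdd hH hK
  have hFT := FT_continuous hf.int
  have c0 : ∀ s, 0 < s → Continuous (mulF a φ ψ h δ r s) := fun s hs => mulF_continuous ha hφ hψ hm hH hδ hr hs
  have c1 := mulF_continuous ha1 hφ hψ hm hH hδ hr hs
  have c2 := mulF_continuous ha2 hφ hψ hm2 hH2 hδ hr hs
  let bd : ℝ × ℝ → ℝ := (Icc (-(hi / (δ * r))) (hi / (δ * r)) ×ˢ Icc (-(hi / (δ * (s / 2)))) (hi / (δ * (s / 2)))).indicator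
    (fun _ => 2 * s⁻¹ * (A1 * (2 * H) + δ⁻¹ * (A2 * (2 * (2 * Real.pi * K * H)))) * ∫ x, ‖f x‖)
  have hbd : Integrable bd := by
    refine (integrable_indicator_iff (measurableSet_Icc.prod measurableSet_Icc)).2 ?_
    exact integrableOn_const (isCompact_Icc.prod isCompact_Icc).measure_lt_top.ne
  have key := hasDerivAt_integral_of_dominated_loc_of_deriv_le (μ := (volume : Measure (ℝ × ℝ))) (x₀ := s) (s := Ioi (s / 2))
    (F := fun s ξ => eI (2 * Real.pi * (x.1 * ξ.1 + x.2 * ξ.2)) * (mulF a φ ψ h δ r s ξ * FT f ξ))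
    (F' := fun s ξ => eI (2 * Real.pi * (x.1 * ξ.1 + x.2 * ξ.2)) * ((((s⁻¹ : ℝ) : ℂ) * (mulF a1 φ ψ h δ r s ξ + ((δ⁻¹ : ℝ) : ℂ) * mulF a2 φ ψ (hder ψ h) δ r s ξ)) * FT f ξ))
    (bound := bd) (Ioi_mem_nhds (by linarith))
    ?_ (integrable_eI_mul (by fun_prop) (mulF_FT_integrable ha hφ hψ hm hH hδ hr hs hf.int)) ?_ ?_ hbd ?_
  · refine key.2.congr_deriv ?_
    have i1 := mulF_FT_integrable ha1 hφ hψ hm hH hδ hr hs hf.int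
    have i2 := mulF_FT_integrable ha2 hφ hψ hm2 hH2 hδ hr hs hf.int
    have i2' : Integrable fun ξ => ((δ⁻¹ : ℝ) : ℂ) * (mulF a2 φ ψ (hder ψ h) δ r s ξ * FT f ξ) := i2.const_mul _
    unfold opT
    rw [FTinv_def _ x, FTinv_def _ x, ← integral_const_mul ((δ⁻¹ : ℝ) : ℂ)]
    rw [← integral_add (integrable_eI_mul (by fun_prop) i1) ((integrable_eI_mul (by fun_prop) i2).const_mul _), ← integral_const_mul]
    refine integral_congr_ae (ae_of_all _ fun ξ => ?_)
    simp only
    ring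
  · filter_upwards [Ioi_mem_nhds hs] with s' hs'
    have := c0 s' hs'
    exact Continuous.aestronglyMeasurable (by fun_prop)
  · exact Continuous.aestronglyMeasurable (by fun_prop)
  · refine ae_of_all _ fun ξ s' hs' => ?_
    have hs2 : s / 2 < s' := hs'
    have hs0 : 0 < s' := by linarith
    have b1 := norm_mulF_le_indicator (φ := φ) (ψ := ψ) ha1 hm hH hδ hr (by linarith : 0 < s / 2) hs2.le ξ
    have b2 := norm_mulF_le_indicator (φ := φ) (ψ := ψ) ha2 hm2 hH2 hδ hr (by linarith : 0 < s / 2) hs2.le ξ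
    have b3 : s'⁻¹ ≤ 2 * s⁻¹ := by
      rw [← div_eq_mul_inv, inv_le_comm₀ hs0 (by positivity), inv_div]; exact hs2.le
    rw [norm_mul, norm_eI, one_mul, norm_mul, norm_mul, Complex.norm_real, Real.norm_of_nonneg (inv_nonneg.2 hs0.le)]
    have b4 : ‖mulF a1 φ ψ h δ r s' ξ + ((δ⁻¹ : ℝ) : ℂ) * mulF a2 φ ψ (hder ψ h) δ r s' ξ‖ ≤
        ‖mulF a1 φ ψ h δ r s' ξ‖ + δ⁻¹ * ‖mulF a2 φ ψ (hder ψ h) δ r s' ξ‖ := by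
      refine (norm_add_le _ _).trans (le_of_eq ?_)
      rw [norm_mul, Complex.norm_real, Real.norm_of_nonneg (inv_nonneg.2 hδ.le)]
    simp only [bd]
    by_cases hmem : ξ ∈ Icc (-(hi / (δ * r))) (hi / (δ * r)) ×ˢ Icc (-(hi / (δ * (s / 2)))) (hi / (δ * (s / 2)))
    · rw [indicator_of_mem hmem] at b1 b2 ⊢
      have b5 := b4.trans (add_le_add b1 (mul_le_mul_of_nonneg_left b2 (inv_nonneg.2 hδ.le)))
      refine mul_le_mul (mul_le_mul b3 b5 (norm_nonneg _) (by positivity)) (norm_FT_le f ξ) (norm_nonneg _) ?_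
      exact mul_nonneg (by positivity) ((norm_nonneg _).trans b5)
    · rw [indicator_of_notMem hmem] at b1 b2 ⊢
      have b5 := b4.trans (add_le_add b1 (mul_le_mul_of_nonneg_left b2 (inv_nonneg.2 hδ.le)))
      have b6 : ‖mulF a1 φ ψ h δ r s' ξ + ((δ⁻¹ : ℝ) : ℂ) * mulF a2 φ ψ (hder ψ h) δ r s' ξ‖ = 0 :=
        le_antisymm (b5.trans (by simp)) (norm_nonneg _)
      rw [b6]; simp
  · refine ae_of_all _ fun ξ s' hs' => ?_
    have hs0 : 0 < s' := lt_trans (by linarith) (show s / 2 < s' from hs')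
    exact ((mulF_hasDeriv (r := r) S hφ hψ hm hH hK hδ hs0 ξ).mul_const (FT f ξ)).const_mul _

end

lemma summable_geom_natAbs : Summable fun m : ℤ => (2:ℝ)⁻¹ ^ m.natAbs := by
  refine Summable.of_nat_of_neg ?_ ?_
  · simpa using summable_geometric_of_lt_one (r := (2:ℝ)⁻¹) (by norm_num) (by norm_num)
  · simpa using summable_geometric_of_lt_one (r := (2:ℝ)⁻¹) (by norm_num) (by norm_num)

/-- The lacunarity constant of dyadic families. -/
def lacL : ℝ := 8 * ∑' m : ℤ, (2:ℝ)⁻¹ ^ m.natAbs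

lemma lacL_nonneg : 0 ≤ lacL := mul_nonneg (by norm_num) (tsum_nonneg fun m => by positivity)

lemma LacSum_dyadic {ι : Type*} [Fintype ι] {t v : ι → ℝ} {k : ι → ℤ} {y : ℝ} (hk : Function.Injective k) (hy : 0 < y)
    (hv : ∀ i, v i ∈ Icc (1/2 : ℝ) 4) (ht : ∀ i, t i = y * ((2:ℝ) ^ k i * v i)) : LacSum t lacL where
  pos i := by
    rw [ht]
    have : 0 < v i := by linarith [(hv i).1]
    positivity
  sum x hx := by
    obtain ⟨k0, h1, h2⟩ := exists_mem_Ico_zpow (mul_pos hx hy) (show (1:ℝ) < 2 by norm_num)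
    have hle : ∀ i, min (x * t i) (x * t i)⁻¹ ≤ 8 * (2:ℝ)⁻¹ ^ (k i + k0).natAbs := by
      intro i
      obtain ⟨hv1, hv2⟩ := hv i
      set m : ℤ := k i + k0 with hm
      have e1 : x * t i = (x * y) * (2:ℝ) ^ k i * v i := by rw [ht]; ring
      have hp : (0:ℝ) < 2 ^ k i := by positivity
      have em : (2:ℝ) ^ m = 2 ^ k0 * 2 ^ k i := by rw [hm, zpow_add₀ (by norm_num), mul_comm]
      have up : x * t i ≤ 8 * 2 ^ m := by
        rw [e1, em]
        rw [zpow_add_one₀ (by norm_num)] at h2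
        have a1 : x * y * 2 ^ k i ≤ 2 ^ k0 * 2 * 2 ^ k i := mul_le_mul_of_nonneg_right h2.le hp.le
        have a2 := mul_le_mul a1 hv2 (by linarith) (by positivity)
        linarith
      have low : 2 ^ m / 2 ≤ x * t i := by
        rw [e1, em]
        have a1 : 2 ^ k0 * 2 ^ k i ≤ x * y * 2 ^ k i := mul_le_mul_of_nonneg_right h1 hp.le
        have a2 := mul_le_mul a1 hv1 (by norm_num) (by positivity)
        linarith
      rcases le_total m 0 with h | h
      · refine (min_le_left _ _).trans (up.trans (le_of_eq ?_))
        congr 1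
        have : m = -(m.natAbs : ℤ) := by omega
        conv_lhs => rw [this, zpow_neg, zpow_natCast]
        rw [inv_pow]
      · refine (min_le_right _ _).trans ?_
        have : (2:ℝ) ^ m = 2 ^ m.natAbs := by
          have : m = (m.natAbs : ℤ) := by omega
          conv_lhs => rw [this, zpow_natCast]
        rw [inv_pow, ← this]
        calc (x * t i)⁻¹ ≤ (2 ^ m / 2)⁻¹ := inv_anti₀ (by positivity) low
          _ = 2 * (2 ^ m)⁻¹ := by rw [inv_div, div_eq_mul_inv]
          _ ≤ _ := mul_le_mul_of_nonneg_right (by norm_num) (by positivity)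
    have hinj : Function.Injective fun i => k i + k0 := fun a b h => hk (add_right_cancel h)
    calc ∑ i, min (x * t i) (x * t i)⁻¹ ≤ ∑ i, 8 * (2:ℝ)⁻¹ ^ (k i + k0).natAbs := Finset.sum_le_sum fun i _ => hle i
      _ = 8 * ∑ m ∈ Finset.univ.image (fun i => k i + k0), (2:ℝ)⁻¹ ^ m.natAbs := by
          rw [Finset.sum_image hinj.injOn, Finset.mul_sum]
      _ ≤ lacL := mul_le_mul_of_nonneg_left (summable_geom_natAbs.sum_le_tsum _ fun _ _ => by positivity) (by norm_num)

lemma Lac2_dyadic (b : ℝ) (J S : Finset ℤ) {v : ℤ → ℝ} (hv : ∀ n, v n ∈ Icc (1/2 : ℝ) 4) :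
    Lac2 (fun j : J => (2:ℝ) ^ (-((j : ℤ) : ℝ))) (fun d : J × S => (2:ℝ) ^ (-(((d.1 : ℤ) : ℝ) * b)) * ((2:ℝ) ^ (d.2 : ℤ) * v d.2)) lacL where
  nn := lacL_nonneg
  one := LacSum_dyadic (k := fun j : J => -(j : ℤ)) (v := fun _ => 1) (y := 1) (fun a b h => Subtype.ext (neg_injective h)) one_pos
    (fun _ => by norm_num) fun j => by
      rw [one_mul, mul_one, ← Real.rpow_intCast]; push_cast; rfl
  pos d := by
    have : 0 < v d.2 := by linarith [(hv d.2).1]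
    positivity
  two j := LacSum_dyadic (k := fun n : S => (n : ℤ)) (v := fun n => v n) (y := (2:ℝ) ^ (-(((j : ℤ) : ℝ) * b))) Subtype.val_injective
    (by positivity) (fun n => hv n) fun n => rfl

lemma covN_attained {A : Set ℝ} {δ : ℝ} (hA : A ⊆ Icc 1 2) (hδ : 0 < δ) :
    (∃ F : Finset ℝ, F.card = covN A δ ∧ A ⊆ ⋃ a ∈ F, Icc a (a + δ)) ∧ covN A δ ≤ ⌈δ⁻¹⌉₊ + 1 := by
  have h0 : A ⊆ ⋃ a ∈ (Finset.range (⌈δ⁻¹⌉₊ + 1)).image (fun i : ℕ => 1 + i * δ), Icc a (a + δ) := by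
    intro x hx
    obtain ⟨h1, h2⟩ := hA hx
    have hq : 0 ≤ (x - 1) / δ := div_nonneg (by linarith) hδ.le
    refine mem_iUnion₂.2 ⟨1 + ⌊(x - 1) / δ⌋₊ * δ, Finset.mem_image_of_mem _ (Finset.mem_range.2 ?_), ?_, ?_⟩
    · have : ((⌊(x - 1) / δ⌋₊ : ℕ) : ℝ) ≤ ⌈δ⁻¹⌉₊ := (Nat.floor_le hq).trans (le_trans (by
        rw [div_eq_mul_inv]; exact mul_le_of_le_one_left (by positivity) (by linarith)) (Nat.le_ceil _))
      have : ⌊(x - 1) / δ⌋₊ ≤ ⌈δ⁻¹⌉₊ := by exact_mod_cast this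
      omega
    · have := Nat.floor_le hq
      rw [le_div_iff₀ hδ] at this
      linarith
    · have := (Nat.lt_floor_add_one ((x - 1) / δ)).le
      rw [div_le_iff₀ hδ] at this
      linarith
  have hne : {n : ℕ | ∃ F : Finset ℝ, F.card = n ∧ A ⊆ ⋃ a ∈ F, Icc a (a + δ)}.Nonempty := ⟨_, _, rfl, h0⟩
  refine ⟨Nat.sInf_mem hne, ?_⟩
  refine le_trans (Nat.sInf_le ⟨_, rfl, h0⟩) (Finset.card_image_le.trans (by simp))

/-- Uniform coverings of the dyadic pieces, with cardinality controlled by `Kp`. -/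
lemma exists_covering (U : Set ℝ) {δ p : ℝ} (hδ : 0 < δ) (hδ2 : δ ≤ 1 / 2) (hp : 1 < p) :
    ∃ N : ℕ, δ ^ (1 - 1 / p) * (N : ℝ) ^ (1 / p) ≤ Kp U δ p ∧
      ∃ a : ℤ → Fin N → ℝ, (∀ n i, a n i ∈ Icc (1/2 : ℝ) 2) ∧ ∀ n, ∀ v ∈ UrSet U ((2:ℝ) ^ n), ∃ i, v ∈ Icc (a n i) (a n i + δ) := by
  have hsub : ∀ r, UrSet U r ⊆ Icc 1 2 := fun r x hx => hx.1
  have hp0 : 0 < p := by linarith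
  set B : ℝ := ⨆ r : {r : ℝ // 0 < r}, ((covN (UrSet U (r : ℝ)) δ : ℝ)) ^ (1 / p) with hB
  have hbdd : BddAbove (range fun r : {r : ℝ // 0 < r} => ((covN (UrSet U (r : ℝ)) δ : ℝ)) ^ (1 / p)) := by
    refine ⟨((⌈δ⁻¹⌉₊ + 1 : ℕ) : ℝ) ^ (1 / p), ?_⟩
    rintro _ ⟨r, rfl⟩
    exact Real.rpow_le_rpow (by positivity) (by exact_mod_cast (covN_attained (hsub r) hδ).2) (by positivity)
  have hle : ∀ r : ℝ, 0 < r → ((covN (UrSet U r) δ : ℝ)) ^ (1 / p) ≤ B := fun r hr => le_ciSup hbdd ⟨r, hr⟩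
  have hB0 : 0 ≤ B := (Real.rpow_nonneg (Nat.cast_nonneg _) _).trans (hle 1 one_pos)
  refine ⟨⌊B ^ p⌋₊, ?_, ?_⟩
  · refine mul_le_mul_of_nonneg_left ?_ (Real.rpow_nonneg hδ.le _)
    calc ((⌊B ^ p⌋₊ : ℕ) : ℝ) ^ (1 / p) ≤ (B ^ p) ^ (1 / p) :=
          Real.rpow_le_rpow (Nat.cast_nonneg _) (Nat.floor_le (Real.rpow_nonneg hB0 _)) (by positivity)
      _ = B := by rw [← Real.rpow_mul hB0, mul_one_div_cancel hp0.ne', Real.rpow_one]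
  · have hex : ∀ n : ℤ, ∃ a : Fin ⌊B ^ p⌋₊ → ℝ, (∀ i, a i ∈ Icc (1/2 : ℝ) 2) ∧
        ∀ v ∈ UrSet U ((2:ℝ) ^ n), ∃ i, v ∈ Icc (a i) (a i + δ) := by
      intro n
      obtain ⟨F, hF, hcov⟩ := (covN_attained (hsub ((2:ℝ) ^ n)) hδ).1
      have hcard : F.card ≤ ⌊B ^ p⌋₊ := by
        rw [hF]
        refine Nat.le_floor ?_
        have := Real.rpow_le_rpow (by positivity) (hle ((2:ℝ) ^ n) (by positivity)) hp0.le
        rwa [← Real.rpow_mul (by positivity), one_div_mul_cancel hp0.ne', Real.rpow_one] at this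
      let a0 : Fin ⌊B ^ p⌋₊ → ℝ := fun i => if h : (i : ℕ) < F.card then (F.equivFin.symm ⟨i, h⟩ : ℝ) else 1
      refine ⟨fun i => if a0 i ∈ Icc (1/2 : ℝ) 2 then a0 i else 1, fun i => ?_, fun v hv => ?_⟩
      · dsimp only
        split_ifs with h
        · exact h
        · norm_num
      · obtain ⟨x, hx, hvx⟩ := mem_iUnion₂.1 (hcov hv)
        have hi := (F.equivFin ⟨x, hx⟩).2
        refine ⟨⟨F.equivFin ⟨x, hx⟩, hi.trans_le hcard⟩, ?_⟩
        have e : a0 ⟨F.equivFin ⟨x, hx⟩, hi.trans_le hcard⟩ = x := by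
          simp only [a0, hi, dif_pos, Fin.eta, Equiv.symm_apply_apply]
        have hx2 : x ∈ Icc (1/2 : ℝ) 2 := by
          obtain ⟨h1, h2⟩ := hsub _ hv
          exact ⟨by linarith [hvx.2], by linarith [hvx.1]⟩
        simp only [e, if_pos hx2]
        exact hvx
    choose a ha using hex
    exact ⟨a, fun n => (ha n).1, fun n => (ha n).2⟩

lemma enorm_le_lintegral_deriv {g g' : ℝ → ℂ} (hd : ∀ s ∈ Icc (0:ℝ) 1, HasDerivAt g (g' s) s) (hm : Measurable g)
    (hm' : Measurable g') {t : ℝ} (ht : t ∈ Icc (0:ℝ) 1) : ‖g t‖ₑ ≤ ∫⁻ s in Icc (0:ℝ) 1, (‖g s‖ₑ + ‖g' s‖ₑ) := by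
  rw [lintegral_add_left hm.enorm]
  by_cases hfin : (∫⁻ s in Icc (0:ℝ) 1, ‖g' s‖ₑ) = ⊤
  · rw [hfin, add_top]; exact le_top
  have hi : IntegrableOn g' (Icc 0 1) := ⟨hm'.aestronglyMeasurable, lt_top_iff_ne_top.2 hfin⟩
  have key : ∀ s ∈ Icc (0:ℝ) 1, ‖g t‖ₑ ≤ ‖g s‖ₑ + ∫⁻ s in Icc (0:ℝ) 1, ‖g' s‖ₑ := by
    intro s hs
    have hsub : uIcc s t ⊆ Icc 0 1 := uIcc_subset_Icc hs ht
    have h1 := intervalIntegral.integral_eq_sub_of_hasDerivAt (fun x hx => hd x (hsub hx))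
      ((intervalIntegrable_iff.2 (hi.mono_set (uIoc_subset_uIcc.trans hsub))))
    have h2 : g t = g s + ∫ y in s..t, g' y := by rw [h1]; ring
    rw [h2]
    refine (enorm_add_le _ _).trans (add_le_add le_rfl ?_)
    rw [← ofReal_norm, intervalIntegral.norm_integral_eq_norm_integral_uIoc, ofReal_norm]
    exact (enorm_integral_le_lintegral_enorm _).trans (lintegral_mono_set (uIoc_subset_uIcc.trans hsub))
  calc ‖g t‖ₑ = ∫⁻ s in Icc (0:ℝ) 1, ‖g t‖ₑ := by simp
    _ ≤ ∫⁻ s in Icc (0:ℝ) 1, (‖g s‖ₑ + ∫⁻ s in Icc (0:ℝ) 1, ‖g' s‖ₑ) := setLIntegral_mono' measurableSet_Icc key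
    _ = _ := by rw [lintegral_add_left hm.enorm]; simp

lemma lintegral_rpow_le_of_unit {E : ℝ → ℝ≥0∞} (hE : Measurable E) {p : ℝ} (hp : 1 ≤ p) :
    (∫⁻ s in Icc (0:ℝ) 1, E s) ^ p ≤ ∫⁻ s in Icc (0:ℝ) 1, E s ^ p := by
  haveI : IsProbabilityMeasure (volume.restrict (Icc (0:ℝ) 1)) := ⟨by simp⟩
  have h := eLpNorm_le_eLpNorm_of_exponent_le (μ := volume.restrict (Icc (0:ℝ) 1)) (f := E) (p := 1) (q := ENNReal.ofReal p)
    (by simpa using hp) hE.aestronglyMeasurable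
  rw [eLpNorm_one_eq_lintegral_enorm, eLpNorm_eq_lintegral_rpow_enorm_toReal (by simp; linarith) (by simp),
    ENNReal.toReal_ofReal (by linarith)] at h
  simp only [enorm_eq_self, one_div] at h
  rwa [← ENNReal.le_rpow_inv_iff (by linarith)]

lemma rpow_three_le {x y z : ℝ≥0∞} {p : ℝ} (hp : 1 ≤ p) (hp2 : p ≤ 2) :
    (x + 2 * y + 2 * z) ^ p ≤ 36 * (x ^ p + y ^ p + z ^ p) := by
  set m := max x (max y z) with hm
  have h1 : x + 2 * y + 2 * z ≤ 6 * m := by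
    have hx : x ≤ m := le_max_left _ _
    have hy : y ≤ m := (le_max_left _ _).trans (le_max_right _ _)
    have hz : z ≤ m := (le_max_right _ _).trans (le_max_right _ _)
    calc x + 2 * y + 2 * z ≤ 2 * m + 2 * m + 2 * m := by
          gcongr
          exact hx.trans (le_mul_of_one_le_left zero_le (by norm_num))
      _ = _ := by ring
  have h2 : m ^ p ≤ x ^ p + y ^ p + z ^ p := by
    rcases max_choice x (max y z) with h | h
    · rw [hm, h, add_assoc]; exact le_self_add
    · rcases max_choice y z with h' | h'
      · rw [hm, h, h']; exact le_add_self.trans le_self_add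
      · rw [hm, h, h']; exact le_add_self
  calc _ ≤ (6 * m) ^ p := ENNReal.rpow_le_rpow h1 (by linarith)
    _ = 6 ^ p * m ^ p := ENNReal.mul_rpow_of_nonneg _ _ (by linarith)
    _ ≤ 36 * _ := by
      gcongr
      calc (6:ℝ≥0∞) ^ p ≤ 6 ^ (2:ℝ) := ENNReal.rpow_le_rpow_of_exponent_le (by norm_num) hp2
        _ = 36 := by norm_num

lemma lintegral_unit_three_le {Φ : Fin 3 → ℝ → ℝ × ℝ → ℝ≥0∞} {M : ℝ≥0∞}
    (hm : ∀ k, Measurable fun y : ℝ × (ℝ × ℝ) => Φ k y.1 y.2) (hb : ∀ k, ∀ s ∈ Icc (0:ℝ) 1, ∫⁻ x, Φ k s x ≤ M) :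
    ∫⁻ x, (∫⁻ s in Icc (0:ℝ) 1, 36 * ∑ k, Φ k s x) ≤ 108 * M := by
  have hms : Measurable fun y : ℝ × (ℝ × ℝ) => 36 * ∑ k, Φ k y.1 y.2 :=
    (Finset.measurable_sum _ fun k _ => hm k).const_mul _
  rw [lintegral_lintegral_swap (f := fun x s => 36 * ∑ k, Φ k s x) (hms.comp measurable_swap).aemeasurable]
  calc ∫⁻ s in Icc (0:ℝ) 1, (∫⁻ x, 36 * ∑ k, Φ k s x) ≤ ∫⁻ s in Icc (0:ℝ) 1, 108 * M := by
        refine setLIntegral_mono' measurableSet_Icc fun s hs => ?_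
        have hm1 : ∀ k, Measurable fun x => Φ k s x := fun k => (hm k).comp measurable_prodMk_left
        rw [lintegral_const_mul _ (Finset.measurable_sum _ fun k _ => hm1 k), lintegral_finsetSum _ fun k _ => hm1 k]
        have := Finset.sum_le_sum fun k (_ : k ∈ (Finset.univ : Finset (Fin 3))) => hb k s hs
        rw [Finset.sum_const, Finset.card_univ, Fintype.card_fin, nsmul_eq_mul] at this
        refine (mul_le_mul_right this _).trans (le_of_eq ?_)
        rw [← mul_assoc]; norm_num
    _ = _ := by simp

/-- The real-variable input of the reduction of a supremum over a dilation set to lacunary families. -/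
structure DilFam (T : Fin 3 → ℤ → ℝ → ℝ × ℝ → ℂ) (δ p : ℝ) (M : ℝ≥0∞) : Prop where
  δ_pos : 0 < δ
  δ_le : δ ≤ 1
  deriv : ∀ j s x, 0 < s → HasDerivAt (fun s => T 0 j s x) ((s⁻¹ : ℝ) * (T 1 j s x + (δ⁻¹ : ℝ) * T 2 j s x)) s
  meas : ∀ k j, Measurable fun y : ℝ × (ℝ × ℝ) => T k j y.1 y.2
  max : ∀ k (J S : Finset ℤ) (v : ℤ → ℝ), (∀ n, v n ∈ Icc (1/2 : ℝ) 4) →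
    ∫⁻ x, (⨆ n : S, ‖∑ j : J, T k j ((2:ℝ) ^ (n : ℤ) * v n) x‖ₑ) ^ p ≤ M

section
variable {T : Fin 3 → ℤ → ℝ → ℝ × ℝ → ℂ} {δ p : ℝ} {M : ℝ≥0∞} (D : DilFam T δ p M) (hp : 1 ≤ p) (hp2 : p ≤ 2)
include D

lemma DilFam.sum_meas (k : Fin 3) (J : Finset ℤ) : Measurable fun y : ℝ × (ℝ × ℝ) => ∑ j ∈ J, T k j y.1 y.2 :=
  Finset.measurable_sum _ fun j _ => D.meas k j

include hp

lemma DilFam.max_all (k : Fin 3) (J : Finset ℤ) {v : ℤ → ℝ} (hv : ∀ n, v n ∈ Icc (1/2 : ℝ) 4) :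
    ∫⁻ x, (⨆ n : ℤ, ‖∑ j ∈ J, T k j ((2:ℝ) ^ n * v n) x‖ₑ) ^ p ≤ M := by
  have hmeas : ∀ n : ℤ, Measurable fun x => ‖∑ j ∈ J, T k j ((2:ℝ) ^ n * v n) x‖ₑ := fun n =>
    ((D.sum_meas k J).comp measurable_prodMk_left).enorm
  have h0 : ∀ x, (⨆ n : ℤ, ‖∑ j ∈ J, T k j ((2:ℝ) ^ n * v n) x‖ₑ) ^ p ≤
      ⨆ S : ℕ, (⨆ n : Finset.Icc (-(S:ℤ)) S, ‖∑ j ∈ J, T k j ((2:ℝ) ^ (n:ℤ) * v n) x‖ₑ) ^ p := by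
    intro x
    refine iSup_rpow_le (by linarith) fun n => ?_
    refine le_trans ?_ (le_iSup _ n.natAbs)
    refine ENNReal.rpow_le_rpow ?_ (by linarith)
    exact le_iSup (fun n : Finset.Icc (-((n.natAbs:ℕ):ℤ)) n.natAbs => ‖∑ j ∈ J, T k j ((2:ℝ) ^ (n:ℤ) * v n) x‖ₑ)
      ⟨n, by rw [Finset.mem_Icc]; omega⟩
  refine (lintegral_mono h0).trans ?_
  rw [lintegral_iSup (f := fun (S : ℕ) x => (⨆ n : Finset.Icc (-(S:ℤ)) S, ‖∑ j ∈ J, T k j ((2:ℝ) ^ (n:ℤ) * v n) x‖ₑ) ^ p)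
    (fun S => (Measurable.iSup fun n : Finset.Icc (-(S:ℤ)) S => hmeas n).pow_const p) ?_]
  · refine iSup_le fun S => ?_
    have := D.max k J (Finset.Icc (-(S:ℤ)) S) v hv
    simpa only [← Finset.sum_coe_sort J] using this
  · intro S S' h x
    refine ENNReal.rpow_le_rpow ?_ (by linarith)
    refine iSup_le fun n => ?_
    have := Finset.mem_Icc.1 n.2
    exact le_iSup (fun n : Finset.Icc (-(S':ℤ)) S' => ‖∑ j ∈ J, T k j ((2:ℝ) ^ (n:ℤ) * v n) x‖ₑ)
      ⟨n, by rw [Finset.mem_Icc]; have : (S:ℤ) ≤ S' := by exact_mod_cast h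
             omega⟩

include hp2

lemma DilFam.local_sup {N : ℕ} {a : ℤ → Fin N → ℝ} (ha : ∀ n i, a n i ∈ Icc (1/2 : ℝ) 2) (J : Finset ℤ) (n : ℤ) (i : Fin N)
    {v : ℝ} (hv : v ∈ Icc (a n i) (a n i + δ)) (x : ℝ × ℝ) :
    ‖∑ j ∈ J, T 0 j ((2:ℝ) ^ n * v) x‖ₑ ^ p ≤ ∫⁻ s in Icc (0:ℝ) 1,
      36 * ∑ k : Fin 3, (⨆ n : ℤ, ‖∑ j ∈ J, T k j ((2:ℝ) ^ n * (a n i + s * δ)) x‖ₑ) ^ p := by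
  have hδ := D.δ_pos
  set F : Fin 3 → ℝ → ℂ := fun k s => ∑ j ∈ J, T k j ((2:ℝ) ^ n * (a n i + s * δ)) x with hF
  have hFm : ∀ k, Measurable (F k) := fun k => (D.sum_meas k J).comp (g := fun y : ℝ × (ℝ × ℝ) => ∑ j ∈ J, T k j y.1 y.2)
    (f := fun s : ℝ => ((2:ℝ) ^ n * (a n i + s * δ), x)) (by fun_prop)
  set g' : ℝ → ℂ := fun s => (((a n i + s * δ)⁻¹ * δ : ℝ) : ℂ) * (F 1 s + (δ⁻¹ : ℝ) * F 2 s) with hg'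
  have hp0 : (0:ℝ) < 2 ^ n := by positivity
  have hd : ∀ s ∈ Icc (0:ℝ) 1, HasDerivAt (F 0) (g' s) s := by
    intro s hs
    have hpos : 0 < a n i + s * δ := by nlinarith [(ha n i).1, hs.1, mul_nonneg hs.1 hδ.le]
    have h1 : ∀ j ∈ J, HasDerivAt (fun s => T 0 j ((2:ℝ) ^ n * (a n i + s * δ)) x)
        (((2:ℝ) ^ n * δ) • ((((2:ℝ) ^ n * (a n i + s * δ))⁻¹ : ℝ) * (T 1 j ((2:ℝ) ^ n * (a n i + s * δ)) x +
          (δ⁻¹ : ℝ) * T 2 j ((2:ℝ) ^ n * (a n i + s * δ)) x))) s := by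
      intro j _
      have hlin : HasDerivAt (fun s : ℝ => (2:ℝ) ^ n * (a n i + s * δ)) ((2:ℝ) ^ n * δ) s := by
        have := ((((hasDerivAt_id s).mul_const δ).const_add (a n i)).const_mul ((2:ℝ) ^ n))
        simpa using this
      have hT := D.deriv j ((2:ℝ) ^ n * (a n i + s * δ)) x (mul_pos hp0 hpos)
      exact hT.scomp s hlin
    refine (HasDerivAt.fun_sum h1).congr_deriv ?_
    simp only [hg', hF, Finset.mul_sum, ← Finset.sum_add_distrib]
    refine Finset.sum_congr rfl fun j _ => ?_
    have e : ((2:ℝ) ^ n * δ) * ((2:ℝ) ^ n * (a n i + s * δ))⁻¹ = (a n i + s * δ)⁻¹ * δ := by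
      generalize a n i + s * δ = w at hpos ⊢
      field_simp
    rw [Complex.real_smul, ← mul_assoc, ← Complex.ofReal_mul, e]
  obtain ⟨t, ht, rfl⟩ : ∃ t ∈ Icc (0:ℝ) 1, v = a n i + t * δ := by
    refine ⟨(v - a n i) / δ, ⟨div_nonneg (by linarith [hv.1]) hδ.le, (div_le_one hδ).2 (by linarith [hv.2])⟩, ?_⟩
    field_simp; ring
  have h1 := enorm_le_lintegral_deriv hd (hFm 0) (by have := hFm 1; have := hFm 2; fun_prop) ht
  have h2 : ∀ s ∈ Icc (0:ℝ) 1, ‖F 0 s‖ₑ + ‖g' s‖ₑ ≤ ‖F 0 s‖ₑ + 2 * ‖F 1 s‖ₑ + 2 * ‖F 2 s‖ₑ := by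
    intro s hs
    rw [add_assoc]
    refine add_le_add le_rfl ?_
    have hlow : 1/2 ≤ a n i + s * δ := by nlinarith [(ha n i).1, hs.1, mul_nonneg hs.1 hδ.le]
    have hinv : (a n i + s * δ)⁻¹ ≤ 2 := by
      rw [inv_le_comm₀ (by linarith) (by norm_num)]; linarith
    have hn : ‖g' s‖ ≤ 2 * ‖F 1 s‖ + 2 * ‖F 2 s‖ := by
      have e : g' s = (((a n i + s * δ)⁻¹ * δ : ℝ) : ℂ) * F 1 s + (((a n i + s * δ)⁻¹ : ℝ) : ℂ) * F 2 s := by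
        have : (((a n i + s * δ)⁻¹ : ℝ) : ℂ) = (((a n i + s * δ)⁻¹ * δ : ℝ) : ℂ) * (δ⁻¹ : ℝ) := by
          rw [← Complex.ofReal_mul]; congr 1; field_simp
        rw [this, hg']; ring
      rw [e]
      refine (norm_add_le _ _).trans (add_le_add ?_ ?_)
      · rw [norm_mul, Complex.norm_real, Real.norm_of_nonneg (by positivity)]
        refine mul_le_mul_of_nonneg_right ?_ (norm_nonneg _)
        nlinarith [D.δ_le]
      · rw [norm_mul, Complex.norm_real, Real.norm_of_nonneg (by positivity)]
        exact mul_le_mul_of_nonneg_right hinv (norm_nonneg _)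
    rw [← ofReal_norm, ← ofReal_norm, ← ofReal_norm]
    refine (ENNReal.ofReal_le_ofReal hn).trans (le_of_eq ?_)
    rw [ENNReal.ofReal_add (by positivity) (by positivity), ENNReal.ofReal_mul (by norm_num), ENNReal.ofReal_mul (by norm_num)]
    norm_num
  have h3 := h1.trans (setLIntegral_mono' measurableSet_Icc h2)
  refine (ENNReal.rpow_le_rpow h3 (by linarith)).trans ?_
  refine (lintegral_rpow_le_of_unit (by have := hFm 0; have := hFm 1; have := hFm 2; fun_prop) hp).trans ?_
  refine lintegral_mono fun s => (rpow_three_le hp hp2).trans ?_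
  rw [Fin.sum_univ_three]
  have h4 : ∀ k, ‖F k s‖ₑ ≤ ⨆ n : ℤ, ‖∑ j ∈ J, T k j ((2:ℝ) ^ n * (a n i + s * δ)) x‖ₑ := fun k =>
    le_iSup (fun n : ℤ => ‖∑ j ∈ J, T k j ((2:ℝ) ^ n * (a n i + s * δ)) x‖ₑ) n
  exact mul_le_mul_right (add_le_add (add_le_add (ENNReal.rpow_le_rpow (h4 0) (by linarith)) (ENNReal.rpow_le_rpow (h4 1) (by linarith)))
    (ENNReal.rpow_le_rpow (h4 2) (by linarith))) _

lemma DilFam.sup_le {U : Set ℝ} (hU : U ⊆ Ioi 0) {N : ℕ} {a : ℤ → Fin N → ℝ} (ha : ∀ n i, a n i ∈ Icc (1/2 : ℝ) 2)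
    (hc : ∀ n, ∀ v ∈ UrSet U ((2:ℝ) ^ n), ∃ i, v ∈ Icc (a n i) (a n i + δ)) :
    ∫⁻ x, (⨆ u : U, ‖∑' j : ℤ, T 0 j u x‖ₑ) ^ p ≤ N * (108 * M) := by
  have hδ := D.δ_pos
  set J : ℕ → Finset ℤ := fun R => Finset.Icc (-(R:ℤ)) R with hJ
  set H : ℕ → Fin N → ℝ → ℝ × ℝ → ℝ≥0∞ := fun R i s x =>
    36 * ∑ k : Fin 3, (⨆ n : ℤ, ‖∑ j ∈ J R, T k j ((2:ℝ) ^ n * (a n i + s * δ)) x‖ₑ) ^ p with hH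
  have hbase : ∀ R k i (n : ℤ), Measurable fun y : ℝ × (ℝ × ℝ) => ‖∑ j ∈ J R, T k j ((2:ℝ) ^ n * (a n i + y.1 * δ)) y.2‖ₑ :=
    fun R k i n => ((D.sum_meas k (J R)).comp (g := fun y : ℝ × (ℝ × ℝ) => ∑ j ∈ J R, T k j y.1 y.2)
      (f := fun y : ℝ × (ℝ × ℝ) => ((2:ℝ) ^ n * (a n i + y.1 * δ), y.2)) (by fun_prop)).enorm
  have hΦ : ∀ R i k, Measurable fun y : ℝ × (ℝ × ℝ) =>
      (⨆ n : ℤ, ‖∑ j ∈ J R, T k j ((2:ℝ) ^ n * (a n i + y.1 * δ)) y.2‖ₑ) ^ p :=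
    fun R i k => (Measurable.iSup fun n => hbase R k i n).pow_const p
  have hHm : ∀ R i, Measurable fun y : ℝ × (ℝ × ℝ) => H R i y.1 y.2 := fun R i =>
    (Finset.measurable_sum _ fun k _ => hΦ R i k).const_mul _
  set G : ℕ → ℝ × ℝ → ℝ≥0∞ := fun R x => ∑ i, ∫⁻ s in Icc (0:ℝ) 1, H R i s x with hG
  have hHm2 : ∀ R i, Measurable fun x : ℝ × ℝ => ∫⁻ s in Icc (0:ℝ) 1, H R i s x := fun R i =>
    (hHm R i).lintegral_prod_left'
  have hGm : ∀ R, Measurable (G R) := fun R => Finset.measurable_sum _ fun i _ => hHm2 R i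
  have hGint : ∀ R, ∫⁻ x, G R x ≤ N * (108 * M) := by
    intro R
    rw [lintegral_finsetSum _ fun i _ => hHm2 R i]
    have : ∀ i ∈ (Finset.univ : Finset (Fin N)), ∫⁻ x, (∫⁻ s in Icc (0:ℝ) 1, H R i s x) ≤ 108 * M := fun i _ => by
      refine lintegral_unit_three_le (hΦ R i) fun k s hs => D.max_all hp k (J R) fun n => ?_
      exact ⟨by nlinarith [(ha n i).1, mul_nonneg hs.1 hδ.le], by nlinarith [(ha n i).2, hs.2, hs.1, D.δ_le]⟩
    refine (Finset.sum_le_sum this).trans (le_of_eq ?_)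
    simp
  have hpt : ∀ x, (⨆ u : U, ‖∑' j : ℤ, T 0 j u x‖ₑ) ^ p ≤ liminf (fun R => G R x) atTop := by
    intro x
    refine iSup_rpow_le (by linarith) fun u => ?_
    by_cases hs : Summable fun j : ℤ => T 0 j u x
    swap
    · rw [tsum_eq_zero_of_not_summable hs]; simp [show 0 < p by linarith]
    have hlim : Tendsto (fun R : ℕ => ‖∑ j ∈ J R, T 0 j u x‖ₑ ^ p) atTop (𝓝 (‖∑' j : ℤ, T 0 j u x‖ₑ ^ p)) := by
      have h1 : Tendsto J atTop atTop := by
        refine tendsto_atTop_finset_of_monotone (fun R R' h => Finset.Icc_subset_Icc ?_ ?_) fun j => ⟨j.natAbs, ?_⟩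
        · have : (R:ℤ) ≤ R' := by exact_mod_cast h
          omega
        · exact_mod_cast h
        · rw [Finset.mem_Icc]; omega
      exact ((hs.hasSum.comp h1).enorm).ennrpow_const p
    rw [← hlim.liminf_eq]
    refine liminf_le_liminf (Eventually.of_forall fun R => ?_)
    have hu : (0:ℝ) < u := hU u.2
    obtain ⟨n, hn1, hn2⟩ := exists_mem_Ico_zpow hu (show (1:ℝ) < 2 by norm_num)
    have hp0 : (0:ℝ) < 2 ^ n := by positivity
    rw [zpow_add_one₀ (by norm_num)] at hn2
    have e : (2:ℝ) ^ n * (u / 2 ^ n) = u := by field_simp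
    obtain ⟨i, hi⟩ := hc n (u / 2 ^ n) ⟨⟨(one_le_div hp0).2 hn1, (div_le_iff₀ hp0).2 (by linarith)⟩, by rw [e]; exact u.2⟩
    have := D.local_sup hp hp2 ha (J R) n i hi x
    rw [e] at this
    exact this.trans (Finset.single_le_sum (f := fun i => ∫⁻ s in Icc (0:ℝ) 1, H R i s x) (fun _ _ => zero_le) (Finset.mem_univ i))
  calc _ ≤ ∫⁻ x, liminf (fun R => G R x) atTop := lintegral_mono hpt
    _ ≤ liminf (fun R => ∫⁻ x, G R x) atTop := lintegral_liminf_le hGm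
    _ ≤ _ := by
      refine (liminf_le_liminf (Eventually.of_forall hGint)).trans (le_of_eq ?_)
      simp
end

lemma NDeg.mono {φ : ℝ → ℝ} {K C K' C' : ℝ} (h : NDeg φ K C) (hK : K ≤ K') (hC : C ≤ C') : NDeg φ K' C' where
  meas := h.meas
  bdd t ht := (h.bdd t ht).trans hK
  pos := h.pos.trans hC
  cov G hG := (h.cov G hG).trans (mul_le_mul_left (ENNReal.ofReal_le_ofReal hC) _)

lemma Dens.hder {h : ℝ → ℂ} (H : Dens h) (c b : ℝ) : Dens (hder (fun t => c * t ^ b) h) where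
  meas := hder_meas (by fun_prop) H.meas
  der := by
    obtain ⟨h1, hd, hc1⟩ := H.der
    have hψ : ContinuousOn (fun t : ℝ => (c * t ^ b)) (Icc (1/2) 2) := fun t ht =>
      (rpow_hasDeriv c b ht).continuousAt.continuousWithinAt
    have hψ1 : ContinuousOn (fun t : ℝ => c * (b * t ^ (b - 1))) (Icc (1/2) 2) := fun t ht =>
      ((rpow_hasDeriv b (b - 1) ht).continuousAt.const_mul c).continuousWithinAt
    have hh : ContinuousOn h (Icc (1/2) 2) := fun t ht => (hd t ht).continuousAt.continuousWithinAt
    refine ⟨fun t => ((-(2 * Real.pi * (c * (b * t ^ (b - 1)))) : ℝ) : ℂ) * Complex.I * h t +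
      ((-(2 * Real.pi * (c * t ^ b)) : ℝ) : ℂ) * Complex.I * h1 t, fun t ht => ?_, ?_⟩
    · exact ((((rpow_hasDeriv c b ht).const_mul (2 * Real.pi)).neg.ofReal_comp).mul_const Complex.I).mul (hd t ht)
    · refine ContinuousOn.add (ContinuousOn.mul (ContinuousOn.mul ?_ continuousOn_const) hh)
        (ContinuousOn.mul (ContinuousOn.mul ?_ continuousOn_const) hc1)
      · exact Complex.continuous_ofReal.comp_continuousOn (continuousOn_const.mul hψ1).neg
      · exact Complex.continuous_ofReal.comp_continuousOn (continuousOn_const.mul hψ).neg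

lemma opT_joint_measurable {a : ℝ × ℝ → ℂ} {φ ψ : ℝ → ℝ} {h : ℝ → ℂ} {H δ r d : ℝ} (ha : Continuous a) (hφ : Measurable φ)
    (hψ : Measurable ψ) (hm : Measurable h) (hH : ∀ t ∈ Icc (1/2 : ℝ) 2, ‖h t‖ ≤ H) {f : ℝ × ℝ → ℂ} (hf : Integrable f) :
    Measurable fun y : ℝ × (ℝ × ℝ) => opT a φ ψ h δ r (d * y.1) f y.2 := by
  have h1 := shF_continuous hφ hψ (h_int hm hH)
  have h2 := FT_continuous hf
  have : StronglyMeasurable (Function.uncurry fun (y : ℝ × (ℝ × ℝ)) (ξ : ℝ × ℝ) =>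
      eI (2 * Real.pi * (y.2.1 * ξ.1 + y.2.2 * ξ.2)) * (mulF a φ ψ h δ r (d * y.1) ξ * FT f ξ)) := by
    refine Continuous.stronglyMeasurable ?_
    unfold mulF Function.uncurry eI
    fun_prop
  unfold opT
  simp only [FTinv_def]
  exact this.integral_prod_right.measurable

lemma rpow_inv_combine {I F : ℝ≥0∞} {p Q Y δ K : ℝ} {N : ℕ} (hp : 1 < p) (hQ : 0 ≤ Q) (hδ : 0 < δ)
    (hN : δ ^ (1 - 1 / p) * (N : ℝ) ^ (1 / p) ≤ K) (hY : Y = Q * δ ^ (1 - 1 / p))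
    (hI : I ≤ N * (108 * (ENNReal.ofReal Y ^ p * F))) : I ^ (1 / p) ≤ ENNReal.ofReal (108 * Q * K) * F ^ (1 / p) := by
  have hp0 : 0 < p := by linarith
  have hip : 0 ≤ 1 / p := by positivity
  have hip1 : 1 / p ≤ 1 := (div_le_one hp0).2 hp.le
  refine (ENNReal.rpow_le_rpow hI hip).trans ?_
  rw [ENNReal.mul_rpow_of_nonneg _ _ hip, ENNReal.mul_rpow_of_nonneg _ _ hip, ENNReal.mul_rpow_of_nonneg _ _ hip,
    ← ENNReal.rpow_mul, mul_one_div_cancel hp0.ne', ENNReal.rpow_one]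
  have h1 : (108:ℝ≥0∞) ^ (1 / p) ≤ 108 := by
    calc (108:ℝ≥0∞) ^ (1 / p) ≤ 108 ^ (1:ℝ) := ENNReal.rpow_le_rpow_of_exponent_le (by norm_num) hip1
      _ = 108 := ENNReal.rpow_one _
  have h2 : ((N : ℝ≥0∞)) ^ (1 / p) = ENNReal.ofReal ((N : ℝ) ^ (1 / p)) := by
    rw [← ENNReal.ofReal_rpow_of_nonneg (by positivity) hip, ENNReal.ofReal_natCast]
  calc _ ≤ (N : ℝ≥0∞) ^ (1 / p) * (108 * (ENNReal.ofReal Y * F ^ (1 / p))) := by gcongr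
    _ = ENNReal.ofReal (108 * Q * (δ ^ (1 - 1 / p) * (N : ℝ) ^ (1 / p))) * F ^ (1 / p) := by
      rw [h2, ← mul_assoc, ← mul_assoc, show (108 : ℝ≥0∞) = ENNReal.ofReal 108 by norm_num, ← ENNReal.ofReal_mul (by positivity),
        ← ENNReal.ofReal_mul (by positivity), hY]
      congr 2; ring
    _ ≤ _ := by gcongr

/-- The maximal estimate over an arbitrary dilation set for a smooth amplitude. -/
lemma sup_opT {a : ℝ × ℝ → ℂ} {lo hi b c e : ℝ} {h : ℝ → ℂ} (S : SAmp a lo hi) (hb : 1 < b) (hc : c ≠ 0) (he : |e| = 1)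
    (Hd : Dens h) : ∃ Q : ℝ, 0 ≤ Q ∧ ∀ l : ℕ, 1 ≤ l → ∀ p : ℝ, 1 < p → p ≤ 2 → ∀ U : Set ℝ, U ⊆ Ioi 0 →
      ∀ f : ℝ × ℝ → ℂ, Nice f →
      (∫⁻ x, (⨆ u : U, ‖∑' j : ℤ, opT a (fun t => e * t) (fun t => c * t ^ b) h (2⁻¹ ^ l) ((2:ℝ) ^ (-(j:ℝ)))
        ((2:ℝ) ^ (-((j:ℝ) * b)) * u) f x‖ₑ) ^ p) ^ (1 / p) ≤
      ENNReal.ofReal (108 * (Q * bigX p l ^ (7 * (2 / p - 1))) * Kp U (2⁻¹ ^ l) p) * (∫⁻ x, ‖f x‖ₑ ^ p) ^ (1 / p) := by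
  obtain ⟨K0, C0, nψ0⟩ := NDeg_pow hb hc
  set K := max K0 2
  set C := max C0 1⁻¹
  have nφ : NDeg (fun t => e * t) K C := (NDeg_lin he).mono (le_max_right _ _) (le_max_right _ _)
  have nψ : NDeg (fun t => c * t ^ b) K C := nψ0.mono (le_max_left _ _) (le_max_left _ _)
  have Hd2 := Hd.hder c b
  obtain ⟨B, hB⟩ := Hd.bdd
  obtain ⟨B2, hB2⟩ := Hd2.bdd
  obtain ⟨V, hV0, hV⟩ := shF_decay (e := e) hb hc Hd
  obtain ⟨V2, hV20, hV2⟩ := shF_decay (e := e) hb hc Hd2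
  obtain ⟨A, hA⟩ := S.exists_amp
  obtain ⟨A1, hA1⟩ := S.deriv_snd.exists_amp
  obtain ⟨A2, hA2⟩ := S.mul_snd.exists_amp
  obtain ⟨Q0, hQ0, hM0⟩ := max_opT (Dat.mk hA nφ nψ Hd.meas hB) hV0 hV lacL_nonneg
  obtain ⟨Q1, hQ1, hM1⟩ := max_opT (Dat.mk hA1 nφ nψ Hd.meas hB) hV0 hV lacL_nonneg
  obtain ⟨Q2, hQ2, hM2⟩ := max_opT (Dat.mk hA2 nφ nψ Hd2.meas hB2) hV20 hV2 lacL_nonneg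
  refine ⟨Q0 + Q1 + Q2, by positivity, fun l hl p hp hp2 U hU f hf => ?_⟩
  have hδ : (0:ℝ) < 2⁻¹ ^ l := by positivity
  have hδ2 : (2⁻¹:ℝ) ^ l ≤ 1 / 2 := by
    simpa using pow_le_pow_of_le_one (a := (2⁻¹:ℝ)) (by norm_num) (by norm_num) hl
  obtain ⟨N, hN, α, hα, hcov⟩ := exists_covering U hδ hδ2 hp
  have hX : 0 ≤ bigX p l ^ (7 * (2 / p - 1)) := Real.rpow_nonneg (by linarith [two_le_bigX hp hp2 l]) _
  have h2δ : (2:ℝ) ^ (-((l : ℝ) * (1 - 1 / p))) = (2⁻¹ ^ l) ^ (1 - 1 / p) := by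
    rw [← Real.rpow_natCast, ← Real.rpow_mul (by norm_num), Real.inv_rpow (by norm_num), Real.rpow_neg (by norm_num)]
  set Y := (Q0 + Q1 + Q2) * bigX p l ^ (7 * (2 / p - 1)) * 2 ^ (-((l : ℝ) * (1 - 1 / p))) with hY
  have hYm : ∀ Q', Q' ≤ Q0 + Q1 + Q2 → ENNReal.ofReal (Q' * bigX p l ^ (7 * (2 / p - 1)) * 2 ^ (-((l : ℝ) * (1 - 1 / p)))) ^ p *
      ∫⁻ x, ‖f x‖ₑ ^ p ≤ ENNReal.ofReal Y ^ p * ∫⁻ x, ‖f x‖ₑ ^ p := fun Q' hQ' => by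
    rw [hY]
    gcongr
  let T : Fin 3 → ℤ → ℝ → ℝ × ℝ → ℂ := fun k j s x => match k with
    | 0 => opT a (fun t => e * t) (fun t => c * t ^ b) h (2⁻¹ ^ l) ((2:ℝ) ^ (-(j:ℝ))) ((2:ℝ) ^ (-((j:ℝ) * b)) * s) f x
    | 1 => opT (fun ξ => (ξ.2 : ℂ) * fderiv ℝ a ξ (0, 1)) (fun t => e * t) (fun t => c * t ^ b) h (2⁻¹ ^ l)
        ((2:ℝ) ^ (-(j:ℝ))) ((2:ℝ) ^ (-((j:ℝ) * b)) * s) f x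
    | 2 => opT (fun ξ => (ξ.2 : ℂ) * a ξ) (fun t => e * t) (fun t => c * t ^ b) (hder (fun t => c * t ^ b) h) (2⁻¹ ^ l)
        ((2:ℝ) ^ (-(j:ℝ))) ((2:ℝ) ^ (-((j:ℝ) * b)) * s) f x
  have D : DilFam T (2⁻¹ ^ l) p (ENNReal.ofReal Y ^ p * ∫⁻ x, ‖f x‖ₑ ^ p) := by
    refine ⟨hδ, by linarith, fun j s x hs => ?_, fun k j => ?_, fun k J S' v hv => ?_⟩
    · have hd0 : (0:ℝ) < 2 ^ (-((j:ℝ) * b)) := by positivity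
      have h1 := opT_hasDeriv S nφ.meas nψ.meas Hd.meas hB nψ.bdd hδ (r := (2:ℝ) ^ (-(j:ℝ))) (by positivity)
        (mul_pos hd0 hs) hf x
      have hlin : HasDerivAt (fun s : ℝ => (2:ℝ) ^ (-((j:ℝ) * b)) * s) ((2:ℝ) ^ (-((j:ℝ) * b))) s := by
        simpa using (hasDerivAt_id s).const_mul ((2:ℝ) ^ (-((j:ℝ) * b)))
      refine (h1.scomp s hlin).congr_deriv ?_
      rw [Complex.real_smul, ← mul_assoc, ← Complex.ofReal_mul]
      congr 2
      generalize (2:ℝ) ^ (-((j:ℝ) * b)) = w at hd0 ⊢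
      field_simp
    · fin_cases k
      · exact opT_joint_measurable S.sm.continuous nφ.meas nψ.meas Hd.meas hB hf.int
      · exact opT_joint_measurable S.deriv_snd.sm.continuous nφ.meas nψ.meas Hd.meas hB hf.int
      · exact opT_joint_measurable S.mul_snd.sm.continuous nφ.meas nψ.meas Hd2.meas hB2 hf.int
    · have hL := Lac2_dyadic b J S' hv
      fin_cases k
      · exact (hM0 J S' _ _ hL l hl p hp hp2 f hf).trans (hYm Q0 (by linarith))
      · exact (hM1 J S' _ _ hL l hl p hp hp2 f hf).trans (hYm Q1 (by linarith))
      · exact (hM2 J S' _ _ hL l hl p hp hp2 f hf).trans (hYm Q2 (by linarith))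
  exact rpow_inv_combine hp (by positivity) hδ hN (by rw [hY, h2δ]) (D.sup_le hp.le hp2 hU hα hcov)

/-- The hypotheses on the two cutoffs `ζ₀` and `η₀`. -/
structure Cutoffs (ζ η : ℝ × ℝ → ℝ) : Prop where
  ζ_smooth : ContDiff ℝ (⊤ : ℕ∞) ζ
  ζ_supp : ∀ ξ : ℝ × ℝ, (4:ℝ) ≤ ξ.1^2 + ξ.2^2 → ζ ξ = 0
  ζ_one : ∀ ξ : ℝ × ℝ, ξ.1^2 + ξ.2^2 ≤ ((5:ℝ)/4)^2 → ζ ξ = 1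
  η_smooth : ContDiff ℝ (⊤ : ℕ∞) η
  η_supp : ∀ ξ : ℝ × ℝ, (100:ℝ)^2 < ξ.1^2 + ξ.2^2 → η ξ = 0

/-- The amplitude obtained by rescaling a dyadic piece of the multiplier to unit scale. -/
def unitAmp (ζ η : ℝ × ℝ → ℝ) (ς : ℝ → ℝ) (c : ℝ) (m : ℕ) (ξ : ℝ × ℝ) : ℂ :=
  (((ζ ξ - ζ ((2:ℝ) • ξ)) * (1 - η ((2:ℝ) ^ m • ξ)) * ς (ξ.1 / (c * ξ.2)) : ℝ) : ℂ)

section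
variable {ζ η : ℝ × ℝ → ℝ} {ς : ℝ → ℝ} {c q1 q2 : ℝ}

lemma annulus_of_ne (Z : Cutoffs ζ η) {ξ : ℝ × ℝ} (h : ζ ξ - ζ ((2:ℝ) • ξ) ≠ 0) :
    25 / 64 < ξ.1 ^ 2 + ξ.2 ^ 2 ∧ ξ.1 ^ 2 + ξ.2 ^ 2 < 4 := by
  have e1 : ((2:ℝ) • ξ).1 = 2 * ξ.1 := rfl
  have e2 : ((2:ℝ) • ξ).2 = 2 * ξ.2 := rfl
  constructor
  · by_contra! hle
    refine h ?_
    rw [Z.ζ_one ξ (by nlinarith), Z.ζ_one ((2:ℝ) • ξ) (by rw [e1, e2]; nlinarith), sub_self]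
  · by_contra! hle
    refine h ?_
    rw [Z.ζ_supp ξ hle, Z.ζ_supp ((2:ℝ) • ξ) (by rw [e1, e2]; nlinarith), sub_self]

lemma unitAmp_SAmp (hc : c ≠ 0) (hq1 : 0 < q1) (hςsm : ContDiff ℝ (⊤ : ℕ∞) ς)
    (hς : ∀ v, ς v ≠ 0 → q1 ≤ |v| ∧ |v| ≤ q2) (Z : Cutoffs ζ η) (hq : q1 ≤ q2) (m : ℕ) :
    ∃ lo, SAmp (unitAmp ζ η ς c m) lo 2 := by
  have hc0 : 0 < |c| := abs_pos.2 hc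
  have hq2 : 0 < q2 := hq1.trans_le hq
  set d := (5 / 8) / (1 + q2 * |c|) with hd
  have hd0 : 0 < d := by positivity
  have hd1 : d ≤ 2 := by
    rw [hd, div_le_iff₀ (by positivity)]
    nlinarith [mul_pos hq2 hc0]
  have hsupp : ∀ ξ, unitAmp ζ η ς c m ξ ≠ 0 → min d (q1 * |c| * d) ≤ |ξ.1| ∧ |ξ.1| ≤ 2 ∧ min d (q1 * |c| * d) ≤ |ξ.2| ∧ |ξ.2| ≤ 2 := by
    intro ξ hξ
    have hne : (ζ ξ - ζ ((2:ℝ) • ξ)) * (1 - η ((2:ℝ) ^ m • ξ)) * ς (ξ.1 / (c * ξ.2)) ≠ 0 := by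
      intro h0; exact hξ (by rw [unitAmp, h0, Complex.ofReal_zero])
    obtain ⟨ha, hb⟩ := annulus_of_ne Z (left_ne_zero_of_mul (left_ne_zero_of_mul hne))
    obtain ⟨h1, h2⟩ := hς _ (right_ne_zero_of_mul hne)
    have hx2 : ξ.2 ≠ 0 := by
      intro h0
      rw [h0, mul_zero, div_zero, abs_zero] at h1
      linarith
    have hp2 : 0 < |ξ.2| := abs_pos.2 hx2
    rw [abs_div, abs_mul] at h1 h2
    rw [le_div_iff₀ (by positivity)] at h1
    rw [div_le_iff₀ (by positivity)] at h2
    have hs1 : |ξ.1| ^ 2 = ξ.1 ^ 2 := sq_abs _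
    have hs2 : |ξ.2| ^ 2 = ξ.2 ^ 2 := sq_abs _
    have hlow : d ≤ |ξ.2| := by
      rw [hd, div_le_iff₀ (by positivity)]
      have : 5 / 8 ≤ |ξ.1| + |ξ.2| := by
        by_contra! hlt
        nlinarith [abs_nonneg ξ.1, abs_nonneg ξ.2, mul_nonneg (abs_nonneg ξ.1) (abs_nonneg ξ.2)]
      nlinarith
    refine ⟨(min_le_right _ _).trans ?_, ?_, (min_le_left _ _).trans hlow, ?_⟩
    · calc q1 * |c| * d ≤ q1 * |c| * |ξ.2| := by gcongr
        _ = q1 * (|c| * |ξ.2|) := by ring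
        _ ≤ _ := h1
    · exact abs_le_of_sq_le_sq (by nlinarith [sq_nonneg ξ.2]) (by norm_num)
    · exact abs_le_of_sq_le_sq (by nlinarith [sq_nonneg ξ.1]) (by norm_num)
  have hlo : 0 < min d (q1 * |c| * d) := lt_min hd0 (by positivity)
  refine ⟨min d (q1 * |c| * d), ?_, hlo, (min_le_left _ _).trans hd1, hsupp⟩
  refine contDiff_iff_contDiffAt.2 fun ξ => ?_
  by_cases hx : ξ.2 = 0
  · have hev : unitAmp ζ η ς c m =ᶠ[𝓝 ξ] fun _ => 0 := by
      have hcont : Continuous fun ω : ℝ × ℝ => |ω.2| := by fun_prop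
      have : ∀ᶠ ω in 𝓝 ξ, |ω.2| < min d (q1 * |c| * d) :=
        hcont.continuousAt.eventually_lt continuousAt_const (by simpa [hx] using hlo)
      filter_upwards [this] with ω hω
      by_contra h0
      exact absurd (hsupp ω h0).2.2.1 (not_le.2 hω)
    exact contDiffAt_const.congr_of_eventuallyEq hev
  · unfold unitAmp
    have h1 : ContDiffAt ℝ (⊤ : ℕ∞) (fun ω : ℝ × ℝ => ω.1 / (c * ω.2)) ξ :=
      contDiffAt_fst.div (contDiffAt_const.mul contDiffAt_snd) (mul_ne_zero hc hx)
    have h2 : ContDiff ℝ (⊤ : ℕ∞) fun ω : ℝ × ℝ => ζ ω - ζ ((2:ℝ) • ω) :=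
      Z.ζ_smooth.sub (Z.ζ_smooth.comp (contDiff_const_smul (2:ℝ)))
    have h3 : ContDiff ℝ (⊤ : ℕ∞) fun ω : ℝ × ℝ => 1 - η ((2:ℝ) ^ m • ω) :=
      contDiff_const.sub (Z.η_smooth.comp (contDiff_const_smul ((2:ℝ) ^ m)))
    exact Complex.ofRealCLM.contDiff.contDiffAt.comp ξ
      ((h2.contDiffAt.mul h3.contDiffAt).mul (hςsm.contDiffAt.comp ξ h1))

lemma zl_mul_eq_unitAmp (Z : Cutoffs ζ η) (l : ℕ) (ν : ℝ × ℝ) :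
    ((zl ζ l ν : ℝ) : ℂ) * (((1 - η ν) * ς (ν.1 / (c * ν.2)) : ℝ) : ℂ) =
      unitAmp ζ η ς c (min l 8) (2⁻¹ ^ l * ν.1, 2⁻¹ ^ l * ν.2) := by
  have hδ : (0:ℝ) < 2⁻¹ ^ l := by positivity
  set ω : ℝ × ℝ := (2⁻¹ ^ l * ν.1, 2⁻¹ ^ l * ν.2) with hω
  have e1 : (2:ℝ) ^ (-(l:ℝ)) • ν = ω := by
    rw [Real.rpow_neg (by norm_num), Real.rpow_natCast, ← inv_pow]; rfl
  have e2 : (2:ℝ) ^ (1 - (l:ℝ)) • ν = (2:ℝ) • ω := by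
    rw [sub_eq_add_neg, Real.rpow_add (by norm_num), Real.rpow_one, mul_smul, e1]
  have e3 : (2:ℝ) ^ l • ω = ν := by
    have : (2:ℝ) ^ l * 2⁻¹ ^ l = 1 := by rw [← mul_pow]; norm_num
    ext
    · show (2:ℝ) ^ l * (2⁻¹ ^ l * ν.1) = ν.1
      rw [← mul_assoc, this, one_mul]
    · show (2:ℝ) ^ l * (2⁻¹ ^ l * ν.2) = ν.2
      rw [← mul_assoc, this, one_mul]
  have e4 : ν.1 / (c * ν.2) = ω.1 / (c * ω.2) := by
    rw [hω]
    simp only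
    rw [show c * (2⁻¹ ^ l * ν.2) = 2⁻¹ ^ l * (c * ν.2) by ring, mul_div_mul_left _ _ hδ.ne']
  rw [unitAmp, zl, e1, e2, e4, ← Complex.ofReal_mul, ← mul_assoc]
  congr 2
  by_cases h0 : ζ ω - ζ ((2:ℝ) • ω) = 0
  · rw [h0, zero_mul, zero_mul]
  congr 2
  rcases le_total l 8 with h | h
  · rw [min_eq_left h, e3]
  · rw [min_eq_right h]
    have hω2 := (annulus_of_ne Z h0).1
    have key : ∀ n : ℕ, 8 ≤ n → η ((2:ℝ) ^ n • ω) = 0 := by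
      intro n hn
      refine Z.η_supp _ ?_
      have e5 : ((2:ℝ) ^ n • ω).1 ^ 2 + ((2:ℝ) ^ n • ω).2 ^ 2 = ((2:ℝ) ^ n) ^ 2 * (ω.1 ^ 2 + ω.2 ^ 2) := by
        show ((2:ℝ) ^ n * ω.1) ^ 2 + ((2:ℝ) ^ n * ω.2) ^ 2 = _
        ring
      rw [e5]
      have h8 : (2:ℝ) ^ 8 ≤ 2 ^ n := pow_le_pow_right₀ (by norm_num) hn
      have : ((2:ℝ) ^ 8) ^ 2 ≤ (2 ^ n) ^ 2 := by gcongr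
      nlinarith
    rw [key 8 le_rfl, ← e3, key l h]
end

lemma Dens_cutoff {χ : ℝ → ℝ} (hχ : ContDiff ℝ (⊤ : ℕ∞) χ) {e : ℝ} (he : e ≠ 0) :
    Dens fun t => ((χ t / (e * t) : ℝ) : ℂ) where
  meas := by
    have := hχ.continuous.measurable
    fun_prop
  der := by
    have hc1 : Continuous (deriv χ) := hχ.continuous_deriv (by simp)
    have hd : Differentiable ℝ χ := hχ.differentiable (by simp)
    refine ⟨fun t => (((deriv χ t * (e * t) - χ t * e) / (e * t) ^ 2 : ℝ) : ℂ), fun t ht => ?_, ?_⟩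
    · have h1 : HasDerivAt (fun t => e * t) e t := by simpa using (hasDerivAt_id t).const_mul e
      exact ((hd t).hasDerivAt.div h1 (mul_ne_zero he (by linarith [ht.1]))).ofReal_comp
    · refine Complex.continuous_ofReal.comp_continuousOn (ContinuousOn.div ?_ ?_ fun t ht => ?_)
      · have := hχ.continuous; fun_prop
      · fun_prop
      · exact pow_ne_zero _ (mul_ne_zero he (by linarith [ht.1]))

lemma sigmaHat_pos (b cp cm : ℝ) {χp : ℝ → ℝ} (hχsupp : ∀ t : ℝ, t ∉ Ioo (1/2 : ℝ) 2 → χp t = 0) (ξ : ℝ × ℝ) :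
    sigmaHat b cp cm χp ξ = shF (fun t => 1 * t) (fun t => cp * t ^ b) (fun t => ((χp t / (1 * t) : ℝ) : ℂ)) ξ := by
  unfold sigmaHat shF eI
  rw [← setIntegral_eq_integral_of_forall_compl_eq_zero (s := Icc (1/2 : ℝ) 2)]
  · refine setIntegral_congr_fun measurableSet_Icc fun t ht => ?_
    have : 0 < t := by linarith [ht.1]
    simp only [curve, if_pos this, one_mul]
  · intro t ht
    rw [hχsupp t fun h => ht (Ioo_subset_Icc_self h)]
    simp

lemma sigmaHat_neg (b cp cm : ℝ) {χp : ℝ → ℝ} (hχsupp : ∀ t : ℝ, t ∉ Ioo (1/2 : ℝ) 2 → χp t = 0) (ξ : ℝ × ℝ) :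
    sigmaHat b cp cm (fun t => χp (-t)) ξ =
      shF (fun t => (-1) * t) (fun t => cm * t ^ b) (fun t => ((χp t / ((-1) * t) : ℝ) : ℂ)) ξ := by
  unfold sigmaHat shF eI
  rw [← integral_neg_eq_self, ← setIntegral_eq_integral_of_forall_compl_eq_zero (s := Icc (1/2 : ℝ) 2)]
  · refine setIntegral_congr_fun measurableSet_Icc fun t ht => ?_
    have : 0 < t := by linarith [ht.1]
    simp only [curve, if_neg (show ¬ 0 < -t by linarith), if_pos (show -t < 0 by linarith), neg_neg, neg_mul, one_mul]
  · intro t ht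
    simp only [neg_neg]
    rw [hχsupp t fun h => ht (Ioo_subset_Icc_self h)]
    simp

lemma SchwartzMap.nice_ofReal (f : SchwartzMap (ℝ × ℝ) ℝ) : Nice fun x => ((f x : ℝ) : ℂ) where
  sm := (Complex.continuous_ofReal.comp f.continuous).stronglyMeasurable
  int := f.integrable.ofReal
  bdd := by
    obtain ⟨C, hC⟩ := f.decay 0 0
    refine ⟨C, fun x => ?_⟩
    have := hC.2 x
    simpa using this

lemma Kp_nonneg (U : Set ℝ) {δ : ℝ} (hδ : 0 ≤ δ) (p : ℝ) : 0 ≤ Kp U δ p :=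
  mul_nonneg (Real.rpow_nonneg hδ _) (Real.iSup_nonneg fun _ => Real.rpow_nonneg (Nat.cast_nonneg _) _)

lemma lpN_le_of_sup {Q Q' p : ℝ} {l : ℕ} {U : Set ℝ}
    {f : SchwartzMap (ℝ × ℝ) ℝ} {S T : ℤ → ℝ → ℝ × ℝ → ℂ} (hl : 1 ≤ l) (hp : 1 < p) (hp2 : p ≤ 2) (hQ0 : 0 ≤ Q) (hQ : Q ≤ Q')
    (hT : ∀ j u, S j u = T j u)
    (hS : (∫⁻ x, (⨆ u : U, ‖∑' j : ℤ, T j u x‖ₑ) ^ p) ^ (1 / p) ≤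
      ENNReal.ofReal (108 * (Q * bigX p l ^ (7 * (2 / p - 1))) * Kp U (2⁻¹ ^ l) p) *
        (∫⁻ x, ‖((f x : ℝ) : ℂ)‖ₑ ^ p) ^ (1 / p)) :
    lpN (fun x => ⨆ u : U, ((‖∑' j : ℤ, S j u x‖₊ : ℝ≥0∞))) p ≤
      ENNReal.ofReal (108 * 2 ^ 7 * Q' * (p - 1) ^ (-(2:ℝ)) * theta p l * Kp U ((2:ℝ) ^ (-(l : ℝ))) p) *
        eLpNorm ⇑f (eN p) volume := by
  have hp0 : 0 < p := by linarith
  have e1 : (2:ℝ) ^ (-(l:ℝ)) = 2⁻¹ ^ l := by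
    rw [Real.rpow_neg (by norm_num), Real.rpow_natCast, ← inv_pow]
  have e2 : eLpNorm ⇑f (eN p) volume = (∫⁻ x, ‖((f x : ℝ) : ℂ)‖ₑ ^ p) ^ (1 / p) := by
    rw [eN, eLpNorm_eq_lintegral_rpow_enorm_toReal (by simpa using hp0) (by simp), ENNReal.toReal_ofReal hp0.le]
    congr 2
    funext x
    rw [← ofReal_norm, ← ofReal_norm, Complex.norm_real]
  rw [e1, e2]
  simp only [hT]
  refine hS.trans (mul_le_mul_left (ENNReal.ofReal_le_ofReal ?_) _)
  refine mul_le_mul_of_nonneg_right ?_ (Kp_nonneg U (by positivity) p)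
  have hX : 0 ≤ bigX p l ^ (7 * (2 / p - 1)) := Real.rpow_nonneg (by linarith [two_le_bigX hp hp2 l]) _
  have hb := bigX_theta hp hp2 hl
  have := mul_le_mul hQ hb hX (hQ0.trans hQ)
  linarith

lemma Tjl_eq_opT {b cp cm c : ℝ} {χp ςp ςm ς φ : ℝ → ℝ} {η ζ : ℝ × ℝ → ℝ} {h : ℝ → ℂ} {sgn : Bool}
    (hμ : ∀ ν, muHat b cp cm χp η ςp ςm sgn ν =
      (((1 - η ν) * ς (ν.1 / (c * ν.2)) : ℝ) : ℂ) * shF φ (fun t => c * t ^ b) h ν)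
    (Z : Cutoffs ζ η) (l : ℕ) (f : ℝ × ℝ → ℝ) (j : ℤ) (u : ℝ) :
    Tjl b cp cm χp η ςp ςm ζ sgn j l u f =
      opT (unitAmp ζ η ς c (min l 8)) φ (fun t => c * t ^ b) h (2⁻¹ ^ l) ((2:ℝ) ^ (-(j:ℝ)))
        ((2:ℝ) ^ (-((j:ℝ) * b)) * u) fun x => ((f x : ℝ) : ℂ) := by
  unfold Tjl opT mulF
  congr 1
  funext ξ
  rw [hμ, ← mul_assoc, zl_mul_eq_unitAmp Z]
  simp only [dil, mul_assoc]

lemma sup_opT_unitAmp {ζ η : ℝ × ℝ → ℝ} {ς : ℝ → ℝ} {b c e q1 q2 : ℝ} {h : ℝ → ℂ} (hb : 1 < b) (hc : c ≠ 0) (he : |e| = 1)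
    (Hd : Dens h) (hq1 : 0 < q1) (hςsm : ContDiff ℝ (⊤ : ℕ∞) ς)
    (hς : ∀ v, ς v ≠ 0 → q1 ≤ |v| ∧ |v| ≤ q2) (Z : Cutoffs ζ η) (hq : q1 ≤ q2) :
    ∃ Q : ℕ → ℝ, (∀ m, 0 ≤ Q m) ∧ ∀ m l : ℕ, 1 ≤ l → ∀ p : ℝ, 1 < p → p ≤ 2 → ∀ U : Set ℝ, U ⊆ Ioi 0 →
      ∀ f : ℝ × ℝ → ℂ, Nice f →
      (∫⁻ x, (⨆ u : U, ‖∑' j : ℤ, opT (unitAmp ζ η ς c m) (fun t => e * t) (fun t => c * t ^ b) h (2⁻¹ ^ l)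
        ((2:ℝ) ^ (-(j:ℝ))) ((2:ℝ) ^ (-((j:ℝ) * b)) * u) f x‖ₑ) ^ p) ^ (1 / p) ≤
      ENNReal.ofReal (108 * (Q m * bigX p l ^ (7 * (2 / p - 1))) * Kp U (2⁻¹ ^ l) p) *
        (∫⁻ x, ‖f x‖ₑ ^ p) ^ (1 / p) := by
  have H := fun m : ℕ => (unitAmp_SAmp hc hq1 hςsm hς Z hq m).elim fun _ S => sup_opT S hb hc he Hd
  exact ⟨fun m => (H m).choose, fun m => (H m).choose_spec.1, fun m => (H m).choose_spec.2⟩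

end

theorem statement11 (b cp cm : ℝ) (hb : 1 < b) (hcp : cp ≠ 0) (hcm : cm ≠ 0)
    (χp : ℝ → ℝ) (hχsm : ContDiff ℝ (⊤ : ℕ∞) χp)
    (hχsupp : ∀ t : ℝ, t ∉ Ioo (1/2 : ℝ) 2 → χp t = 0)
    (hχsum : ∀ t : ℝ, 0 < t → HasSum (fun j : ℤ => χp ((2:ℝ) ^ j * t)) 1)
    (η : ℝ × ℝ → ℝ) (hηsm : ContDiff ℝ (⊤ : ℕ∞) η)
    (hηsupp : ∀ ξ : ℝ × ℝ, (100:ℝ)^2 < ξ.1^2 + ξ.2^2 → η ξ = 0)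
    (hηone : ∀ ξ : ℝ × ℝ, ξ.1^2 + ξ.2^2 ≤ (50:ℝ)^2 → η ξ = 1)
    (ςp : ℝ → ℝ) (hςpsm : ContDiff ℝ (⊤ : ℕ∞) ςp)
    (hςpsupp : ∀ v : ℝ, v ∉ Ioo (b * (4:ℝ)⁻¹ ^ (b-1)) (b * (4:ℝ) ^ (b-1)) → ςp v = 0)
    (hςpone : ∀ v ∈ Icc (b * ((2:ℝ)/7) ^ (b-1)) (b * ((7:ℝ)/2) ^ (b-1)), ςp v = 1)
    (ςm : ℝ → ℝ) (hςmsm : ContDiff ℝ (⊤ : ℕ∞) ςm)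
    (hςmsupp : ∀ v : ℝ, v ∉ Ioo (-(b * (4:ℝ) ^ (b-1))) (-(b * (4:ℝ)⁻¹ ^ (b-1))) → ςm v = 0)
    (hςmone : ∀ v ∈ Icc (-(b * ((7:ℝ)/2) ^ (b-1))) (-(b * ((2:ℝ)/7) ^ (b-1))), ςm v = 1)
    (ζ : ℝ × ℝ → ℝ) (hζsm : ContDiff ℝ (⊤ : ℕ∞) ζ)
    (hζsupp : ∀ ξ : ℝ × ℝ, (4:ℝ) ≤ ξ.1^2 + ξ.2^2 → ζ ξ = 0)
    (hζone : ∀ ξ : ℝ × ℝ, ξ.1^2 + ξ.2^2 ≤ ((5:ℝ)/4)^2 → ζ ξ = 1) :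
    ∃ C : ℝ, ∀ l : ℕ, 1 ≤ l → ∀ p : ℝ, 1 < p → p ≤ 2 →
      ∀ U : Set ℝ, U.Nonempty → U ⊆ Ioi (0:ℝ) → ∀ sgn : Bool,
      ∀ f : SchwartzMap (ℝ × ℝ) ℝ,
        lpN (fun x => ⨆ u : U,
            ((‖∑' j : ℤ, Tjl b cp cm χp η ςp ςm ζ sgn j l (u : ℝ) ⇑f x‖₊ : ℝ≥0∞))) p
          ≤ ENNReal.ofReal
                (C * (p - 1) ^ (-(2:ℝ)) * theta p l * Kp U ((2:ℝ) ^ (-(l : ℝ))) p)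
              * eLpNorm ⇑f (eN p) volume := by
  set q1 := b * (4:ℝ)⁻¹ ^ (b - 1)
  set q2 := b * (4:ℝ) ^ (b - 1)
  have hb0 : 0 < b := by linarith
  have hq1 : 0 < q1 := by positivity
  have hq : q1 ≤ q2 :=
    mul_le_mul_of_nonneg_left (Real.rpow_le_rpow (by norm_num) (by norm_num) (by linarith)) hb0.le
  have hp : ∀ v, ςp v ≠ 0 → q1 ≤ |v| ∧ |v| ≤ q2 := fun v hv => by
    have h := not_imp_comm.1 (hςpsupp v) hv
    rw [abs_of_pos (hq1.trans h.1)]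
    exact ⟨h.1.le, h.2.le⟩
  have hm : ∀ v, ςm v ≠ 0 → q1 ≤ |v| ∧ |v| ≤ q2 := fun v hv => by
    have h := not_imp_comm.1 (hςmsupp v) hv
    rw [abs_of_neg (h.2.trans (neg_lt_zero.2 hq1))]
    exact ⟨by linarith [h.2], by linarith [h.1]⟩
  have Z : Cutoffs ζ η := ⟨hζsm, hζsupp, hζone, hηsm, hηsupp⟩
  obtain ⟨P, hP0, hP⟩ := sup_opT_unitAmp (e := 1) hb hcp abs_one (Dens_cutoff hχsm one_ne_zero) hq1 hςmsm hm Z hq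
  obtain ⟨N, hN0, hN⟩ := sup_opT_unitAmp (e := -1) hb hcm (by simp) (Dens_cutoff hχsm (neg_ne_zero.2 one_ne_zero)) hq1
    hςpsm hp Z hq
  have hle : ∀ l : ℕ, P (min l 8) + N (min l 8) ≤ ∑ m ∈ Finset.range 9, (P m + N m) := fun l =>
    Finset.single_le_sum (f := fun m => P m + N m) (fun m _ => add_nonneg (hP0 m) (hN0 m))
      (Finset.mem_range.2 (by omega))
  refine ⟨108 * 2 ^ 7 * ∑ m ∈ Finset.range 9, (P m + N m), fun l hl p h1 h2 U _ hU sgn f => ?_⟩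
  cases sgn
  · exact lpN_le_of_sup (S := fun j u => Tjl b cp cm χp η ςp ςm ζ false j l u f) hl h1 h2 (hN0 (min l 8))
      ((le_add_of_nonneg_left (hP0 _)).trans (hle l))
      (Tjl_eq_opT (fun ν => by rw [muHat, if_neg (by simp), sigmaHat_neg b cp cm hχsupp]) Z l f)
      (hN _ l hl p h1 h2 U hU _ f.nice_ofReal)
  · exact lpN_le_of_sup (S := fun j u => Tjl b cp cm χp η ςp ςm ζ true j l u f) hl h1 h2 (hP0 (min l 8))
      ((le_add_of_nonneg_right (hN0 _)).trans (hle l))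
      (Tjl_eq_opT (fun ν => by rw [muHat, if_pos rfl, sigmaHat_pos b cp cm hχsupp]) Z l f)
      (hP _ l hl p h1 h2 U hU _ f.nice_ofReal)

end
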